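/- Fix a constant c < 1/4. Suppose k = k(n) satisfies k < sqrt(c·n·log n) and p = p(n) is such that Λ(Δ) < o(1) almost surely, i.e. there exists ε(n) → 0 such that Pr(Λ(Δ) > ε(n)) → 0 as n → ∞. Then H_k(n,p) satisfies EKR almost surely. -/

import Mathlib

open Filter

noncomputable section

/-- The collection of all `k`-element subsets of `Fin n`. -/
def kSets (n k : ℕ) : Finset (Finset (Fin n)) := Finset.powersetCard k Finset.univ

open Classical in
/-- The probability that the random hypergraph `H_k(n,p)` (each `k`-subset of `[n]`
present independently with probability `p`) satisfies the property `P`. -/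
def hprob (n k : ℕ) (p : ℝ) (P : Finset (Finset (Fin n)) → Prop) : ℝ :=
  ∑ H ∈ (kSets n k).powerset,
    if P H then p ^ H.card * (1 - p) ^ ((kSets n k).card - H.card) else 0

/-- A family of sets is intersecting (a clique) if no two of its members are disjoint. -/
def IsClique {n : ℕ} (C : Finset (Finset (Fin n))) : Prop :=
  ∀ A ∈ C, ∀ B ∈ C, (A ∩ B).Nonempty

/-- The star of `x` in `H`: the set of edges of `H` containing `x`. -/
def starOf {n : ℕ} (H : Finset (Finset (Fin n))) (x : Fin n) : Finset (Finset (Fin n)) :=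
  H.filter (fun A => x ∈ A)

/-- The degree of `x` in `H`. -/
def vdeg {n : ℕ} (H : Finset (Finset (Fin n))) (x : Fin n) : ℕ := (starOf H x).card

/-- The maximum degree of `H`. -/
def maxDegree {n : ℕ} (H : Finset (Finset (Fin n))) : ℕ :=
  Finset.univ.sup (vdeg H)

/-- A family is nontrivial if it is not contained in a star. -/
def IsNontrivial {n : ℕ} (C : Finset (Finset (Fin n))) : Prop :=
  ¬ ∃ x : Fin n, ∀ A ∈ C, x ∈ A

/-- `H` satisfies (strong) EKR if every maximum-size intersecting subfamily of `H`
is a star of `H`. -/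
def EKR {n : ℕ} (H : Finset (Finset (Fin n))) : Prop :=
  ∀ C ⊆ H, IsClique C → (∀ D ⊆ H, IsClique D → D.card ≤ C.card) →
    ∃ x : Fin n, C = starOf H x

open Classical in
/-- `q = q(n,k)`: the probability that two independent uniform `k`-subsets of `[n]` meet. -/
def interProb (n k : ℕ) : ℝ :=
  ((((kSets n k) ×ˢ (kSets n k)).filter fun AB => (AB.1 ∩ AB.2).Nonempty).card : ℝ) /
    ((kSets n k).card : ℝ) ^ 2

/-- `φ = p·C(n-1,k-1)`, the expected degree of a vertex. -/
def phi (n k : ℕ) (p : ℝ) : ℝ := p * ((n - 1).choose (k - 1) : ℝ)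

/-- `μ̄ = φ·n/k`, the expected number of edges. -/
def mubar (n k : ℕ) (p : ℝ) : ℝ := phi n k p * n / k

/-- The generalized binomial coefficient `C(x,t) = x(x-1)⋯(x-t+1)/t!`. -/
def gchoose (x : ℝ) (t : ℕ) : ℝ := (∏ i ∈ Finset.range t, (x - i)) / (t.factorial : ℝ)

/-- `Λ(t) = C(μ̄,t)·q^{C(t,2)}`. -/
def Lam (n k : ℕ) (p : ℝ) (t : ℕ) : ℝ :=
  gchoose (mubar n k p) t * interProb n k ^ t.choose 2

/-- `Λ'(t)`: equals `0` for `t ≤ 2` and `Λ(t)` otherwise. -/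
def Lam' (n k : ℕ) (p : ℝ) (t : ℕ) : ℝ := if t ≤ 2 then 0 else Lam n k p t

open Classical in
/-- The probability of `E` for a uniform sample from the finite set `s`. -/
def uprob {α : Type*} (s : Finset α) (E : α → Prop) : ℝ :=
  ((s.filter E).card : ℝ) / (s.card : ℝ)

open Classical in
/-- The probability of `E` under the probability mass function `w` on `Ω`. -/
def wprob {Ω : Type*} [Fintype Ω] (w : Ω → ℝ) (E : Ω → Prop) : ℝ :=
  ∑ ω ∈ Finset.univ.filter E, w ω

open Classical in
/-- The probability that the family `{A_1,…,A_m}` formed by `m` independent uniform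
`k`-subsets of `[n]` satisfies `P`. -/
def iidprob (n k m : ℕ) (P : Finset (Finset (Fin n)) → Prop) : ℝ :=
  uprob ((Finset.univ : Finset (Fin m → Finset (Fin n))).filter fun f => ∀ i, f i ∈ kSets n k)
    (fun f => P (Finset.image f Finset.univ))

open Classical in
/-- The probability that the tuple `(A_1,…,A_m)` of independent uniform `k`-subsets of `[n]`
satisfies `P`. -/
def tupleProb (n k m : ℕ) (P : (Fin m → Finset (Fin n)) → Prop) : ℝ :=
  uprob ((Finset.univ : Finset (Fin m → Finset (Fin n))).filter fun f => ∀ i, f i ∈ kSets n k) P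

/-- `Pr(Bin(M,p) ≥ θ)`. -/
def binomProbGe (M : ℕ) (p : ℝ) (θ : ℕ) : ℝ :=
  ∑ j ∈ Finset.Icc θ M, (M.choose j : ℝ) * p ^ j * (1 - p) ^ (M - j)

/-- `φ* = log³ n / log(1/q)`. -/
def phiStar (n k : ℕ) : ℝ := (Real.log n) ^ 3 / Real.log (1 / interProb n k)

/-- `α₁`: the largest integer `t` with `Pr(Bin(C(n-1,k-1),p) ≥ t) ≥ ψ/n`, where `ψ = log n`. -/
def alpha1 (n k : ℕ) (p : ℝ) : ℕ :=
  sSup {t : ℕ | Real.log n / n ≤ binomProbGe ((n - 1).choose (k - 1)) p t}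

/-- `α₂ = min{t : Λ(t) ≤ σ}`. -/
def alpha2 (n k : ℕ) (p σn : ℝ) : ℕ := sInf {t : ℕ | Lam n k p t ≤ σn}

/-- `α = max{α₁, α₂}`. -/
def alphaP (n k : ℕ) (p σn : ℝ) : ℕ := max (alpha1 n k p) (alpha2 n k p σn)

/-- `γ = min{α, φ*/3}`. -/
def gammaP (n k : ℕ) (p σn : ℝ) : ℕ := min (alphaP n k p σn) ⌊phiStar n k / 3⌋₊

/-- `τ = (1-ε)·γ`. -/
def tauP (ε : ℝ) (n k : ℕ) (p σn : ℝ) : ℝ := (1 - ε) * (gammaP n k p σn : ℝ)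

/-- `λ = max{√(log n)/log(1/q), 2·√(log n/log(1/q))}`. -/
def lamP (n k : ℕ) : ℝ :=
  max (Real.sqrt (Real.log n) / Real.log (1 / interProb n k))
    (2 * Real.sqrt (Real.log n / Real.log (1 / interProb n k)))

/-- `w̄ = max{φ²k²/n, 6 log n}`. -/
def wbar (n k : ℕ) (p : ℝ) : ℝ := max (phi n k p ^ 2 * (k : ℝ) ^ 2 / n) (6 * Real.log n)

/-- `q̄ = (1 + 2k²w̄/(q n²))·q`. -/
def qbar (n k : ℕ) (p : ℝ) : ℝ :=
  (1 + 2 * (k : ℝ) ^ 2 * wbar n k p / (interProb n k * (n : ℝ) ^ 2)) * interProb n k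

open Classical in
/-- The probability that the random subset of `H`, keeping each element independently
with probability `ρ`, satisfies `P`. -/
def sprob {β : Type*} [DecidableEq β] (H : Finset β) (ρ : ℝ) (P : Finset β → Prop) : ℝ :=
  ∑ G ∈ H.powerset, if P G then ρ ^ G.card * (1 - ρ) ^ (H.card - G.card) else 0

/-- The degree of `v` in the multiset `{f 0, …, f (m-1)}` (with multiplicity). -/
def tdeg {n m : ℕ} (f : Fin m → Finset (Fin n)) (v : Fin n) : ℕ :=
  (Finset.univ.filter fun i => v ∈ f i).card

/-- An increasing (up-)event in `{0,1}^ι`. -/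
def IncrEvent {ι : Type*} (A : Set (ι → Bool)) : Prop :=
  ∀ x y : ι → Bool, y ≤ x → y ∈ A → x ∈ A

/-- The coordinate `i` affects the event `A`. -/
def Affects {ι : Type*} (i : ι) (A : Set (ι → Bool)) : Prop :=
  ∃ η ∈ A, ∃ ν, ν ∉ A ∧ ∀ j, j ≠ i → η j = ν j

/-- Negative association of a family of `{0,1}`-valued random variables, defined on the
finite probability space `Ω` with probability mass function `w`. -/
def NegAssoc {Ω ι : Type*} [Fintype Ω] (w : Ω → ℝ) (X : ι → Ω → Bool) : Prop :=
  ∀ A B : Set (ι → Bool), IncrEvent A → IncrEvent B →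
    (∀ i, ¬ (Affects i A ∧ Affects i B)) →
    wprob w (fun ω => (fun i => X i ω) ∈ A ∧ (fun i => X i ω) ∈ B) ≤
      wprob w (fun ω => (fun i => X i ω) ∈ A) * wprob w (fun ω => (fun i => X i ω) ∈ B)

/-- `X = X_1 + ⋯ + X_m` for `{0,1}`-valued random variables. -/
def bcount {Ω : Type*} {m : ℕ} (X : Fin m → Ω → Bool) (ω : Ω) : ℕ :=
  (Finset.univ.filter fun i => X i ω = true).card

end

set_option linter.unusedSectionVars false

namespace EKRP
noncomputable section

open Classical in
/-- Indicator of a proposition. -/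
def ind (P : Prop) : ℝ := if P then 1 else 0

lemma ind_nonneg (P : Prop) : 0 ≤ ind P := by unfold ind; split_ifs <;> norm_num
lemma ind_le_one (P : Prop) : ind P ≤ 1 := by unfold ind; split_ifs <;> norm_num
lemma ind_true {P : Prop} (h : P) : ind P = 1 := by simp [ind, h]
lemma ind_false {P : Prop} (h : ¬ P) : ind P = 0 := by simp [ind, h]
lemma ind_mono {P Q : Prop} (h : P → Q) : ind P ≤ ind Q := by
  by_cases hP : P
  · rw [ind_true hP, ind_true (h hP)]
  · rw [ind_false hP]; exact ind_nonneg _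
lemma ind_le {P : Prop} {x : ℝ} (hx : 0 ≤ x) (h : P → 1 ≤ x) : ind P ≤ x := by
  by_cases hP : P
  · rw [ind_true hP]; exact h hP
  · rw [ind_false hP]; exact hx
lemma ind_or (P Q : Prop) : ind (P ∨ Q) ≤ ind P + ind Q := by
  by_cases hP : P <;> by_cases hQ : Q <;> simp [ind, hP, hQ]
lemma ind_not (P : Prop) : ind (¬ P) = 1 - ind P := by
  by_cases hP : P <;> simp [ind, hP]
lemma ind_and (P Q : Prop) : ind (P ∧ Q) = ind P * ind Q := by
  by_cases hP : P <;> by_cases hQ : Q <;> simp [ind, hP, hQ]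

section prob
variable {β : Type*} [DecidableEq β]

/-- Weight of `G` in the random subset of `E`. -/
def wt (E : Finset β) (p : ℝ) (G : Finset β) : ℝ := p ^ G.card * (1 - p) ^ (E.card - G.card)

/-- Expectation over the random subset of `E`. -/
def ex (E : Finset β) (p : ℝ) (f : Finset β → ℝ) : ℝ := ∑ G ∈ E.powerset, wt E p G * f G

lemma sprob_eq (E : Finset β) (p : ℝ) (P : Finset β → Prop) :
    sprob E p P = ex E p (fun G => ind (P G)) := by
  unfold sprob ex ind wt
  refine Finset.sum_congr rfl fun G _ => ?_
  by_cases hP : P G <;> simp [hP]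

lemma hprob_eq (n k : ℕ) (p : ℝ) (P : Finset (Finset (Fin n)) → Prop) :
    hprob n k p P = sprob (kSets n k) p P := rfl

lemma wt_nonneg {E : Finset β} {p : ℝ} (h0 : 0 ≤ p) (h1 : p ≤ 1) (G : Finset β) : 0 ≤ wt E p G :=
  mul_nonneg (pow_nonneg h0 _) (pow_nonneg (by linarith) _)

lemma ex_const (E : Finset β) (p c : ℝ) : ex E p (fun _ => c) = c := by
  unfold ex wt
  rw [← Finset.sum_mul, Finset.sum_pow_mul_eq_add_pow]; simp

lemma ex_mono {E : Finset β} {p : ℝ} (h0 : 0 ≤ p) (h1 : p ≤ 1) {f g : Finset β → ℝ}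
    (h : ∀ G ⊆ E, f G ≤ g G) : ex E p f ≤ ex E p g :=
  Finset.sum_le_sum fun G hG =>
    mul_le_mul_of_nonneg_left (h G (Finset.mem_powerset.1 hG)) (wt_nonneg h0 h1 G)

lemma ex_congr {E : Finset β} {p : ℝ} {f g : Finset β → ℝ}
    (h : ∀ G ⊆ E, f G = g G) : ex E p f = ex E p g :=
  Finset.sum_congr rfl fun G hG => by rw [h G (Finset.mem_powerset.1 hG)]

lemma ex_add (E : Finset β) (p : ℝ) (f g : Finset β → ℝ) :
    ex E p (fun G => f G + g G) = ex E p f + ex E p g := by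
  unfold ex; rw [← Finset.sum_add_distrib]; exact Finset.sum_congr rfl fun _ _ => by ring

lemma ex_sub (E : Finset β) (p : ℝ) (f g : Finset β → ℝ) :
    ex E p (fun G => f G - g G) = ex E p f - ex E p g := by
  unfold ex; rw [← Finset.sum_sub_distrib]; exact Finset.sum_congr rfl fun _ _ => by ring

lemma ex_mul_left (E : Finset β) (p c : ℝ) (f : Finset β → ℝ) :
    ex E p (fun G => c * f G) = c * ex E p f := by
  unfold ex; rw [Finset.mul_sum]; exact Finset.sum_congr rfl fun _ _ => by ring

lemma ex_mul_right (E : Finset β) (p c : ℝ) (f : Finset β → ℝ) :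
    ex E p (fun G => f G * c) = ex E p f * c := by
  unfold ex; rw [Finset.sum_mul]; exact Finset.sum_congr rfl fun _ _ => by ring

lemma ex_sum {ι : Type*} (s : Finset ι) (E : Finset β) (p : ℝ) (f : ι → Finset β → ℝ) :
    ex E p (fun G => ∑ i ∈ s, f i G) = ∑ i ∈ s, ex E p (f i) := by
  unfold ex; rw [Finset.sum_comm]; exact Finset.sum_congr rfl fun _ _ => by rw [Finset.mul_sum]

lemma ex_nonneg {E : Finset β} {p : ℝ} (h0 : 0 ≤ p) (h1 : p ≤ 1) {f : Finset β → ℝ}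
    (h : ∀ G ⊆ E, 0 ≤ f G) : 0 ≤ ex E p f :=
  Finset.sum_nonneg fun G hG => mul_nonneg (wt_nonneg h0 h1 G) (h G (Finset.mem_powerset.1 hG))

lemma ex_le_const {E : Finset β} {p c : ℝ} (h0 : 0 ≤ p) (h1 : p ≤ 1) {f : Finset β → ℝ}
    (h : ∀ G ⊆ E, f G ≤ c) : ex E p f ≤ c := by
  have := ex_mono h0 h1 h
  rwa [ex_const] at this

lemma sprob_nonneg {E : Finset β} {p : ℝ} (h0 : 0 ≤ p) (h1 : p ≤ 1) (P : Finset β → Prop) :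
    0 ≤ sprob E p P := by rw [sprob_eq]; exact ex_nonneg h0 h1 fun _ _ => ind_nonneg _

lemma sprob_le_one {E : Finset β} {p : ℝ} (h0 : 0 ≤ p) (h1 : p ≤ 1) (P : Finset β → Prop) :
    sprob E p P ≤ 1 := by rw [sprob_eq]; exact ex_le_const h0 h1 fun _ _ => ind_le_one _

lemma sprob_mono {E : Finset β} {p : ℝ} (h0 : 0 ≤ p) (h1 : p ≤ 1) {P Q : Finset β → Prop}
    (h : ∀ G ⊆ E, P G → Q G) : sprob E p P ≤ sprob E p Q := by
  rw [sprob_eq, sprob_eq]; exact ex_mono h0 h1 fun G hG => ind_mono (h G hG)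

lemma sprob_not (E : Finset β) (p : ℝ) (P : Finset β → Prop) :
    sprob E p (fun G => ¬ P G) = 1 - sprob E p P := by
  rw [sprob_eq, sprob_eq]; simp only [ind_not]; rw [ex_sub, ex_const]

lemma sprob_or {E : Finset β} {p : ℝ} (h0 : 0 ≤ p) (h1 : p ≤ 1) (P Q : Finset β → Prop) :
    sprob E p (fun G => P G ∨ Q G) ≤ sprob E p P + sprob E p Q := by
  rw [sprob_eq, sprob_eq, sprob_eq, ← ex_add]; exact ex_mono h0 h1 fun G _ => ind_or _ _

lemma sprob_le_ex {E : Finset β} {p : ℝ} (h0 : 0 ≤ p) (h1 : p ≤ 1) {P : Finset β → Prop}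
    {f : Finset β → ℝ} (hf : ∀ G ⊆ E, 0 ≤ f G) (h : ∀ G ⊆ E, P G → 1 ≤ f G) :
    sprob E p P ≤ ex E p f := by
  rw [sprob_eq]; exact ex_mono h0 h1 fun G hG => ind_le (hf G hG) (h G hG)

lemma sprob_exists {ι : Type*} {E : Finset β} {p : ℝ} (h0 : 0 ≤ p) (h1 : p ≤ 1) (s : Finset ι)
    (P : ι → Finset β → Prop) :
    sprob E p (fun G => ∃ i ∈ s, P i G) ≤ ∑ i ∈ s, sprob E p (P i) := by
  simp only [sprob_eq]; rw [← ex_sum]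
  refine ex_mono h0 h1 fun G _ => ind_le (Finset.sum_nonneg fun _ _ => ind_nonneg _) ?_
  rintro ⟨i, hi, hP⟩
  rw [← ind_true hP]
  exact Finset.single_le_sum (f := fun i => ind (P i G)) (fun _ _ => ind_nonneg _) hi

lemma wt_union {E1 E2 : Finset β} (hd : Disjoint E1 E2) (p : ℝ) {G1 G2 : Finset β}
    (h1 : G1 ⊆ E1) (h2 : G2 ⊆ E2) : wt (E1 ∪ E2) p (G1 ∪ G2) = wt E1 p G1 * wt E2 p G2 := by
  unfold wt
  rw [Finset.card_union_of_disjoint hd,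
    Finset.card_union_of_disjoint (Finset.disjoint_of_subset_left h1
      (Finset.disjoint_of_subset_right h2 hd))]
  have a1 := Finset.card_le_card h1
  have a2 := Finset.card_le_card h2
  rw [show E1.card + E2.card - (G1.card + G2.card) = (E1.card - G1.card) + (E2.card - G2.card) by
    omega, pow_add, pow_add]
  ring

lemma ex_union {E1 E2 : Finset β} (hd : Disjoint E1 E2) (p : ℝ) (f : Finset β → ℝ) :
    ex (E1 ∪ E2) p f = ex E1 p (fun G1 => ex E2 p (fun G2 => f (G1 ∪ G2))) := by
  unfold ex
  simp only [Finset.mul_sum]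
  rw [← Finset.sum_product']
  symm
  refine Finset.sum_bij' (fun x _ => x.1 ∪ x.2) (fun G _ => (G ∩ E1, G ∩ E2)) ?_ ?_ ?_ ?_ ?_
  · rintro ⟨a, b⟩ h
    simp only [Finset.mem_product, Finset.mem_powerset] at h ⊢
    exact Finset.union_subset_union h.1 h.2
  · intro G h
    simp only [Finset.mem_product, Finset.mem_powerset] at h ⊢
    exact ⟨Finset.inter_subset_right, Finset.inter_subset_right⟩
  · rintro ⟨a, b⟩ h
    simp only [Finset.mem_product, Finset.mem_powerset] at h ⊢
    have hd' := Finset.disjoint_left.1 hd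
    ext y
    · simp only [Finset.mem_inter, Finset.mem_union]
      constructor
      · rintro ⟨h1 | h1, h2⟩
        · exact h1
        · exact absurd (h.2 h1) (hd' h2)
      · exact fun h1 => ⟨Or.inl h1, h.1 h1⟩
    · simp only [Finset.mem_inter, Finset.mem_union]
      constructor
      · rintro ⟨h1 | h1, h2⟩
        · exact absurd h2 (hd' (h.1 h1))
        · exact h1
      · exact fun h1 => ⟨Or.inr h1, h.2 h1⟩
  · intro G h
    simp only [Finset.mem_powerset] at h
    show G ∩ E1 ∪ G ∩ E2 = G
    rw [← Finset.inter_union_distrib_left]; exact Finset.inter_eq_left.2 h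
  · rintro ⟨a, b⟩ h
    simp only [Finset.mem_product, Finset.mem_powerset] at h
    rw [wt_union hd p h.1 h.2]; ring

/-- Splitting over a subset and its complement. -/
lemma ex_split {E F : Finset β} (hF : F ⊆ E) (p : ℝ) (f : Finset β → ℝ) :
    ex E p f = ex F p (fun G1 => ex (E \ F) p (fun G2 => f (G1 ∪ G2))) := by
  conv_lhs => rw [← Finset.union_sdiff_of_subset hF]
  exact ex_union Finset.disjoint_sdiff p f

lemma ex_marg {E F : Finset β} (hF : F ⊆ E) (p : ℝ) (f : Finset β → ℝ) :
    ex E p (fun G => f (G ∩ F)) = ex F p f := by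
  rw [ex_split hF]
  refine ex_congr fun G1 h1 => ?_
  rw [ex_congr (g := fun _ => f G1), ex_const]
  intro G2 h2
  congr 1
  ext y
  have := @h1 y
  have := @h2 y
  simp only [Finset.mem_inter, Finset.mem_union, Finset.mem_sdiff] at *
  tauto

lemma sprob_marg {E F : Finset β} (hF : F ⊆ E) (p : ℝ) (P : Finset β → Prop) :
    sprob E p (fun G => P (G ∩ F)) = sprob F p P := by
  rw [sprob_eq, sprob_eq]; exact ex_marg hF p (fun G => ind (P G))

/-- independence product -/
lemma ex_indep {E F : Finset β} (hF : F ⊆ E) (p : ℝ) (f g : Finset β → ℝ) :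
    ex E p (fun G => f (G ∩ F) * g (G \ F)) = ex F p f * ex (E \ F) p g := by
  rw [ex_split hF, ← ex_mul_right]
  refine ex_congr fun G1 h1 => ?_
  rw [← ex_mul_left]
  refine ex_congr fun G2 h2 => ?_
  have e1 : (G1 ∪ G2) ∩ F = G1 := by
    ext y
    have := @h1 y
    have := @h2 y
    simp only [Finset.mem_inter, Finset.mem_union, Finset.mem_sdiff] at *
    tauto
  have e2 : (G1 ∪ G2) \ F = G2 := by
    ext y
    have := @h1 y
    have := @h2 y
    simp only [Finset.mem_union, Finset.mem_sdiff] at *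
    tauto
  rw [e1, e2]

lemma sprob_self (E : Finset β) (p : ℝ) : sprob E p (fun G => G = E) = p ^ E.card := by
  unfold sprob
  rw [Finset.sum_eq_single E]
  · simp
  · intro b _ hb; simp [hb]
  · intro h; exact absurd (Finset.mem_powerset_self E) h

lemma sprob_subset {E C : Finset β} (hC : C ⊆ E) (p : ℝ) :
    sprob E p (fun G => C ⊆ G) = p ^ C.card := by
  rw [← sprob_self C p, ← sprob_marg hC]
  simp only [sprob_eq]
  refine ex_congr fun G _ => ?_
  simp only [Finset.inter_eq_right]

/-- First moment bound. -/
lemma first_moment {E : Finset β} {p : ℝ} (h0 : 0 ≤ p) (h1 : p ≤ 1)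
    (𝒞 : Finset (Finset β)) (h𝒞 : ∀ C ∈ 𝒞, C ⊆ E) :
    sprob E p (fun G => ∃ C ∈ 𝒞, C ⊆ G) ≤ ∑ C ∈ 𝒞, p ^ C.card := by
  refine (sprob_exists h0 h1 𝒞 (fun C G => C ⊆ G)).trans (le_of_eq ?_)
  exact Finset.sum_congr rfl fun C hC => sprob_subset (h𝒞 C hC) p

lemma ex_pow_card (E : Finset β) (p a : ℝ) :
    ex E p (fun G => a ^ G.card) = (1 - p + p * a) ^ E.card := by
  unfold ex wt
  rw [add_comm, ← Finset.sum_pow_mul_eq_add_pow]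
  exact Finset.sum_congr rfl fun G _ => by rw [mul_pow]; ring

lemma ex_fcard (E : Finset β) (p : ℝ) (f : ℕ → ℝ) :
    ex E p (fun G => f G.card) =
      ∑ j ∈ Finset.range (E.card + 1), (E.card.choose j : ℝ) * p ^ j * (1 - p) ^ (E.card - j) * f j := by
  unfold ex wt
  rw [Finset.sum_powerset_apply_card (fun j => p ^ j * (1 - p) ^ (E.card - j) * f j)]
  refine Finset.sum_congr rfl fun j _ => ?_
  rw [nsmul_eq_mul]; ring

lemma sprob_card_ge (E : Finset β) (p : ℝ) (t : ℕ) :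
    sprob E p (fun G => t ≤ G.card) = binomProbGe E.card p t := by
  rw [sprob_eq, ex_fcard E p (fun j => ind (t ≤ j))]
  unfold binomProbGe
  have : Finset.Icc t E.card = (Finset.range (E.card + 1)).filter (fun j => t ≤ j) := by
    ext j; simp only [Finset.mem_Icc, Finset.mem_filter, Finset.mem_range]; omega
  rw [this, Finset.sum_filter]
  refine Finset.sum_congr rfl fun j _ => ?_
  unfold ind; split_ifs <;> simp

lemma sprob_inter_card_ge {E F : Finset β} (hF : F ⊆ E) (p : ℝ) (t : ℕ) :
    sprob E p (fun G => t ≤ (G ∩ F).card) = binomProbGe F.card p t := by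
  rw [sprob_marg hF p (fun G => t ≤ G.card), sprob_card_ge]

/-- Two-stage sampling. -/
lemma ex_ex (E : Finset β) (p r : ℝ) (f : Finset β → ℝ) :
    ex E p (fun H => ex H r f) = ex E (p * r) f := by
  induction E using Finset.induction_on generalizing f with
  | empty => simp [ex, wt]
  | insert a s ha ih =>
    have hd : Disjoint ({a} : Finset β) s := by simpa using ha
    have single : ∀ (q : ℝ) (g : Finset β → ℝ), ex {a} q g = (1 - q) * g ∅ + q * g {a} := by
      intro q g
      unfold ex wt
      rw [show ({a} : Finset β) = insert a ∅ by simp, Finset.sum_powerset_insert (by simp)]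
      simp
    rw [Finset.insert_eq, ex_union hd, ex_union hd, single, single, ← ih, ← ih]
    have e2 : ex s p (fun G2 => ex ({a} ∪ G2) r f) =
        ex s p (fun G2 => (1 - r) * ex G2 r (fun G => f (∅ ∪ G)) + r * ex G2 r (fun G => f ({a} ∪ G))) := by
      refine ex_congr fun G hG => ?_
      have hd' : Disjoint ({a} : Finset β) G := Finset.disjoint_of_subset_right hG hd
      rw [ex_union hd', single]
    rw [e2, ex_add, ex_mul_left, ex_mul_left]
    have e1 : ex s p (fun G2 => ex (∅ ∪ G2) r f) = ex s p (fun G2 => ex G2 r (fun G => f (∅ ∪ G))) := by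
      simp
    rw [e1]; ring

lemma sprob_two_stage (E : Finset β) (p r : ℝ) (P : Finset β → Prop) :
    ex E p (fun H => sprob H r P) = sprob E (p * r) P := by
  simp only [sprob_eq]; exact ex_ex E p r _

/-- Lower Chernoff. -/
lemma chernoff_lower {E F : Finset β} (hF : F ⊆ E) {p : ℝ} (h0 : 0 ≤ p) (h1 : p ≤ 1) :
    sprob E p (fun G => ((G ∩ F).card : ℝ) < p * F.card / 2) ≤ Real.exp (-(p * F.card) / 8) := by
  rw [sprob_marg hF p (fun G => ((G.card : ℕ) : ℝ) < p * F.card / 2)]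
  set m := p * F.card with hm
  have key : sprob F p (fun G => ((G.card : ℕ) : ℝ) < m / 2) ≤
      ex F p (fun G => Real.exp (m * (5/16)) * (Real.exp (-(5/8))) ^ G.card) := by
    refine sprob_le_ex h0 h1 (fun _ _ => by positivity) fun G _ hG => ?_
    rw [← Real.exp_nat_mul, ← Real.exp_add]
    apply Real.one_le_exp
    linarith
  refine key.trans ?_
  rw [ex_mul_left, ex_pow_card]
  have hb : (1 - p + p * Real.exp (-(5/8))) ^ F.card ≤ Real.exp (-(7/16) * m) := by
    have hle : 1 - p + p * Real.exp (-(5/8)) ≤ Real.exp (-(7/16) * p) := by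
      have h2 : Real.exp (-(5/8)) ≤ 9/16 := by
        rw [Real.exp_neg, inv_le_comm₀ (Real.exp_pos _) (by norm_num)]
        have := Real.quadratic_le_exp_of_nonneg (x := 5/8) (by norm_num)
        norm_num at this ⊢
        linarith
      have h3 := Real.add_one_le_exp (-(7/16) * p)
      nlinarith
    have hpos : 0 ≤ 1 - p + p * Real.exp (-(5/8)) := by
      have := mul_nonneg h0 (Real.exp_pos (-(5/8))).le
      linarith
    calc _ ≤ (Real.exp (-(7/16) * p)) ^ F.card := pow_le_pow_left₀ hpos hle _
      _ = _ := by rw [← Real.exp_nat_mul, hm]; congr 1; ring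
  calc _ ≤ Real.exp (m * (5/16)) * Real.exp (-(7/16) * m) := by gcongr
    _ = _ := by rw [← Real.exp_add]; congr 1; ring

/-- Upper Chernoff. -/
lemma chernoff_upper {E F : Finset β} (hF : F ⊆ E) {p : ℝ} (h0 : 0 ≤ p) (h1 : p ≤ 1) {m : ℝ}
    (hm : p * F.card ≤ m) :
    sprob E p (fun G => 2 * m < ((G ∩ F).card : ℝ)) ≤ Real.exp (- m / 8) := by
  rw [sprob_marg hF p (fun G => 2 * m < ((G.card : ℕ) : ℝ))]
  have hm0 : 0 ≤ m := le_trans (by positivity) hm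
  have key : sprob F p (fun G => 2 * m < ((G.card : ℕ) : ℝ)) ≤
      ex F p (fun G => Real.exp (- m * (5/4)) * (Real.exp (5/8)) ^ G.card) := by
    refine sprob_le_ex h0 h1 (fun _ _ => by positivity) fun G _ hG => ?_
    rw [← Real.exp_nat_mul, ← Real.exp_add]
    apply Real.one_le_exp
    linarith
  refine key.trans ?_
  rw [ex_mul_left, ex_pow_card]
  have hb : (1 - p + p * Real.exp (5/8)) ^ F.card ≤ Real.exp ((9/8) * m) := by
    have hle : 1 - p + p * Real.exp (5/8) ≤ Real.exp ((9/8) * p) := by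
      have h2 : Real.exp (5/8) ≤ 17/8 := by
        have h := Real.exp_bound_div_one_sub_of_interval (x := 5/8) (by norm_num) (by norm_num)
        have h4 : Real.exp (5/8) ^ 8 ≤ (17/8) ^ 8 := by
          rw [← Real.exp_nat_mul]
          have h5 := Real.exp_one_lt_d9
          calc Real.exp (((8:ℕ):ℝ) * (5/8)) = Real.exp 1 ^ 5 := by
                rw [← Real.exp_nat_mul]; norm_num
            _ ≤ 2.7182818286 ^ 5 := by gcongr
            _ ≤ _ := by norm_num
        exact le_of_pow_le_pow_left₀ (by norm_num) (by norm_num) h4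
      have h3 := Real.add_one_le_exp ((9/8) * p)
      nlinarith
    have hpos : 0 ≤ 1 - p + p * Real.exp (5/8) := by
      have := mul_nonneg h0 (Real.exp_pos (5/8)).le
      linarith
    calc _ ≤ (Real.exp ((9/8) * p)) ^ F.card := pow_le_pow_left₀ hpos hle _
      _ = Real.exp ((9/8) * (p * F.card)) := by rw [← Real.exp_nat_mul]; congr 1; ring
      _ ≤ _ := by gcongr
  calc _ ≤ Real.exp (- m * (5/4)) * Real.exp ((9/8) * m) := by gcongr
    _ = _ := by rw [← Real.exp_add]; congr 1; ring

end prob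
end
end EKRP

set_option linter.unusedSectionVars false

namespace EKRP
noncomputable section

section na
variable {α : Type*} [DecidableEq α]

open Classical in
/-- number of `m`-subsets of `V` with property `F` -/
def cnt (V : Finset α) (m : ℕ) (F : Finset α → Prop) : ℕ := ((Finset.powersetCard m V).filter F).card

lemma cnt_split (V : Finset α) (m : ℕ) (F G : Finset α → Prop) :
    cnt V m F = cnt V m (fun A => F A ∧ G A) + cnt V m (fun A => F A ∧ ¬ G A) := by
  classical
  unfold cnt
  have := Finset.card_filter_add_card_filter_not (s := (Finset.powersetCard m V).filter F) G
  rw [Finset.filter_filter, Finset.filter_filter] at this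
  rw [← this]
  congr!

lemma cnt_congr {V V' : Finset α} {m : ℕ} {F F' : Finset α → Prop}
    (h : ∀ A, (A ⊆ V ∧ A.card = m ∧ F A) ↔ (A ⊆ V' ∧ A.card = m ∧ F' A)) : cnt V m F = cnt V' m F' := by
  classical
  unfold cnt
  congr 1
  ext A
  simp only [Finset.mem_filter, Finset.mem_powersetCard, and_assoc]
  exact h A

lemma cnt_le_choose (V : Finset α) (m : ℕ) (F : Finset α → Prop) : cnt V m F ≤ V.card.choose m := by
  classical
  unfold cnt
  refine (Finset.card_filter_le _ _).trans ?_
  rw [Finset.card_powersetCard]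

lemma cnt_lym (W : Finset α) (m : ℕ) (F : Finset α → Prop)
    (hmono : ∀ A B, A ⊆ B → F A → F B) :
    (W.card - m) * cnt W m F ≤ (m + 1) * cnt W (m + 1) F := by
  classical
  unfold cnt
  set S := (Finset.powersetCard m W).filter F
  set T := (Finset.powersetCard (m+1) W).filter F
  have h1 : (S.sigma fun A => W \ A).card = (W.card - m) * S.card := by
    rw [Finset.card_sigma, Finset.sum_const_nat (m := W.card - m)]
    · ring
    · intro A hA
      simp only [S, Finset.mem_filter, Finset.mem_powersetCard] at hA
      rw [Finset.card_sdiff_of_subset hA.1.1, hA.1.2]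
  have h2 : (T.sigma fun A => A).card = (m + 1) * T.card := by
    rw [Finset.card_sigma, Finset.sum_const_nat (m := m + 1)]
    · ring
    · intro A hA
      simp only [T, Finset.mem_filter, Finset.mem_powersetCard] at hA
      exact hA.1.2
  rw [← h1, ← h2]
  refine Finset.card_le_card_of_injOn (fun x => ⟨insert x.2 x.1, x.2⟩) ?_ ?_
  · rintro ⟨A, a⟩ h
    simp only [Finset.coe_sigma, Set.mem_sigma_iff, Finset.mem_coe, S, T, Finset.mem_filter,
      Finset.mem_powersetCard, Finset.mem_sdiff] at h ⊢
    refine ⟨⟨⟨Finset.insert_subset h.2.1 h.1.1.1, ?_⟩, hmono _ _ (Finset.subset_insert _ _) h.1.2⟩,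
      Finset.mem_insert_self _ _⟩
    rw [Finset.card_insert_of_notMem h.2.2, h.1.1.2]
  · rintro ⟨A, a⟩ h ⟨A', a'⟩ h' heq
    simp only [Finset.coe_sigma, Set.mem_sigma_iff, Finset.mem_coe, Finset.mem_sdiff] at h h'
    simp only [Sigma.mk.injEq, heq_eq_eq] at heq
    obtain ⟨e1, rfl⟩ := heq
    have : A = A' := by
      rw [← Finset.erase_insert h.2.2, e1, Finset.erase_insert h'.2.2]
    subst this; rfl

lemma cnt_insert (W : Finset α) {e : α} (he : e ∉ W) (m : ℕ) (F : Finset α → Prop)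
    (hind : ∀ A, F (insert e A) ↔ F A) :
    cnt (insert e W) (m + 1) F = cnt W (m + 1) F + cnt W m F := by
  classical
  unfold cnt
  rw [Finset.powersetCard_succ_insert he, Finset.filter_union, Finset.card_union_of_disjoint]
  · congr 1
    rw [Finset.filter_image]
    simp only [hind]
    refine Finset.card_image_of_injOn ?_
    intro A hA B hB hAB
    simp only [Finset.coe_filter, Finset.mem_powersetCard, Set.mem_ofPred_eq] at hA hB
    have h1 : e ∉ A := fun h => he (hA.1.1 h)
    have h2 : e ∉ B := fun h => he (hB.1.1 h)
    rw [← Finset.erase_insert h1, hAB, Finset.erase_insert h2]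
  · rw [Finset.disjoint_left]
    intro A h1 h2
    simp only [Finset.mem_filter, Finset.mem_powersetCard, Finset.mem_image] at h1 h2
    obtain ⟨⟨B, hB, rfl⟩, _⟩ := h2
    exact he (h1.1.1 (Finset.mem_insert_self _ _))

lemma cnt_remove1 (W : Finset α) {e : α} (he : e ∉ W) (m : ℕ) (F : Finset α → Prop)
    (hmono : ∀ A B, A ⊆ B → F A → F B) (hind : ∀ A, F (insert e A) ↔ F A) :
    cnt (insert e W) m F * W.card.choose m ≤ cnt W m F * (W.card + 1).choose m := by
  rcases m with _ | m
  · simp [cnt]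
  · rw [cnt_insert W he m F hind]
    by_cases hm : W.card ≤ m
    · rw [Nat.choose_eq_zero_of_lt (by omega : W.card < m + 1)]; simp
    · have h1 := cnt_lym W m F hmono
      have h2 := Nat.choose_succ_right_eq W.card m
      have h3 := Nat.choose_succ_succ' W.card m
      rw [h3]
      have : cnt W m F * W.card.choose (m+1) ≤ cnt W (m+1) F * W.card.choose m := by
        have h4 : (m + 1) * (cnt W m F * W.card.choose (m+1)) ≤
            (m + 1) * (cnt W (m+1) F * W.card.choose m) := by
          calc _ = cnt W m F * (W.card.choose (m+1) * (m+1)) := by ring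
            _ = ((W.card - m) * cnt W m F) * W.card.choose m := by rw [h2]; ring
            _ ≤ ((m+1) * cnt W (m+1) F) * W.card.choose m := Nat.mul_le_mul_right _ h1
            _ = _ := by ring
        exact Nat.le_of_mul_le_mul_left h4 (by omega)
      nlinarith

lemma cnt_remove (V B : Finset α) (hd : Disjoint V B) (m : ℕ) (F : Finset α → Prop)
    (hmono : ∀ A B, A ⊆ B → F A → F B) (hind : ∀ e ∈ B, ∀ A, F (insert e A) ↔ F A) :
    cnt (V ∪ B) m F * V.card.choose m ≤ cnt V m F * (V.card + B.card).choose m := by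
  induction B using Finset.induction_on with
  | empty => simp
  | insert e B he ih =>
    rw [Finset.disjoint_insert_right] at hd
    have ih' := ih hd.2 (fun e h => hind e (Finset.mem_insert_of_mem h))
    have he' : e ∉ V ∪ B := by simp [hd.1, he]
    have h1 := cnt_remove1 (V ∪ B) he' m F hmono (hind e (Finset.mem_insert_self _ _))
    rw [Finset.union_insert, Finset.card_insert_of_notMem he]
    rw [Finset.card_union_of_disjoint hd.2] at h1
    rcases Nat.eq_zero_or_pos ((V.card + B.card).choose m) with h0 | hpos
    · have : V.card.choose m = 0 := by
        have := Nat.choose_le_choose m (show V.card ≤ V.card + B.card by omega)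
        omega
      simp [this]
    · refine Nat.le_of_mul_le_mul_left ?_ hpos
      calc _ = (cnt (insert e (V ∪ B)) m F * (V.card + B.card).choose m) * V.card.choose m := by ring
        _ ≤ (cnt (V ∪ B) m F * (V.card + B.card + 1).choose m) * V.card.choose m :=
            Nat.mul_le_mul_right _ h1
        _ = (cnt (V ∪ B) m F * V.card.choose m) * (V.card + B.card + 1).choose m := by ring
        _ ≤ (cnt V m F * (V.card + B.card).choose m) * (V.card + B.card + 1).choose m :=
            Nat.mul_le_mul_right _ ih'
        _ = _ := by ring_nf

/-- Negative-association counting lemma. -/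
lemma na_count {ι : Type*} [DecidableEq ι] (U : Finset α) (m : ℕ) (I : Finset ι) (B : ι → Finset α)
    {θ : ℝ} (hθ : 0 ≤ θ) (hB : ∀ i ∈ I, B i ⊆ U)
    (hdis : ∀ i ∈ I, ∀ j ∈ I, i ≠ j → Disjoint (B i) (B j))
    (hmiss : ∀ i ∈ I, (1 - θ) * (U.card.choose m : ℝ) ≤ ((U.card - (B i).card).choose m : ℝ)) :
    (cnt U m (fun A => ∀ i ∈ I, (A ∩ B i).Nonempty) : ℝ) ≤ θ ^ I.card * (U.card.choose m : ℝ) := by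
  classical
  induction I using Finset.induction_on with
  | empty => simp [cnt]
  | insert i I hi ih =>
    have ih' := ih (fun j h => hB j (Finset.mem_insert_of_mem h))
      (fun a ha b hb => hdis a (Finset.mem_insert_of_mem ha) b (Finset.mem_insert_of_mem hb))
      (fun j h => hmiss j (Finset.mem_insert_of_mem h))
    set F : Finset α → Prop := fun A => ∀ i ∈ I, (A ∩ B i).Nonempty with hF
    have hBi := hB i (Finset.mem_insert_self _ _)
    have hmono : ∀ A A', A ⊆ A' → F A → F A' := fun A A' h hA j hj =>
      (hA j hj).mono (Finset.inter_subset_inter_right h)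
    have hind : ∀ e ∈ B i, ∀ A, F (insert e A) ↔ F A := by
      intro e he A
      refine forall₂_congr fun j hj => ?_
      have hne : e ∉ B j := by
        have := hdis i (Finset.mem_insert_self _ _) j (Finset.mem_insert_of_mem hj)
          (fun h => hi (h ▸ hj))
        exact Finset.disjoint_left.1 this he
      rw [Finset.insert_inter_of_notMem hne]
    have hsplit : cnt U m F = cnt U m (fun A => ∀ j ∈ insert i I, (A ∩ B j).Nonempty) +
        cnt (U \ B i) m F := by
      rw [cnt_split U m F (fun A => (A ∩ B i).Nonempty)]
      congr 1
      · refine cnt_congr fun A => ?_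
        rw [Finset.forall_mem_insert, hF]; tauto
      · refine cnt_congr fun A => ?_
        simp only [Finset.not_nonempty_iff_eq_empty, ← Finset.disjoint_iff_inter_eq_empty,
          Finset.subset_sdiff]
        tauto
    have hrem := cnt_remove (U \ B i) (B i) Finset.sdiff_disjoint m F hmono hind
    rw [Finset.sdiff_union_of_subset hBi, Finset.card_sdiff_of_subset hBi,
      Nat.sub_add_cancel (Finset.card_le_card hBi)] at hrem
    have hm := hmiss i (Finset.mem_insert_self _ _)
    have hrem' : (cnt U m F : ℝ) * ((U.card - (B i).card).choose m : ℝ) ≤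
        (cnt (U \ B i) m F : ℝ) * (U.card.choose m : ℝ) := by exact_mod_cast hrem
    have hs : (cnt U m F : ℝ) = cnt U m (fun A => ∀ j ∈ insert i I, (A ∩ B j).Nonempty) +
        cnt (U \ B i) m F := by exact_mod_cast hsplit
    have hcle : cnt U m (fun A => ∀ j ∈ insert i I, (A ∩ B j).Nonempty) ≤ U.card.choose m :=
      cnt_le_choose _ _ _
    rw [Finset.card_insert_of_notMem hi, pow_succ]
    rcases Nat.eq_zero_or_pos (U.card.choose m) with h0 | hpos
    · rw [h0] at hcle
      have : cnt U m (fun A => ∀ j ∈ insert i I, (A ∩ B j).Nonempty) = 0 := by omega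
      rw [this, h0]; simp
    · have hpos' : (0:ℝ) < (U.card.choose m : ℝ) := by exact_mod_cast hpos
      have h1 : (1 - θ) * (cnt U m F : ℝ) ≤ cnt (U \ B i) m F := by
        refine le_of_mul_le_mul_right ?_ hpos'
        calc _ = (cnt U m F : ℝ) * ((1 - θ) * (U.card.choose m : ℝ)) := by ring
          _ ≤ _ := mul_le_mul_of_nonneg_left hm (by positivity)
          _ ≤ _ := hrem'
      have h2 : (cnt U m (fun A => ∀ j ∈ insert i I, (A ∩ B j).Nonempty) : ℝ) ≤ θ * cnt U m F := by
        linarith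
      calc _ ≤ θ * cnt U m F := h2
        _ ≤ θ * (θ ^ I.card * (U.card.choose m : ℝ)) := mul_le_mul_of_nonneg_left ih' hθ
        _ = _ := by ring

open Classical in
/-- Hereditary counting. -/
lemma hered_count (E : Finset α) (𝒟 : Finset α → Prop)
    (hher : ∀ C A, A ∈ C → 𝒟 C → 𝒟 (C.erase A)) (X : ℕ → ℝ) (hX : ∀ i, 0 ≤ X i) (t : ℕ)
    (hext : ∀ C ⊆ E, C.card < t → 𝒟 C → ((E.filter fun A => A ∉ C ∧ 𝒟 (insert A C)).card : ℝ) ≤ X C.card) :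
    ((((Finset.powersetCard t E).filter 𝒟).card : ℝ)) ≤ (∏ i ∈ Finset.range t, X i) / t.factorial := by
  induction t with
  | zero => simpa using (Finset.card_filter_le (Finset.powersetCard 0 E) 𝒟)
  | succ t ih =>
    have ih' := ih (fun C h1 h2 h3 => hext C h1 (by omega) h3)
    set S := (Finset.powersetCard t E).filter 𝒟
    set T := (Finset.powersetCard (t+1) E).filter 𝒟
    have h1 : ((T.sigma fun C => C).card : ℝ) = (t+1) * T.card := by
      have : (T.sigma fun C => C).card = (t+1) * T.card := by
        rw [Finset.card_sigma, Finset.sum_const_nat (m := t+1)]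
        · ring
        · intro A hA
          simp only [T, Finset.mem_filter, Finset.mem_powersetCard] at hA
          exact hA.1.2
      rw [this]; push_cast; ring
    have h2 : (T.sigma fun C => C).card ≤ (S.sigma fun C => E.filter fun A => A ∉ C ∧ 𝒟 (insert A C)).card := by
      refine Finset.card_le_card_of_injOn (fun x => ⟨x.1.erase x.2, x.2⟩) ?_ ?_
      · rintro ⟨C, A⟩ h
        simp only [Finset.coe_sigma, Set.mem_sigma_iff, Finset.mem_coe, S, T, Finset.mem_filter,
          Finset.mem_powersetCard] at h ⊢
        obtain ⟨⟨⟨h1, h2⟩, h3⟩, h4⟩ := h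
        refine ⟨⟨⟨(Finset.erase_subset _ _).trans h1, ?_⟩, hher _ _ h4 h3⟩, h1 h4,
          Finset.notMem_erase _ _, ?_⟩
        · rw [Finset.card_erase_of_mem h4, h2]; rfl
        · rw [Finset.insert_erase h4]; exact h3
      · rintro ⟨C, A⟩ h ⟨C', A'⟩ h' heq
        simp only [Finset.coe_sigma, Set.mem_sigma_iff, Finset.mem_coe] at h h'
        simp only [Sigma.mk.injEq, heq_eq_eq] at heq
        obtain ⟨e1, rfl⟩ := heq
        have : C = C' := by rw [← Finset.insert_erase h.2, e1, Finset.insert_erase h'.2]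
        subst this; rfl
    have h3 : ((S.sigma fun C => E.filter fun A => A ∉ C ∧ 𝒟 (insert A C)).card : ℝ) ≤ S.card * X t := by
      rw [Finset.card_sigma]; push_cast
      rw [← nsmul_eq_mul]
      refine Finset.sum_le_card_nsmul _ _ _ fun C hC => ?_
      simp only [S, Finset.mem_filter, Finset.mem_powersetCard] at hC
      have := hext C hC.1.1 (by omega) hC.2
      rwa [hC.1.2] at this
    have h4 : ((t:ℝ)+1) * T.card ≤ S.card * X t := by
      rw [← h1]; exact le_trans (by exact_mod_cast h2) h3
    rw [Finset.prod_range_succ, Nat.factorial_succ, le_div_iff₀ (by positivity)]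
    rw [le_div_iff₀ (by positivity)] at ih'
    push_cast
    calc (T.card : ℝ) * (((t:ℝ)+1) * t.factorial) = (((t:ℝ)+1) * T.card) * t.factorial := by ring
      _ ≤ (S.card * X t) * t.factorial := by gcongr
      _ = (S.card * t.factorial) * X t := by ring
      _ ≤ _ := mul_le_mul_of_nonneg_right ih' (hX t)

end na
end
end EKRP

namespace EKRP
noncomputable section

lemma card_kSets (n k : ℕ) : (kSets n k).card = n.choose k := by
  simp [kSets]

lemma mem_kSets {n k : ℕ} {A : Finset (Fin n)} : A ∈ kSets n k ↔ A.card = k := by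
  simp [kSets, Finset.mem_powersetCard]

/-- number of `k`-sets containing `Y` -/
lemma card_supersets {n k : ℕ} (Y : Finset (Fin n)) (hY : Y.card ≤ k) :
    ((kSets n k).filter fun A => Y ⊆ A).card = (n - Y.card).choose (k - Y.card) := by
  have : ((kSets n k).filter fun A => Y ⊆ A) =
      (Finset.powersetCard (k - Y.card) (Finset.univ \ Y)).image (fun A => A ∪ Y) := by
    ext A
    simp only [Finset.mem_filter, mem_kSets, Finset.mem_image, Finset.mem_powersetCard]
    constructor
    · rintro ⟨h1, h2⟩
      refine ⟨A \ Y, ⟨Finset.sdiff_subset_sdiff (Finset.subset_univ _) le_rfl, ?_⟩,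
        Finset.sdiff_union_of_subset h2⟩
      rw [Finset.card_sdiff_of_subset h2, h1]
    · rintro ⟨B, ⟨h1, h2⟩, rfl⟩
      refine ⟨?_, Finset.subset_union_right⟩
      rw [Finset.card_union_of_disjoint (Finset.subset_sdiff.1 h1).2, h2]; omega
  rw [this, Finset.card_image_of_injOn, Finset.card_powersetCard,
    Finset.card_sdiff_of_subset (Finset.subset_univ _), Finset.card_univ, Fintype.card_fin]
  intro A hA B hB hAB
  simp only [Finset.mem_coe, Finset.mem_powersetCard, Finset.subset_sdiff] at hA hB
  have e1 : (A ∪ Y) \ Y = A := Finset.union_sdiff_cancel_right hA.1.2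
  have e2 : (B ∪ Y) \ Y = B := Finset.union_sdiff_cancel_right hB.1.2
  rw [← e1, ← e2]; exact congrArg (· \ Y) hAB

lemma choose_sub_le {n k : ℕ} (hn : 0 < n) (hkn : k ≤ n) (y : ℕ) (hy : y ≤ k) :
    ((n - y).choose (k - y) : ℝ) ≤ ((k : ℝ) / n) ^ y * (n.choose k : ℝ) := by
  induction y with
  | zero => simp
  | succ y ih =>
    have ih' := ih (by omega)
    have h1 := Nat.add_one_mul_choose_eq (n - (y+1)) (k - (y+1))
    rw [show n - (y+1) + 1 = n - y by omega, show k - (y+1) + 1 = k - y by omega] at h1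
    have h2 : ((n:ℝ) - y) * ((n - (y+1)).choose (k - (y+1)) : ℝ) = ((n-y).choose (k-y) : ℝ) * ((k:ℝ) - y) := by
      have : (((n - y : ℕ):ℝ)) = (n:ℝ) - y := Nat.cast_sub (by omega)
      rw [← this]
      have : (((k - y : ℕ):ℝ)) = (k:ℝ) - y := Nat.cast_sub (by omega)
      rw [← this]
      exact_mod_cast h1
    have hny : (0:ℝ) < (n:ℝ) - y := by
      have : (y:ℝ) + 1 ≤ k := by exact_mod_cast hy
      have : (k:ℝ) ≤ n := by exact_mod_cast hkn
      linarith
    have hn' : (0:ℝ) < n := by exact_mod_cast hn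
    have hr : ((k:ℝ) - y) / (n - y) ≤ k / n := by
      rw [div_le_div_iff₀ hny hn']
      have : (k:ℝ) ≤ n := by exact_mod_cast hkn
      have : (0:ℝ) ≤ y := by positivity
      nlinarith
    have h3 : ((n - (y+1)).choose (k - (y+1)) : ℝ) = ((n-y).choose (k-y) : ℝ) * (((k:ℝ) - y) / (n - y)) := by
      field_simp; linarith
    rw [h3]
    calc _ ≤ ((n-y).choose (k-y) : ℝ) * (k / n) := by gcongr
      _ ≤ (((k : ℝ) / n) ^ y * (n.choose k : ℝ)) * (k / n) := by gcongr
      _ = _ := by ring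

lemma card_supersets_le {n k : ℕ} (hn : 0 < n) (hkn : k ≤ n) (Y : Finset (Fin n)) :
    (((kSets n k).filter fun A => Y ⊆ A).card : ℝ) ≤ ((k : ℝ) / n) ^ Y.card * (n.choose k : ℝ) := by
  by_cases hY : Y.card ≤ k
  · rw [card_supersets Y hY]; exact choose_sub_le hn hkn _ hY
  · have : ((kSets n k).filter fun A => Y ⊆ A) = ∅ := by
      ext A
      simp only [Finset.mem_filter, mem_kSets, Finset.notMem_empty, iff_false, not_and]
      intro h1 h2
      exact hY (h1 ▸ Finset.card_le_card h2)
    rw [this]; simp; positivity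

lemma card_star {n k : ℕ} (hk : 1 ≤ k) (x : Fin n) :
    ((kSets n k).filter fun A => x ∈ A).card = (n-1).choose (k-1) := by
  have := card_supersets (n := n) (k := k) {x} (by simpa using hk)
  simpa using this

/-- the number of `k`-sets missing a given `k`-set -/
lemma card_miss {n k : ℕ} (A : Finset (Fin n)) (hA : A.card = k) :
    ((kSets n k).filter fun B => ¬ (A ∩ B).Nonempty).card = (n - k).choose k := by
  have : ((kSets n k).filter fun B => ¬ (A ∩ B).Nonempty) = Finset.powersetCard k (Finset.univ \ A) := by
    ext B
    simp only [Finset.mem_filter, mem_kSets, Finset.mem_powersetCard, Finset.subset_sdiff,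
      Finset.not_nonempty_iff_eq_empty, ← Finset.disjoint_iff_inter_eq_empty]
    constructor
    · rintro ⟨h1, h2⟩; exact ⟨⟨Finset.subset_univ _, h2.symm⟩, h1⟩
    · rintro ⟨⟨_, h2⟩, h1⟩; exact ⟨h1, h2.symm⟩
  rw [this, Finset.card_powersetCard, Finset.card_sdiff_of_subset (Finset.subset_univ _),
    Finset.card_univ, Fintype.card_fin, hA]

lemma one_sub_interProb {n k : ℕ} (hkn : k ≤ n) :
    1 - interProb n k = ((n - k).choose k : ℝ) / (n.choose k : ℝ) := by
  have hN : (0:ℝ) < (n.choose k : ℝ) := by exact_mod_cast Nat.choose_pos hkn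
  unfold interProb
  classical
  have h1 := Finset.card_filter_add_card_filter_not (s := (kSets n k) ×ˢ (kSets n k))
    (fun AB => (AB.1 ∩ AB.2).Nonempty)
  have h2 : (((kSets n k) ×ˢ (kSets n k)).filter (fun AB => ¬ (AB.1 ∩ AB.2).Nonempty)).card =
      n.choose k * (n-k).choose k := by
    have : (((kSets n k) ×ˢ (kSets n k)).filter (fun AB => ¬ (AB.1 ∩ AB.2).Nonempty)).card =
        ∑ A ∈ kSets n k, ((kSets n k).filter fun B => ¬ (A ∩ B).Nonempty).card := by
      rw [Finset.card_filter, Finset.sum_product]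
      exact Finset.sum_congr rfl fun A _ => by rw [Finset.card_filter]
    rw [this, Finset.sum_const_nat (m := (n-k).choose k), card_kSets]
    intro A hA
    exact card_miss A (mem_kSets.1 hA)
  rw [h2, Finset.card_product, card_kSets] at h1
  have h3 : ((((kSets n k) ×ˢ (kSets n k)).filter fun AB => (AB.1 ∩ AB.2).Nonempty).card : ℝ) =
      (n.choose k : ℝ)^2 - n.choose k * (n-k).choose k := by
    have : ((((kSets n k) ×ˢ (kSets n k)).filter fun AB => (AB.1 ∩ AB.2).Nonempty).card : ℝ) +
      ((n.choose k * (n-k).choose k : ℕ) : ℝ) = ((n.choose k * n.choose k : ℕ) : ℝ) := by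
        exact_mod_cast h1
    push_cast at this; linarith
  rw [card_kSets]
  convert_to 1 - ((((kSets n k) ×ˢ (kSets n k)).filter fun AB => (AB.1 ∩ AB.2).Nonempty).card : ℝ) /
    (n.choose k : ℝ)^2 = _
  rw [h3]
  field_simp
  ring

lemma interProb_le_one {n k : ℕ} (hkn : k ≤ n) : interProb n k ≤ 1 := by
  have := one_sub_interProb hkn
  have h2 : 0 ≤ ((n - k).choose k : ℝ) / (n.choose k : ℝ) := by positivity
  linarith

lemma interProb_nonneg (n k : ℕ) : 0 ≤ interProb n k := by unfold interProb; positivity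

/-- ratio comparison -/
lemma ratio_aux {n k w m : ℕ} (hk : 1 ≤ k) (hkn : 2 * k ≤ n) (hw : k * w + k ≤ n) (hm : m ≤ k) :
    (n - k).choose m * (n - w).choose m ≤ (n - w - (k - 1)).choose m * n.choose m := by
  induction m with
  | zero => simp
  | succ m ih =>
    have ih' := ih (by omega)
    have e1 := Nat.choose_succ_right_eq (n - k) m
    have e2 := Nat.choose_succ_right_eq (n - w) m
    have e3 := Nat.choose_succ_right_eq (n - w - (k-1)) m
    have e4 := Nat.choose_succ_right_eq n m
    have hfac : (n - k - m) * (n - w - m) ≤ (n - w - (k-1) - m) * (n - m) := by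
      have hwn : w + (2 * k - 1) ≤ n := by
        rcases Nat.eq_zero_or_pos w with h | h
        · omega
        · have : w + k ≤ k * w + 1 := by nlinarith
          omega
      zify [show k ≤ n by omega, show m ≤ n - k by omega, show w ≤ n by omega,
        show m ≤ n - w by omega, show k - 1 ≤ n - w by omega, show m ≤ n - w - (k-1) by omega,
        show m ≤ n by omega, hk]
      zify at hw hm
      nlinarith
    have hpos : 0 < (m+1)*(m+1) := by positivity
    refine Nat.le_of_mul_le_mul_left ?_ hpos
    calc _ = ((n-k).choose (m+1) * (m+1)) * ((n-w).choose (m+1) * (m+1)) := by ring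
      _ = ((n - k).choose m * (n - w).choose m) * ((n - k - m) * (n - w - m)) := by
          rw [e1, e2]; ring
      _ ≤ ((n - w - (k - 1)).choose m * n.choose m) * ((n - w - (k-1) - m) * (n - m)) :=
          Nat.mul_le_mul ih' hfac
      _ = ((n - w - (k - 1)).choose (m+1) * (m+1)) * (n.choose (m+1) * (m+1)) := by
          rw [e3, e4]; ring
      _ = _ := by ring

lemma ratio_mono {a b m k : ℕ} (hab : a ≤ b) (hm : m ≤ k) :
    a.choose k * b.choose m ≤ a.choose m * b.choose k := by
  induction k, hm using Nat.le_induction with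
  | base => exact le_refl _
  | succ k hk ih =>
    have e1 := Nat.choose_succ_right_eq a k
    have e2 := Nat.choose_succ_right_eq b k
    refine Nat.le_of_mul_le_mul_left ?_ (show 0 < k + 1 by omega)
    calc _ = (a.choose (k+1) * (k+1)) * b.choose m := by ring
      _ = (a.choose k * b.choose m) * (a - k) := by rw [e1]; ring
      _ ≤ (a.choose m * b.choose k) * (b - k) := Nat.mul_le_mul ih (by omega)
      _ = a.choose m * (b.choose (k+1) * (k+1)) := by rw [e2]; ring
      _ = _ := by ring

lemma miss_bound {n k w m b : ℕ} (hk : 1 ≤ k) (hkn : 2 * k ≤ n) (hw : k * w + k ≤ n) (hm : m ≤ k)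
    (hb : b ≤ k - 1) :
    (1 - interProb n k) * ((n - w).choose m : ℝ) ≤ ((n - w - b).choose m : ℝ) := by
  rw [one_sub_interProb (by omega)]
  have hN : (0:ℝ) < (n.choose k : ℝ) := by exact_mod_cast Nat.choose_pos (by omega)
  have hNm : (0:ℝ) < (n.choose m : ℝ) := by exact_mod_cast Nat.choose_pos (by omega)
  have h1 : ((n - k).choose m : ℝ) * (n - w).choose m ≤ (n - w - (k - 1)).choose m * n.choose m := by
    exact_mod_cast ratio_aux hk hkn hw hm
  have h2 : ((n - k).choose k : ℝ) * n.choose m ≤ (n-k).choose m * n.choose k := by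
    exact_mod_cast ratio_mono (show n - k ≤ n by omega) hm
  have h3 : ((n - w - (k-1)).choose m : ℝ) ≤ (n - w - b).choose m := by
    exact_mod_cast Nat.choose_le_choose m (by omega)
  refine le_trans ?_ h3
  rw [div_mul_eq_mul_div, div_le_iff₀ hN]
  refine le_of_mul_le_mul_right ?_ hNm
  calc _ = ((n - k).choose k : ℝ) * n.choose m * (n-w).choose m := by ring
    _ ≤ (n-k).choose m * n.choose k * (n-w).choose m := by gcongr
    _ = ((n - k).choose m : ℝ) * (n - w).choose m * n.choose k := by ring
    _ ≤ (n - w - (k - 1)).choose m * n.choose m * n.choose k := by gcongr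
    _ = _ := by ring

/-- Lemma H. -/
lemma hit_count {n k : ℕ} (hk : 1 ≤ k) (hkn : 2 * k ≤ n) (hq : 0 < interProb n k)
    (𝒜 : Finset (Finset (Fin n))) (hA : ∀ B ∈ 𝒜, B.card = k) (W X : Finset (Fin n)) (_hX : X ⊆ W)
    (hW : ∀ v, 2 ≤ vdeg 𝒜 v → v ∈ W) (hmeet : ∀ B ∈ 𝒜, (B ∩ W).Nonempty) (hw : k * W.card + k ≤ n) :
    (((kSets n k).filter fun A => Disjoint A X ∧ ∀ B ∈ 𝒜, (A ∩ B).Nonempty).card : ℝ) ≤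
      (n.choose k : ℝ) * interProb n k ^ 𝒜.card *
        ∏ v ∈ W \ X, (1 + (k : ℝ) / n * ((interProb n k)⁻¹ ^ vdeg 𝒜 v - 1)) := by
  classical
  set q := interProb n k with hqdef
  have hq1 : q ≤ 1 := interProb_le_one (by omega)
  have hqi : 1 ≤ q⁻¹ := (one_le_inv₀ hq).2 hq1
  set y : Fin n → ℝ := fun v => q⁻¹ ^ vdeg 𝒜 v with hy
  have hy1 : ∀ v, 1 ≤ y v := fun v => one_le_pow₀ hqi
  -- bound for each trace
  have trace : ∀ Z ∈ (W \ X).powerset,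
      (((kSets n k).filter fun A => A ∩ W = Z ∧ ∀ B ∈ 𝒜, (A ∩ B).Nonempty).card : ℝ) ≤
      ((kSets n k).filter fun A => A ∩ W = Z).card * (q ^ 𝒜.card * ∏ v ∈ Z, y v) := by
    intro Z hZ
    rw [Finset.mem_powerset, Finset.subset_sdiff] at hZ
    set U : Finset (Fin n) := Finset.univ \ W with hU
    have hUc : U.card = n - W.card := by
      rw [hU, Finset.card_sdiff_of_subset (Finset.subset_univ _), Finset.card_univ, Fintype.card_fin]
    by_cases hZk : Z.card ≤ k
    swap
    · have h0 : ((kSets n k).filter fun A => A ∩ W = Z ∧ ∀ B ∈ 𝒜, (A ∩ B).Nonempty) = ∅ := by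
        ext A
        simp only [Finset.mem_filter, mem_kSets, Finset.notMem_empty, iff_false, not_and]
        intro h1 h2
        exact absurd (h1 ▸ h2 ▸ Finset.card_le_card Finset.inter_subset_left) hZk
      rw [h0, Finset.card_empty, Nat.cast_zero]
      have : 0 ≤ ∏ v ∈ Z, y v := Finset.prod_nonneg fun v _ => le_trans zero_le_one (hy1 v)
      positivity
    set 𝒜Z := 𝒜.filter fun B => Disjoint B Z with h𝒜Z
    have hna := na_count U (k - Z.card) 𝒜Z (fun B => B \ W) hq.le
      (fun B _ => Finset.sdiff_subset_sdiff (Finset.subset_univ _) le_rfl)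
      (by
        intro B hB B' hB' hne
        rw [Finset.disjoint_left]
        intro v hv hv'
        rw [Finset.mem_sdiff] at hv hv'
        refine hv.2 (hW v ?_)
        rw [h𝒜Z, Finset.mem_filter] at hB hB'
        have : ({B, B'} : Finset (Finset (Fin n))) ⊆ starOf 𝒜 v := by
          intro D hD
          rw [Finset.mem_insert, Finset.mem_singleton] at hD
          rw [starOf, Finset.mem_filter]
          rcases hD with rfl | rfl
          · exact ⟨hB.1, hv.1⟩
          · exact ⟨hB'.1, hv'.1⟩
        have := Finset.card_le_card this
        rwa [Finset.card_pair hne] at this)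
      (by
        intro B hB
        rw [h𝒜Z, Finset.mem_filter] at hB
        rw [hUc]
        refine miss_bound hk hkn hw (by omega) ?_
        have h1 := Finset.card_sdiff_add_card_inter B W
        have h2 := (hmeet B hB.1).card_pos
        have h3 := hA B hB.1
        omega)
    have inj : Set.InjOn (fun A : Finset (Fin n) => A \ W)
        ((kSets n k).filter fun A => A ∩ W = Z : Finset (Finset (Fin n))) := by
      intro A h1 A' h2 h
      simp only [Finset.coe_filter, Set.mem_ofPred_eq] at h1 h2
      rw [← Finset.sdiff_union_inter A W, ← Finset.sdiff_union_inter A' W, h1.2, h2.2]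
      exact congrArg (· ∪ Z) h
    have c1 : ((kSets n k).filter fun A => A ∩ W = Z ∧ ∀ B ∈ 𝒜, (A ∩ B).Nonempty).card ≤
        cnt U (k - Z.card) (fun A => ∀ B ∈ 𝒜Z, (A ∩ (B \ W)).Nonempty) := by
      unfold cnt
      refine Finset.card_le_card_of_injOn (fun A => A \ W) ?_ ?_
      · intro A hA'
        simp only [Finset.coe_filter, Set.mem_ofPred_eq, mem_kSets] at hA'
        obtain ⟨h1, h2, h3⟩ := hA'
        simp only [Finset.coe_filter, Set.mem_ofPred_eq, Finset.mem_powersetCard]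
        refine ⟨⟨Finset.sdiff_subset_sdiff (Finset.subset_univ _) le_rfl, ?_⟩, ?_⟩
        · have := Finset.card_sdiff_add_card_inter A W
          rw [h2] at this; omega
        · intro B hB
          rw [h𝒜Z, Finset.mem_filter] at hB
          obtain ⟨v, hv⟩ := h3 B hB.1
          rw [Finset.mem_inter] at hv
          have hvW : v ∉ W := by
            intro hvW
            have : v ∈ Z := by rw [← h2]; exact Finset.mem_inter.2 ⟨hv.1, hvW⟩
            exact Finset.disjoint_left.1 hB.2 hv.2 this
          exact ⟨v, by simp [hv.1, hv.2, hvW]⟩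
      · intro A h1 A' h2 h
        refine inj ?_ ?_ h
        · simp only [Finset.coe_filter, Set.mem_ofPred_eq] at h1 ⊢; exact ⟨h1.1, h1.2.1⟩
        · simp only [Finset.coe_filter, Set.mem_ofPred_eq] at h2 ⊢; exact ⟨h2.1, h2.2.1⟩
    have c2 : U.card.choose (k - Z.card) ≤ ((kSets n k).filter fun A => A ∩ W = Z).card := by
      rw [← Finset.card_powersetCard]
      refine Finset.card_le_card_of_injOn (fun A => A ∪ Z) ?_ ?_
      · intro A h
        simp only [Finset.mem_coe, Finset.mem_powersetCard, hU, Finset.subset_sdiff] at h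
        simp only [Finset.coe_filter, Set.mem_ofPred_eq, mem_kSets]
        have hd : Disjoint A Z := Finset.disjoint_of_subset_right hZ.1 h.1.2
        refine ⟨?_, ?_⟩
        · rw [Finset.card_union_of_disjoint hd, h.2]; omega
        · rw [Finset.union_inter_distrib_right, Finset.disjoint_iff_inter_eq_empty.1 h.1.2,
            Finset.empty_union]
          exact Finset.inter_eq_left.2 hZ.1
      · intro A h1 A' h2 h
        simp only [Finset.mem_coe, Finset.mem_powersetCard, hU, Finset.subset_sdiff] at h1 h2
        have hd : Disjoint A Z := Finset.disjoint_of_subset_right hZ.1 h1.1.2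
        have hd' : Disjoint A' Z := Finset.disjoint_of_subset_right hZ.1 h2.1.2
        rw [← Finset.union_sdiff_cancel_right hd, ← Finset.union_sdiff_cancel_right hd']
        exact congrArg (· \ Z) h
    have c3 : 𝒜.card ≤ 𝒜Z.card + ∑ v ∈ Z, vdeg 𝒜 v := by
      have h1 := Finset.card_filter_add_card_filter_not (s := 𝒜) (fun B => Disjoint B Z)
      rw [← h𝒜Z] at h1
      have h2 : (𝒜.filter fun B => ¬ Disjoint B Z) ⊆ Z.biUnion (fun v => starOf 𝒜 v) := by
        intro B hB
        rw [Finset.mem_filter, Finset.not_disjoint_iff] at hB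
        obtain ⟨hB, v, hv, hvZ⟩ := hB
        exact Finset.mem_biUnion.2 ⟨v, hvZ, Finset.mem_filter.2 ⟨hB, hv⟩⟩
      have h3 := (Finset.card_le_card h2).trans Finset.card_biUnion_le
      have h4 : ∑ v ∈ Z, (starOf 𝒜 v).card = ∑ v ∈ Z, vdeg 𝒜 v := rfl
      omega
    have c4 : q ^ 𝒜Z.card ≤ q ^ 𝒜.card * ∏ v ∈ Z, y v := by
      have : ∏ v ∈ Z, y v = (q ^ (∑ v ∈ Z, vdeg 𝒜 v))⁻¹ := by
        rw [hy, Finset.prod_pow_eq_pow_sum, inv_pow]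
      rw [this, ← div_eq_mul_inv, le_div_iff₀ (by positivity), ← pow_add]
      exact pow_le_pow_of_le_one hq.le hq1 c3
    calc (((kSets n k).filter fun A => A ∩ W = Z ∧ ∀ B ∈ 𝒜, (A ∩ B).Nonempty).card : ℝ)
        ≤ cnt U (k - Z.card) (fun A => ∀ B ∈ 𝒜Z, (A ∩ (B \ W)).Nonempty) := by exact_mod_cast c1
      _ ≤ q ^ 𝒜Z.card * (U.card.choose (k - Z.card) : ℝ) := hna
      _ ≤ (q ^ 𝒜.card * ∏ v ∈ Z, y v) * ((kSets n k).filter fun A => A ∩ W = Z).card := by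
          refine mul_le_mul c4 (by exact_mod_cast c2) (by positivity) (le_trans (by positivity) c4)
      _ = _ := by ring
  -- sum over traces
  have s1 : (((kSets n k).filter fun A => Disjoint A X ∧ ∀ B ∈ 𝒜, (A ∩ B).Nonempty).card : ℝ) ≤
      ∑ Z ∈ (W \ X).powerset,
        (((kSets n k).filter fun A => A ∩ W = Z ∧ ∀ B ∈ 𝒜, (A ∩ B).Nonempty).card : ℝ) := by
    have : ((kSets n k).filter fun A => Disjoint A X ∧ ∀ B ∈ 𝒜, (A ∩ B).Nonempty) ⊆
        (W \ X).powerset.biUnion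
          (fun Z => (kSets n k).filter fun A => A ∩ W = Z ∧ ∀ B ∈ 𝒜, (A ∩ B).Nonempty) := by
      intro A h
      rw [Finset.mem_filter] at h
      refine Finset.mem_biUnion.2 ⟨A ∩ W, ?_, Finset.mem_filter.2 ⟨h.1, rfl, h.2.2⟩⟩
      rw [Finset.mem_powerset, Finset.subset_sdiff]
      exact ⟨Finset.inter_subset_right, Finset.disjoint_of_subset_left Finset.inter_subset_left h.2.1⟩
    exact_mod_cast (Finset.card_le_card this).trans Finset.card_biUnion_le
  refine s1.trans ((Finset.sum_le_sum trace).trans ?_)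
  have s2 : ∀ Z, ∏ v ∈ Z, y v = ∑ Y ∈ Z.powerset, ∏ v ∈ Y, (y v - 1) := by
    intro Z
    rw [← Finset.prod_one_add]
    exact Finset.prod_congr rfl fun v _ => by ring
  have s3 : ∑ Z ∈ (W \ X).powerset, (((kSets n k).filter fun A => A ∩ W = Z).card : ℝ) *
      (q ^ 𝒜.card * ∏ v ∈ Z, y v) ≤
      q ^ 𝒜.card * ∑ Y ∈ (W \ X).powerset, (∏ v ∈ Y, (y v - 1)) *
        (((kSets n k).filter fun A => Y ⊆ A).card : ℝ) := by
    rw [Finset.mul_sum]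
    have : ∀ Z ∈ (W \ X).powerset, (((kSets n k).filter fun A => A ∩ W = Z).card : ℝ) *
        (q ^ 𝒜.card * ∏ v ∈ Z, y v) = ∑ Y ∈ (W \ X).powerset,
          q ^ 𝒜.card * ((∏ v ∈ Y, (y v - 1)) * ∑ A ∈ (kSets n k).filter (fun A => A ∩ W = Z), (if Y ⊆ A then 1 else 0 : ℝ)) := by
      intro Z hZ
      have hsub : Z.powerset ⊆ (W \ X).powerset := Finset.powerset_mono.2 (Finset.mem_powerset.1 hZ)
      rw [s2, ← Finset.sum_subset hsub]
      · rw [← mul_assoc, Finset.mul_sum]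
        refine Finset.sum_congr rfl fun Y hY => ?_
        have : ∑ A ∈ (kSets n k).filter (fun A => A ∩ W = Z), (if Y ⊆ A then 1 else 0 : ℝ) =
            ((kSets n k).filter fun A => A ∩ W = Z).card := by
          rw [Finset.sum_congr rfl (g := fun _ => (1:ℝ))]
          · simp
          · intro A hA'
            rw [Finset.mem_filter] at hA'
            rw [if_pos]
            rw [Finset.mem_powerset] at hY
            exact hY.trans (hA'.2 ▸ Finset.inter_subset_left)
        rw [this]; ring
      · intro Y hY hY'
        rw [Finset.sum_eq_zero]; · simp
        intro A hA'
        rw [Finset.mem_filter] at hA'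
        rw [if_neg]
        intro hYA
        refine hY' (Finset.mem_powerset.2 ?_)
        rw [← hA'.2]
        rw [Finset.mem_powerset] at hY
        exact Finset.subset_inter hYA (hY.trans Finset.sdiff_subset)
    rw [Finset.sum_congr rfl this, Finset.sum_comm]
    refine Finset.sum_le_sum fun Y hY => ?_
    rw [← Finset.mul_sum, ← Finset.mul_sum]
    have hpn : 0 ≤ ∏ v ∈ Y, (y v - 1) := Finset.prod_nonneg fun v _ => sub_nonneg.2 (hy1 v)
    refine mul_le_mul_of_nonneg_left (mul_le_mul_of_nonneg_left ?_ hpn) (by positivity)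
    rw [← Finset.sum_biUnion]
    · rw [Finset.card_filter]; push_cast
      refine Finset.sum_le_sum_of_subset_of_nonneg ?_ ?_
      · intro A hA'
        rw [Finset.mem_biUnion] at hA'
        obtain ⟨Z, _, h⟩ := hA'
        exact (Finset.mem_filter.1 h).1
      · intros; split_ifs <;> norm_num
    · intro Z _ Z' _ hne
      rw [Function.onFun, Finset.disjoint_left]
      intro A h1 h2
      rw [Finset.mem_filter] at h1 h2
      exact hne (h1.2.symm.trans h2.2)
  refine s3.trans ?_
  have s4 : ∑ Y ∈ (W \ X).powerset, (∏ v ∈ Y, (y v - 1)) *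
        (((kSets n k).filter fun A => Y ⊆ A).card : ℝ) ≤
      (n.choose k : ℝ) * ∏ v ∈ W \ X, (1 + (k : ℝ) / n * (y v - 1)) := by
    rw [Finset.prod_one_add, Finset.mul_sum]
    refine Finset.sum_le_sum fun Y _ => ?_
    have hpn : 0 ≤ ∏ v ∈ Y, (y v - 1) := Finset.prod_nonneg fun v _ => sub_nonneg.2 (hy1 v)
    rw [Finset.prod_mul_distrib, Finset.prod_const]
    calc _ ≤ (∏ v ∈ Y, (y v - 1)) * (((k : ℝ) / n) ^ Y.card * (n.choose k : ℝ)) :=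
          mul_le_mul_of_nonneg_left (card_supersets_le (by omega) (by omega) Y) hpn
      _ = _ := by ring
  calc _ ≤ q ^ 𝒜.card * ((n.choose k : ℝ) * ∏ v ∈ W \ X, (1 + (k : ℝ) / n * (y v - 1))) := by gcongr
    _ = _ := by ring

end
end EKRP

namespace EKRP
noncomputable section

/-- Pattern of a tuple of sets: the blocks `{i : v ∈ f i}` of size at least two. -/
def pat {n s : ℕ} (f : Fin s → Finset (Fin n)) : Finset (Finset (Fin s)) :=
  ((Finset.univ : Finset (Fin n)).image fun v => Finset.univ.filter fun i => v ∈ f i).filter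
    fun P => 2 ≤ P.card

lemma mem_pat {n s : ℕ} {f : Fin s → Finset (Fin n)} {P : Finset (Fin s)} :
    P ∈ pat f ↔ (∃ v, Finset.univ.filter (fun i => v ∈ f i) = P) ∧ 2 ≤ P.card := by
  simp [pat]

open Classical in
lemma pat_count {n k s : ℕ} (hn : 0 < n) (hkn : k ≤ n) (ℬ : Finset (Finset (Fin s))) :
    (((Fintype.piFinset fun _ : Fin s => kSets n k).filter fun f => pat f = ℬ).card : ℝ) ≤
      (n.choose k : ℝ) ^ s * ∏ P ∈ ℬ, ((n : ℝ) * ((k : ℝ) / n) ^ P.card) := by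
  set T := ((Fintype.piFinset fun _ : Fin s => kSets n k).filter fun f => pat f = ℬ)
  set V := (Finset.univ : Finset (ℬ → Fin n)).filter fun v => Function.Injective v
  -- sets through prescribed vertices
  set S : (ℬ → Fin n) → Finset (Fin s → Finset (Fin n)) := fun v =>
    Fintype.piFinset fun i => (kSets n k).filter fun A =>
      (Finset.univ.filter fun P : ℬ => i ∈ P.1).image v ⊆ A with hS
  have h1 : T ⊆ V.biUnion S := by
    intro f hf
    simp only [T, Finset.mem_filter, Fintype.mem_piFinset] at hf
    have hex : ∀ P : ℬ, ∃ v, Finset.univ.filter (fun i => v ∈ f i) = P.1 := by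
      rintro ⟨P, hP⟩
      have h := hP
      rw [← hf.2, mem_pat] at h
      exact h.1
    choose v hv using hex
    refine Finset.mem_biUnion.2 ⟨v, ?_, ?_⟩
    · simp only [V, Finset.mem_filter, Finset.mem_univ, true_and]
      intro P Q hPQ
      apply Subtype.ext
      rw [← hv P, ← hv Q, hPQ]
    · simp only [hS, Fintype.mem_piFinset, Finset.mem_filter]
      refine fun i => ⟨hf.1 i, ?_⟩
      intro x hx
      simp only [Finset.mem_image, Finset.mem_filter, Finset.mem_univ, true_and] at hx
      obtain ⟨P, hP, rfl⟩ := hx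
      rw [← hv P] at hP
      simpa using hP
  have h2 : ∀ v ∈ V, ((S v).card : ℝ) ≤ (n.choose k : ℝ) ^ s * ∏ P ∈ ℬ, ((k : ℝ) / n) ^ P.card := by
    intro v hv
    simp only [V, Finset.mem_filter, Finset.mem_univ, true_and] at hv
    simp only [hS]
    rw [Fintype.card_piFinset]
    push_cast
    calc _ ≤ ∏ i : Fin s, (((k : ℝ) / n) ^ (Finset.univ.filter fun P : ℬ => i ∈ P.1).card * (n.choose k : ℝ)) := by
          refine Finset.prod_le_prod (fun _ _ => by positivity) fun i _ => ?_
          have := card_supersets_le (k := k) hn hkn ((Finset.univ.filter fun P : ℬ => i ∈ P.1).image v)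
          rwa [Finset.card_image_of_injective _ hv] at this
      _ = _ := by
          rw [Finset.prod_mul_distrib, Finset.prod_const, Finset.card_univ, Fintype.card_fin, mul_comm]
          congr 1
          rw [Finset.prod_pow_eq_pow_sum, Finset.prod_pow_eq_pow_sum]
          congr 1
          simp only [Finset.card_filter]
          rw [Finset.sum_comm, ← Finset.sum_coe_sort ℬ]
          refine Finset.sum_congr rfl fun P _ => ?_
          rw [← Finset.card_filter]; simp
  have h3 : (V.card : ℝ) ≤ (n : ℝ) ^ ℬ.card := by
    have : V.card ≤ n ^ ℬ.card := by
      refine (Finset.card_filter_le _ _).trans ?_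
      simp
    exact_mod_cast this
  calc (T.card : ℝ) ≤ ∑ v ∈ V, ((S v).card : ℝ) := by
        exact_mod_cast (Finset.card_le_card h1).trans Finset.card_biUnion_le
    _ ≤ V.card • ((n.choose k : ℝ) ^ s * ∏ P ∈ ℬ, ((k : ℝ) / n) ^ P.card) :=
        Finset.sum_le_card_nsmul _ _ _ h2
    _ = V.card * ((n.choose k : ℝ) ^ s * ∏ P ∈ ℬ, ((k : ℝ) / n) ^ P.card) := by rw [nsmul_eq_mul]
    _ ≤ (n : ℝ) ^ ℬ.card * ((n.choose k : ℝ) ^ s * ∏ P ∈ ℬ, ((k : ℝ) / n) ^ P.card) := by gcongr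
    _ = _ := by rw [Finset.prod_mul_distrib, Finset.prod_const]; ring

lemma phi_mul {n k : ℕ} (hk : 1 ≤ k) (hkn : k ≤ n) (p : ℝ) :
    p * (n.choose k : ℝ) = mubar n k p := by
  unfold mubar phi
  have h := Nat.add_one_mul_choose_eq (n-1) (k-1)
  rw [show n - 1 + 1 = n by omega, show k - 1 + 1 = k by omega] at h
  have h' : (n:ℝ) * ((n-1).choose (k-1) : ℝ) = (n.choose k : ℝ) * k := by exact_mod_cast h
  have hk' : (k:ℝ) ≠ 0 := by positivity
  field_simp
  linear_combination (-p) * h'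

open Classical in
/-- first moment for patterns -/
lemma pat_prob {n k s : ℕ} (hk : 1 ≤ k) (hkn : k ≤ n) {p : ℝ} (h0 : 0 ≤ p) (h1 : p ≤ 1)
    (𝔉 : Finset (Finset (Finset (Fin s)))) :
    hprob n k p (fun H => ∃ f : Fin s → Finset (Fin n), Function.Injective f ∧ (∀ i, f i ∈ H) ∧
      pat f ∈ 𝔉) ≤
      ∑ ℬ ∈ 𝔉, mubar n k p ^ s * ∏ P ∈ ℬ, ((n : ℝ) * ((k : ℝ) / n) ^ P.card) := by
  set 𝒯 := (Fintype.piFinset fun _ : Fin s => kSets n k).filter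
    fun f => Function.Injective f ∧ pat f ∈ 𝔉 with h𝒯
  have a1 : hprob n k p (fun H => ∃ f : Fin s → Finset (Fin n), Function.Injective f ∧ (∀ i, f i ∈ H) ∧
      pat f ∈ 𝔉) ≤ ∑ f ∈ 𝒯, sprob (kSets n k) p (fun G => Finset.univ.image f ⊆ G) := by
    rw [hprob_eq]
    refine le_trans (sprob_mono h0 h1 ?_) (sprob_exists h0 h1 𝒯 _)
    rintro G hG ⟨f, hf, hfG, hfp⟩
    refine ⟨f, ?_, ?_⟩
    · simp only [h𝒯, Finset.mem_filter, Fintype.mem_piFinset]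
      exact ⟨fun i => hG (hfG i), hf, hfp⟩
    · intro A hA
      rw [Finset.mem_image] at hA
      obtain ⟨i, _, rfl⟩ := hA
      exact hfG i
  have a2 : ∀ f ∈ 𝒯, sprob (kSets n k) p (fun G => Finset.univ.image f ⊆ G) = p ^ s := by
    intro f hf
    simp only [h𝒯, Finset.mem_filter, Fintype.mem_piFinset] at hf
    rw [sprob_subset, Finset.card_image_of_injective _ hf.2.1]
    · simp
    · intro A hA
      rw [Finset.mem_image] at hA
      obtain ⟨i, _, rfl⟩ := hA
      exact hf.1 i
  rw [Finset.sum_congr rfl a2, Finset.sum_const, nsmul_eq_mul] at a1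
  have a3 : (𝒯.card : ℝ) ≤ ∑ ℬ ∈ 𝔉,
      (((Fintype.piFinset fun _ : Fin s => kSets n k).filter fun f => pat f = ℬ).card : ℝ) := by
    have : 𝒯 ⊆ 𝔉.biUnion (fun ℬ => (Fintype.piFinset fun _ : Fin s => kSets n k).filter fun f => pat f = ℬ) := by
      intro f hf
      simp only [h𝒯, Finset.mem_filter] at hf
      exact Finset.mem_biUnion.2 ⟨pat f, hf.2.2, Finset.mem_filter.2 ⟨hf.1, rfl⟩⟩
    exact_mod_cast (Finset.card_le_card this).trans Finset.card_biUnion_le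
  refine a1.trans ?_
  calc _ ≤ (∑ ℬ ∈ 𝔉, (n.choose k : ℝ) ^ s * ∏ P ∈ ℬ, ((n : ℝ) * ((k : ℝ) / n) ^ P.card)) * p ^ s := by
        refine mul_le_mul_of_nonneg_right (a3.trans ?_) (by positivity)
        exact Finset.sum_le_sum fun ℬ _ => pat_count (by omega) hkn ℬ
    _ = _ := by
        rw [Finset.sum_mul]
        refine Finset.sum_congr rfl fun ℬ _ => ?_
        rw [← phi_mul hk hkn, mul_pow]; ring

end
end EKRP

namespace EKRP
noncomputable section

/-- exponent of a block -/
def cc (γ : ℝ) (m : ℕ) : ℝ := ((1 + γ) * m - 2) / 2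

lemma cover_pairs {s : ℕ} (ℬ : Finset (Finset (Fin s)))
    (hcov : ∀ i j, i ≠ j → ∃ P ∈ ℬ, i ∈ P ∧ j ∈ P) :
    (s : ℝ) * (s - 1) ≤ ∑ P ∈ ℬ, (P.card : ℝ) * (P.card - 1) := by
  have h1 : (Finset.univ : Finset (Fin s)).offDiag ⊆ ℬ.biUnion (fun P => P.offDiag) := by
    rintro ⟨i, j⟩ h
    simp only [Finset.mem_offDiag, Finset.mem_univ, true_and] at h
    obtain ⟨P, hP, hi, hj⟩ := hcov i j h
    exact Finset.mem_biUnion.2 ⟨P, hP, Finset.mem_offDiag.2 ⟨hi, hj, h⟩⟩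
  have h2 := (Finset.card_le_card h1).trans Finset.card_biUnion_le
  have e : ∀ (m : ℕ) (P : Finset (Fin m)), ((P.offDiag.card : ℕ) : ℝ) = (P.card : ℝ) * (P.card - 1) := by
    intro m P
    rw [Finset.offDiag_card, Nat.cast_sub (Nat.le_mul_self _)]; push_cast; ring
  have h3 : ((Finset.univ : Finset (Fin s)).offDiag.card : ℝ) ≤ ∑ P ∈ ℬ, (P.offDiag.card : ℝ) := by
    exact_mod_cast h2
  rw [e] at h3
  simp only [e] at h3
  simpa using h3

lemma cover_dichotomy {s : ℕ} (hs : 3 ≤ s) {γ : ℝ} (hγ : 0 < γ) (hγ1 : γ ≤ 1)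
    (ℬ : Finset (Finset (Fin s))) (h2 : ∀ P ∈ ℬ, 2 ≤ P.card) (hlt : ∀ P ∈ ℬ, P.card < s)
    (hcov : ∀ i j, i ≠ j → ∃ P ∈ ℬ, i ∈ P ∧ j ∈ P) :
    γ * (s * (s - 1) / 2) ≤ ∑ P ∈ ℬ, cc γ P.card ∨
    (s : ℝ) * (1 + γ) / 2 - 1 + 1 / (s + 1) + 1 / (20 * s ^ 2) ≤ ∑ P ∈ ℬ, cc γ P.card := by
  classical
  by_cases hall : ∀ P ∈ ℬ, P.card = 2 ∨ γ * P.card ≤ 1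
  · left
    have h1 := cover_pairs ℬ hcov
    calc _ ≤ γ / 2 * ∑ P ∈ ℬ, (P.card : ℝ) * (P.card - 1) := by
            rw [show γ * ((s:ℝ) * (s - 1) / 2) = γ / 2 * (s * (s-1)) by ring]; gcongr
      _ = ∑ P ∈ ℬ, γ / 2 * ((P.card : ℝ) * (P.card - 1)) := by rw [Finset.mul_sum]
      _ ≤ _ := by
        refine Finset.sum_le_sum fun P hP => ?_
        unfold cc
        have h2' : (2:ℝ) ≤ P.card := by exact_mod_cast h2 P hP
        rcases hall P hP with h | h
        · rw [h]; push_cast; linarith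
        · nlinarith
  · right
    push Not at hall
    obtain ⟨P0, hP0, hne, hg0⟩ := hall
    obtain ⟨D, hD, hmax⟩ := Finset.exists_max_image ℬ Finset.card ⟨P0, hP0⟩
    have hd3 : 3 ≤ D.card := by
      have := h2 P0 hP0; have := hmax P0 hP0; omega
    have hgd : 1 < γ * D.card := by
      have : (P0.card : ℝ) ≤ D.card := by exact_mod_cast hmax P0 hP0
      nlinarith
    have hs4 : 4 ≤ s := by have := hlt D hD; omega
    set T1 := (ℬ.erase D).filter fun P => 2 ≤ (P ∩ D).card ∧ (P \ D).Nonempty with hT1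
    set T2 := (ℬ.erase D).filter fun P => (P ∩ D).card = 1 with hT2
    set R1 := T1.biUnion (fun P => P \ D) with hR1
    set R2 := Dᶜ \ R1 with hR2
    have hdis : Disjoint T1 T2 := by
      rw [Finset.disjoint_left]
      intro P h1 h2
      simp only [hT1, hT2, Finset.mem_filter] at h1 h2
      omega
    have cardP : ∀ P : Finset (Fin s), (P.card : ℝ) = (P ∩ D).card + (P \ D).card := by
      intro P
      have := Finset.card_sdiff_add_card_inter P D
      rw [← this]; push_cast; ring
    have cnn : ∀ P ∈ ℬ, 0 ≤ cc γ P.card := by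
      intro P hP
      have : (2:ℝ) ≤ P.card := by exact_mod_cast h2 P hP
      unfold cc; nlinarith
    have b1 : ∀ P ∈ T1, (1 + γ) / 2 * ((P \ D).card : ℝ) + γ ≤ cc γ P.card := by
      intro P hP
      simp only [hT1, Finset.mem_filter] at hP
      have : (2:ℝ) ≤ (P ∩ D).card := by exact_mod_cast hP.2.1
      unfold cc
      rw [cardP P]; nlinarith
    have b2 : ∀ P ∈ T2, γ * ((P \ D).card : ℝ) ≤ cc γ P.card := by
      intro P hP
      simp only [hT2, Finset.mem_filter, Finset.mem_erase] at hP
      have e1 : ((P ∩ D).card : ℝ) = 1 := by exact_mod_cast hP.2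
      have h3 := h2 P hP.1.2
      have h4 := Finset.card_sdiff_add_card_inter P D
      have : (1:ℝ) ≤ (P \ D).card := by
        have : 1 ≤ (P \ D).card := by omega
        exact_mod_cast this
      unfold cc
      rw [cardP P, e1]; nlinarith
    have r1card : (R1.card : ℝ) ≤ ∑ P ∈ T1, ((P \ D).card : ℝ) := by
      exact_mod_cast Finset.card_biUnion_le
    have r2card : (D.card : ℝ) * R2.card ≤ ∑ P ∈ T2, ((P \ D).card : ℝ) := by
      have : (D ×ˢ R2).card ≤ ∑ P ∈ T2, ((P ∩ D) ×ˢ (P \ D)).card := by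
        refine (Finset.card_le_card ?_).trans Finset.card_biUnion_le
        rintro ⟨a, y⟩ hay
        rw [Finset.mem_product] at hay
        obtain ⟨ha, hy⟩ := hay
        simp only [hR2, Finset.mem_sdiff, Finset.mem_compl] at ha hy
        obtain ⟨P, hP, haP, hyP⟩ := hcov a y (fun h => hy.1 (h ▸ ha))
        refine Finset.mem_biUnion.2 ⟨P, ?_, ?_⟩
        · simp only [hT2, Finset.mem_filter, Finset.mem_erase]
          have hPD : P ≠ D := fun h => hy.1 (h ▸ hyP)
          refine ⟨⟨hPD, hP⟩, ?_⟩
          have h1 : 1 ≤ (P ∩ D).card := Finset.card_pos.2 ⟨a, Finset.mem_inter.2 ⟨haP, ha⟩⟩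
          by_contra hne1
          refine hy.2 ?_
          rw [hR1, Finset.mem_biUnion]
          have hyPD : y ∈ P \ D := Finset.mem_sdiff.2 ⟨hyP, hy.1⟩
          refine ⟨P, ?_, hyPD⟩
          simp only [hT1, Finset.mem_filter, Finset.mem_erase]
          exact ⟨⟨hPD, hP⟩, by omega, ⟨y, hyPD⟩⟩
        · simp only [Finset.mem_product, Finset.mem_inter, Finset.mem_sdiff]
          exact ⟨⟨haP, ha⟩, hyP, hy.1⟩
      rw [Finset.card_product] at this
      have e : ∑ P ∈ T2, ((P ∩ D) ×ˢ (P \ D)).card = ∑ P ∈ T2, (P \ D).card := by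
        refine Finset.sum_congr rfl fun P hP => ?_
        simp only [hT2, Finset.mem_filter] at hP
        rw [Finset.card_product, hP.2, one_mul]
      rw [e] at this
      exact_mod_cast this
    have rtot : (s : ℝ) - D.card = R1.card + R2.card := by
      have hsub : R1 ⊆ Dᶜ := by
        intro y hy
        rw [hR1, Finset.mem_biUnion] at hy
        obtain ⟨P, _, h⟩ := hy
        simpa using (Finset.mem_sdiff.1 h).2
      have h1 : R2.card + R1.card = s - D.card := by
        rw [hR2, Finset.card_sdiff_add_card_eq_card hsub, Finset.card_compl, Fintype.card_fin]
      have h2 := hlt D hD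
      have : ((R2.card + R1.card : ℕ) : ℝ) = (s:ℝ) - D.card := by
        rw [h1, Nat.cast_sub (by omega)]
      push_cast at this; linarith
    have sumT : cc γ D.card + (∑ P ∈ T1, cc γ P.card + ∑ P ∈ T2, cc γ P.card) ≤ ∑ P ∈ ℬ, cc γ P.card := by
      rw [← Finset.add_sum_erase ℬ _ hD, ← Finset.sum_union hdis]
      have : ∑ P ∈ T1 ∪ T2, cc γ P.card ≤ ∑ P ∈ ℬ.erase D, cc γ P.card :=
        Finset.sum_le_sum_of_subset_of_nonneg
          (Finset.union_subset (Finset.filter_subset _ _) (Finset.filter_subset _ _))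
          (fun P hP _ => cnn P (Finset.mem_of_mem_erase hP))
      linarith
    have s1 : (1 + γ) / 2 * (R1.card : ℝ) + γ * T1.card ≤ ∑ P ∈ T1, cc γ P.card := by
      calc _ ≤ (1 + γ) / 2 * ∑ P ∈ T1, ((P \ D).card : ℝ) + γ * T1.card := by gcongr
        _ = ∑ P ∈ T1, ((1 + γ) / 2 * ((P \ D).card : ℝ) + γ) := by
            rw [Finset.sum_add_distrib, Finset.mul_sum, Finset.sum_const, nsmul_eq_mul]; ring
        _ ≤ _ := Finset.sum_le_sum b1
    have s2 : γ * (D.card * R2.card) ≤ ∑ P ∈ T2, cc γ P.card := by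
      calc _ ≤ γ * ∑ P ∈ T2, ((P \ D).card : ℝ) := by gcongr
        _ = ∑ P ∈ T2, γ * ((P \ D).card : ℝ) := by rw [Finset.mul_sum]
        _ ≤ _ := Finset.sum_le_sum b2
    have hcD : cc γ D.card = (s:ℝ) * (1+γ)/2 - 1 - (1+γ)/2 * (R1.card + R2.card) := by
      rw [← rtot]; unfold cc; ring
    have hsR : (4:ℝ) ≤ s := by exact_mod_cast hs4
    have hdR : (3:ℝ) ≤ D.card := by exact_mod_cast hd3
    rcases Nat.eq_zero_or_pos R2.card with h0 | hpos
    · have hT1ne : 1 ≤ T1.card := by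
        rw [Nat.one_le_iff_ne_zero]
        intro hz
        rw [Finset.card_eq_zero] at hz
        have : R1.card = 0 := by rw [hR1, hz]; simp
        rw [h0, this] at rtot
        have := hlt D hD
        have h3 : (D.card : ℝ) < s := by exact_mod_cast this
        simp at rtot
        linarith
      have hT1' : (1:ℝ) ≤ T1.card := by exact_mod_cast hT1ne
      have hds : (D.card : ℝ) ≤ s - 1 := by
        have := hlt D hD
        have : (D.card : ℝ) + 1 ≤ s := by exact_mod_cast this
        linarith
      have hγs : 1 / ((s:ℝ) - 1) ≤ γ := by
        rw [div_le_iff₀ (by linarith)]; nlinarith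
      have hfin : 1 / ((s:ℝ) + 1) + 1 / (20 * (s:ℝ)^2) ≤ 1 / (s - 1) := by
        have e : 1 / ((s:ℝ) - 1) - 1 / (s + 1) = 2 / (s^2 - 1) := by
          have : (s:ℝ) - 1 ≠ 0 := by linarith
          have : (s:ℝ) + 1 ≠ 0 := by linarith
          have : (s:ℝ)^2 - 1 ≠ 0 := by nlinarith
          field_simp; ring
        have : 1 / (20 * (s:ℝ)^2) ≤ 2 / (s^2 - 1) := by
          rw [div_le_div_iff₀ (by positivity) (by nlinarith)]; nlinarith
        linarith
      have hR20 : (R2.card : ℝ) = 0 := by exact_mod_cast h0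
      rw [hR20] at s2 hcD
      nlinarith
    · have hp1 : (1:ℝ) ≤ R2.card := by exact_mod_cast hpos
      have key : 1/3 ≤ γ * D.card - (1+γ)/2 := by
        have : γ * 3 ≤ γ * D.card := by gcongr
        by_cases hh : γ ≤ 1/3
        · linarith
        · push Not at hh
          linarith
      have hfin : 1 / ((s:ℝ) + 1) + 1 / (20 * (s:ℝ)^2) ≤ 1/3 := by
        have a1 : 1 / ((s:ℝ) + 1) ≤ 1/5 := by
          rw [div_le_div_iff₀ (by linarith) (by norm_num)]; linarith
        have a2 : 1 / (20 * (s:ℝ)^2) ≤ 1/20 := by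
          rw [div_le_div_iff₀ (by positivity) (by norm_num)]; nlinarith
        linarith
      have hT0 : 0 ≤ γ * T1.card := mul_nonneg hγ.le (Nat.cast_nonneg _)
      have : 1/3 * 1 ≤ (γ * D.card - (1+γ)/2) * R2.card :=
        mul_le_mul key hp1 (by norm_num) (by linarith)
      nlinarith

end
end EKRP

namespace EKRP
noncomputable section
lemma miss_upper {n k : ℕ} (hn : 0 < n) (hkn : k ≤ n) (m : ℕ) :
    ((n - k).choose m : ℝ) ≤ (1 - (k:ℝ)/n) ^ m * (n.choose m : ℝ) := by
  have hn' : (0:ℝ) < n := by exact_mod_cast hn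
  have hkn' : (k:ℝ) ≤ n := by exact_mod_cast hkn
  have h0 : 0 ≤ 1 - (k:ℝ)/n := by
    rw [sub_nonneg, div_le_one hn']; exact hkn'
  induction m with
  | zero => simp
  | succ m ih =>
    by_cases hm : n - k ≤ m
    · rw [Nat.choose_eq_zero_of_lt (by omega : n - k < m + 1)]
      simp only [Nat.cast_zero]; positivity
    · have e1 := Nat.choose_succ_right_eq (n - k) m
      have e2 := Nat.choose_succ_right_eq n m
      have e1' : ((n-k).choose (m+1) : ℝ) * (m+1) = (n-k).choose m * ((n:ℝ) - k - m) := by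
        have : ((n - k - m : ℕ) : ℝ) = (n:ℝ) - k - m := by
          rw [Nat.cast_sub (by omega), Nat.cast_sub hkn]
        rw [← this]; exact_mod_cast e1
      have e2' : (n.choose (m+1) : ℝ) * (m+1) = n.choose m * ((n:ℝ) - m) := by
        have : ((n - m : ℕ) : ℝ) = (n:ℝ) - m := by rw [Nat.cast_sub (by omega)]
        rw [← this]; exact_mod_cast e2
      have hm' : (m:ℝ) ≤ (n:ℝ) - k := by
        have : ((m + k : ℕ):ℝ) ≤ n := by exact_mod_cast (by omega : m + k ≤ n)
        push_cast at this; linarith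
      have hfac : (n:ℝ) - k - m ≤ (1 - (k:ℝ)/n) * (n - m) := by
        have : (1 - (k:ℝ)/n) * (n - m) = n - k - m + k * m / n := by field_simp; ring
        rw [this]
        have : 0 ≤ (k:ℝ) * m / n := by positivity
        linarith
      have hpos : (0:ℝ) < (m:ℝ) + 1 := by positivity
      refine le_of_mul_le_mul_right ?_ hpos
      calc _ = ((n-k).choose m : ℝ) * ((n:ℝ) - k - m) := e1'
        _ ≤ ((1 - (k:ℝ)/n) ^ m * (n.choose m : ℝ)) * ((1 - (k:ℝ)/n) * (n - m)) :=
            mul_le_mul ih hfac (by linarith) (by positivity)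
        _ = (1 - (k:ℝ)/n) ^ (m+1) * (n.choose m * ((n:ℝ) - m)) := by ring
        _ = _ := by rw [← e2']; ring

lemma interProb_ge_exp {n k : ℕ} (hn : 0 < n) (hkn : k ≤ n) :
    1 - Real.exp (-((k:ℝ)^2 / n)) ≤ interProb n k := by
  have h := one_sub_interProb hkn
  have hN : (0:ℝ) < (n.choose k : ℝ) := by exact_mod_cast Nat.choose_pos hkn
  have h1 : ((n - k).choose k : ℝ) / (n.choose k : ℝ) ≤ (1 - (k:ℝ)/n) ^ k := by
    rw [div_le_iff₀ hN]; exact miss_upper hn hkn k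
  have hn' : (0:ℝ) < n := by exact_mod_cast hn
  have h0 : 0 ≤ 1 - (k:ℝ)/n := by
    rw [sub_nonneg, div_le_one hn']; exact_mod_cast hkn
  have h2 : (1 - (k:ℝ)/n) ^ k ≤ Real.exp (-((k:ℝ)^2 / n)) := by
    calc _ ≤ (Real.exp (-((k:ℝ)/n))) ^ k := by
          refine pow_le_pow_left₀ h0 ?_ _
          have := Real.add_one_le_exp (-((k:ℝ)/n)); linarith
      _ = _ := by rw [← Real.exp_nat_mul]; congr 1; ring
  linarith

lemma interProb_ge_half {n k : ℕ} (hn : 0 < n) (hkn : k ≤ n) (hQ : (k:ℝ)^2 / n ≤ 1) :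
    (k:ℝ)^2 / n / 2 ≤ interProb n k := by
  refine le_trans ?_ (interProb_ge_exp hn hkn)
  set Q := (k:ℝ)^2 / n
  have hQ0 : 0 ≤ Q := by positivity
  have h1 : Real.exp (-Q) ≤ 1 / (1 + Q) := by
    rw [Real.exp_neg, ← one_div]
    refine one_div_le_one_div_of_le (by linarith) ?_
    have := Real.add_one_le_exp Q; linarith
  have h2 : 1 / (1 + Q) ≤ 1 - Q / 2 := by
    rw [div_le_iff₀ (by linarith)]; nlinarith
  linarith

lemma binom_mono {M : ℕ} {p p' : ℝ} (h0 : 0 ≤ p) (hpp : p ≤ p') (h1 : p' ≤ 1) (m : ℕ) :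
    binomProbGe M p m ≤ binomProbGe M p' m := by
  rcases eq_or_lt_of_le (h0.trans hpp) with h | hpos
  · have : p = p' := le_antisymm hpp (by rw [← h]; exact h0)
    rw [this]
  have e : M = (Finset.range M).card := by simp
  have hr0 : 0 ≤ p / p' := by positivity
  have hr1 : p / p' ≤ 1 := (div_le_one hpos).2 hpp
  rw [e, ← sprob_card_ge, ← sprob_card_ge]
  have : p = p' * (p / p') := by field_simp
  conv_lhs => rw [this]
  rw [← sprob_two_stage, sprob_eq]
  refine ex_mono hpos.le h1 fun G _ => ?_
  by_cases h : m ≤ G.card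
  · rw [ind_true h]; exact sprob_le_one hr0 hr1 _
  · rw [ind_false h]
    refine le_of_eq ?_
    unfold sprob
    refine Finset.sum_eq_zero fun H hH => ?_
    rw [if_neg]
    have := Finset.card_le_card (Finset.mem_powerset.1 hH)
    omega

lemma binom_nonneg {M : ℕ} {p : ℝ} (h0 : 0 ≤ p) (h1 : p ≤ 1) (m : ℕ) : 0 ≤ binomProbGe M p m := by
  unfold binomProbGe
  refine Finset.sum_nonneg fun j _ => ?_
  have : 0 ≤ 1 - p := by linarith
  positivity

lemma binom_anti {M : ℕ} {p : ℝ} (h0 : 0 ≤ p) (h1 : p ≤ 1) {m m' : ℕ} (h : m ≤ m') :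
    binomProbGe M p m' ≤ binomProbGe M p m := by
  unfold binomProbGe
  have : 0 ≤ 1 - p := by linarith
  exact Finset.sum_le_sum_of_subset_of_nonneg (Finset.Icc_subset_Icc_left h)
    (fun j _ _ => by positivity)

lemma binom_lower {M m : ℕ} (hm : 1 ≤ m) (hM : 2 * m ≤ M) {p : ℝ} (h0 : 0 ≤ p) (hφ : p * M ≤ 1) :
    (p * M / 2) ^ m / m.factorial * Real.exp (-2) ≤ binomProbGe M p m := by
  have hM0 : (2:ℝ) ≤ M := by exact_mod_cast (by omega : 2 ≤ M)
  have hp2 : p ≤ 1/2 := by nlinarith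
  have h1 : (M.choose m : ℝ) * p ^ m * (1 - p) ^ (M - m) ≤ binomProbGe M p m := by
    unfold binomProbGe
    have : 0 ≤ 1 - p := by linarith
    exact Finset.single_le_sum (f := fun j => (M.choose j : ℝ) * p ^ j * (1 - p) ^ (M - j))
      (fun j _ => by positivity) (Finset.mem_Icc.2 ⟨le_rfl, by omega⟩)
  refine le_trans ?_ h1
  have h2 : ((M:ℝ) / 2) ^ m / m.factorial ≤ (M.choose m : ℝ) := by
    rw [div_le_iff₀ (by positivity)]
    have h3 := Nat.pow_sub_le_descFactorial M m
    have h4 := Nat.descFactorial_eq_factorial_mul_choose M m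
    have h5 : ((M + 1 - m : ℕ) : ℝ) ^ m ≤ (M.choose m : ℝ) * m.factorial := by
      rw [h4] at h3
      have : (((M + 1 - m) ^ m : ℕ) : ℝ) ≤ ((m.factorial * M.choose m : ℕ) : ℝ) := by exact_mod_cast h3
      push_cast at this; linarith
    refine le_trans ?_ h5
    refine pow_le_pow_left₀ (by positivity) ?_ _
    rw [Nat.cast_sub (by omega)]
    have : (2:ℝ) * m ≤ M := by exact_mod_cast hM
    push_cast; linarith
  have h6 : Real.exp (-2) ≤ (1 - p) ^ (M - m) := by
    have h7 : Real.exp (-(2 * p)) ≤ 1 - p := by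
      rw [Real.exp_neg, inv_le_comm₀ (Real.exp_pos _) (by linarith)]
      have := Real.add_one_le_exp (2 * p)
      refine le_trans ?_ this
      rw [inv_le_iff_one_le_mul₀ (by linarith)]
      nlinarith
    calc Real.exp (-2) ≤ Real.exp (-(2 * p)) ^ (M - m) := by
          rw [← Real.exp_nat_mul]
          apply Real.exp_le_exp.2
          have : ((M - m : ℕ) : ℝ) ≤ M := by exact_mod_cast Nat.sub_le M m
          nlinarith
      _ ≤ _ := pow_le_pow_left₀ (Real.exp_pos _).le h7 _
  calc (p * M / 2) ^ m / m.factorial * Real.exp (-2) = (((M:ℝ)/2)^m / m.factorial) * p ^ m * Real.exp (-2) := by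
        rw [show p * M / 2 = (M / 2) * p by ring, mul_pow]; ring
    _ ≤ _ := by gcongr

/-- small expected degree from small tail -/
lemma phi_small (m : ℕ) (hm : 1 ≤ m) (ω : ℝ) (hω : 0 < ω) :
    ∀ᶠ n : ℕ in atTop, ∀ (M : ℕ) (p : ℝ), n ≤ M + 1 → 0 ≤ p → p ≤ 1 →
      n * binomProbGe M p m < Real.log n → p * M ≤ Real.exp (Real.log n * (-(1/m) + ω)) := by
  have hm0 : (0:ℝ) < m := by exact_mod_cast hm
  set K : ℝ := 2 ^ m * m.factorial * Real.exp 2 with hK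
  have hK0 : 0 < K := by positivity
  have hlim : Tendsto (fun n : ℕ => Real.log n) atTop atTop :=
    Real.tendsto_log_atTop.comp tendsto_natCast_atTop_atTop
  -- K * x ≤ exp (x * min(mω, 1/2))
  have hbig : ∀ a : ℝ, 0 < a → ∀ᶠ n : ℕ in atTop, K * Real.log n < Real.exp (a * Real.log n) := by
    intro a ha
    have h1 : Tendsto (fun x : ℝ => x / Real.exp (a * x)) atTop (nhds 0) := by
      have := Real.tendsto_pow_mul_exp_neg_atTop_nhds_zero 1
      have h2 := (this.comp (tendsto_id.const_mul_atTop ha)).const_mul (1/a)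
      simp only [mul_zero] at h2
      refine h2.congr fun x => ?_
      simp only [Function.comp, id]
      rw [Real.exp_neg]; field_simp
    have h3 := (h1.comp hlim).eventually (gt_mem_nhds (show (0:ℝ) < 1 / K by positivity))
    filter_upwards [h3] with n hn
    simp only [Function.comp] at hn
    rw [div_lt_div_iff₀ (Real.exp_pos _) hK0] at hn
    linarith
  filter_upwards [hbig (m * ω) (by positivity), hbig 1 one_pos, eventually_ge_atTop (2 * m + 1)]
    with n h1 h2 h3 M p hnM hp0 hp1 hb
  have hn0 : (0:ℝ) < n := by exact_mod_cast (by omega : 0 < n)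
  have hexp : Real.exp (Real.log n) = n := Real.exp_log hn0
  have hM0 : (0:ℝ) < M := by exact_mod_cast (by omega : 0 < M)
  have main : ∀ p' : ℝ, 0 ≤ p' → p' ≤ p → p' * M ≤ 1 → n * (p' * M) ^ m < K * Real.log n := by
    intro p' h0 hpp h4
    have h5 := binom_lower hm (by omega : 2 * m ≤ M) h0 h4
    have h6 := h5.trans (binom_mono h0 hpp hp1 m)
    have h7 : n * ((p' * M / 2) ^ m / m.factorial * Real.exp (-2)) < Real.log n :=
      lt_of_le_of_lt (mul_le_mul_of_nonneg_left h6 hn0.le) hb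
    have h8 : n * (p' * M) ^ m = K * (n * ((p' * M / 2) ^ m / m.factorial * Real.exp (-2))) := by
      rw [hK, div_pow, Real.exp_neg]; field_simp
    rw [h8]; exact mul_lt_mul_of_pos_left h7 hK0
  by_cases hφ : p * M ≤ 1
  · have h4 := main p hp0 le_rfl hφ
    have h5 : (p * M) ^ m ≤ Real.exp (Real.log n * (-(1/m) + ω)) ^ m := by
      rw [← Real.exp_nat_mul]
      have : (m:ℝ) * (Real.log n * (-(1/m) + ω)) = m * ω * Real.log n - Real.log n := by
        field_simp; ring
      rw [this, Real.exp_sub, hexp, le_div_iff₀ hn0]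
      linarith
    exact le_of_pow_le_pow_left₀ (by omega) (Real.exp_pos _).le h5
  · exfalso
    push Not at hφ
    have h4 := main (1/M) (by positivity) (by rw [div_le_iff₀ hM0]; linarith) (by
      field_simp; exact le_rfl)
    rw [show 1 / (M:ℝ) * M = 1 by field_simp, one_pow, mul_one] at h4
    rw [one_mul, hexp] at h2
    linarith

end
end EKRP

namespace EKRP
noncomputable section

/-- `γ`, defined by `k² / n = n^{-γ}`. -/
def gam (n k : ℕ) : ℝ := 1 - 2 * Real.log k / Real.log n

lemma log_pos_of_two {n : ℕ} (hn : 2 ≤ n) : 0 < Real.log n :=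
  Real.log_pos (by exact_mod_cast hn)

lemma k_eq_exp {n k : ℕ} (hn : 2 ≤ n) (hk : 1 ≤ k) :
    (k : ℝ) = Real.exp ((1 - gam n k) / 2 * Real.log n) := by
  have h := log_pos_of_two hn
  have : (1 - gam n k) / 2 * Real.log n = Real.log k := by unfold gam; field_simp; ring
  rw [this, Real.exp_log (by exact_mod_cast hk)]

lemma n_eq_exp {n : ℕ} (hn : 2 ≤ n) : (n : ℝ) = Real.exp (Real.log n) := by
  rw [Real.exp_log (by positivity)]

lemma kn_eq_exp {n k : ℕ} (hn : 2 ≤ n) (hk : 1 ≤ k) :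
    (k : ℝ) / n = Real.exp (-((1 + gam n k) / 2 * Real.log n)) := by
  rw [k_eq_exp hn hk]
  conv_lhs => rw [n_eq_exp hn]
  rw [← Real.exp_sub, ← n_eq_exp hn]; congr 1; ring

lemma k2n_eq_exp {n k : ℕ} (hn : 2 ≤ n) (hk : 1 ≤ k) :
    (k : ℝ) ^ 2 / n = Real.exp (-(gam n k * Real.log n)) := by
  have h1 : (k : ℝ) ^ 2 / n = ((k:ℝ) / n) * ((k:ℝ)/n) * Real.exp (Real.log n) := by
    have : (n:ℝ) ≠ 0 := by positivity
    rw [← n_eq_exp hn]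
    field_simp
  rw [h1, kn_eq_exp hn hk, ← Real.exp_add, ← Real.exp_add]; congr 1; ring

lemma gam_le_one {n k : ℕ} (hn : 2 ≤ n) (hk : 1 ≤ k) : gam n k ≤ 1 := by
  have := Real.log_nonneg (show (1:ℝ) ≤ k by exact_mod_cast hk)
  have := log_pos_of_two hn
  unfold gam
  have : 0 ≤ 2 * Real.log k / Real.log n := by positivity
  linarith

lemma mubar_eq {n k : ℕ} (hn : 2 ≤ n) (hk : 1 ≤ k) (p : ℝ) :
    mubar n k p = phi n k p * Real.exp ((1 + gam n k) / 2 * Real.log n) := by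
  have h := kn_eq_exp hn hk
  have hk' : (0:ℝ) < k := by exact_mod_cast hk
  have hn' : (0:ℝ) < n := by positivity
  unfold mubar
  rw [Real.exp_neg] at h
  have h2 : (n:ℝ) / k = Real.exp ((1 + gam n k) / 2 * Real.log n) := by
    rw [← inv_inj, ← h, inv_div]
  rw [← h2]; ring

lemma block_prod {n k s : ℕ} (hn : 2 ≤ n) (hk : 1 ≤ k) (ℬ : Finset (Finset (Fin s))) :
    ∏ P ∈ ℬ, ((n : ℝ) * ((k : ℝ) / n) ^ P.card) =
      Real.exp (-((∑ P ∈ ℬ, cc (gam n k) P.card) * Real.log n)) := by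
  rw [Finset.sum_mul, ← Finset.sum_neg_distrib, Real.exp_sum]
  refine Finset.prod_congr rfl fun P _ => ?_
  rw [kn_eq_exp hn hk, ← Real.exp_nat_mul]
  conv_lhs => rw [n_eq_exp hn]
  rw [← Real.exp_add, ← n_eq_exp hn]; congr 1; unfold cc; ring

lemma phi_nonneg {n k : ℕ} {p : ℝ} (h0 : 0 ≤ p) : 0 ≤ phi n k p := by unfold phi; positivity
lemma mubar_nonneg {n k : ℕ} {p : ℝ} (h0 : 0 ≤ p) : 0 ≤ mubar n k p := by
  have := phi_nonneg (n := n) (k := k) h0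
  unfold mubar; positivity

lemma pat_le {n k s : ℕ} (hn : 2 ≤ n) (hk : 1 ≤ k) {p a : ℝ} (h0 : 0 ≤ p)
    (hφ : phi n k p ≤ Real.exp (a * Real.log n)) (ℬ : Finset (Finset (Fin s))) :
    mubar n k p ^ s * ∏ P ∈ ℬ, ((n : ℝ) * ((k : ℝ) / n) ^ P.card) ≤
      Real.exp ((s * (a + (1 + gam n k) / 2) - ∑ P ∈ ℬ, cc (gam n k) P.card) * Real.log n) := by
  rw [block_prod hn hk, mubar_eq hn hk, mul_pow, ← Real.exp_nat_mul]
  calc _ ≤ (Real.exp (a * Real.log n)) ^ s * Real.exp (s * ((1 + gam n k) / 2 * Real.log n)) *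
        Real.exp (-((∑ P ∈ ℬ, cc (gam n k) P.card) * Real.log n)) := by
        have := phi_nonneg (n := n) (k := k) h0
        gcongr
    _ = _ := by
        rw [← Real.exp_nat_mul, ← Real.exp_add, ← Real.exp_add]; congr 1; ring

lemma cc_ge {γ : ℝ} (h1 : γ ≤ 1) {m : ℕ} (hm : 2 ≤ m) : γ * (m - 1) ≤ cc γ m := by
  have : (2:ℝ) ≤ m := by exact_mod_cast hm
  unfold cc
  nlinarith

lemma pat_cover {n s : ℕ} {f : Fin s → Finset (Fin n)} {i j : Fin s} (hij : i ≠ j)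
    (h : (f i ∩ f j).Nonempty) : ∃ P ∈ pat f, i ∈ P ∧ j ∈ P := by
  obtain ⟨v, hv⟩ := h
  rw [Finset.mem_inter] at hv
  refine ⟨Finset.univ.filter fun i => v ∈ f i, mem_pat.2 ⟨⟨v, rfl⟩, ?_⟩, by simpa using hv.1, by simpa using hv.2⟩
  have : ({i, j} : Finset (Fin s)) ⊆ Finset.univ.filter fun i => v ∈ f i := by
    intro a ha
    simp only [Finset.mem_insert, Finset.mem_singleton] at ha
    rcases ha with rfl | rfl <;> simp [hv]
  calc 2 = ({i, j} : Finset (Fin s)).card := (Finset.card_pair hij).symm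
    _ ≤ _ := Finset.card_le_card this

/-- An injective enumeration of a finset. -/
lemma exists_enum {β : Type*} (C : Finset β) {s : ℕ} (hs : C.card = s) :
    ∃ f : Fin s → β, Function.Injective f ∧ (∀ i, f i ∈ C) ∧ ∀ a ∈ C, ∃ i, f i = a := by
  let e := Finset.equivFinOfCardEq hs
  refine ⟨fun i => (e.symm i).1, fun i j h => ?_, fun i => (e.symm i).2, fun a ha => ⟨e ⟨a, ha⟩, by simp⟩⟩
  exact e.symm.injective (Subtype.ext h)

/-- number of patterns -/
def npat (s : ℕ) : ℝ := ((2 : ℝ) ^ (2 ^ s))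

open Classical in
lemma pat_prob' {n k s : ℕ} (hk : 1 ≤ k) (hkn : k ≤ n) {p : ℝ} (h0 : 0 ≤ p) (h1 : p ≤ 1)
    (Q : Finset (Finset (Fin s)) → Prop) {b : ℝ} (hb : 0 ≤ b)
    (h : ∀ ℬ, Q ℬ → mubar n k p ^ s * ∏ P ∈ ℬ, ((n : ℝ) * ((k : ℝ) / n) ^ P.card) ≤ b) :
    hprob n k p (fun H => ∃ f : Fin s → Finset (Fin n), Function.Injective f ∧ (∀ i, f i ∈ H) ∧
      Q (pat f)) ≤ npat s * b := by
  have := pat_prob (s := s) hk hkn h0 h1 (Finset.univ.filter Q)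
  simp only [Finset.mem_filter, Finset.mem_univ, true_and] at this
  refine this.trans ?_
  calc _ ≤ ∑ ℬ ∈ Finset.univ.filter Q, b := Finset.sum_le_sum fun ℬ hℬ => h ℬ (by simpa using hℬ)
    _ = ((Finset.univ.filter Q).card : ℝ) * b := by rw [Finset.sum_const, nsmul_eq_mul]
    _ ≤ _ := by
      gcongr
      have h3 : (Finset.univ.filter Q).card ≤ 2 ^ (2 ^ s) := by
        refine (Finset.card_filter_le _ _).trans ?_
        simp
      unfold npat
      exact_mod_cast h3

/-- First part of A1. -/
lemma A1i {n k T : ℕ} (hn : 2 ≤ n) (hk : 1 ≤ k) (hkn : k ≤ n) {p δ : ℝ} (h0 : 0 ≤ p) (h1 : p ≤ 1)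
    (hδ : 0 < δ) (hγ : δ ≤ gam n k) (hT : 6 / δ ≤ T) (hφ : phi n k p ≤ Real.exp (δ / 2 * Real.log n)) :
    hprob n k p (fun H => ∃ C ⊆ H, IsClique C ∧ IsNontrivial C ∧ ∃ x, T ≤ vdeg C x) ≤
      npat (T + 1) * Real.exp (-(1/2) * Real.log n) := by
  have hg1 := gam_le_one hn hk
  have hδ1 : δ ≤ 1 := hγ.trans hg1
  have hT2 : 6 ≤ (T:ℝ) := le_trans (by rw [le_div_iff₀ hδ]; linarith) hT
  have hT' : 6 ≤ T := by exact_mod_cast hT2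
  set Q : Finset (Finset (Fin (T+1))) → Prop := fun ℬ => (∀ P ∈ ℬ, 2 ≤ P.card) ∧
    (Finset.univ.erase 0 ∈ ℬ) ∧ ∀ i, i ≠ 0 → ∃ P ∈ ℬ, i ∈ P ∧ 0 ∈ P with hQ
  refine le_trans (sprob_mono h0 h1 ?_) (pat_prob' hk hkn h0 h1 Q (Real.exp_nonneg _) ?_)
  · rintro H - ⟨C, hCH, hcl, hnt, x, hx⟩
    unfold IsNontrivial at hnt
    push Not at hnt
    obtain ⟨A, hA, hxA⟩ := hnt x
    obtain ⟨D, hD, hDc⟩ := Finset.exists_subset_card_eq hx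
    obtain ⟨e, he, heD, -⟩ := exists_enum D hDc
    have hD' : ∀ i, e i ∈ C ∧ x ∈ e i := fun i => by
      have := hD (heD i)
      simpa [starOf] using this
    set f : Fin (T+1) → Finset (Fin n) := Fin.cons A e with hf
    have hfC : ∀ i, f i ∈ C := by
      intro i; refine Fin.cases ?_ (fun j => ?_) i
      · simpa [hf] using hA
      · simpa [hf] using (hD' j).1
    refine ⟨f, ?_, fun i => hCH (hfC i), ?_, ?_, ?_⟩
    · rw [hf, Fin.cons_injective_iff]
      refine ⟨?_, he⟩
      rintro ⟨i, rfl⟩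
      exact hxA (hD' i).2
    · intro P hP; exact (mem_pat.1 hP).2
    · rw [mem_pat]
      refine ⟨⟨x, ?_⟩, ?_⟩
      · ext i
        refine Fin.cases ?_ (fun j => ?_) i
        · simp [hf, hxA]
        · simp [hf, (hD' j).2]
      · rw [Finset.card_erase_of_mem (Finset.mem_univ _)]; simp; omega
    · intro i hi
      exact pat_cover hi (hcl _ (hfC _) _ (hfC _))
  · intro ℬ ⟨h2, hB, hcov⟩
    refine (pat_le hn hk h0 hφ ℬ).trans ?_
    rw [Real.exp_le_exp]
    refine mul_le_mul_of_nonneg_right ?_ (log_pos_of_two hn).le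
    have hγ0 : 0 < gam n k := hδ.trans_le hγ
    set γ := gam n k
    have hccn : ∀ P ∈ ℬ, 0 ≤ cc γ P.card := fun P hP => by
      have := cc_ge hg1 (h2 P hP)
      have h3 : (2:ℝ) ≤ P.card := by exact_mod_cast h2 P hP
      nlinarith
    have k1 : cc γ T + γ * T ≤ ∑ P ∈ ℬ, cc γ P.card := by
      rw [← Finset.add_sum_erase _ _ hB]
      have e1 : (Finset.univ.erase (0 : Fin (T+1))).card = T := by
        rw [Finset.card_erase_of_mem (Finset.mem_univ _)]; simp
      rw [e1]
      gcongr
      set Z := ((ℬ.erase (Finset.univ.erase 0)).filter fun P => 0 ∈ P) with hZ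
      calc γ * T ≤ γ * ∑ P ∈ Z, ((P.card : ℝ) - 1) := by
            gcongr
            have : (Finset.univ.erase (0 : Fin (T+1))) ⊆ Z.biUnion fun P => P.erase 0 := by
              intro i hi
              obtain ⟨P, hP, hiP, h0P⟩ := hcov i (Finset.ne_of_mem_erase hi)
              refine Finset.mem_biUnion.2 ⟨P, ?_, Finset.mem_erase.2 ⟨Finset.ne_of_mem_erase hi, hiP⟩⟩
              simp only [hZ, Finset.mem_filter, Finset.mem_erase]
              refine ⟨⟨?_, hP⟩, h0P⟩
              rintro rfl
              simp at h0P
            have h3 := (Finset.card_le_card this).trans Finset.card_biUnion_le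
            rw [e1] at h3
            have h4 : ∀ P ∈ Z, ((P.erase 0).card : ℝ) = P.card - 1 := by
              intro P hP
              simp only [hZ, Finset.mem_filter, Finset.mem_erase] at hP
              rw [Finset.card_erase_of_mem hP.2, Nat.cast_sub]
              · simp
              · exact le_trans (by norm_num) (h2 P hP.1.2)
            rw [← Finset.sum_congr rfl h4]
            exact_mod_cast h3
        _ ≤ ∑ P ∈ Z, cc γ P.card := by
            rw [Finset.mul_sum]
            refine Finset.sum_le_sum fun P hP => cc_ge hg1 (h2 P ?_)
            simp only [hZ, Finset.mem_filter, Finset.mem_erase] at hP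
            exact hP.1.2
        _ ≤ _ := Finset.sum_le_sum_of_subset_of_nonneg (Finset.filter_subset _ _)
            fun P hP _ => hccn P (Finset.mem_of_mem_erase hP)
    have k2 : 6 ≤ δ * T := by rw [div_le_iff₀ hδ] at hT; linarith
    rw [show cc γ T = ((1 + γ) * T - 2) / 2 from rfl] at k1
    push_cast
    have k3 : δ * T ≤ γ * T := by gcongr
    nlinarith

/-- Second part of A1. -/
lemma A1ii {n k T S : ℕ} (hn : 2 ≤ n) (hk : 1 ≤ k) (hkn : k ≤ n) {p δ : ℝ} (h0 : 0 ≤ p) (h1 : p ≤ 1)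
    (hδ : 0 < δ) (hγ : δ ≤ gam n k) (hT : 1 ≤ T) (hS : 3 * T / δ ≤ S - 1)
    (hφ : phi n k p ≤ Real.exp (δ / 2 * Real.log n)) :
    hprob n k p (fun H => ∃ C ⊆ H, IsClique C ∧ S ≤ C.card ∧ ∀ x, vdeg C x < T) ≤
      npat S * Real.exp (-(1/2) * Real.log n) := by
  have hg1 := gam_le_one hn hk
  have hδ1 : δ ≤ 1 := hγ.trans hg1
  have hT' : (1:ℝ) ≤ T := by exact_mod_cast hT
  have hS1 : (3:ℝ) ≤ S - 1 := le_trans (by rw [le_div_iff₀ hδ]; nlinarith) hS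
  set Q : Finset (Finset (Fin S)) → Prop := fun ℬ => (∀ P ∈ ℬ, 2 ≤ P.card ∧ P.card ≤ T) ∧
    ∀ i j, i ≠ j → ∃ P ∈ ℬ, i ∈ P ∧ j ∈ P with hQ
  refine le_trans (sprob_mono h0 h1 ?_) (pat_prob' hk hkn h0 h1 Q (Real.exp_nonneg _) ?_)
  · rintro H - ⟨C, hCH, hcl, hCS, hdeg⟩
    obtain ⟨D, hD, hDc⟩ := Finset.exists_subset_card_eq hCS
    obtain ⟨f, hf, hfD, -⟩ := exists_enum D hDc
    refine ⟨f, hf, fun i => hCH (hD (hfD i)), ?_, ?_⟩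
    · intro P hP
      obtain ⟨⟨v, hv⟩, h2⟩ := mem_pat.1 hP
      refine ⟨h2, le_trans ?_ (hdeg v).le⟩
      rw [← hv, vdeg, ← Finset.card_image_of_injective _ hf]
      refine Finset.card_le_card ?_
      intro A hA
      simp only [Finset.mem_image, Finset.mem_filter, Finset.mem_univ, true_and] at hA
      obtain ⟨i, hi, rfl⟩ := hA
      simp only [starOf, Finset.mem_filter]
      exact ⟨hD (hfD i), hi⟩
    · intro i j hij
      exact pat_cover hij (hcl _ (hD (hfD _)) _ (hD (hfD _)))
  · intro ℬ ⟨h2, hcov⟩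
    refine (pat_le hn hk h0 hφ ℬ).trans ?_
    rw [Real.exp_le_exp]
    refine mul_le_mul_of_nonneg_right ?_ (log_pos_of_two hn).le
    have hγ0 : 0 < gam n k := hδ.trans_le hγ
    set γ := gam n k
    have k1 : γ / T * (S * (S - 1)) ≤ ∑ P ∈ ℬ, cc γ P.card := by
      calc _ ≤ γ / T * ∑ P ∈ ℬ, (P.card : ℝ) * (P.card - 1) := by
            gcongr; exact cover_pairs ℬ hcov
        _ ≤ _ := by
          rw [Finset.mul_sum]
          refine Finset.sum_le_sum fun P hP => le_trans ?_ (cc_ge hg1 (h2 P hP).1)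
          have a : (2:ℝ) ≤ P.card := by exact_mod_cast (h2 P hP).1
          have b : (P.card:ℝ) ≤ T := by exact_mod_cast (h2 P hP).2
          have c : (P.card:ℝ) / T ≤ 1 := by rw [div_le_one (by positivity)]; exact b
          calc γ / T * (P.card * (P.card - 1)) = γ * (P.card - 1) * (P.card / T) := by ring
            _ ≤ γ * (P.card - 1) * 1 := mul_le_mul_of_nonneg_left c (by nlinarith)
            _ = _ := by ring
    have k2 : δ / T * (S - 1) ≤ γ / T * (S - 1) := by gcongr
    have k3 : 3 ≤ δ / T * (S - 1) := by
      calc (3:ℝ) = δ / T * (3 * T / δ) := by field_simp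
        _ ≤ _ := mul_le_mul_of_nonneg_left hS (by positivity)
    have k4 : (3:ℝ) * S ≤ γ / T * (S * (S - 1)) := by
      have : γ / T * (S * (S - 1)) = S * (γ / T * (S - 1)) := by ring
      rw [this]; nlinarith
    nlinarith

lemma tendsto_explog {a : ℝ} (ha : 0 < a) :
    Tendsto (fun n : ℕ => Real.exp (-a * Real.log n)) atTop (nhds 0) := by
  refine Real.tendsto_exp_atBot.comp ?_
  refine Tendsto.const_mul_atTop_of_neg (by linarith) ?_
  exact Real.tendsto_log_atTop.comp tendsto_natCast_atTop_atTop

/-- Lemma A1. -/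
lemma A1 {δ : ℝ} (hδ : 0 < δ) : ∃ T : ℕ, 1 ≤ T ∧ ∀ θ > 0, ∀ᶠ n : ℕ in atTop, ∀ (k : ℕ) (p : ℝ),
    1 ≤ k → k ≤ n → 0 ≤ p → p ≤ 1 → δ ≤ gam n k → phi n k p ≤ Real.exp (δ / 2 * Real.log n) →
    hprob n k p (fun H => ∃ C ⊆ H, IsClique C ∧ IsNontrivial C ∧ T ≤ C.card) ≤ θ := by
  obtain ⟨T, hT⟩ := exists_nat_ge (6 / δ + 1)
  obtain ⟨S, hS⟩ := exists_nat_ge (3 * T / δ + 1)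
  have hT1 : (1:ℝ) ≤ T := le_trans (by have : 0 < 6 / δ := by positivity
                                       linarith) hT
  have hS1 : (1:ℝ) ≤ S := le_trans (by have : 0 ≤ 3 * T / δ := by positivity
                                       linarith) hS
  refine ⟨S, by exact_mod_cast hS1, fun θ hθ => ?_⟩
  have e1 := (tendsto_explog (a := 1/2) (by norm_num)).const_mul (npat (T+1) + npat S)
  rw [mul_zero] at e1
  filter_upwards [eventually_ge_atTop 2, e1.eventually (gt_mem_nhds hθ)] with n hn hlt k p hk hkn h0 h1 hγ hφ
  refine le_trans ?_ hlt.le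
  rw [add_mul]
  refine le_trans (le_trans (sprob_mono h0 h1 ?_) (sprob_or h0 h1 _ _)) (add_le_add
    (A1i (T := T) hn hk hkn h0 h1 hδ hγ (by linarith) hφ)
    (A1ii (T := T) (S := S) hn hk hkn h0 h1 hδ hγ (by exact_mod_cast hT1) (by linarith) hφ))
  rintro H - ⟨C, hCH, hcl, hnt, hc⟩
  by_cases h : ∃ x, T ≤ vdeg C x
  · exact Or.inl ⟨C, hCH, hcl, hnt, h⟩
  · push Not at h
    exact Or.inr ⟨C, hCH, hcl, hc, h⟩

lemma choose_ge_aux (m : ℕ) : ∀ r, 1 ≤ r → r < m → m ≤ m.choose r := by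
  induction m with
  | zero => intro r h1 h2; omega
  | succ m ih =>
    intro r h1 h2
    obtain ⟨r, rfl⟩ := Nat.exists_eq_succ_of_ne_zero (by omega : r ≠ 0)
    rw [Nat.succ_eq_add_one, Nat.choose_succ_succ, Nat.succ_eq_add_one]
    rcases Nat.lt_or_ge (r+1) m with h | h
    · have := ih (r+1) (by omega) h
      have h3 : 0 < m.choose r := Nat.choose_pos (by omega)
      omega
    · obtain rfl : m = r + 1 := by omega
      simp

lemma choose_ge_self {n k : ℕ} (hk : 2 ≤ k) (hkn : 2 * k ≤ n) : n ≤ (n-1).choose (k-1) + 1 := by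
  have h := choose_ge_aux (n-1) (k-1) (by omega) (by omega)
  omega

/-- Lemma A2. -/
lemma A2 (s : ℕ) (hs : 3 ≤ s) {θ : ℝ} (hθ : 0 < θ) : ∃ η > 0, ∀ᶠ n : ℕ in atTop, ∀ (k : ℕ) (p : ℝ),
    2 ≤ k → 2 * k ≤ n → 0 ≤ p → p ≤ 1 → 0 < gam n k →
    n * binomProbGe ((n-1).choose (k-1)) p (s+1) < Real.log n →
    mubar n k p ^ s * interProb n k ^ (s.choose 2) ≤ η →
    hprob n k p (fun H => ∃ C ⊆ H, IsClique C ∧ IsNontrivial C ∧ C.card = s) ≤ θ := by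
  have hnp : 0 < npat s := by unfold npat; positivity
  have hs' : (3:ℝ) ≤ s := by exact_mod_cast hs
  refine ⟨θ / npat s / 2 ^ (s.choose 2), by positivity, ?_⟩
  have e1 := (tendsto_explog (a := 1/(40*(s:ℝ)^2)) (by positivity)).eventually
    (gt_mem_nhds (show 0 < θ / npat s by positivity))
  filter_upwards [eventually_ge_atTop 2, e1, phi_small (s+1) (by omega) (1/(40*(s:ℝ)^3)) (by positivity)] with
    n hn hlt hsm k p hk hkn h0 h1 hγ hbin hmu
  have hk1 : 1 ≤ k := by omega
  have hg1 := gam_le_one hn hk1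
  have hφ : phi n k p ≤ Real.exp ((-(1/((s:ℝ)+1)) + 1/(40*(s:ℝ)^3)) * Real.log n) := by
    have := hsm _ p (choose_ge_self hk hkn) h0 h1 hbin
    rw [mul_comm (_ + _)]
    push_cast at this
    exact this
  set Q : Finset (Finset (Fin s)) → Prop := fun ℬ => (∀ P ∈ ℬ, 2 ≤ P.card) ∧ (∀ P ∈ ℬ, P.card < s) ∧
    ∀ i j, i ≠ j → ∃ P ∈ ℬ, i ∈ P ∧ j ∈ P with hQ
  have key := pat_prob' (n := n) (k := k) hk1 (by omega) h0 h1 Q (b := θ / npat s) (by positivity) ?_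
  · rw [mul_div_cancel₀ _ hnp.ne'] at key
    refine le_trans (sprob_mono h0 h1 ?_) key
    rintro H - ⟨C, hCH, hcl, hnt, hCS⟩
    obtain ⟨f, hf, hfC, hsurj⟩ := exists_enum C hCS
    refine ⟨f, hf, fun i => hCH (hfC i), ?_, ?_, ?_⟩
    · intro P hP; exact (mem_pat.1 hP).2
    · intro P hP
      obtain ⟨⟨v, hv⟩, -⟩ := mem_pat.1 hP
      by_contra hcon
      apply hnt
      refine ⟨v, fun A hA => ?_⟩
      obtain ⟨i, rfl⟩ := hsurj A hA
      have : P = Finset.univ := by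
        rw [← Finset.card_eq_iff_eq_univ, Fintype.card_fin]
        exact le_antisymm ((Finset.card_le_univ P).trans (by simp)) (by omega)
      have hi : i ∈ P := by rw [this]; simp
      rw [← hv] at hi
      simpa using hi
    · intro i j hij
      exact pat_cover hij (hcl _ (hfC _) _ (hfC _))
  · intro ℬ ⟨h2, hlt', hcov⟩
    rcases cover_dichotomy hs hγ hg1 ℬ h2 hlt' hcov with h | h
    · rw [block_prod hn hk1]
      have hch : ((s.choose 2 : ℕ) : ℝ) = s * (s-1) / 2 := by
        rw [Nat.cast_choose_two]
      calc _ ≤ mubar n k p ^ s * Real.exp (-((gam n k * (s * (s-1)/2)) * Real.log n)) := by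
            have := mubar_nonneg (n := n) (k := k) h0
            have := (log_pos_of_two hn).le
            gcongr
        _ = mubar n k p ^ s * ((k:ℝ)^2/n) ^ (s.choose 2) := by
            rw [k2n_eq_exp hn hk1, ← Real.exp_nat_mul, hch]; congr 2; ring
        _ ≤ mubar n k p ^ s * (2 * interProb n k) ^ (s.choose 2) := by
            have := mubar_nonneg (n := n) (k := k) h0
            have hq := interProb_ge_half (n := n) (k := k) (by omega) (by omega) (by
              rw [k2n_eq_exp hn hk1, Real.exp_le_one_iff]
              have := mul_nonneg hγ.le (log_pos_of_two hn).le
              linarith)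
            gcongr
            linarith
        _ = 2 ^ (s.choose 2) * (mubar n k p ^ s * interProb n k ^ (s.choose 2)) := by
            rw [mul_pow]; ring
        _ ≤ 2 ^ (s.choose 2) * (θ / npat s / 2 ^ (s.choose 2)) := by gcongr
        _ = _ := by field_simp
    · refine (pat_le hn hk1 h0 hφ ℬ).trans (le_trans ?_ hlt.le)
      rw [Real.exp_le_exp]
      refine mul_le_mul_of_nonneg_right ?_ (log_pos_of_two hn).le
      refine (sub_le_sub_left h _).trans (le_of_eq ?_)
      field_simp
      ring

end
end EKRP

namespace EKRP
noncomputable section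

/-- number of members of `C` missing `x` -/
def mdeg {n : ℕ} (C : Finset (Finset (Fin n))) (x : Fin n) : ℕ := (C.filter fun A => x ∉ A).card

lemma vdeg_add_mdeg {n : ℕ} (C : Finset (Finset (Fin n))) (x : Fin n) :
    vdeg C x + mdeg C x = C.card := by
  unfold vdeg mdeg starOf
  exact Finset.card_filter_add_card_filter_not _

/-- the bad event -/
def Bad {n : ℕ} (f τ : ℕ) (H : Finset (Finset (Fin n))) : Prop :=
  ∃ C ⊆ H, IsClique C ∧ τ ≤ C.card ∧ ∀ x, 1 ≤ mdeg C x ∧ vdeg H x ≤ vdeg C x + f * mdeg C x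

lemma vdeg_le_maxDegree {n : ℕ} (H : Finset (Finset (Fin n))) (x : Fin n) : vdeg H x ≤ maxDegree H :=
  Finset.le_sup (f := vdeg H) (Finset.mem_univ x)

lemma maxDegree_le {n : ℕ} {H : Finset (Finset (Fin n))} {m : ℕ} (h : ∀ x, vdeg H x ≤ m) :
    maxDegree H ≤ m := Finset.sup_le fun x _ => h x

lemma mdeg_pos_of {n : ℕ} {C : Finset (Finset (Fin n))} (h : ∀ x, 1 ≤ mdeg C x) : IsNontrivial C := by
  rintro ⟨x, hx⟩
  have := h x
  unfold mdeg at this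
  obtain ⟨A, hA⟩ := Finset.card_pos.1 this
  rw [Finset.mem_filter] at hA
  exact hA.2 (hx A hA.1)

/-- structure of counterexamples to EKR -/
lemma not_ekr {n : ℕ} {H : Finset (Finset (Fin n))} (h : ¬ EKR H) :
    ∃ C ⊆ H, IsClique C ∧ maxDegree H ≤ C.card ∧
      ∀ x, 1 ≤ mdeg C x ∧ vdeg H x ≤ C.card := by
  unfold EKR at h
  push Not at h
  obtain ⟨C, hCH, hcl, hmax, hst⟩ := h
  have h1 : ∀ x, vdeg H x ≤ C.card := by
    intro x
    refine hmax _ (Finset.filter_subset _ _) ?_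
    intro A hA B hB
    simp only [starOf, Finset.mem_filter] at hA hB
    exact ⟨x, Finset.mem_inter.2 ⟨hA.2, hB.2⟩⟩
  refine ⟨C, hCH, hcl, maxDegree_le h1, fun x => ⟨?_, h1 x⟩⟩
  by_contra hcon
  apply hst x
  have h0 : C.filter (fun A => x ∉ A) = ∅ := by
    rw [← Finset.card_eq_zero]; unfold mdeg at hcon; omega
  have hsub : C ⊆ starOf H x := by
    intro A hA
    simp only [starOf, Finset.mem_filter]
    refine ⟨hCH hA, ?_⟩
    by_contra hx
    have : A ∈ C.filter (fun A => x ∉ A) := Finset.mem_filter.2 ⟨hA, hx⟩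
    rw [h0] at this
    simp at this
  exact Finset.eq_of_subset_of_card_le hsub (h1 x)

lemma bad_of_not_ekr {n : ℕ} {H : Finset (Finset (Fin n))} (h : ¬ EKR H) {t : ℕ} (ht : t ≤ maxDegree H) :
    Bad 1 t H := by
  obtain ⟨C, hCH, hcl, hm, hx⟩ := not_ekr h
  refine ⟨C, hCH, hcl, ht.trans hm, fun x => ⟨(hx x).1, ?_⟩⟩
  rw [one_mul, vdeg_add_mdeg]; exact (hx x).2

lemma sum_vdeg {n k : ℕ} {H : Finset (Finset (Fin n))} (hH : H ⊆ kSets n k) :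
    ∑ x, vdeg H x = k * H.card := by
  unfold vdeg starOf
  simp only [Finset.card_filter]
  rw [Finset.sum_comm]
  have : ∀ A ∈ H, ∑ x : Fin n, (if x ∈ A then 1 else 0) = k := by
    intro A hA
    rw [← Finset.card_filter]
    have := mem_kSets.1 (hH hA)
    simpa using this
  rw [Finset.sum_congr rfl this]; simp [mul_comm]

lemma card_le_maxDegree {n k : ℕ} {H : Finset (Finset (Fin n))} (hH : H ⊆ kSets n k) :
    k * H.card ≤ n * maxDegree H := by
  rw [← sum_vdeg hH]
  calc _ ≤ ∑ _x : Fin n, maxDegree H := Finset.sum_le_sum fun x _ => vdeg_le_maxDegree H x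
    _ = _ := by simp

/-- sets through `x` missing `A` -/
def starMiss (n k : ℕ) (x : Fin n) (A : Finset (Fin n)) : Finset (Finset (Fin n)) :=
  (kSets n k).filter fun B => x ∈ B ∧ Disjoint A B

lemma card_starMiss {n k : ℕ} (hk : 1 ≤ k) {x : Fin n} {A : Finset (Fin n)} (hA : A.card = k) (hx : x ∉ A) :
    (starMiss n k x A).card = (n - k - 1).choose (k - 1) := by
  have : starMiss n k x A = (Finset.powersetCard (k-1) ((Finset.univ \ A).erase x)).image (insert x) := by
    ext B
    simp only [starMiss, Finset.mem_filter, mem_kSets, Finset.mem_image, Finset.mem_powersetCard]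
    constructor
    · rintro ⟨hB, hxB, hd⟩
      refine ⟨B.erase x, ⟨?_, by rw [Finset.card_erase_of_mem hxB, hB]⟩, Finset.insert_erase hxB⟩
      intro y hy
      simp only [Finset.mem_erase, Finset.mem_sdiff, Finset.mem_univ, true_and] at hy ⊢
      exact ⟨hy.1, fun h => Finset.disjoint_left.1 hd h hy.2⟩
    · rintro ⟨D, ⟨hD, hDc⟩, rfl⟩
      have hxD : x ∉ D := fun h => by simpa using hD h
      refine ⟨by rw [Finset.card_insert_of_notMem hxD, hDc]; omega, Finset.mem_insert_self _ _, ?_⟩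
      rw [Finset.disjoint_insert_right]
      refine ⟨hx, Finset.disjoint_left.2 fun y hy hyD => ?_⟩
      have := hD hyD
      simp only [Finset.mem_erase, Finset.mem_sdiff, Finset.mem_univ, true_and] at this
      exact this.2 hy
  rw [this, Finset.card_image_of_injOn, Finset.card_powersetCard, Finset.card_erase_of_mem (by simpa using hx),
    Finset.card_sdiff_of_subset (Finset.subset_univ _), Finset.card_univ, Fintype.card_fin, hA]
  intro D hD D' hD' h
  have aux : ∀ D ∈ (Finset.powersetCard (k-1) ((Finset.univ \ A).erase x)), x ∉ D := by
    intro D hD h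
    have := (Finset.mem_powersetCard.1 hD).1 h
    simp at this
  have h1 := aux D (by exact_mod_cast hD)
  have h2 := aux D' (by exact_mod_cast hD')
  rw [← Finset.erase_insert h1, ← Finset.erase_insert h2]
  exact congrArg (fun Z => Finset.erase Z x) h

lemma starMiss_ge {n k : ℕ} (hk : 1 ≤ k) (hkn : 2 * k ≤ n) :
    (1 - interProb n k) * ((n-1).choose (k-1) : ℝ) ≤ ((n - k - 1).choose (k - 1) : ℝ) := by
  rw [one_sub_interProb (by omega)]
  have hN : (0:ℝ) < (n.choose k : ℝ) := by exact_mod_cast Nat.choose_pos (by omega)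
  rw [div_mul_eq_mul_div, div_le_iff₀ hN]
  have e1 : (n:ℝ) * ((n-1).choose (k-1) : ℝ) = (n.choose k : ℝ) * k := by
    have h := Nat.add_one_mul_choose_eq (n-1) (k-1)
    rw [show n - 1 + 1 = n by omega, show k - 1 + 1 = k by omega] at h
    exact_mod_cast h
  have e2 : ((n-k : ℕ):ℝ) * ((n-k-1).choose (k-1) : ℝ) = ((n-k).choose k : ℝ) * k := by
    have h := Nat.add_one_mul_choose_eq (n-k-1) (k-1)
    rw [show n - k - 1 + 1 = n-k by omega, show k - 1 + 1 = k by omega] at h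
    exact_mod_cast h
  have hk0 : (0:ℝ) < k := by exact_mod_cast hk
  have hle : ((n-k:ℕ):ℝ) ≤ n := by exact_mod_cast Nat.sub_le n k
  set a : ℝ := ((n-1).choose (k-1) : ℝ)
  set b : ℝ := ((n-k-1).choose (k-1) : ℝ)
  have hb : 0 ≤ b := by positivity
  have ha : 0 ≤ a := by positivity
  refine le_of_mul_le_mul_right ?_ hk0
  calc ((n-k).choose k : ℝ) * a * k = (((n-k:ℕ):ℝ) * b) * a := by rw [e2]; ring
    _ ≤ (n * b) * a := by gcongr
    _ = b * (n.choose k : ℝ) * k := by rw [mul_assoc b, ← e1]; ring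

/-- A.s. each vertex has many edges missing a given edge. -/
lemma star_miss_prob {n k : ℕ} (hk : 1 ≤ k) (hkn : 2 * k ≤ n) {p : ℝ} (h0 : 0 ≤ p) (h1 : p ≤ 1) :
    hprob n k p (fun H => ∃ x : Fin n, ∃ A ∈ H, x ∉ A ∧
      ((H ∩ starMiss n k x A).card : ℝ) < phi n k p * (1 - interProb n k) / 2) ≤
      n * mubar n k p * Real.exp (-(phi n k p * (1 - interProb n k)) / 8) := by
  classical
  set S := (Finset.univ ×ˢ kSets n k).filter fun xA : Fin n × Finset (Fin n) => xA.1 ∉ xA.2 with hS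
  refine le_trans (le_trans (sprob_mono h0 h1 (Q := fun H => ∃ xA ∈ S, xA.2 ∈ H ∧
      ((H ∩ starMiss n k xA.1 xA.2).card : ℝ) < phi n k p * (1 - interProb n k) / 2) ?_)
      (sprob_exists h0 h1 S _)) ?_
  · rintro H hH ⟨x, A, hA, hx, hlt⟩
    exact ⟨(x, A), by simp [hS, hx, hH hA], hA, hlt⟩
  · have key : ∀ xA ∈ S, sprob (kSets n k) p (fun H => xA.2 ∈ H ∧
      ((H ∩ starMiss n k xA.1 xA.2).card : ℝ) < phi n k p * (1 - interProb n k) / 2) ≤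
        p * Real.exp (-(phi n k p * (1 - interProb n k)) / 8) := by
      rintro ⟨x, A⟩ hxA
      simp only [hS, Finset.mem_filter, Finset.mem_product, Finset.mem_univ, true_and] at hxA
      obtain ⟨hA, hx⟩ := hxA
      have hA' := mem_kSets.1 hA
      have hAS : A ∉ starMiss n k x A := fun h => hx (Finset.mem_filter.1 h).2.1
      have hF : ({A} : Finset (Finset (Fin n))) ⊆ kSets n k := by simpa using hA
      set m := phi n k p * (1 - interProb n k) with hm
      have e := ex_indep hF p (fun G => ind (A ∈ G)) (fun G => ind (((G ∩ starMiss n k x A).card : ℝ) < m / 2))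
      have e2 : sprob (kSets n k) p (fun H => A ∈ H ∧
          ((H ∩ starMiss n k x A).card : ℝ) < m / 2) = ex (kSets n k) p (fun G => ind (A ∈ G ∩ {A}) *
            ind ((((G \ {A}) ∩ starMiss n k x A).card : ℝ) < m / 2)) := by
        rw [sprob_eq]
        refine ex_congr fun G _ => ?_
        have e3 : (G \ {A}) ∩ starMiss n k x A = G ∩ starMiss n k x A := by
          ext B
          simp only [Finset.mem_inter, Finset.mem_sdiff, Finset.mem_singleton]
          constructor
          · tauto
          · rintro ⟨a, b⟩
            exact ⟨⟨a, fun h => hAS (h ▸ b)⟩, b⟩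
        rw [e3, ind_and]
        simp
      rw [e2, e, ← sprob_eq, ← sprob_eq]
      have p1 : sprob {A} p (fun G => A ∈ G) = p := by
        have := sprob_subset (E := {A}) (C := {A}) (Finset.Subset.refl _) p
        simpa using this
      rw [p1]
      have hle : m ≤ p * (starMiss n k x A).card := by
        rw [card_starMiss hk hA' hx, hm]
        have := mul_le_mul_of_nonneg_left (starMiss_ge hk hkn) h0
        unfold phi
        linarith
      have hsub : starMiss n k x A ⊆ kSets n k \ {A} := by
        intro B hB
        rw [Finset.mem_sdiff, Finset.mem_singleton]
        exact ⟨(Finset.mem_filter.1 hB).1, fun h => hAS (h ▸ hB)⟩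
      have := chernoff_lower hsub h0 h1
      refine mul_le_mul_of_nonneg_left ?_ h0
      refine le_trans (sprob_mono h0 h1 fun G _ hG => ?_) (this.trans ?_)
      · exact hG.trans_le (by linarith)
      · gcongr
    refine (Finset.sum_le_sum key).trans ?_
    rw [Finset.sum_const, nsmul_eq_mul]
    have hc : (S.card : ℝ) ≤ n * (n.choose k : ℝ) := by
      have : S.card ≤ n * n.choose k := by
        refine (Finset.card_filter_le _ _).trans ?_
        rw [Finset.card_product, card_kSets]; simp
      exact_mod_cast this
    rw [← phi_mul hk (by omega) p]
    calc _ ≤ n * (n.choose k : ℝ) * (p * Real.exp (-(phi n k p * (1 - interProb n k)) / 8)) := by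
          gcongr
      _ = _ := by ring

/-- One thinning step: from a max clique counterexample to `Bad 4`. -/
lemma thin_bad {n : ℕ} {H C : Finset (Finset (Fin n))} (hCH : C ⊆ H) (hcl : IsClique C) {r b D : ℝ}
    (hr0 : 0 ≤ r) (hr1 : r ≤ 1) (hb0 : 0 < b) (hC : D ≤ r * C.card) (hD : b ≤ D)
    (hm : ∀ x, b ≤ r * mdeg C x) (hd : ∀ x, vdeg H x ≤ C.card)
    (hsmall : (2 * n + 1) * Real.exp (- b / 8) ≤ 1 / 2) :
    1 / 2 ≤ sprob H r (Bad 4 ⌈D / 2⌉₊) := by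
  set Bd : Finset (Finset (Fin n)) → Prop := fun G => (((G ∩ C).card : ℝ) < r * C.card / 2) ∨
    ∃ x ∈ (Finset.univ : Finset (Fin n)), (((G ∩ C.filter fun A => x ∉ A).card : ℝ) < r * (C.filter fun A => x ∉ A).card / 2) ∨
      2 * (r * mdeg C x) < ((G ∩ (starOf H x \ C)).card : ℝ)
  have h1 : sprob H r Bd ≤ 1/2 := by
    refine le_trans ?_ hsmall
    refine (sprob_or hr0 hr1 _ _).trans ?_
    have a1 : sprob H r (fun G => ((G ∩ C).card : ℝ) < r * C.card / 2) ≤ Real.exp (-b/8) := by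
      refine (chernoff_lower hCH hr0 hr1).trans ?_
      rw [Real.exp_le_exp]; linarith
    have a2 : ∀ x ∈ (Finset.univ : Finset (Fin n)), sprob H r (fun G => (((G ∩ C.filter fun A => x ∉ A).card : ℝ) < r * (C.filter fun A => x ∉ A).card / 2) ∨
      2 * (r * mdeg C x) < ((G ∩ (starOf H x \ C)).card : ℝ)) ≤ 2 * Real.exp (-b/8) := by
      intro x _
      refine (sprob_or hr0 hr1 _ _).trans ?_
      have b1 := chernoff_lower (E := H) (F := C.filter fun A => x ∉ A) ((Finset.filter_subset _ _).trans hCH) hr0 hr1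
      have b2 := chernoff_upper (E := H) (F := starOf H x \ C) (Finset.sdiff_subset.trans (Finset.filter_subset _ _)) hr0 hr1
        (m := r * mdeg C x) (by
          gcongr
          have e1 := vdeg_add_mdeg C x
          have e2 := hd x
          have e3 : starOf C x ⊆ starOf H x := Finset.filter_subset_filter _ hCH
          have e4 : starOf H x \ C = starOf H x \ starOf C x := by
            ext A
            simp only [starOf, Finset.mem_sdiff, Finset.mem_filter]; tauto
          rw [e4, Finset.card_sdiff_of_subset e3]
          unfold vdeg at e1 e2
          omega)
      have e := hm x
      have c1 : Real.exp (-(r * (C.filter fun A => x ∉ A).card) / 8) ≤ Real.exp (-b/8) := by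
        rw [Real.exp_le_exp]; unfold mdeg at e; linarith
      have c2 : Real.exp (-(r * mdeg C x) / 8) ≤ Real.exp (-b/8) := by
        rw [Real.exp_le_exp]; linarith
      linarith
    have a3 := (sprob_exists hr0 hr1 (E := H) (Finset.univ : Finset (Fin n)) _).trans (Finset.sum_le_sum a2)
    rw [Finset.sum_const, nsmul_eq_mul, Finset.card_univ, Fintype.card_fin] at a3
    linarith
  have h2 := sprob_not H r Bd
  have h3 : sprob H r (fun G => ¬ Bd G) ≤ sprob H r (Bad 4 ⌈D / 2⌉₊) := by
    refine sprob_mono hr0 hr1 fun G hG hb => ?_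
    simp only [Bd] at hb
    push Not at hb
    obtain ⟨g1, g2⟩ := hb
    refine ⟨G ∩ C, Finset.inter_subset_left, fun A hA B hB => hcl A (Finset.mem_inter.1 hA).2 B (Finset.mem_inter.1 hB).2, ?_, ?_⟩
    · rw [Nat.ceil_le]; linarith
    · intro x
      obtain ⟨g3, g4⟩ := g2 x (Finset.mem_univ _)
      have e1 : mdeg (G ∩ C) x = (G ∩ C.filter fun A => x ∉ A).card := by
        unfold mdeg; congr 1; ext A; simp only [Finset.mem_filter, Finset.mem_inter]; tauto
      rw [← e1] at g3
      have e := hm x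
      have e' : r * ((C.filter fun A => x ∉ A).card : ℝ) = r * mdeg C x := rfl
      rw [e'] at g3
      refine ⟨?_, ?_⟩
      · have : (0:ℝ) < mdeg (G ∩ C) x := by linarith
        exact_mod_cast this
      · have e5 : vdeg G x ≤ vdeg (G ∩ C) x + (G ∩ (starOf H x \ C)).card := by
          unfold vdeg
          refine le_trans (Finset.card_le_card ?_) (Finset.card_union_le _ _)
          intro A hA
          simp only [starOf, Finset.mem_filter, Finset.mem_union, Finset.mem_inter, Finset.mem_sdiff] at hA ⊢
          have := hG hA.1
          tauto
        have e6 : (((G ∩ (starOf H x \ C)).card : ℕ) : ℝ) ≤ 4 * mdeg (G ∩ C) x := by linarith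
        have e7 : (G ∩ (starOf H x \ C)).card ≤ 4 * mdeg (G ∩ C) x := by exact_mod_cast e6
        omega
  linarith

/-- Reduction of large `φ` to moderate `φ₁`. -/
lemma large_phi {n k : ℕ} (hk : 1 ≤ k) (hkn : 2 * k ≤ n) {p r b : ℝ} (h0 : 0 ≤ p) (h1 : p ≤ 1)
    (hr0 : 0 < r) (hr1 : r ≤ 1) (hb : b = phi n k p * r * (1 - interProb n k)) (hb0 : 0 < b)
    (hqn : 1 ≤ n * (1 - interProb n k))
    (hsmall : (2 * n + 1) * Real.exp (- b / 16) ≤ 1 / 2) :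
    hprob n k p (fun H => ¬ EKR H) ≤ Real.exp (-b / 8) + 16 * n ^ 3 * Real.exp (- b / 16) +
      2 * hprob n k (p * r) (Bad 4 ⌈phi n k p * r / 4⌉₊) := by
  classical
  set φ := phi n k p with hφ
  set q := interProb n k with hq
  have hn : (0:ℝ) < n := by exact_mod_cast (by omega : 0 < n)
  have hk0 : (0:ℝ) < k := by exact_mod_cast hk
  have hkn' : (k:ℝ) ≤ n := by exact_mod_cast (by omega : k ≤ n)
  have hq1 : 0 < 1 - q := by
    by_contra hcon
    have : n * (1 - q) ≤ 0 := mul_nonpos_of_nonneg_of_nonpos hn.le (by linarith)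
    linarith
  have hq0 : 0 ≤ q := interProb_nonneg n k
  have hφ0 : 0 ≤ φ := phi_nonneg h0
  have hbφ : b ≤ φ * (1 - q) := by
    rw [hb]
    calc φ * r * (1 - q) ≤ φ * 1 * (1 - q) := by gcongr
      _ = _ := by ring
  have hbφ2 : b ≤ φ * r := by
    rw [hb]
    have : 0 ≤ φ * r := by positivity
    nlinarith
  have hmu : mubar n k p = φ * n / k := rfl
  have hmuφ : φ ≤ mubar n k p := by
    rw [hmu, le_div_iff₀ hk0]; gcongr
  -- the two a.s. events
  set B1 : Finset (Finset (Fin n)) → Prop := fun H => (H.card : ℝ) < mubar n k p / 2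
  set B2 : Finset (Finset (Fin n)) → Prop := fun H => ∃ x : Fin n, ∃ A ∈ H, x ∉ A ∧
      ((H ∩ starMiss n k x A).card : ℝ) < φ * (1 - q) / 2
  set B3 : Finset (Finset (Fin n)) → Prop := fun H => ¬ EKR H ∧ ¬ B1 H ∧ ¬ B2 H
  have p1 : hprob n k p B1 ≤ Real.exp (- b / 8) := by
    have := chernoff_lower (E := kSets n k) (F := kSets n k) (Finset.Subset.refl _) h0 h1
    rw [card_kSets, phi_mul hk (by omega)] at this
    refine le_trans (sprob_mono h0 h1 fun G hG hB => ?_) (this.trans ?_)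
    · rw [Finset.inter_eq_left.2 hG]; exact hB
    · rw [Real.exp_le_exp]
      have : φ * (1 - q) ≤ φ := by nlinarith
      linarith
  have p2 : hprob n k p B2 ≤ 16 * n ^ 3 * Real.exp (- b / 16) := by
    refine (star_miss_prob hk hkn h0 h1).trans ?_
    set y := φ * (1 - q) with hy
    have hmun : mubar n k p ≤ n * φ := by
      rw [hmu, div_le_iff₀ hk0]
      have : (1:ℝ) ≤ k := by exact_mod_cast hk
      have : 0 ≤ φ * n := by positivity
      nlinarith
    have hφy : φ ≤ n * y := by
      rw [hy]; nlinarith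
    have hye : y ≤ 16 * Real.exp (y / 16) := by
      have := Real.add_one_le_exp (y / 16); linarith
    calc n * mubar n k p * Real.exp (-y / 8) ≤ n * (n * (n * (16 * Real.exp (y/16)))) * Real.exp (-y/8) := by
          gcongr
          refine hmun.trans ?_
          gcongr
          refine hφy.trans ?_
          gcongr
      _ = 16 * n ^ 3 * Real.exp (- y / 16) := by
          rw [show -y/16 = y/16 + -y/8 by ring, Real.exp_add]; ring
      _ ≤ _ := by gcongr
  have p3 : hprob n k p B3 ≤ 2 * hprob n k (p * r) (Bad 4 ⌈φ * r / 4⌉₊) := by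
    have e1 : hprob n k (p * r) (Bad 4 ⌈φ * r / 4⌉₊) = ex (kSets n k) p (fun H => sprob H r (Bad 4 ⌈φ * r / 4⌉₊)) :=
      (sprob_two_stage _ _ _ _).symm
    rw [e1, ← ex_mul_left, hprob_eq]
    refine sprob_le_ex h0 h1 (fun G _ => mul_nonneg (by norm_num) (sprob_nonneg hr0.le hr1 _)) ?_
    rintro H hH ⟨hE, hb1, hb2⟩
    obtain ⟨C, hCH, hcl, hmax, hx⟩ := not_ekr hE
    have hb1' : mubar n k p / 2 ≤ H.card := not_lt.1 hb1
    have hCφ : φ / 2 ≤ C.card := by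
      have a1 : (k:ℝ) * H.card ≤ n * maxDegree H := by exact_mod_cast card_le_maxDegree hH
      have a2 : (maxDegree H : ℝ) ≤ C.card := by exact_mod_cast hmax
      have a3 : φ * n = mubar n k p * k := by rw [hmu]; field_simp
      refine le_of_mul_le_mul_left ?_ hn
      nlinarith
    have key := thin_bad (D := φ * r / 2) (b := b / 2) hCH hcl hr0.le hr1 (by linarith) ?_ (by linarith) ?_ (fun x => (hx x).2) ?_
    · rw [show φ * r / 2 / 2 = φ * r / 4 by ring] at key
      linarith
    · nlinarith
    · intro x
      have hb2' := hb2
      simp only [B2] at hb2'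
      push Not at hb2'
      obtain ⟨A, hA⟩ := Finset.card_pos.1 (hx x).1
      rw [Finset.mem_filter] at hA
      have h5 := hb2' x A (hCH hA.1) hA.2
      have h6 : (H ∩ starMiss n k x A).card ≤ mdeg C x := by
        have e1 := vdeg_add_mdeg C x
        have e2 := (hx x).2
        have e3 : vdeg C x + (H ∩ starMiss n k x A).card ≤ vdeg H x := by
          unfold vdeg
          rw [← Finset.card_union_of_disjoint]
          · refine Finset.card_le_card (Finset.union_subset (Finset.filter_subset_filter _ hCH) ?_)
            intro B hB
            simp only [Finset.mem_inter, starMiss, Finset.mem_filter, starOf] at hB ⊢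
            tauto
          · refine Finset.disjoint_left.2 fun B hB hB' => ?_
            simp only [Finset.mem_inter, starMiss, Finset.mem_filter, starOf] at hB hB'
            have := hcl A hA.1 B hB.1
            rw [Finset.disjoint_iff_inter_eq_empty.1 hB'.2.2.2] at this
            simp at this
        omega
      have h7 : ((H ∩ starMiss n k x A).card : ℝ) ≤ mdeg C x := by exact_mod_cast h6
      rw [hb]
      have : φ * (1 - q) / 2 ≤ mdeg C x := h5.trans h7
      nlinarith
    · rw [show -(b/2)/8 = -b/16 by ring]; exact hsmall
  have : hprob n k p (fun H => ¬ EKR H) ≤ hprob n k p B1 + (hprob n k p B2 + hprob n k p B3) := by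
    refine le_trans (sprob_mono h0 h1 (Q := fun H => B1 H ∨ (B2 H ∨ B3 H)) fun H _ hE => ?_) ((sprob_or h0 h1 _ _).trans
      (add_le_add le_rfl (sprob_or h0 h1 _ _)))
    by_cases g1 : B1 H
    · exact Or.inl g1
    · by_cases g2 : B2 H
      · exact Or.inr (Or.inl g2)
      · exact Or.inr (Or.inr ⟨hE, g1, g2⟩)
  linarith

end
end EKRP

namespace EKRP
noncomputable section

lemma binom_size_mono {M M' : ℕ} (hM : M ≤ M') {p : ℝ} (h0 : 0 ≤ p) (h1 : p ≤ 1) (t : ℕ) :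
    binomProbGe M p t ≤ binomProbGe M' p t := by
  have e := sprob_inter_card_ge (E := Finset.range M') (F := Finset.range M)
    (Finset.range_subset_range.2 hM) p t
  have e' := sprob_card_ge (Finset.range M') p t
  rw [Finset.card_range] at e e'
  rw [← e, ← e']
  exact sprob_mono h0 h1 fun G _ h => h.trans (Finset.card_le_card Finset.inter_subset_left)

lemma binom_le_one {M : ℕ} {p : ℝ} (h0 : 0 ≤ p) (h1 : p ≤ 1) (t : ℕ) : binomProbGe M p t ≤ 1 := by
  have e' := sprob_card_ge (Finset.range M) p t
  rw [Finset.card_range] at e'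
  rw [← e']; exact sprob_le_one h0 h1 _

lemma binom_upper {M : ℕ} {p : ℝ} (h0 : 0 ≤ p) (h1 : p ≤ 1) (t : ℕ) :
    binomProbGe M p t ≤ (p * M) ^ t / t.factorial := by
  have e' := sprob_card_ge (Finset.range M) p t
  rw [Finset.card_range] at e'
  rw [← e']
  refine le_trans (sprob_mono h0 h1 (Q := fun G => ∃ C ∈ Finset.powersetCard t (Finset.range M), C ⊆ G) ?_)
    ((first_moment h0 h1 _ fun C hC => (Finset.mem_powersetCard.1 hC).1).trans ?_)
  · intro G hG hc
    obtain ⟨C, hC, hCc⟩ := Finset.exists_subset_card_eq hc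
    exact ⟨C, Finset.mem_powersetCard.2 ⟨hC.trans hG, hCc⟩, hC⟩
  · have : ∀ C ∈ Finset.powersetCard t (Finset.range M), p ^ C.card = p ^ t := by
      intro C hC; rw [(Finset.mem_powersetCard.1 hC).2]
    rw [Finset.sum_congr rfl this, Finset.sum_const, nsmul_eq_mul, Finset.card_powersetCard, Finset.card_range]
    have h2 := Nat.choose_le_pow_div (α := ℝ) t M
    calc (M.choose t : ℝ) * p ^ t ≤ (M:ℝ) ^ t / t.factorial * p ^ t := by gcongr
      _ = _ := by rw [mul_pow]; ring

lemma factorial_ge (t : ℕ) : ((t:ℝ) / Real.exp 1) ^ t ≤ t.factorial := by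
  have h := Real.pow_div_factorial_le_exp (t:ℝ) (by positivity) t
  rw [div_pow, ← Real.exp_nat_mul, mul_one, div_le_iff₀ (Real.exp_pos _)]
  rw [div_le_iff₀ (by positivity)] at h
  linarith

lemma pow_div_fact_le {y : ℝ} (hy : 0 ≤ y) {t : ℕ} (ht : 1 ≤ t) :
    y ^ t / t.factorial ≤ (Real.exp 1 * y / t) ^ t := by
  have ht0 : (0:ℝ) < t := by exact_mod_cast ht
  have := factorial_ge t
  have hp : 0 < ((t:ℝ) / Real.exp 1) ^ t := by positivity
  calc y ^ t / t.factorial ≤ y ^ t / ((t:ℝ) / Real.exp 1) ^ t := by gcongr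
    _ = _ := by rw [← div_pow]; congr 1; field_simp

lemma binom_ratio {M t : ℕ} (hM : 2 * (t + 1) ≤ M) {p : ℝ} (h0 : 0 < p) (h1 : p ≤ 1) :
    binomProbGe M p t ≤ (1 + 2 * (t + 1) / (p * M)) * binomProbGe M p (t + 1) := by
  have hM0 : (0:ℝ) < M := by exact_mod_cast (by omega : 0 < M)
  have h1p : 0 ≤ 1 - p := by linarith
  have e1 : binomProbGe M p t = (M.choose t : ℝ) * p ^ t * (1 - p) ^ (M - t) + binomProbGe M p (t+1) := by
    unfold binomProbGe
    rw [← Finset.insert_Icc_add_one_left_eq_Icc (by omega : t ≤ M), Finset.sum_insert (by simp)]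
  have e2 : (M.choose (t+1) : ℝ) * p ^ (t+1) * (1 - p) ^ (M - (t+1)) ≤ binomProbGe M p (t+1) := by
    unfold binomProbGe
    exact Finset.single_le_sum (f := fun j => (M.choose j : ℝ) * p ^ j * (1 - p) ^ (M - j))
      (fun j _ => by positivity) (Finset.mem_Icc.2 ⟨le_refl _, by omega⟩)
  have e3 : (M.choose (t+1) : ℝ) * (t+1) = M.choose t * ((M - t : ℕ) : ℝ) := by
    exact_mod_cast Nat.choose_succ_right_eq M t
  have e4 : (M:ℝ) / 2 ≤ ((M - t : ℕ) : ℝ) := by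
    rw [Nat.cast_sub (by omega)]
    have : (2:ℝ) * (t + 1) ≤ M := by exact_mod_cast hM
    linarith
  have e5 : (M.choose t : ℝ) ≤ 2 * (t+1) / M * M.choose (t+1) := by
    rw [div_mul_eq_mul_div, le_div_iff₀ hM0]
    have : (0:ℝ) ≤ M.choose t := by positivity
    nlinarith
  have e6 : (1-p) ^ (M - t) ≤ (1 - p) ^ (M - (t+1)) :=
    pow_le_pow_of_le_one h1p (by linarith) (by omega)
  rw [e1, add_mul, one_mul, add_comm (binomProbGe M p (t+1))]
  refine add_le_add_left ?_ _
  calc (M.choose t : ℝ) * p ^ t * (1 - p) ^ (M - t)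
      ≤ (2 * (t+1) / M * M.choose (t+1)) * p ^ t * (1 - p) ^ (M - (t+1)) := by gcongr
    _ = 2 * (t+1) / (p * M) * ((M.choose (t+1) : ℝ) * p ^ (t+1) * (1 - p) ^ (M - (t+1))) := by
        rw [pow_succ]; field_simp
    _ ≤ _ := by gcongr

lemma binom_ratio_pow {M t : ℕ} (hM : 2 * t ≤ M) {p : ℝ} (h0 : 0 < p) (h1 : p ≤ 1) (z : ℕ) :
    binomProbGe M p (t - z) ≤ (1 + 2 * t / (p * M)) ^ z * binomProbGe M p t := by
  induction z with
  | zero => simp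
  | succ z ih =>
    have hb := binom_nonneg (M := M) h0.le h1 t
    rcases Nat.lt_or_ge z t with h | h
    · have h2 := binom_ratio (M := M) (t := t - (z+1)) (by omega) h0 h1
      rw [show t - (z+1) + 1 = t - z by omega] at h2
      have h3 : (((t - (z+1) : ℕ):ℝ) + 1) ≤ t := by exact_mod_cast (by omega : t - (z+1) + 1 ≤ t)
      calc _ ≤ _ := h2
        _ ≤ (1 + 2 * t / (p * M)) * ((1 + 2 * t / (p * M)) ^ z * binomProbGe M p t) := by
            have hz := binom_nonneg (M := M) h0.le h1 (t - z)
            gcongr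
        _ = _ := by rw [pow_succ]; ring
    · rw [show t - (z+1) = t - z by omega]
      refine ih.trans ?_
      gcongr
      · have : 0 ≤ 2 * (t:ℝ) / (p * M) := by positivity
        linarith
      · omega

lemma vdeg_eq_inter {n k : ℕ} {H : Finset (Finset (Fin n))} (hH : H ⊆ kSets n k) (x : Fin n) :
    vdeg H x = (H ∩ (kSets n k).filter fun A => x ∈ A).card := by
  unfold vdeg starOf
  congr 1
  ext A
  simp only [Finset.mem_filter, Finset.mem_inter]
  constructor
  · rintro ⟨a, b⟩; exact ⟨a, hH a, b⟩
  · rintro ⟨a, _, b⟩; exact ⟨a, b⟩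

lemma hprob_vdeg_ge {n k : ℕ} (hk : 1 ≤ k) {p : ℝ} (x : Fin n) (t : ℕ) :
    hprob n k p (fun H => t ≤ vdeg H x) = binomProbGe ((n-1).choose (k-1)) p t := by
  rw [← card_star hk x, ← sprob_inter_card_ge (E := kSets n k) (Finset.filter_subset _ _) p t, hprob_eq,
    sprob_eq, sprob_eq]
  exact ex_congr fun G hG => by rw [vdeg_eq_inter hG]

lemma hprob_maxdeg_ge {n k : ℕ} (hk : 1 ≤ k) {p : ℝ} (h0 : 0 ≤ p) (h1 : p ≤ 1) {t : ℕ} (ht : 1 ≤ t) :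
    hprob n k p (fun H => t ≤ maxDegree H) ≤ n * binomProbGe ((n-1).choose (k-1)) p t := by
  refine le_trans (sprob_mono h0 h1 (Q := fun H => ∃ x ∈ (Finset.univ : Finset (Fin n)), t ≤ vdeg H x) ?_)
    ((sprob_exists h0 h1 _ _).trans ?_)
  · intro H _ h
    unfold maxDegree at h
    rw [Finset.le_sup_iff (show 0 < t by omega)] at h
    exact h
  · have : ∀ x ∈ (Finset.univ : Finset (Fin n)), sprob (kSets n k) p (fun H => t ≤ vdeg H x) = binomProbGe ((n-1).choose (k-1)) p t :=
      fun x _ => hprob_vdeg_ge hk x t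
    rw [Finset.sum_congr rfl this]; simp

open Classical in
lemma pair_prob {n k : ℕ} (hk : 1 ≤ k) (hkn : k ≤ n) {p : ℝ} (h0 : 0 < p) (h1 : p ≤ 1) {t : ℕ}
    (ht : 2 * t ≤ (n-1).choose (k-1)) {x y : Fin n} (hxy : x ≠ y) :
    hprob n k p (fun H => t ≤ vdeg H x ∧ t ≤ vdeg H y) ≤
      (binomProbGe ((n-1).choose (k-1)) p t) ^ 2 *
        Real.exp ((1 + 2 * t / phi n k p) ^ 2 * (phi n k p * k / n)) := by
  set M := (n-1).choose (k-1) with hM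
  set π := binomProbGe M p t with hπ
  have hn : 0 < n := lt_of_le_of_lt (Nat.zero_le _) x.2
  have hφM : phi n k p = p * M := rfl
  set ρ := 1 + 2 * t / phi n k p with hρ
  set E := kSets n k
  set Sx := E.filter fun A => x ∈ A with hSx
  set Sy := E.filter fun A => y ∈ A with hSy
  set F := E.filter fun A => x ∈ A ∧ y ∈ A with hF
  have hFE : F ⊆ E := Finset.filter_subset _ _
  have hρ1 : 1 ≤ ρ := by
    have : 0 ≤ 2 * t / phi n k p := by have := phi_nonneg (n := n) (k := k) h0.le; positivity
    linarith
  have main : hprob n k p (fun H => t ≤ vdeg H x ∧ t ≤ vdeg H y) ≤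
      ex F p (fun G1 => π ^ 2 * (ρ ^ 2) ^ G1.card) := by
    rw [hprob_eq, sprob_eq, ex_split hFE]
    refine ex_mono h0.le h1 fun G1 hG1 => ?_
    have hsub : Sx \ F ⊆ E \ F := Finset.sdiff_subset_sdiff (Finset.filter_subset _ _) (Finset.Subset.refl _)
    have hsub2 : Sy \ F ⊆ (E \ F) \ (Sx \ F) := by
      intro A hA
      simp only [hSy, hF, hSx, Finset.mem_sdiff, Finset.mem_filter] at hA ⊢
      tauto
    set z := G1.card
    have hind := ex_indep hsub p (fun G => ind (t - z ≤ G.card)) (fun G => ind (t - z ≤ (G ∩ (Sy \ F)).card))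
    rw [← sprob_eq, ← sprob_eq, sprob_card_ge, sprob_inter_card_ge hsub2] at hind
    calc _ ≤ ex (E \ F) p (fun G => ind (t - z ≤ (G ∩ (Sx \ F)).card) * ind (t - z ≤ ((G \ (Sx \ F)) ∩ (Sy \ F)).card)) := by
          refine ex_mono h0.le h1 fun G2 hG2 => ?_
          rw [← ind_and]
          refine ind_mono ?_
          rintro ⟨a, b⟩
          have hcomb : G1 ∪ G2 ⊆ E := Finset.union_subset (hG1.trans hFE) (hG2.trans Finset.sdiff_subset)
          rw [vdeg_eq_inter hcomb] at a b
          have a1 : ((G1 ∪ G2) ∩ Sx).card ≤ z + (G2 ∩ (Sx \ F)).card := by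
            refine le_trans (Finset.card_le_card ?_) (Finset.card_union_le _ _)
            intro A hA
            simp only [Finset.mem_inter, Finset.mem_union, Finset.mem_sdiff] at hA ⊢
            rcases hA.1 with h | h
            · exact Or.inl h
            · exact Or.inr ⟨h, hA.2, (Finset.mem_sdiff.1 (hG2 h)).2⟩
          have b1 : ((G1 ∪ G2) ∩ Sy).card ≤ z + ((G2 \ (Sx \ F)) ∩ (Sy \ F)).card := by
            refine le_trans (Finset.card_le_card ?_) (Finset.card_union_le _ _)
            intro A hA
            rw [Finset.mem_inter, Finset.mem_union] at hA
            rw [Finset.mem_union]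
            rcases hA.1 with h | h
            · exact Or.inl h
            · refine Or.inr ?_
              have hAF := (Finset.mem_sdiff.1 (hG2 h)).2
              rw [Finset.mem_inter, Finset.mem_sdiff]
              have h5 : A ∈ Sy \ F := Finset.mem_sdiff.2 ⟨hA.2, hAF⟩
              exact ⟨⟨h, (Finset.mem_sdiff.1 (hsub2 h5)).2⟩, h5⟩
          constructor
          · have : t ≤ ((G1 ∪ G2) ∩ Sx).card := a
            omega
          · have : t ≤ ((G1 ∪ G2) ∩ Sy).card := b
            omega
      _ = binomProbGe (Sx \ F).card p (t - z) * binomProbGe (Sy \ F).card p (t - z) := hind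
      _ ≤ (ρ ^ z * π) * (ρ ^ z * π) := by
          have cx : (Sx \ F).card ≤ M := by
            rw [hM, ← card_star hk x]; exact Finset.card_le_card Finset.sdiff_subset
          have cy : (Sy \ F).card ≤ M := by
            rw [hM, ← card_star hk y]; exact Finset.card_le_card Finset.sdiff_subset
          have r := binom_ratio_pow ht h0 h1 z
          rw [← hφM] at r
          have q1 := (binom_size_mono cx h0.le h1 (t - z)).trans r
          have q2 := (binom_size_mono cy h0.le h1 (t - z)).trans r
          exact mul_le_mul q1 q2 (binom_nonneg h0.le h1 _) (le_trans (binom_nonneg h0.le h1 _) q1)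
      _ = _ := by rw [← pow_mul, mul_comm 2 z, pow_mul]; ring
  refine main.trans ?_
  rw [ex_mul_left, ex_pow_card]
  refine mul_le_mul_of_nonneg_left ?_ (sq_nonneg _)
  have hρ2 : 1 ≤ ρ ^ 2 := one_le_pow₀ hρ1
  calc (1 - p + p * ρ ^ 2) ^ F.card ≤ (Real.exp (p * ρ ^ 2)) ^ F.card := by
        gcongr
        have := Real.add_one_le_exp (p * ρ ^ 2); linarith
    _ = Real.exp (ρ ^ 2 * (p * F.card)) := by rw [← Real.exp_nat_mul]; congr 1; ring
    _ ≤ _ := by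
        rw [Real.exp_le_exp]
        refine mul_le_mul_of_nonneg_left ?_ (sq_nonneg _)
        have hc := card_supersets_le (k := k) hn hkn {x, y}
        rw [Finset.card_pair hxy] at hc
        have hFe : F = (kSets n k).filter fun A => {x, y} ⊆ A := by
          rw [hF]; ext A
          simp [Finset.mem_filter, Finset.insert_subset_iff, E]
        have hc' : (F.card : ℝ) ≤ ((k:ℝ)/n)^2 * (n.choose k : ℝ) := by
          rw [hFe]; convert hc
        have hk0 : (0:ℝ) < k := by exact_mod_cast hk
        have hn0 : (0:ℝ) < n := by exact_mod_cast hn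
        calc p * F.card ≤ p * (((k:ℝ)/n)^2 * (n.choose k : ℝ)) := by gcongr
          _ = ((k:ℝ)/n)^2 * mubar n k p := by rw [← phi_mul hk hkn]; ring
          _ = _ := by unfold mubar; field_simp

/-- Second moment lower bound for the maximum degree. -/
lemma second_moment {n k : ℕ} (hk : 1 ≤ k) (hkn : k ≤ n) (hn : 2 ≤ n) {p : ℝ} (h0 : 0 < p) (h1 : p ≤ 1) {t : ℕ}
    (ht : 2 * t ≤ (n-1).choose (k-1))
    (hπ : Real.log n ≤ n * binomProbGe ((n-1).choose (k-1)) p t) :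
    hprob n k p (fun H => maxDegree H < t) ≤ 1 / Real.log n +
      (Real.exp ((1 + 2 * t / phi n k p) ^ 2 * (phi n k p * k / n)) - 1) := by
  set M := (n-1).choose (k-1) with hM
  set π := binomProbGe M p t with hπ'
  set R := Real.exp ((1 + 2 * t / phi n k p) ^ 2 * (phi n k p * k / n)) with hR
  have hR1 : 1 ≤ R := by
    rw [hR]; apply Real.one_le_exp
    have := phi_nonneg (n := n) (k := k) h0.le
    positivity
  have hlog := log_pos_of_two hn
  set m := n * π with hm
  have hm0 : 0 < m := hlog.trans_le hπ
  set Y : Finset (Finset (Fin n)) → ℝ := fun H => ∑ x : Fin n, ind (t ≤ vdeg H x) with hY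
  have eY : ex (kSets n k) p Y = m := by
    rw [hY, ex_sum]
    have : ∀ x : Fin n, ex (kSets n k) p (fun H => ind (t ≤ vdeg H x)) = π := fun x => by
      rw [← sprob_eq]; exact hprob_vdeg_ge hk x t
    rw [Finset.sum_congr rfl fun x _ => this x]; simp [hm]
  have eY2 : ex (kSets n k) p (fun H => Y H ^ 2) ≤ m + m ^ 2 * R := by
    have e1 : (fun H => Y H ^ 2) = fun H => ∑ x : Fin n, ∑ y : Fin n, ind (t ≤ vdeg H x ∧ t ≤ vdeg H y) := by
      funext H
      simp only [hY]
      rw [sq, Finset.sum_mul_sum]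
      simp only [ind_and]
    rw [e1, ex_sum]
    have hπ0 : 0 ≤ π := binom_nonneg h0.le h1 _
    have e2 : ∀ x : Fin n, ex (kSets n k) p (fun H => ∑ y : Fin n, ind (t ≤ vdeg H x ∧ t ≤ vdeg H y)) ≤
        π + n * (π ^ 2 * R) := by
      intro x
      rw [ex_sum, ← Finset.add_sum_erase _ _ (Finset.mem_univ x)]
      have a1 : ex (kSets n k) p (fun H => ind (t ≤ vdeg H x ∧ t ≤ vdeg H x)) = π := by
        simp only [and_self]; rw [← sprob_eq]; exact hprob_vdeg_ge hk x t
      have a2 : ∀ y ∈ Finset.univ.erase x, ex (kSets n k) p (fun H => ind (t ≤ vdeg H x ∧ t ≤ vdeg H y)) ≤ π ^ 2 * R := by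
        intro y hy
        rw [← sprob_eq]
        exact pair_prob hk hkn h0 h1 ht (Finset.ne_of_mem_erase hy).symm
      rw [a1]
      gcongr
      refine (Finset.sum_le_sum a2).trans ?_
      rw [Finset.sum_const, nsmul_eq_mul]
      gcongr
      refine (Finset.card_le_univ _).trans (by simp)
    refine (Finset.sum_le_sum fun x _ => e2 x).trans (le_of_eq ?_)
    simp [hm]; ring
  have key : hprob n k p (fun H => maxDegree H < t) ≤ ex (kSets n k) p (fun H => (m⁻¹)^2 * (Y H ^ 2 - 2 * m * Y H + m ^ 2)) := by
    rw [hprob_eq]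
    refine sprob_le_ex h0.le h1 ?_ ?_
    · intro H _
      have : Y H ^ 2 - 2 * m * Y H + m ^ 2 = (Y H - m)^2 := by ring
      rw [this]; positivity
    · intro H _ hH
      have : Y H = 0 := by
        simp only [hY]
        refine Finset.sum_eq_zero fun x _ => ind_false ?_
        have := vdeg_le_maxDegree H x
        omega
      rw [this]; field_simp; norm_num
  have e3 : ex (kSets n k) p (fun H => (m⁻¹)^2 * (Y H ^ 2 - 2 * m * Y H + m ^ 2)) =
      (m⁻¹)^2 * (ex (kSets n k) p (fun H => Y H ^ 2) - 2 * m * m + m ^ 2) := by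
    rw [ex_mul_left, ex_add, ex_sub, ex_mul_left, ex_const, eY]
  rw [e3] at key
  refine key.trans ?_
  calc _ ≤ (m⁻¹)^2 * (m + m ^ 2 * R - 2 * m * m + m ^ 2) := by gcongr
    _ = 1 / m + (R - 1) := by field_simp; ring
    _ ≤ _ := by gcongr

end
end EKRP

namespace EKRP
noncomputable section

lemma hprob_true {n k : ℕ} {p : ℝ} {P : Finset (Finset (Fin n)) → Prop} (h : ∀ H ⊆ kSets n k, P H) :
    hprob n k p P = 1 := by
  rw [hprob_eq, sprob_eq, ex_congr (g := fun _ => 1) fun G hG => ind_true (h G hG), ex_const]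

lemma hprob_mono {n k : ℕ} {p : ℝ} (h0 : 0 ≤ p) (h1 : p ≤ 1) {P Q : Finset (Finset (Fin n)) → Prop}
    (h : ∀ H ⊆ kSets n k, P H → Q H) : hprob n k p P ≤ hprob n k p Q := sprob_mono h0 h1 h

lemma hprob_or {n k : ℕ} {p : ℝ} (h0 : 0 ≤ p) (h1 : p ≤ 1) (P Q : Finset (Finset (Fin n)) → Prop) :
    hprob n k p (fun H => P H ∨ Q H) ≤ hprob n k p P + hprob n k p Q := sprob_or h0 h1 P Q

lemma hprob_nonneg {n k : ℕ} {p : ℝ} (h0 : 0 ≤ p) (h1 : p ≤ 1) (P : Finset (Finset (Fin n)) → Prop) :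
    0 ≤ hprob n k p P := sprob_nonneg h0 h1 P

lemma hprob_compl {n k : ℕ} {p : ℝ} (P : Finset (Finset (Fin n)) → Prop) :
    hprob n k p (fun H => ¬ P H) = 1 - hprob n k p P := sprob_not _ _ P

lemma hprob_nonempty {n k : ℕ} (hk : 1 ≤ k) (hkn : k ≤ n) {p : ℝ} (h0 : 0 ≤ p) (h1 : p ≤ 1) :
    hprob n k p (fun H => H.Nonempty) ≤ mubar n k p := by
  refine le_trans (hprob_mono h0 h1 (Q := fun H => ∃ A ∈ kSets n k, {A} ⊆ H) ?_)
    ((sprob_exists h0 h1 _ _).trans ?_)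
  · rintro H hH ⟨A, hA⟩; exact ⟨A, hH hA, by simpa using hA⟩
  · rw [Finset.sum_congr rfl fun A hA => sprob_subset (by simpa using hA) p]
    simp [card_kSets]
    rw [← phi_mul hk hkn]; linarith

open Classical in
lemma hprob_deg2 {n k : ℕ} (hk : 1 ≤ k) (hkn : k ≤ n) {p : ℝ} (h0 : 0 ≤ p) (h1 : p ≤ 1) :
    hprob n k p (fun H => 2 ≤ maxDegree H) ≤ mubar n k p ^ 2 * interProb n k := by
  set S := ((kSets n k) ×ˢ (kSets n k)).filter fun AB => (AB.1 ∩ AB.2).Nonempty with hS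
  set S' := S.filter fun AB => AB.1 ≠ AB.2 with hS'
  refine le_trans (hprob_mono h0 h1 (Q := fun H => ∃ AB ∈ S', {AB.1, AB.2} ⊆ H) ?_)
    ((sprob_exists h0 h1 _ _).trans ?_)
  · intro H hH h
    unfold maxDegree at h
    rw [Finset.le_sup_iff (show 0 < 2 by omega)] at h
    obtain ⟨x, _, hx⟩ := h
    obtain ⟨A, hA, B, hB, hAB⟩ := Finset.one_lt_card.1 (show 1 < (starOf H x).card from hx)
    unfold starOf at hA hB
    rw [Finset.mem_filter] at hA hB
    refine ⟨(A, B), ?_, ?_⟩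
    · simp only [hS', hS, Finset.mem_filter, Finset.mem_product]
      exact ⟨⟨⟨hH hA.1, hH hB.1⟩, ⟨x, Finset.mem_inter.2 ⟨hA.2, hB.2⟩⟩⟩, hAB⟩
    · intro Z hZ
      simp only [Finset.mem_insert, Finset.mem_singleton] at hZ
      rcases hZ with rfl | rfl
      · exact hA.1
      · exact hB.1
  · have : ∀ AB ∈ S', sprob (kSets n k) p (fun H => {AB.1, AB.2} ⊆ H) = p ^ 2 := by
      intro AB hAB
      simp only [hS', hS, Finset.mem_filter, Finset.mem_product] at hAB
      rw [sprob_subset, Finset.card_pair hAB.2]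
      intro Z hZ
      simp only [Finset.mem_insert, Finset.mem_singleton] at hZ
      rcases hZ with rfl | rfl
      · exact hAB.1.1.1
      · exact hAB.1.1.2
    rw [Finset.sum_congr rfl this, Finset.sum_const, nsmul_eq_mul]
    have hc : (S'.card : ℝ) ≤ S.card := by exact_mod_cast Finset.card_le_card (Finset.filter_subset _ _)
    have hN : (0:ℝ) < (n.choose k : ℝ) := by exact_mod_cast Nat.choose_pos hkn
    have hq : (S.card : ℝ) = (n.choose k : ℝ) ^ 2 * interProb n k := by
      unfold interProb; rw [card_kSets, ← hS]; field_simp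
    rw [← phi_mul hk hkn, mul_pow, mul_assoc, ← hq]
    nlinarith [sq_nonneg p]

lemma hprob_empty (n k : ℕ) (p : ℝ) : hprob n k p (fun H => H = ∅) = (1 - p) ^ (n.choose k) := by
  unfold hprob
  rw [Finset.sum_eq_single ∅]
  · simp [card_kSets]
  · intro b _ hb; simp [hb]
  · simp

lemma one_sub_pow_ge {p : ℝ} (h0 : 0 ≤ p) (h1 : p ≤ 1/2) (N : ℕ) : Real.exp (-2 * (p * N)) ≤ (1 - p) ^ N := by
  have h2 : Real.exp (-2 * p) ≤ 1 - p := by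
    have h3 := Real.add_one_le_exp (2 * p)
    have h4 : Real.exp (-2 * p) * Real.exp (2 * p) = 1 := by
      rw [← Real.exp_add]; simp
    have h5 : Real.exp (-2 * p) * (1 + 2 * p) ≤ 1 := by
      rw [← h4]; gcongr; linarith
    nlinarith [Real.exp_pos (-2 * p)]
  calc Real.exp (-2 * (p * N)) = (Real.exp (-2 * p)) ^ N := by
        rw [← Real.exp_nat_mul]; congr 1; ring
    _ ≤ _ := by gcongr

lemma Lam_zero (n k : ℕ) (p : ℝ) : Lam n k p 0 = 1 := by simp [Lam, gchoose]
lemma Lam_one (n k : ℕ) (p : ℝ) : Lam n k p 1 = mubar n k p := by simp [Lam, gchoose]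
lemma Lam_two (n k : ℕ) (p : ℝ) :
    Lam n k p 2 = mubar n k p * (mubar n k p - 1) / 2 * interProb n k := by
  simp [Lam, gchoose, Finset.prod_range_succ]

lemma vdeg_zero_of {n : ℕ} {H : Finset (Finset (Fin n))} (hH : H ⊆ kSets n 0) : maxDegree H = 0 := by
  refine Nat.le_zero.1 (maxDegree_le fun x => ?_)
  unfold vdeg starOf
  rw [Nat.le_zero, Finset.card_eq_zero, Finset.filter_eq_empty_iff]
  intro A hA
  have := mem_kSets.1 (hH hA)
  rw [Finset.card_eq_zero] at this
  simp [this]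

lemma vdeg_one_of {n : ℕ} {H : Finset (Finset (Fin n))} (hH : H ⊆ kSets n 1) : maxDegree H ≤ 1 := by
  refine maxDegree_le fun x => ?_
  unfold vdeg starOf
  rw [Finset.card_le_one]
  intro A hA B hB
  rw [Finset.mem_filter] at hA hB
  have a := mem_kSets.1 (hH hA.1)
  have b := mem_kSets.1 (hH hB.1)
  rw [Finset.card_eq_one] at a b
  obtain ⟨a, rfl⟩ := a
  obtain ⟨b, rfl⟩ := b
  have h1 := hA.2
  have h2 := hB.2
  rw [Finset.mem_singleton] at h1 h2
  rw [← h1, ← h2]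

lemma maxDegree_pos_imp {n : ℕ} {H : Finset (Finset (Fin n))} (h : 1 ≤ maxDegree H) : H.Nonempty := by
  rw [Finset.nonempty_iff_ne_empty]
  rintro rfl
  have : maxDegree (∅ : Finset (Finset (Fin n))) ≤ 0 := maxDegree_le fun x => by simp [vdeg, starOf]
  omega

lemma t2_facts {n k : ℕ} (hn : 10 ≤ n) (hkn : 2 * k < n) {p e η : ℝ} (h0 : 0 ≤ p) (h1 : p ≤ 1)
    (hη0 : 0 < η) (hη : η ≤ 1/100) (he : e ≤ η)
    (hL : hprob n k p (fun H => e < Lam n k p (maxDegree H)) ≤ η) :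
    2 ≤ k ∧ 0 < p ∧ ∃ t, 3 ≤ t ∧ Lam n k p t ≤ η ∧ (∀ s < t, η < Lam n k p s) ∧
      hprob n k p (fun H => maxDegree H < t) ≤ η ∧
      1/2 ≤ n * (phi n k p ^ t / t.factorial) ∧ 1/2 ≤ n * (phi n k p ^ 3 / 6) := by
  have hex : ∃ t, Lam n k p t ≤ η := by
    by_contra! hcon
    have := hprob_true (n := n) (k := k) (p := p) (P := fun H => e < Lam n k p (maxDegree H))
      fun H _ => he.trans_lt (hcon _)
    rw [this] at hL; linarith
  classical
  set t := Nat.find hex with ht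
  have ht1 : Lam n k p t ≤ η := Nat.find_spec hex
  have ht2 : ∀ s < t, η < Lam n k p s := fun s hs => not_le.1 (Nat.find_min hex hs)
  have hP : hprob n k p (fun H => maxDegree H < t) ≤ η :=
    (hprob_mono h0 h1 fun H _ h => he.trans_lt (ht2 _ h)).trans hL
  have hP' : 1 - η ≤ hprob n k p (fun H => t ≤ maxDegree H) := by
    have := hprob_compl (n := n) (k := k) (p := p) (fun H => maxDegree H < t)
    simp only [not_lt] at this
    rw [this]; linarith
  have t0 : t ≠ 0 := by
    intro h; rw [h, Lam_zero] at ht1; linarith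
  have k0 : k ≠ 0 := by
    rintro rfl
    rw [hprob_true fun H hH => by rw [vdeg_zero_of hH]; omega] at hP
    linarith
  have hk1 : 1 ≤ k := by omega
  have t1 : t ≠ 1 := by
    intro h
    rw [h, Lam_one] at ht1
    have := (hprob_mono h0 h1 fun H _ h' => maxDegree_pos_imp (h ▸ h')).trans
      (hprob_nonempty hk1 (by omega : k ≤ n) h0 h1)
    linarith
  have k1 : k ≠ 1 := by
    rintro rfl
    rw [hprob_true fun H hH => by have := vdeg_one_of hH; omega] at hP
    linarith
  have hk2 : 2 ≤ k := by omega
  have hN : 4 ≤ n.choose k := by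
    have a := choose_ge_self hk2 hkn.le
    have b := Nat.choose_le_choose (k-1) (show n - 1 ≤ n by omega)
    have : (n-1).choose (k-1) ≤ n.choose k := by
      obtain ⟨n', rfl⟩ : ∃ n', n = n' + 1 := ⟨n-1, by omega⟩
      obtain ⟨k', rfl⟩ : ∃ k', k = k' + 1 := ⟨k-1, by omega⟩
      simp [Nat.choose_succ_succ]
    omega
  have hμ : 2 ≤ mubar n k p := by
    by_contra! hcon
    rw [← phi_mul hk1 (by omega : k ≤ n)] at hcon
    have hN' : (4:ℝ) ≤ n.choose k := by exact_mod_cast hN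
    have hp2 : p ≤ 1/2 := by nlinarith
    have h2 := one_sub_pow_ge h0 hp2 (n.choose k)
    rw [← hprob_empty] at h2
    have h3 : hprob n k p (fun H => H = ∅) ≤ η := by
      refine (hprob_mono h0 h1 ?_).trans hP
      rintro H _ rfl
      by_contra! h'
      exact Finset.not_nonempty_empty (maxDegree_pos_imp (by omega) : (∅ : Finset (Finset (Fin n))).Nonempty)
    have h4 : Real.exp (-4) ≤ Real.exp (-2 * (p * n.choose k)) := by
      rw [Real.exp_le_exp]; linarith
    have h5 : (1:ℝ)/81 < Real.exp (-4) := by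
      have := Real.exp_one_lt_three
      rw [Real.exp_neg, one_div]
      refine inv_strictAnti₀ (Real.exp_pos _) ?_
      have : Real.exp 4 = Real.exp 1 ^ 4 := by rw [← Real.exp_nat_mul]; norm_num
      rw [this]
      calc Real.exp 1 ^ 4 < 3 ^ 4 := by gcongr
        _ = 81 := by norm_num
    linarith
  have t2 : t ≠ 2 := by
    intro h
    rw [h, Lam_two] at ht1
    rw [h] at hP'
    have := hprob_deg2 hk1 (by omega : k ≤ n) h0 h1
    have hq := interProb_nonneg n k
    nlinarith [mul_nonneg (mul_nonneg (by linarith : 0 ≤ mubar n k p) (by linarith : 0 ≤ mubar n k p - 2)) hq]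
  have hp : 0 < p := by
    rcases h0.lt_or_eq with h | h
    · exact h
    · exfalso
      rw [← h] at hμ; simp [mubar, phi] at hμ; linarith
  have bd : ∀ s, 1 ≤ s → s ≤ t → 1/2 ≤ n * (phi n k p ^ s / s.factorial) := by
    intro s hs hst
    have a := hprob_maxdeg_ge (n := n) hk1 h0 h1 hs
    have b := hprob_mono (n := n) (k := k) h0 h1 (P := fun H => t ≤ maxDegree H) (Q := fun H => s ≤ maxDegree H)
      fun H _ h => hst.trans h
    have c := binom_upper (M := (n-1).choose (k-1)) h0 h1 s
    calc 1/2 ≤ 1 - η := by linarith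
      _ ≤ _ := hP'
      _ ≤ _ := b
      _ ≤ _ := a
      _ ≤ _ := by gcongr; exact c
  refine ⟨hk2, hp, t, by omega, ht1, ht2, hP, bd t (by omega) le_rfl, ?_⟩
  have := bd 3 (by omega) (by omega)
  simpa [Nat.factorial] using this

/-- choice of the second-moment threshold -/
lemma t1_choice {n k : ℕ} (hn : 3 ≤ n) (hk : 1 ≤ k) (hkn : k ≤ n) {p : ℝ} (h0 : 0 < p) (h1 : p ≤ 1)
    (hM : 2 * (Real.exp 2 * phi n k p + Real.log n) ≤ ((n-1).choose (k-1) : ℝ)) :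
    ∃ t : ℕ, n * binomProbGe ((n-1).choose (k-1)) p (t+1) < Real.log n ∧
      (t:ℝ) ≤ Real.exp 2 * phi n k p + Real.log n ∧
      hprob n k p (fun H => maxDegree H < t) ≤ 1 / Real.log n +
        (Real.exp ((phi n k p + 2 * (Real.exp 2 * phi n k p + Real.log n)) ^ 2 * k / (n * phi n k p)) - 1) := by
  classical
  set M := (n-1).choose (k-1) with hMd
  have hlog := log_pos_of_two (show 2 ≤ n by omega)
  have hn0 : (0:ℝ) < n := by exact_mod_cast (by omega : 0 < n)
  have hMpos : 0 < M := Nat.choose_pos (by omega)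
  have hφ0 : 0 < phi n k p := by
    unfold phi
    have : (0:ℝ) < ((n-1).choose (k-1) : ℝ) := by exact_mod_cast hMpos
    positivity
  have hlogn : Real.log n ≤ n := by
    have := Real.log_le_sub_one_of_pos hn0
    linarith
  set P : ℕ → Prop := fun t => Real.log n ≤ n * binomProbGe M p t with hPdef
  have hP0 : P 0 := by
    have : binomProbGe M p 0 = 1 := by
      have e' := sprob_card_ge (Finset.range M) p 0
      rw [Finset.card_range] at e'
      rw [← e', sprob_eq, ex_congr (g := fun _ => 1) fun G _ => ind_true (Nat.zero_le _), ex_const]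
    simp only [hPdef, this]; linarith
  set t := Nat.findGreatest P M with ht
  have htP : P t := Nat.findGreatest_spec (Nat.zero_le _) hP0
  have htn : ¬ P (t+1) := by
    intro h
    by_cases hle : t + 1 ≤ M
    · have := Nat.le_findGreatest hle h
      omega
    · simp only [hPdef] at h
      have : binomProbGe M p (t+1) = 0 := by
        unfold binomProbGe
        rw [Finset.Icc_eq_empty (by omega)]; simp
      rw [this] at h; linarith
  have htle : (t:ℝ) ≤ Real.exp 2 * phi n k p + Real.log n := by
    by_contra! hcon
    have ht0 : (0:ℝ) < t := lt_trans (by positivity) hcon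
    have ht1 : 1 ≤ t := by exact_mod_cast ht0
    have a := binom_upper (M := M) h0.le h1 t
    have b := pow_div_fact_le (y := p * M) (by positivity) ht1
    have c : (Real.exp 1 * (p * M) / t) ^ t ≤ Real.exp (-1) ^ t := by
      gcongr
      rw [div_le_iff₀ ht0]
      have : p * M = phi n k p := rfl
      rw [this]
      have e2 : Real.exp 2 = Real.exp 1 * Real.exp 1 := by rw [← Real.exp_add]; norm_num
      have e3 : Real.exp (-1) * Real.exp 1 = 1 := by rw [← Real.exp_add]; norm_num
      have e4 : Real.exp 1 * phi n k p = Real.exp (-1) * (Real.exp 2 * phi n k p) := by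
        rw [e2]; linear_combination (-(Real.exp 1) * phi n k p) * e3
      rw [e4]; gcongr; linarith
    rw [← Real.exp_nat_mul] at c
    have d : Real.exp (t * -1) < Real.exp (- Real.log n) := by
      rw [Real.exp_lt_exp]
      have : 0 < Real.exp 2 * phi n k p := by positivity
      linarith
    rw [Real.exp_neg, Real.exp_log hn0] at d
    have e : n * binomProbGe M p t < 1 := by
      calc n * binomProbGe M p t ≤ n * Real.exp (t * -1) := by gcongr; exact a.trans (b.trans c)
        _ < n * (n:ℝ)⁻¹ := by gcongr
        _ = 1 := by field_simp
    have f : 1 < Real.log n := by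
      rw [Real.lt_log_iff_exp_lt hn0]
      have := Real.exp_one_lt_three
      have : (3:ℝ) ≤ n := by exact_mod_cast hn
      linarith
    have := htP
    simp only [hPdef] at this
    linarith
  refine ⟨t, not_le.1 htn, htle, ?_⟩
  have h2t : 2 * t ≤ M := by
    have : (2:ℝ) * t ≤ M := by linarith
    exact_mod_cast this
  refine (second_moment hk hkn (by omega) h0 h1 h2t htP).trans ?_
  gcongr 1 / _ + (Real.exp ?_ - 1)
  have e : (1 + 2 * (t:ℝ) / phi n k p) ^ 2 * (phi n k p * k / n) =
      (phi n k p + 2 * t) ^ 2 * k / (n * phi n k p) := by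
    field_simp
  rw [e]
  gcongr

end
end EKRP

namespace EKRP
noncomputable section

lemma ev_log {P : ℝ → Prop} (h : ∀ᶠ x : ℝ in atTop, P x) : ∀ᶠ n : ℕ in atTop, P (Real.log n) :=
  (Real.tendsto_log_atTop.comp tendsto_natCast_atTop_atTop).eventually h

lemma ev_exp_small {a : ℝ} (ha : 0 < a) {θ : ℝ} (hθ : 0 < θ) : ∀ᶠ x : ℝ in atTop, Real.exp (-(a * x)) ≤ θ := by
  have h : Tendsto (fun x : ℝ => Real.exp (-(a * x))) atTop (nhds 0) :=
    Real.tendsto_exp_neg_atTop_nhds_zero.comp (tendsto_id.const_mul_atTop ha)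
  exact (h.eventually (gt_mem_nhds hθ)).mono fun x hx => le_of_lt hx

lemma ev_exp_large {a : ℝ} (ha : 0 < a) (C : ℝ) : ∀ᶠ x : ℝ in atTop, C ≤ Real.exp (a * x) :=
  (Real.tendsto_exp_atTop.comp (tendsto_id.const_mul_atTop ha)).eventually_ge_atTop C

lemma ev_lin_exp {a : ℝ} (ha : 0 < a) (C : ℝ) : ∀ᶠ x : ℝ in atTop, C * x ≤ Real.exp (a * x) := by
  filter_upwards [eventually_ge_atTop (2 * |C| / a ^ 2), eventually_ge_atTop 0] with x hx hx0
  have h1 := Real.quadratic_le_exp_of_nonneg (x := a * x) (by positivity)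
  rw [div_le_iff₀ (by positivity)] at hx
  have h2 : C ≤ |C| := le_abs_self C
  have h3 : C * x ≤ |C| * x := by gcongr
  nlinarith [mul_nonneg ha.le hx0]

lemma one_sub_q_ge {n k : ℕ} (hkn : 2 * k < n) :
    (1 - (k:ℝ) / (n - k)) ^ k ≤ 1 - interProb n k := by
  rw [one_sub_interProb (by omega)]
  have e1 : ((n-k).choose k : ℝ) * k.factorial = ∏ i ∈ Finset.range k, ((n - k - i : ℕ) : ℝ) := by
    have := Nat.descFactorial_eq_factorial_mul_choose (n-k) k
    rw [Nat.descFactorial_eq_prod_range] at this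
    have h := congrArg (Nat.cast (R := ℝ)) this
    push_cast at h
    rw [mul_comm, ← h]
  have e2 : (n.choose k : ℝ) * k.factorial = ∏ i ∈ Finset.range k, ((n - i : ℕ) : ℝ) := by
    have := Nat.descFactorial_eq_factorial_mul_choose n k
    rw [Nat.descFactorial_eq_prod_range] at this
    have h := congrArg (Nat.cast (R := ℝ)) this
    push_cast at h
    rw [mul_comm, ← h]
  have hf : (0:ℝ) < k.factorial := by positivity
  rw [← mul_div_mul_right ((n-k).choose k : ℝ) (n.choose k : ℝ) hf.ne', e1, e2, ← Finset.prod_div_distrib]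
  have hnk : (2:ℝ) * k < n := by exact_mod_cast hkn
  have hk0 : (0:ℝ) ≤ k := by positivity
  have h0 : 0 ≤ 1 - (k:ℝ) / (n - k) := by
    rw [sub_nonneg, div_le_one (by linarith)]; linarith
  calc (1 - (k:ℝ) / (n - k)) ^ k = ∏ i ∈ Finset.range k, (1 - (k:ℝ) / (n - k)) := by simp
    _ ≤ _ := by
      refine Finset.prod_le_prod (fun _ _ => h0) fun i hi => ?_
      rw [Finset.mem_range] at hi
      have hi' : (i:ℝ) ≤ k := by exact_mod_cast hi.le
      rw [Nat.sub_sub, Nat.cast_sub (by omega), Nat.cast_sub (by omega)]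
      push_cast
      have h2 : (0:ℝ) < n - k := by linarith
      have h3 : (0:ℝ) < n - i := by linarith
      have : ((n:ℝ) - (k + i)) / (n - i) = 1 - k / (n - i) := by field_simp; ring
      rw [this]
      gcongr

lemma q_le {n k : ℕ} (hkn : 2 * k < n) : interProb n k ≤ 2 * ((k:ℝ)^2 / n) := by
  have h := one_sub_q_ge hkn
  have hnk : (2:ℝ) * k < n := by exact_mod_cast hkn
  have hk0 : (0:ℝ) ≤ k := by positivity
  have h2 : (0:ℝ) < n - k := by linarith
  have h1 : (-2:ℝ) ≤ -((k:ℝ) / (n - k)) := by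
    have : (k:ℝ) / (n - k) ≤ 1 := by rw [div_le_one h2]; linarith
    linarith
  have h3 := one_add_mul_le_pow h1 k
  have h4 : (k:ℝ) / (n - k) ≤ 2 * k / n := by
    rw [div_le_div_iff₀ h2 (by linarith)]; nlinarith
  have h5 : (k:ℝ) * (k / (n-k)) ≤ k * (2 * k / n) := by gcongr
  have h6 : (k:ℝ) * (2 * k / n) = 2 * (k^2/n) := by ring
  have h7 : (1:ℝ) + -((k:ℝ) / (n - k)) = 1 - (k:ℝ) / (n - k) := by ring
  rw [h7] at h3
  linarith

lemma large_gen {θ : ℝ} (hθ : 0 < θ) : ∀ᶠ n : ℕ in atTop, ∀ (k : ℕ) (p φ₁ : ℝ), 1 ≤ k → 2 * k ≤ n →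
    0 ≤ p → p ≤ 1 → 0 < φ₁ → φ₁ ≤ phi n k p → 1 ≤ n * (1 - interProb n k) →
    160 * Real.log n ≤ φ₁ * (1 - interProb n k) →
    ∃ p', 0 ≤ p' ∧ p' ≤ 1 ∧ phi n k p' = φ₁ ∧
    hprob n k p (fun H => ¬ EKR H) ≤ θ + 2 * hprob n k p' (Bad 4 ⌈φ₁ / 4⌉₊) := by
  filter_upwards [ev_log (ev_exp_small (a := 7) (by norm_num) (show 0 < min (1/6) (θ/20) by positivity)),
    eventually_ge_atTop 3] with n hn7 hn k p φ₁ hk hkn h0 h1 hφ0 hφ hqn hb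
  have hlog := log_pos_of_two (show 2 ≤ n by omega)
  set x := Real.log n with hx
  have hne : (n:ℝ) = Real.exp x := n_eq_exp (by omega)
  have hφp : 0 < phi n k p := hφ0.trans_le hφ
  set r := φ₁ / phi n k p with hr
  have hr1 : r ≤ 1 := by rw [hr, div_le_one hφp]; exact hφ
  have hr0 : 0 < r := by positivity
  have hφr : phi n k p * r = φ₁ := by rw [hr]; field_simp
  set b := φ₁ * (1 - interProb n k) with hbd
  have hexpb : Real.exp (-b/16) ≤ Real.exp (-(10 * x)) := by
    rw [Real.exp_le_exp]; linarith
  have hexpb8 : Real.exp (-b/8) ≤ Real.exp (-(7 * x)) := by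
    rw [Real.exp_le_exp]; linarith
  have h7a := hn7.trans (min_le_left _ _)
  have h7b := hn7.trans (min_le_right _ _)
  have hn1 : (1:ℝ) ≤ n := by exact_mod_cast (by omega : 1 ≤ n)
  have h3 : (n:ℝ)^3 * Real.exp (-(10*x)) = Real.exp (-(7*x)) := by
    rw [hne, ← Real.exp_nat_mul, ← Real.exp_add]; congr 1; push_cast; ring
  have h4 : (2 * (n:ℝ) + 1) ≤ 3 * (n:ℝ)^3 := by nlinarith [sq_nonneg ((n:ℝ)-1), mul_nonneg (sub_nonneg.2 hn1) (sq_nonneg (n:ℝ))]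
  have key := large_phi hk hkn h0 h1 hr0 hr1 (b := b) (by rw [hφr]) (by linarith [mul_pos (by norm_num : (0:ℝ) < 160) hlog]) hqn
    (by
      calc (2 * (n:ℝ) + 1) * Real.exp (-b/16) ≤ (3 * (n:ℝ)^3) * Real.exp (-(10*x)) := by gcongr
        _ = 3 * Real.exp (-(7*x)) := by rw [mul_assoc, h3]
        _ ≤ 1/2 := by linarith)
  refine ⟨p * r, by positivity, by nlinarith, ?_, key.trans ?_⟩
  · rw [← hφr]; unfold phi; ring
  · rw [hφr]
    have h5 : 16 * (n:ℝ)^3 * Real.exp (-b/16) ≤ 16 * Real.exp (-(7*x)) := by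
      calc _ ≤ 16 * (n:ℝ)^3 * Real.exp (-(10*x)) := by gcongr
        _ = _ := by rw [mul_assoc, h3]
    linarith

lemma pow_ladder {μ q η : ℝ} (hμ : 0 ≤ μ) (hq0 : 0 ≤ q) (hq1 : q ≤ 1) (hη : η ≤ 1) {t : ℕ} (ht : 1 ≤ t)
    (h : μ ^ t * q ^ t.choose 2 ≤ η) : ∀ s ≥ t, μ ^ s * q ^ s.choose 2 ≤ η := by
  have h1 : μ ^ 2 * q ^ (t - 1) ≤ 1 := by
    have e : (μ ^ 2 * q ^ (t-1)) ^ t = (μ ^ t * q ^ t.choose 2) ^ 2 := by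
      have : (t - 1) * t = t.choose 2 * 2 := by
        rw [Nat.choose_two_right, Nat.div_mul_cancel (Nat.even_mul_pred_self t).two_dvd, mul_comm]
      rw [mul_pow, mul_pow, ← pow_mul, ← pow_mul, ← pow_mul, ← pow_mul, this, mul_comm 2 t]
    have e2 : (μ ^ 2 * q ^ (t-1)) ^ t ≤ 1 := by
      rw [e]; exact pow_le_one₀ (by positivity) (h.trans hη)
    exact (pow_le_one_iff_of_nonneg (by positivity) (by omega)).1 e2
  intro s hs
  induction s, hs using Nat.le_induction with
  | base => exact h
  | succ s hs ih =>
    have h2 : μ * q ^ s ≤ 1 := by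
      have : (μ * q ^ s) ^ 2 ≤ 1 := by
        calc (μ * q ^ s) ^ 2 = μ ^ 2 * q ^ (s * 2) := by rw [mul_pow, ← pow_mul]
          _ ≤ μ ^ 2 * q ^ (t - 1) := by
            gcongr μ ^ 2 * ?_
            exact pow_le_pow_of_le_one hq0 hq1 (by omega)
          _ ≤ 1 := h1
      exact (pow_le_one_iff_of_nonneg (by positivity) (by norm_num)).1 this
    have e : (s+1).choose 2 = s + s.choose 2 := by
      rw [Nat.choose_succ_succ' s 1, Nat.choose_one_right]
    calc μ ^ (s+1) * q ^ (s+1).choose 2 = (μ ^ s * q ^ s.choose 2) * (μ * q ^ s) := by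
          rw [e, pow_add, pow_succ]; ring
      _ ≤ (μ ^ s * q ^ s.choose 2) * 1 := by gcongr
      _ ≤ η := by rw [mul_one]; exact ih

lemma gchoose_ge {μ : ℝ} {t : ℕ} (h : 2 * (t:ℝ) ≤ μ) : (μ/2) ^ t / t.factorial ≤ gchoose μ t := by
  unfold gchoose
  gcongr
  rw [← Finset.card_range t, ← Finset.prod_const, Finset.card_range]
  refine Finset.prod_le_prod (fun i _ => ?_) fun i hi => ?_
  · have : (0:ℝ) ≤ t := by positivity
    linarith
  · rw [Finset.mem_range] at hi
    have : (i:ℝ) ≤ t := by exact_mod_cast hi.le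
    linarith

lemma exp_two_le : Real.exp 2 ≤ 8 := by
  have h := Real.exp_one_lt_d9
  have : Real.exp 2 = Real.exp 1 ^ 2 := by rw [← Real.exp_nat_mul]; norm_num
  rw [this]
  nlinarith [Real.exp_pos 1]

lemma phi_ge_third {n k : ℕ} (hn : 2 ≤ n) {p : ℝ} (h0 : 0 ≤ p) (h : 1/2 ≤ n * (phi n k p ^ 3 / 6)) :
    Real.exp (-(Real.log n / 3)) ≤ phi n k p := by
  have hφ := phi_nonneg (n := n) (k := k) h0
  by_contra! hcon
  have h2 : phi n k p ^ 3 < Real.exp (-(Real.log n / 3)) ^ 3 := by gcongr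
  rw [← Real.exp_nat_mul] at h2
  have h3 : Real.exp ((3:ℕ) * (-(Real.log n / 3))) * n = 1 := by
    conv_lhs => rw [n_eq_exp hn]
    rw [Real.log_exp, ← Real.exp_add]
    rw [show (((3:ℕ):ℝ) * (-(Real.log n / 3)) + Real.log n) = 0 by push_cast; ring, Real.exp_zero]
  have hn0 : (0:ℝ) < n := by exact_mod_cast (by omega : 0 < n)
  nlinarith

set_option maxHeartbeats 1000000 in
lemma regA {δ : ℝ} (hδ : 0 < δ) (hδ1 : δ ≤ 1/10) {θ : ℝ} (hθ : 0 < θ) : ∃ η > 0, ∀ᶠ n : ℕ in atTop,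
    ∀ (k : ℕ) (p e : ℝ), 2 * k < n → 0 ≤ p → p ≤ 1 → δ ≤ gam n k → e ≤ η →
    hprob n k p (fun H => e < Lam n k p (maxDegree H)) ≤ η → hprob n k p (fun H => ¬ EKR H) ≤ θ := by
  obtain ⟨T, hT1, hA1⟩ := A1 hδ
  have hT0 : (0:ℝ) < T := by exact_mod_cast hT1
  have hs : ∀ s : ℕ, ∃ η > 0, ∀ᶠ n : ℕ in atTop, 3 ≤ s → ∀ (k : ℕ) (p : ℝ),
    2 ≤ k → 2 * k ≤ n → 0 ≤ p → p ≤ 1 → 0 < gam n k →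
    n * binomProbGe ((n-1).choose (k-1)) p (s+1) < Real.log n →
    mubar n k p ^ s * interProb n k ^ (s.choose 2) ≤ η →
    hprob n k p (fun H => ∃ C ⊆ H, IsClique C ∧ IsNontrivial C ∧ C.card = s) ≤ θ / (4 * T) := by
    intro s
    by_cases h3 : 3 ≤ s
    · obtain ⟨η, hη, h⟩ := A2 s h3 (θ := θ / (4 * T)) (by positivity)
      exact ⟨η, hη, h.mono fun n hn _ => hn⟩
    · exact ⟨1, one_pos, Eventually.of_forall fun n h => absurd h h3⟩
  choose ηs hηs hA2 using hs
  have hmin : ∃ η₀ > 0, ∀ s < T, η₀ ≤ ηs s := by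
    obtain ⟨s₀, _, h⟩ := Finset.exists_min_image (Finset.range T) ηs (Finset.nonempty_range_iff.2 (by omega))
    exact ⟨ηs s₀, hηs s₀, fun s hs => h s (by simpa using hs)⟩
  obtain ⟨η₀, hη₀, hη₀'⟩ := hmin
  set ηT := min η₀ 1 / (2 ^ T * T.factorial) with hηT
  have hηT0 : 0 < ηT := by positivity
  refine ⟨min (min (1/100) (θ/8)) ηT, by positivity, ?_⟩
  -- eventual facts
  have hall : ∀ᶠ n : ℕ in atTop, ∀ s < T, 3 ≤ s → ∀ (k : ℕ) (p : ℝ),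
    2 ≤ k → 2 * k ≤ n → 0 ≤ p → p ≤ 1 → 0 < gam n k →
    n * binomProbGe ((n-1).choose (k-1)) p (s+1) < Real.log n →
    mubar n k p ^ s * interProb n k ^ (s.choose 2) ≤ ηs s →
    hprob n k p (fun H => ∃ C ⊆ H, IsClique C ∧ IsNontrivial C ∧ C.card = s) ≤ θ / (4 * T) := by
    have := (eventually_all_finset (Finset.range T) (l := (atTop : Filter ℕ))).2 fun s _ => hA2 s
    filter_upwards [this] with n hn s hs
    exact hn s (by simpa using hs)
  obtain ⟨ω, hω0, hω⟩ : ∃ ω > 0, Real.exp ω - 1 ≤ θ / 16 := by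
    refine ⟨Real.log (1 + θ/16), Real.log_pos (by linarith), ?_⟩
    rw [Real.exp_log (by positivity)]; linarith
  filter_upwards [hA1 (θ/8) (by positivity), hall, large_gen (θ := θ/2) (by positivity),
    eventually_ge_atTop 10,
    ev_log (ev_exp_small (a := δ) hδ (show (0:ℝ) < 1/4 by norm_num)),
    ev_log (ev_exp_large (a := δ/2) (by positivity) (4 * T)),
    ev_log (ev_lin_exp (a := δ/2) (by positivity) 320),
    ev_log (ev_exp_large (a := 9/10) (by positivity) 20),
    ev_log (ev_exp_large (a := 1/6) (by positivity) (2 * T)),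
    ev_log (ev_exp_small (a := 1/9) (by positivity) (show 0 < ω/324 by positivity)),
    ev_log (eventually_ge_atTop (16/θ))] with
    n hA1 hall hlg hn hδx hTx hlin h20 h2T hωx hθx k p e hkn h0 h1 hγ he hL
  have hlog := log_pos_of_two (show 2 ≤ n by omega)
  set x := Real.log n with hx
  have hne : (n:ℝ) = Real.exp x := n_eq_exp (by omega)
  have hn0 : (0:ℝ) < n := by rw [hne]; positivity
  obtain ⟨hk2, hp, t₂, ht3, hΛ, -, hΔ, -, h3⟩ := t2_facts hn hkn h0 h1 (by positivity)
    ((min_le_left _ _).trans (min_le_left _ _)) he hL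
  have hk1 : 1 ≤ k := by omega
  have hφ3 := phi_ge_third (by omega) h0 h3
  have hφ0 : 0 < phi n k p := (Real.exp_pos _).trans_le hφ3
  have hq0 := interProb_nonneg n k
  have hq1 := interProb_le_one (n := n) (k := k) (by omega)
  have hqs : interProb n k ≤ 1/2 := by
    refine (q_le hkn).trans ?_
    rw [k2n_eq_exp (by omega) hk1]
    have : Real.exp (-(gam n k * x)) ≤ Real.exp (-(δ * x)) := by
      rw [Real.exp_le_exp]; nlinarith
    linarith
  rcases le_or_gt (phi n k p) (Real.exp (δ / 2 * x)) with hmid | hlarge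
  · -- middle range
    have hM := choose_ge_self hk2 hkn.le
    have hM' : (n:ℝ) - 1 ≤ ((n-1).choose (k-1) : ℝ) := by
      have : (n:ℝ) ≤ ((n-1).choose (k-1) : ℝ) + 1 := by exact_mod_cast hM
      linarith
    have he2 := exp_two_le
    have hE : Real.exp 2 * phi n k p ≤ 8 * Real.exp (δ/2*x) := by
      have := Real.exp_pos 2
      nlinarith
    have hexp1 : Real.exp (δ/2 * x) * 20 ≤ n := by
      rw [hne]
      calc Real.exp (δ/2 * x) * 20 ≤ Real.exp (1/10 * x) * Real.exp (9/10*x) := by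
            exact mul_le_mul (Real.exp_le_exp.2 (by nlinarith)) h20 (by norm_num) (Real.exp_pos _).le
        _ = Real.exp x := by rw [← Real.exp_add]; congr 1; ring
    have hexp0 : 1 ≤ Real.exp (δ/2*x) := Real.one_le_exp (by positivity)
    obtain ⟨t₁, hb1, ht1le, hΔ1⟩ := t1_choice (n := n) (k := k) (by omega) hk1 (by omega) hp h1
      (by linarith)
    have herr : (phi n k p + 2 * (Real.exp 2 * phi n k p + Real.log n)) ^ 2 * k / (n * phi n k p) ≤ ω := by
      have a1 : phi n k p + 2 * (Real.exp 2 * phi n k p + Real.log n) ≤ 18 * Real.exp (δ/2*x) := by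
        linarith
      have a2 : (k:ℝ) / n ≤ Real.exp (-((1+δ)/2 * x)) := by
        rw [kn_eq_exp (by omega) hk1, Real.exp_le_exp]; nlinarith
      have a3 : (phi n k p)⁻¹ ≤ Real.exp (x/3) := by
        rw [← neg_neg (x/3), Real.exp_neg (-(x/3))]
        gcongr
      calc (phi n k p + 2 * (Real.exp 2 * phi n k p + Real.log n)) ^ 2 * k / (n * phi n k p)
          = (phi n k p + 2 * (Real.exp 2 * phi n k p + Real.log n)) ^ 2 * (k / n) * (phi n k p)⁻¹ := by
            field_simp
        _ ≤ (18 * Real.exp (δ/2*x)) ^ 2 * Real.exp (-((1+δ)/2 * x)) * Real.exp (x/3) := by gcongr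
        _ = 324 * Real.exp ((δ/2 - 1/6) * x) := by
            rw [mul_pow, ← Real.exp_nat_mul, mul_assoc, mul_assoc, ← Real.exp_add, ← Real.exp_add]
            norm_num
            ring
        _ ≤ 324 * Real.exp (-(1/9*x)) := by
            gcongr
            nlinarith
        _ ≤ ω := by linarith
    have hΔ1' : hprob n k p (fun H => maxDegree H < t₁) ≤ θ / 8 := by
      refine hΔ1.trans ?_
      have b1 : 1 / x ≤ θ / 16 := by
        rw [div_le_iff₀ hlog]
        rw [div_le_iff₀ hθ] at hθx
        linarith
      have b2 := Real.exp_le_exp.2 herr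
      linarith
    set t := max t₁ t₂ with ht
    have hsum : hprob n k p (fun H => ¬ EKR H) ≤ hprob n k p (fun H => maxDegree H < t₁) +
        hprob n k p (fun H => maxDegree H < t₂) + hprob n k p (fun H => ∃ C ⊆ H, IsClique C ∧ IsNontrivial C ∧ T ≤ C.card)
        + hprob n k p (fun H => ∃ s ∈ (Finset.range T).filter (fun s => t ≤ s), ∃ C ⊆ H, IsClique C ∧ IsNontrivial C ∧ C.card = s) := by
      refine le_trans (hprob_mono h0 h1 (Q := fun H => ((maxDegree H < t₁ ∨ maxDegree H < t₂) ∨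
        (∃ C ⊆ H, IsClique C ∧ IsNontrivial C ∧ T ≤ C.card)) ∨
        ∃ s ∈ (Finset.range T).filter (fun s => t ≤ s), ∃ C ⊆ H, IsClique C ∧ IsNontrivial C ∧ C.card = s) ?_) ?_
      · intro H _ hE
        by_cases ha : maxDegree H < t₁
        · exact Or.inl (Or.inl (Or.inl ha))
        by_cases hb : maxDegree H < t₂
        · exact Or.inl (Or.inl (Or.inr hb))
        obtain ⟨C, hC, hcl, htC, hx⟩ := bad_of_not_ekr hE (t := t) (by omega)
        have hnt := mdeg_pos_of fun x => (hx x).1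
        by_cases hc : T ≤ C.card
        · exact Or.inl (Or.inr ⟨C, hC, hcl, hnt, hc⟩)
        · exact Or.inr ⟨C.card, by simp; omega, C, hC, hcl, hnt, rfl⟩
      · refine (hprob_or h0 h1 _ _).trans ?_
        gcongr
        refine (hprob_or h0 h1 _ _).trans ?_
        gcongr
        exact hprob_or h0 h1 _ _
    have hμ : 2 * (T:ℝ) ≤ mubar n k p := by
      rw [mubar_eq (by omega) hk1]
      calc 2 * (T:ℝ) ≤ Real.exp (1/6 * x) := h2T
        _ ≤ Real.exp (-(x/3)) * Real.exp ((1 + gam n k)/2 * x) := by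
          rw [← Real.exp_add, Real.exp_le_exp]; nlinarith
        _ ≤ _ := by gcongr
    have hterm : ∀ s ∈ (Finset.range T).filter (fun s => t ≤ s),
        hprob n k p (fun H => ∃ C ⊆ H, IsClique C ∧ IsNontrivial C ∧ C.card = s) ≤ θ / (4 * T) := by
      intro s hs
      rw [Finset.mem_filter, Finset.mem_range] at hs
      refine hall s hs.1 (by omega) k p hk2 hkn.le h0 h1 (by linarith) ?_ ?_
      · refine lt_of_le_of_lt ?_ hb1
        gcongr
        exact binom_anti h0 h1 (by omega)
      · have htT : t₂ ≤ T := by omega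
        have htT' : (t₂:ℝ) ≤ T := by exact_mod_cast htT
        have g1 := gchoose_ge (μ := mubar n k p) (t := t₂) (by linarith)
        have g2 : mubar n k p ^ t₂ * interProb n k ^ t₂.choose 2 ≤ min η₀ 1 := by
          have g3 : (mubar n k p / 2) ^ t₂ / t₂.factorial * interProb n k ^ t₂.choose 2 ≤ ηT := by
            refine le_trans ?_ (hΛ.trans (min_le_right _ _))
            unfold Lam; gcongr
          have g4 : mubar n k p ^ t₂ * interProb n k ^ t₂.choose 2 =
            (2 ^ t₂ * t₂.factorial) * ((mubar n k p / 2) ^ t₂ / t₂.factorial * interProb n k ^ t₂.choose 2) := by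
            rw [div_pow]; field_simp
          rw [g4]
          have g5 : (2:ℝ) ^ t₂ * t₂.factorial ≤ 2 ^ T * T.factorial := by
            have : (t₂.factorial : ℝ) ≤ T.factorial := by exact_mod_cast Nat.factorial_le htT
            gcongr
            norm_num
          calc _ ≤ (2 ^ t₂ * t₂.factorial) * ηT := by gcongr
            _ ≤ (2 ^ T * T.factorial) * ηT := by gcongr
            _ = _ := by rw [hηT]; field_simp
        have g6 := pow_ladder (mubar_nonneg h0) hq0 hq1 (min_le_right _ _) (by omega) g2 s (by omega)
        exact g6.trans ((min_le_left _ _).trans (hη₀' s hs.1))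
    have hlast : hprob n k p (fun H => ∃ s ∈ (Finset.range T).filter (fun s => t ≤ s), ∃ C ⊆ H, IsClique C ∧ IsNontrivial C ∧ C.card = s) ≤ θ / 4 := by
      refine (sprob_exists h0 h1 _ _).trans ?_
      refine (Finset.sum_le_sum hterm).trans ?_
      rw [Finset.sum_const, nsmul_eq_mul]
      have : (((Finset.range T).filter (fun s => t ≤ s)).card : ℝ) ≤ T := by
        have := Finset.card_le_card (Finset.filter_subset (fun s => t ≤ s) (Finset.range T))
        rw [Finset.card_range] at this
        exact_mod_cast this
      calc _ ≤ (T:ℝ) * (θ / (4 * T)) := by gcongr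
        _ = θ/4 := by field_simp
    have hA := hA1 k p hk1 (by omega) h0 h1 hγ hmid
    have hη8 : hprob n k p (fun H => maxDegree H < t₂) ≤ θ/8 :=
      hΔ.trans ((min_le_left _ _).trans (min_le_right _ _))
    linarith
  · -- large range
    have hn1 : (10:ℝ) ≤ n := by exact_mod_cast hn
    obtain ⟨p', hp0, hp1', hφ', hfin⟩ := hlg k p (Real.exp (δ/2*x)) hk1 hkn.le h0 h1 (Real.exp_pos _) hlarge.le
      (by nlinarith) (by nlinarith [Real.exp_pos (δ/2*x)])
    have hA := hA1 k p' hk1 (by omega) hp0 hp1' hγ hφ'.le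
    have hB : hprob n k p' (Bad 4 ⌈Real.exp (δ/2*x) / 4⌉₊) ≤ hprob n k p' (fun H => ∃ C ⊆ H, IsClique C ∧ IsNontrivial C ∧ T ≤ C.card) := by
      refine hprob_mono hp0 hp1' ?_
      rintro H _ ⟨C, hC, hcl, htC, hx⟩
      refine ⟨C, hC, hcl, mdeg_pos_of fun x => (hx x).1, le_trans ?_ htC⟩
      have : (T:ℝ) ≤ (⌈Real.exp (δ/2*x) / 4⌉₊ : ℝ) := le_trans (by linarith) (Nat.le_ceil _)
      exact_mod_cast this
    linarith

end
end EKRP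

namespace EKRP
noncomputable section

/-- Good families: cliques with small pairwise intersections and small codegrees. -/
def Good {n : ℕ} (l K : ℕ) (C : Finset (Finset (Fin n))) : Prop :=
  IsClique C ∧ (∀ A ∈ C, ∀ B ∈ C, A ≠ B → (A ∩ B).card ≤ l) ∧
    ∀ x y : Fin n, x ≠ y → (C.filter fun A => x ∈ A ∧ y ∈ A).card ≤ K

lemma Good.mono {n l K : ℕ} {C D : Finset (Finset (Fin n))} (h : Good l K C) (hD : D ⊆ C) :
    Good l K D := by
  refine ⟨fun A hA B hB => h.1 A (hD hA) B (hD hB),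
    fun A hA B hB hne => h.2.1 A (hD hA) B (hD hB) hne, fun x y hxy => ?_⟩
  exact (Finset.card_le_card (Finset.filter_subset_filter _ hD)).trans (h.2.2 x y hxy)

lemma vdeg_mono {n : ℕ} {C D : Finset (Finset (Fin n))} (h : C ⊆ D) (x : Fin n) :
    vdeg C x ≤ vdeg D x :=
  Finset.card_le_card (Finset.filter_subset_filter _ h)

lemma sum_offDiag {n : ℕ} (C : Finset (Finset (Fin n))) :
    ∑ v, (starOf C v).offDiag.card = ∑ P ∈ C.offDiag, (P.1 ∩ P.2).card := by
  have h1 : ∀ v : Fin n, (starOf C v).offDiag.card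
      = ∑ P ∈ C.offDiag, if v ∈ P.1 ∩ P.2 then 1 else 0 := by
    intro v
    rw [← Finset.card_filter]
    congr 1
    ext P
    simp only [starOf, Finset.mem_offDiag, Finset.mem_filter, Finset.mem_inter]
    tauto
  rw [Finset.sum_congr rfl fun v _ => h1 v, Finset.sum_comm]
  refine Finset.sum_congr rfl fun P _ => ?_
  rw [← Finset.card_filter]
  congr 1
  ext v; simp

lemma W_exists {n l : ℕ} (C : Finset (Finset (Fin n))) (hne : ∀ B ∈ C, B.Nonempty)
    (hl : ∀ A ∈ C, ∀ B ∈ C, A ≠ B → (A ∩ B).card ≤ l) :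
    ∃ W : Finset (Fin n), (∀ v, 2 ≤ vdeg C v → v ∈ W) ∧ (∀ B ∈ C, (B ∩ W).Nonempty) ∧
      (∀ v ∈ W, 1 ≤ vdeg C v) ∧ ∑ v ∈ W, vdeg C v ≤ (l + 1) * C.card ^ 2 := by
  classical
  let pick : {B // B ∈ C} → Fin n := fun B => (hne B.1 B.2).choose
  have hpick : ∀ B : {B // B ∈ C}, pick B ∈ B.1 := fun B => (hne B.1 B.2).choose_spec
  set P : Finset (Fin n) := Finset.univ.image pick with hP
  set D : Finset (Fin n) := Finset.univ.filter fun v => 2 ≤ vdeg C v with hD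
  have hPc : P.card ≤ C.card := by
    refine Finset.card_image_le.trans ?_
    simp
  have hdeg1 : ∀ v ∈ P, 1 ≤ vdeg C v := by
    intro v hv
    obtain ⟨B, -, rfl⟩ := Finset.mem_image.1 hv
    refine Finset.card_pos.2 ⟨B.1, ?_⟩
    simp only [starOf, Finset.mem_filter]
    exact ⟨B.2, hpick B⟩
  refine ⟨D ∪ P, fun v hv => ?_, fun B hB => ?_, fun v hv => ?_, ?_⟩
  · exact Finset.mem_union_left _ (by simp [hD, hv])
  · refine ⟨pick ⟨B, hB⟩, Finset.mem_inter.2 ⟨hpick ⟨B, hB⟩, Finset.mem_union_right _ ?_⟩⟩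
    exact Finset.mem_image_of_mem _ (Finset.mem_univ _)
  · rcases Finset.mem_union.1 hv with h | h
    · simp only [hD, Finset.mem_filter] at h; omega
    · exact hdeg1 v h
  · have hpt : ∀ v ∈ D ∪ P, vdeg C v ≤ (starOf C v).offDiag.card + if v ∈ P then 1 else 0 := by
      intro v hv
      rw [Finset.offDiag_card]
      change vdeg C v ≤ vdeg C v * vdeg C v - vdeg C v + _
      by_cases h2 : 2 ≤ vdeg C v
      · have : 2 * vdeg C v ≤ vdeg C v * vdeg C v := Nat.mul_le_mul_right _ h2
        omega
      · have hvP : v ∈ P := by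
          rcases Finset.mem_union.1 hv with h | h
          · simp only [hD, Finset.mem_filter] at h; omega
          · exact h
        rw [if_pos hvP]; omega
    calc ∑ v ∈ D ∪ P, vdeg C v
        ≤ ∑ v ∈ D ∪ P, ((starOf C v).offDiag.card + if v ∈ P then 1 else 0) := Finset.sum_le_sum hpt
      _ ≤ ∑ v, ((starOf C v).offDiag.card + if v ∈ P then 1 else 0) :=
          Finset.sum_le_sum_of_subset (Finset.subset_univ _)
      _ = ∑ Q ∈ C.offDiag, (Q.1 ∩ Q.2).card + P.card := by
          rw [Finset.sum_add_distrib, sum_offDiag]; simp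
      _ ≤ ∑ Q ∈ C.offDiag, l + C.card := by
          gcongr with Q hQ
          rw [Finset.mem_offDiag] at hQ
          exact hl _ hQ.1 _ hQ.2.1 hQ.2.2
      _ ≤ (l + 1) * C.card ^ 2 := by
          rw [Finset.sum_const, Finset.offDiag_card, smul_eq_mul]
          have : C.card ≤ C.card ^ 2 := Nat.le_self_pow (by norm_num) _
          have h2 : C.card * C.card - C.card ≤ C.card ^ 2 := by rw [sq]; omega
          have h3 := Nat.mul_le_mul_right l h2
          calc _ ≤ C.card ^ 2 * l + C.card ^ 2 := Nat.add_le_add h3 this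
            _ = _ := by ring

/-- few vertices of high degree -/
lemma heavy {n K h : ℕ} (C : Finset (Finset (Fin n)))
    (hK : ∀ x y : Fin n, x ≠ y → (C.filter fun A => x ∈ A ∧ y ∈ A).card ≤ K)
    (M : Finset (Fin n)) (hM : ∀ v ∈ M, h < vdeg C v) :
    M.card * (h + 1) ≤ C.card + M.card ^ 2 * K := by
  classical
  have h1 : ∑ v ∈ M, vdeg C v = ∑ A ∈ C, (M.filter fun v => v ∈ A).card := by
    unfold vdeg starOf
    simp only [Finset.card_filter]
    rw [Finset.sum_comm]
  have h2 : ∑ A ∈ C, (M.filter fun v => v ∈ A).offDiag.card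
      = ∑ Q ∈ M.offDiag, (C.filter fun A => Q.1 ∈ A ∧ Q.2 ∈ A).card := by
    have : ∀ A ∈ C, (M.filter fun v => v ∈ A).offDiag.card
        = ∑ Q ∈ M.offDiag, if Q.1 ∈ A ∧ Q.2 ∈ A then 1 else 0 := by
      intro A _
      rw [← Finset.card_filter]
      congr 1
      ext P
      simp only [Finset.mem_offDiag, Finset.mem_filter]
      tauto
    rw [Finset.sum_congr rfl this, Finset.sum_comm]
    refine Finset.sum_congr rfl fun Q _ => ?_
    rw [← Finset.card_filter]
  calc M.card * (h + 1) ≤ ∑ v ∈ M, vdeg C v := by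
        rw [← smul_eq_mul, ← Finset.sum_const]
        exact Finset.sum_le_sum fun v hv => hM v hv
    _ = ∑ A ∈ C, (M.filter fun v => v ∈ A).card := h1
    _ ≤ ∑ A ∈ C, (1 + (M.filter fun v => v ∈ A).offDiag.card) := by
        refine Finset.sum_le_sum fun A _ => ?_
        rw [Finset.offDiag_card]
        set z := (M.filter fun v => v ∈ A).card
        rcases Nat.lt_or_ge z 2 with hz | hz
        · omega
        · have := Nat.mul_le_mul_right z hz
          omega
    _ = C.card + ∑ Q ∈ M.offDiag, (C.filter fun A => Q.1 ∈ A ∧ Q.2 ∈ A).card := by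
        rw [Finset.sum_add_distrib, h2]; simp
    _ ≤ C.card + ∑ Q ∈ M.offDiag, K := by
        gcongr with Q hQ
        rw [Finset.mem_offDiag] at hQ
        exact hK _ _ hQ.2.2
    _ ≤ C.card + M.card ^ 2 * K := by
        rw [Finset.sum_const, Finset.offDiag_card, smul_eq_mul, sq]
        gcongr
        omega

lemma inv_pow_sub_one_le {q : ℝ} (hq : 0 < q) (hq1 : q ≤ 1) (d : ℕ) :
    q⁻¹ ^ d - 1 ≤ d * (1 - q) * q⁻¹ ^ d := by
  have hB : 1 - (d:ℝ) * (1 - q) ≤ q ^ d := by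
    have := one_add_mul_le_pow (a := q - 1) (by linarith) d
    have h2 : (1 + (q - 1)) = q := by ring
    rw [h2] at this; linarith
  have hp : 0 < q ^ d := by positivity
  rw [inv_pow]
  have : (q ^ d)⁻¹ * q ^ d = 1 := inv_mul_cancel₀ hp.ne'
  have h3 : 0 < (q ^ d)⁻¹ := by positivity
  nlinarith

/-- extension count -/
lemma ext_count {n k l s d h m : ℕ} (hk : 1 ≤ k) (hkn : 2 * k ≤ n) (hq : 0 < interProb n k)
    (C : Finset (Finset (Fin n))) (hC : C ⊆ kSets n k) (hs : C.card = s)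
    (hl : ∀ A ∈ C, ∀ B ∈ C, A ≠ B → (A ∩ B).card ≤ l)
    (X : Finset (Fin n)) (hX : X.card ≤ 1) (hd : ∀ v ∉ X, vdeg C v ≤ d)
    (hm : (Finset.univ.filter fun v => v ∉ X ∧ h < vdeg C v).card ≤ m)
    (hw : k * ((l + 1) * s ^ 2 + 2) ≤ n) :
    (((kSets n k).filter fun A => Disjoint A X ∧ ∀ B ∈ C, (A ∩ B).Nonempty).card : ℝ) ≤
      (n.choose k : ℝ) * interProb n k ^ s *
        ((1 + (k:ℝ) / n * (interProb n k)⁻¹ ^ d) ^ m *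
          Real.exp ((k:ℝ) / n * (1 - interProb n k) * (interProb n k)⁻¹ ^ h * ((l + 1) * s ^ 2))) := by
  classical
  have hcard : ∀ B ∈ C, B.card = k := fun B hB => mem_kSets.1 (hC hB)
  obtain ⟨W, hW2, hWm, hW1, hWs⟩ := W_exists C
    (fun B hB => Finset.card_pos.1 (by rw [hcard B hB]; omega)) hl
  rw [hs] at hWs
  have hWc : W.card ≤ (l + 1) * s ^ 2 := by
    refine le_trans ?_ hWs
    rw [Finset.card_eq_sum_ones]
    exact Finset.sum_le_sum fun v hv => hW1 v hv
  set q := interProb n k with hqd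
  have hq1 : q ≤ 1 := interProb_le_one (by omega)
  have hqi : 1 ≤ q⁻¹ := (one_le_inv₀ hq).2 hq1
  have hkn0 : (0:ℝ) ≤ (k:ℝ) / n := by positivity
  have key := hit_count hk hkn hq C hcard (W ∪ X) X Finset.subset_union_right
    (fun v hv => Finset.mem_union_left _ (hW2 v hv))
    (fun B hB => (hWm B hB).mono (Finset.inter_subset_inter_left Finset.subset_union_left))
    (by
      have : (W ∪ X).card ≤ (l + 1) * s ^ 2 + 1 := (Finset.card_union_le _ _).trans (by omega)
      calc k * (W ∪ X).card + k ≤ k * ((l + 1) * s ^ 2 + 1) + k := by gcongr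
        _ = k * ((l + 1) * s ^ 2 + 2) := by ring
        _ ≤ n := hw)
  rw [← hqd, hs] at key
  refine key.trans ?_
  have hU : (W ∪ X) \ X = W \ X := by
    ext v; simp only [Finset.mem_sdiff, Finset.mem_union]; tauto
  rw [hU]
  refine mul_le_mul_of_nonneg_left ?_ (by positivity)
  set f : Fin n → ℝ := fun v => 1 + (k : ℝ) / n * (q⁻¹ ^ vdeg C v - 1) with hf
  have hf1 : ∀ v, 1 ≤ f v := fun v => by
    have : 1 ≤ q⁻¹ ^ vdeg C v := one_le_pow₀ hqi
    have : 0 ≤ (k : ℝ) / n * (q⁻¹ ^ vdeg C v - 1) := mul_nonneg hkn0 (by linarith)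
    simp only [hf]; linarith
  rw [← Finset.prod_filter_mul_prod_filter_not (W \ X) (fun v => h < vdeg C v)]
  refine mul_le_mul ?_ ?_ (Finset.prod_nonneg fun v _ => by linarith [hf1 v]) (by positivity)
  · have hsub : ((W \ X).filter fun v => h < vdeg C v).card ≤ m := by
      refine le_trans (Finset.card_le_card ?_) hm
      intro v hv
      simp only [Finset.mem_filter, Finset.mem_sdiff, Finset.mem_univ, true_and] at hv ⊢
      exact ⟨hv.1.2, hv.2⟩
    have hb : (1:ℝ) ≤ 1 + (k:ℝ) / n * q⁻¹ ^ d := by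
      have : 0 ≤ (k:ℝ) / n * q⁻¹ ^ d := by positivity
      linarith
    calc ∏ v ∈ (W \ X).filter (fun v => h < vdeg C v), f v
        ≤ ∏ v ∈ (W \ X).filter (fun v => h < vdeg C v), (1 + (k:ℝ) / n * q⁻¹ ^ d) := by
          refine Finset.prod_le_prod (fun v _ => by linarith [hf1 v]) fun v hv => ?_
          simp only [Finset.mem_filter, Finset.mem_sdiff] at hv
          have h1 : q⁻¹ ^ vdeg C v ≤ q⁻¹ ^ d := pow_le_pow_right₀ hqi (hd v hv.1.2)
          have := mul_le_mul_of_nonneg_left (show q⁻¹ ^ vdeg C v - 1 ≤ q⁻¹ ^ d by linarith) hkn0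
          simp only [hf]; linarith
      _ = (1 + (k:ℝ) / n * q⁻¹ ^ d) ^ ((W \ X).filter (fun v => h < vdeg C v)).card := by
          rw [Finset.prod_const]
      _ ≤ _ := pow_le_pow_right₀ hb hsub
  · calc ∏ v ∈ (W \ X).filter (fun v => ¬ h < vdeg C v), f v
        ≤ ∏ v ∈ (W \ X).filter (fun v => ¬ h < vdeg C v),
            Real.exp ((k:ℝ) / n * (1 - q) * q⁻¹ ^ h * vdeg C v) := by
          refine Finset.prod_le_prod (fun v _ => by linarith [hf1 v]) fun v hv => ?_
          simp only [Finset.mem_filter, Finset.mem_sdiff, not_lt] at hv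
          have h1 : q⁻¹ ^ vdeg C v ≤ q⁻¹ ^ h := pow_le_pow_right₀ hqi hv.2
          have h2 := inv_pow_sub_one_le hq hq1 (vdeg C v)
          have h3 : (vdeg C v : ℝ) * (1 - q) * q⁻¹ ^ vdeg C v ≤ vdeg C v * (1 - q) * q⁻¹ ^ h :=
            mul_le_mul_of_nonneg_left h1 (mul_nonneg (by positivity) (by linarith))
          have h4 := mul_le_mul_of_nonneg_left (h2.trans h3) hkn0
          have h5 := Real.add_one_le_exp ((k:ℝ) / n * (1 - q) * q⁻¹ ^ h * vdeg C v)
          simp only [hf]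
          nlinarith
      _ = Real.exp (∑ v ∈ (W \ X).filter (fun v => ¬ h < vdeg C v),
            (k:ℝ) / n * (1 - q) * q⁻¹ ^ h * vdeg C v) := (Real.exp_sum _ _).symm
      _ ≤ _ := by
          apply Real.exp_le_exp.2
          rw [← Finset.mul_sum]
          refine mul_le_mul_of_nonneg_left ?_
            (mul_nonneg (mul_nonneg hkn0 (by linarith)) (by positivity))
          have : ∑ v ∈ (W \ X).filter (fun v => ¬ h < vdeg C v), vdeg C v ≤ (l + 1) * s ^ 2 := by
            refine le_trans (Finset.sum_le_sum_of_subset ?_) hWs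
            exact (Finset.filter_subset _ _).trans Finset.sdiff_subset
          exact_mod_cast this

end
end EKRP

namespace EKRP
noncomputable section

section gen
variable {β : Type*} [DecidableEq β]

open Classical in
lemma R_count {E₁ S : Finset β} {𝒟 : Finset β → Prop}
    (hher : ∀ C D, D ⊆ C → 𝒟 C → 𝒟 D) (X : ℕ → ℝ) (hX : ∀ i, 0 ≤ X i) (r : ℕ)
    (hext : ∀ R ⊆ E₁, R.card < r → 𝒟 (S ∪ R) →
      ((E₁.filter fun A => A ∉ R ∧ 𝒟 (S ∪ insert A R)).card : ℝ) ≤ X R.card) :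
    (((Finset.powersetCard r E₁).filter fun R => 𝒟 (S ∪ R)).card : ℝ) ≤
      (∏ i ∈ Finset.range r, X i) / r.factorial := by
  have := hered_count E₁ (fun R => 𝒟 (S ∪ R))
    (fun C A _ h => hher _ _ (Finset.union_subset_union_right (Finset.erase_subset _ _)) h) X hX r
    (fun C h1 h2 h3 => by convert hext C h1 h2 h3)
  convert this

lemma R_prob {E₁ S : Finset β} {p : ℝ} (h0 : 0 ≤ p) (h1 : p ≤ 1) {𝒟 : Finset β → Prop}
    (hher : ∀ C D, D ⊆ C → 𝒟 C → 𝒟 D) (X : ℕ → ℝ) (hX : ∀ i, 0 ≤ X i) (r : ℕ)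
    (hext : ∀ R ⊆ E₁, R.card < r → 𝒟 (S ∪ R) → ∀ F : Finset β,
      (∀ A ∈ F, A ∈ E₁ ∧ A ∉ R ∧ 𝒟 (S ∪ insert A R)) → (F.card : ℝ) ≤ X R.card) :
    sprob E₁ p (fun G => ∃ R ⊆ G, R.card = r ∧ 𝒟 (S ∪ R)) ≤
      p ^ r * ((∏ i ∈ Finset.range r, X i) / r.factorial) := by
  classical
  have hc := R_count (E₁ := E₁) (S := S) (𝒟 := 𝒟) hher X hX r (fun R a b c => hext R a b c _ (by
    intro A hA; simpa only [Finset.mem_filter] using hA))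
  calc sprob E₁ p (fun G => ∃ R ⊆ G, R.card = r ∧ 𝒟 (S ∪ R))
      ≤ sprob E₁ p (fun G => ∃ R ∈ (Finset.powersetCard r E₁).filter fun R => 𝒟 (S ∪ R), R ⊆ G) := by
        refine sprob_mono h0 h1 fun G hG => ?_
        rintro ⟨R, hR, hr, hD⟩
        exact ⟨R, Finset.mem_filter.2 ⟨Finset.mem_powersetCard.2 ⟨hR.trans hG, hr⟩, hD⟩, hR⟩
    _ ≤ ∑ R ∈ (Finset.powersetCard r E₁).filter fun R => 𝒟 (S ∪ R), p ^ R.card := by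
        refine first_moment h0 h1 _ fun R hR => ?_
        exact (Finset.mem_powersetCard.1 (Finset.mem_filter.1 hR).1).1
    _ = ∑ R ∈ (Finset.powersetCard r E₁).filter fun R => 𝒟 (S ∪ R), p ^ r := by
        refine Finset.sum_congr rfl fun R hR => ?_
        rw [(Finset.mem_powersetCard.1 (Finset.mem_filter.1 hR).1).2]
    _ = p ^ r * (((Finset.powersetCard r E₁).filter fun R => 𝒟 (S ∪ R)).card : ℝ) := by
        rw [Finset.sum_const, nsmul_eq_mul, mul_comm]
    _ ≤ _ := mul_le_mul_of_nonneg_left hc (by positivity)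

/-- splitting event -/
lemma split_prob {E E₀ : Finset β} (hE : E₀ ⊆ E) {p : ℝ} (h0 : 0 ≤ p) (h1 : p ≤ 1)
    (𝒮 : Finset β → Finset β → Prop) (𝒬 : Finset β → Finset β → Prop) {Q : ℝ} (hQ0 : 0 ≤ Q)
    (hQ : ∀ G₁ S, S ⊆ G₁ → G₁ ⊆ E₀ → 𝒮 G₁ S → sprob (E \ E₀) p (𝒬 S) ≤ Q)
    (w : Finset β → ℝ) (hw : ∀ G₁ ⊆ E₀, ∀ F : Finset (Finset β), (∀ S ∈ F, S ⊆ G₁ ∧ 𝒮 G₁ S) →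
      (F.card : ℝ) ≤ w G₁) :
    sprob E p (fun G => ∃ S ⊆ G ∩ E₀, 𝒮 (G ∩ E₀) S ∧ 𝒬 S (G \ E₀)) ≤ ex E₀ p w * Q := by
  classical
  rw [sprob_eq, ex_split hE, ← ex_mul_right]
  refine ex_mono h0 h1 fun G₁ hG₁ => ?_
  have e1 : ex (E \ E₀) p (fun G₂ => ind (∃ S ⊆ (G₁ ∪ G₂) ∩ E₀, 𝒮 ((G₁ ∪ G₂) ∩ E₀) S ∧ 𝒬 S ((G₁ ∪ G₂) \ E₀)))
      ≤ sprob (E \ E₀) p (fun G₂ => ∃ S ∈ G₁.powerset.filter (fun S => 𝒮 G₁ S), 𝒬 S G₂) := by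
    rw [sprob_eq]
    refine ex_mono h0 h1 fun G₂ hG₂ => ind_mono ?_
    have hd : ∀ A ∈ G₂, A ∉ E₀ := fun A hA => (Finset.mem_sdiff.1 (hG₂ hA)).2
    have a1 : (G₁ ∪ G₂) ∩ E₀ = G₁ := by
      ext A; simp only [Finset.mem_inter, Finset.mem_union]
      constructor
      · rintro ⟨h | h, h'⟩
        · exact h
        · exact absurd h' (hd A h)
      · intro h; exact ⟨Or.inl h, hG₁ h⟩
    have a2 : (G₁ ∪ G₂) \ E₀ = G₂ := by
      ext A; simp only [Finset.mem_sdiff, Finset.mem_union]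
      constructor
      · rintro ⟨h | h, h'⟩
        · exact absurd (hG₁ h) h'
        · exact h
      · intro h; exact ⟨Or.inr h, hd A h⟩
    rw [a1, a2]
    rintro ⟨S, hS, hS1, hS2⟩
    exact ⟨S, Finset.mem_filter.2 ⟨Finset.mem_powerset.2 hS, hS1⟩, hS2⟩
  refine e1.trans ((sprob_exists h0 h1 _ _).trans ?_)
  calc ∑ S ∈ G₁.powerset.filter (fun S => 𝒮 G₁ S), sprob (E \ E₀) p (𝒬 S)
      ≤ ∑ S ∈ G₁.powerset.filter (fun S => 𝒮 G₁ S), Q := by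
        refine Finset.sum_le_sum fun S hS => ?_
        rw [Finset.mem_filter, Finset.mem_powerset] at hS
        exact hQ G₁ S hS.1 hG₁ hS.2
    _ = ((G₁.powerset.filter (fun S => 𝒮 G₁ S)).card : ℝ) * Q := by
        rw [Finset.sum_const, nsmul_eq_mul]
    _ ≤ w G₁ * Q := by
        refine mul_le_mul_of_nonneg_right (hw G₁ hG₁ _ fun S hS => ?_) hQ0
        rw [Finset.mem_filter, Finset.mem_powerset] at hS
        exact hS

lemma ex_choose (E : Finset β) {p : ℝ} (h0 : 0 ≤ p) (h1 : p ≤ 1) (d : ℕ) :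
    ex E p (fun G => (G.card.choose d : ℝ)) ≤ (p * E.card) ^ d / d.factorial := by
  classical
  have e1 : ∀ G ⊆ E, (G.card.choose d : ℝ) = ∑ S ∈ Finset.powersetCard d E, ind (S ⊆ G) := by
    intro G hG
    rw [← Finset.card_powersetCard]
    have e2 : ∑ S ∈ Finset.powersetCard d E, ind (S ⊆ G)
        = ∑ S ∈ Finset.powersetCard d E, if S ⊆ G then (1:ℝ) else 0 := by
      refine Finset.sum_congr rfl fun S _ => ?_
      by_cases h : S ⊆ G <;> simp [ind, h]
    rw [e2, Finset.sum_boole]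
    congr 2
    ext S; simp only [Finset.mem_powersetCard, Finset.mem_filter]
    constructor
    · rintro ⟨a, b⟩; exact ⟨⟨a.trans hG, b⟩, a⟩
    · rintro ⟨⟨_, b⟩, c⟩; exact ⟨c, b⟩
  rw [ex_congr e1, ex_sum]
  calc ∑ S ∈ Finset.powersetCard d E, ex E p (fun G => ind (S ⊆ G))
      = ∑ S ∈ Finset.powersetCard d E, p ^ d := by
        refine Finset.sum_congr rfl fun S hS => ?_
        rw [Finset.mem_powersetCard] at hS
        rw [← sprob_eq, sprob_subset hS.1, hS.2]
    _ = (E.card.choose d : ℝ) * p ^ d := by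
        rw [Finset.sum_const, Finset.card_powersetCard, nsmul_eq_mul]
    _ ≤ ((E.card : ℝ) ^ d / d.factorial) * p ^ d := by
        gcongr
        exact Nat.choose_le_pow_div d E.card
    _ = _ := by rw [mul_pow]; ring

/-- star part of fixed size -/
lemma SR_prob {E E₀ : Finset β} (hE : E₀ ⊆ E) {p : ℝ} (h0 : 0 ≤ p) (h1 : p ≤ 1)
    {𝒟 : Finset β → Prop} (hher : ∀ C D, D ⊆ C → 𝒟 C → 𝒟 D) (X : ℕ → ℝ) (hX : ∀ i, 0 ≤ X i)
    (d r : ℕ)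
    (hext : ∀ S ⊆ E₀, S.card = d → ∀ R ⊆ E \ E₀, R.card < r → 𝒟 (S ∪ R) → ∀ F : Finset β,
      (∀ A ∈ F, A ∈ E \ E₀ ∧ A ∉ R ∧ 𝒟 (S ∪ insert A R)) → (F.card : ℝ) ≤ X R.card) :
    sprob E p (fun G => ∃ S ⊆ G ∩ E₀, S.card = d ∧ ∃ R ⊆ G \ E₀, R.card = r ∧ 𝒟 (S ∪ R)) ≤
      (p * E₀.card) ^ d / d.factorial * (p ^ r * ((∏ i ∈ Finset.range r, X i) / r.factorial)) := by
  have hQ0 : 0 ≤ p ^ r * ((∏ i ∈ Finset.range r, X i) / r.factorial) := by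
    have := Finset.prod_nonneg (s := Finset.range r) (fun i _ => hX i)
    positivity
  refine (split_prob hE h0 h1 (fun _ S => S.card = d)
    (fun S G => ∃ R ⊆ G, R.card = r ∧ 𝒟 (S ∪ R)) hQ0 ?_ (fun G => (G.card.choose d : ℝ)) ?_).trans ?_
  · intro G₁ S hS hG₁ hc
    exact R_prob h0 h1 hher X hX r (hext S (hS.trans hG₁) hc)
  · intro G₁ _ F hF
    rw [← Finset.card_powersetCard]
    exact_mod_cast Finset.card_le_card fun S hS => Finset.mem_powersetCard.2 (hF S hS)
  · exact mul_le_mul_of_nonneg_right (ex_choose E₀ h0 h1 d) hQ0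

/-- almost full star part -/
lemma S2a_prob {E E₀ : Finset β} (hE : E₀ ⊆ E) {p : ℝ} (h0 : 0 ≤ p) (h1 : p ≤ 1)
    {𝒟 : Finset β → Prop} (hher : ∀ C D, D ⊆ C → 𝒟 C → 𝒟 D) (X : ℕ → ℝ) (hX : ∀ i, 0 ≤ X i)
    (s D m r : ℕ) (hD : 1 ≤ D)
    (hext : ∀ S ⊆ E₀, s ≤ S.card → S.card ≤ D → ∀ R ⊆ E \ E₀, R.card < r → 𝒟 (S ∪ R) → ∀ F : Finset β,
      (∀ A ∈ F, A ∈ E \ E₀ ∧ A ∉ R ∧ 𝒟 (S ∪ insert A R)) → (F.card : ℝ) ≤ X R.card) :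
    sprob E p (fun G => ∃ S ⊆ G ∩ E₀, (s ≤ S.card ∧ (G ∩ E₀).card ≤ S.card + m ∧ (G ∩ E₀).card ≤ D) ∧
        ∃ R ⊆ G \ E₀, R.card = r ∧ 𝒟 (S ∪ R)) ≤
      binomProbGe E₀.card p s * (3 * D ^ m) * (p ^ r * ((∏ i ∈ Finset.range r, X i) / r.factorial)) := by
  classical
  have hQ0 : 0 ≤ p ^ r * ((∏ i ∈ Finset.range r, X i) / r.factorial) := by
    have := Finset.prod_nonneg (s := Finset.range r) (fun i _ => hX i)
    positivity
  refine (split_prob hE h0 h1 (fun G S => s ≤ S.card ∧ G.card ≤ S.card + m ∧ G.card ≤ D)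
    (fun S G => ∃ R ⊆ G, R.card = r ∧ 𝒟 (S ∪ R)) hQ0 ?_
    (fun G => ind (s ≤ G.card) * (3 * D ^ m)) ?_).trans ?_
  · intro G₁ S hS hG₁ hc
    exact R_prob h0 h1 hher X hX r (hext S (hS.trans hG₁) hc.1
      ((Finset.card_le_card hS).trans hc.2.2))
  · intro G₁ _ F hF
    rcases F.eq_empty_or_nonempty with rfl | ⟨S₀, hS₀⟩
    · simp only [Finset.card_empty, Nat.cast_zero]
      exact mul_nonneg (ind_nonneg _) (by positivity)
    have hs0 := hF S₀ hS₀
    rw [ind_true (hs0.2.1.trans (Finset.card_le_card hs0.1)), one_mul]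
    have hDr : (1:ℝ) ≤ D := by exact_mod_cast hD
    have hgD : G₁.card ≤ D := hs0.2.2.2
    have hsub : F ⊆ G₁.powerset := fun S hS => Finset.mem_powerset.2 (hF S hS).1
    have hsum := Finset.sum_pow_mul_eq_add_pow (1:ℝ) ((D:ℝ)⁻¹) G₁
    have h3 : (1 + (D:ℝ)⁻¹) ^ G₁.card ≤ 3 := by
      have a1 : (1 + (D:ℝ)⁻¹) ≤ Real.exp ((D:ℝ)⁻¹) := by
        have := Real.add_one_le_exp ((D:ℝ)⁻¹); linarith
      calc (1 + (D:ℝ)⁻¹) ^ G₁.card ≤ (1 + (D:ℝ)⁻¹) ^ D :=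
            pow_le_pow_right₀ (by have : 0 ≤ (D:ℝ)⁻¹ := by positivity
                                  linarith) hgD
        _ ≤ Real.exp ((D:ℝ)⁻¹) ^ D := by gcongr
        _ = Real.exp 1 := by rw [← Real.exp_nat_mul, mul_inv_cancel₀ (by linarith)]
        _ ≤ 3 := by linarith [Real.exp_one_lt_d9]
    have h4 : (F.card : ℝ) * ((D:ℝ)⁻¹) ^ m ≤ 3 := by
      calc (F.card : ℝ) * ((D:ℝ)⁻¹) ^ m = ∑ S ∈ F, ((D:ℝ)⁻¹) ^ m := by
            rw [Finset.sum_const, nsmul_eq_mul]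
        _ ≤ ∑ S ∈ F, (1:ℝ) ^ S.card * ((D:ℝ)⁻¹) ^ (G₁.card - S.card) := by
            refine Finset.sum_le_sum fun S hS => ?_
            rw [one_pow, one_mul]
            refine pow_le_pow_of_le_one (by positivity) (inv_le_one_of_one_le₀ hDr) ?_
            have := (hF S hS).2.2.1; omega
        _ ≤ ∑ S ∈ G₁.powerset, (1:ℝ) ^ S.card * ((D:ℝ)⁻¹) ^ (G₁.card - S.card) :=
            Finset.sum_le_sum_of_subset_of_nonneg hsub fun _ _ _ => by positivity
        _ ≤ 3 := by rw [hsum]; exact h3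
    have h5 : ((D:ℝ)⁻¹) ^ m * (D:ℝ) ^ m = 1 := by
      rw [← mul_pow, inv_mul_cancel₀ (by linarith), one_pow]
    calc (F.card : ℝ) = (F.card : ℝ) * ((D:ℝ)⁻¹) ^ m * (D:ℝ) ^ m := by rw [mul_assoc, h5, mul_one]
      _ ≤ 3 * (D:ℝ) ^ m := by gcongr
  · rw [ex_mul_right, ← sprob_eq, sprob_card_ge]

end gen

/-- codegrees -/
lemma P1_prob {n k K : ℕ} {p : ℝ} (hn : 0 < n) (hkn : k ≤ n) (h0 : 0 ≤ p) (h1 : p ≤ 1) :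
    hprob n k p (fun H => ∃ x y : Fin n, x ≠ y ∧ K + 1 ≤ (H.filter fun A => x ∈ A ∧ y ∈ A).card) ≤
      (n:ℝ) ^ 2 * (p * (((k:ℝ) / n) ^ 2 * n.choose k)) ^ (K + 1) := by
  classical
  have hle : hprob n k p (fun H => ∃ x y : Fin n, x ≠ y ∧ K + 1 ≤ (H.filter fun A => x ∈ A ∧ y ∈ A).card)
      ≤ sprob (kSets n k) p (fun H => ∃ i ∈ (Finset.univ : Finset (Fin n × Fin n)),
        i.1 ≠ i.2 ∧ K + 1 ≤ (H ∩ (kSets n k).filter fun A => i.1 ∈ A ∧ i.2 ∈ A).card) := by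
    refine sprob_mono h0 h1 fun H hH => ?_
    rintro ⟨x, y, hxy, hc⟩
    refine ⟨(x, y), Finset.mem_univ _, hxy, hc.trans (Finset.card_le_card ?_)⟩
    intro A hA
    rw [Finset.mem_filter] at hA
    exact Finset.mem_inter.2 ⟨hA.1, Finset.mem_filter.2 ⟨hH hA.1, hA.2⟩⟩
  refine hle.trans ((sprob_exists h0 h1 _ _).trans ?_)
  have hb : ∀ i ∈ (Finset.univ : Finset (Fin n × Fin n)), sprob (kSets n k) p (fun H => i.1 ≠ i.2 ∧
      K + 1 ≤ (H ∩ (kSets n k).filter fun A => i.1 ∈ A ∧ i.2 ∈ A).card) ≤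
      (p * (((k:ℝ) / n) ^ 2 * n.choose k)) ^ (K + 1) := by
    intro i _
    by_cases hi : i.1 = i.2
    · have : sprob (kSets n k) p (fun H => i.1 ≠ i.2 ∧
        K + 1 ≤ (H ∩ (kSets n k).filter fun A => i.1 ∈ A ∧ i.2 ∈ A).card) = 0 := by
        rw [sprob_eq]
        have : ∀ H ⊆ kSets n k, ind (i.1 ≠ i.2 ∧
          K + 1 ≤ (H ∩ (kSets n k).filter fun A => i.1 ∈ A ∧ i.2 ∈ A).card) = 0 :=
          fun H _ => ind_false (by tauto)
        rw [ex_congr this, ex_const]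
      rw [this]; positivity
    · refine (sprob_mono h0 h1 (Q := fun H =>
        K + 1 ≤ (H ∩ (kSets n k).filter fun A => i.1 ∈ A ∧ i.2 ∈ A).card) fun _ _ h => h.2).trans ?_
      rw [sprob_inter_card_ge (Finset.filter_subset _ _)]
      refine (binom_upper h0 h1 _).trans ?_
      have hS := card_supersets_le hn hkn ({i.1, i.2} : Finset (Fin n))
      rw [Finset.card_pair hi] at hS
      have heq : ((kSets n k).filter fun A => {i.1, i.2} ⊆ A)
          = (kSets n k).filter fun A => i.1 ∈ A ∧ i.2 ∈ A := by
        ext A; simp [Finset.insert_subset_iff]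
      rw [heq] at hS
      refine (div_le_self (by positivity) (by exact_mod_cast Nat.factorial_pos _)).trans ?_
      gcongr
  refine (Finset.sum_le_sum hb).trans (le_of_eq ?_)
  rw [Finset.sum_const, nsmul_eq_mul]
  simp [Fintype.card_prod, sq]

/-- big intersections -/
lemma P2_prob {n k l : ℕ} {p : ℝ} (hn : 0 < n) (hkn : k ≤ n) (h0 : 0 ≤ p) (h1 : p ≤ 1) :
    hprob n k p (fun H => ∃ A ∈ H, ∃ B ∈ H, A ≠ B ∧ l < (A ∩ B).card) ≤
      (p * n.choose k) ^ 2 * (((k:ℝ) ^ 2 / n) ^ (l + 1) / (l + 1).factorial) := by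
  classical
  set E := kSets n k with hE
  set T : Finset ((Σ _ : Finset (Fin n), Σ _ : Finset (Fin n), Finset (Fin n))) :=
    E.sigma fun A => (Finset.powersetCard (l + 1) A).sigma fun Z => (E.filter fun B => Z ⊆ B ∧ A ≠ B) with hT
  have hle : hprob n k p (fun H => ∃ A ∈ H, ∃ B ∈ H, A ≠ B ∧ l < (A ∩ B).card)
      ≤ sprob E p (fun H => ∃ i ∈ T, ({i.1, i.2.2} : Finset (Finset (Fin n))) ⊆ H) := by
    refine sprob_mono h0 h1 fun H hH => ?_
    rintro ⟨A, hA, B, hB, hAB, hc⟩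
    obtain ⟨Z, hZ, hZc⟩ := Finset.exists_subset_card_eq (Nat.succ_le_of_lt hc)
    refine ⟨⟨A, Z, B⟩, ?_, by simp [Finset.insert_subset_iff, hA, hB]⟩
    simp only [hT, Finset.mem_sigma, Finset.mem_powersetCard, Finset.mem_filter]
    exact ⟨hH hA, ⟨hZ.trans Finset.inter_subset_left, hZc⟩, hH hB, hZ.trans Finset.inter_subset_right, hAB⟩
  refine hle.trans ((sprob_exists h0 h1 _ _).trans ?_)
  have hb : ∀ i ∈ T, sprob E p (fun H => ({i.1, i.2.2} : Finset (Finset (Fin n))) ⊆ H) = p ^ 2 := by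
    intro i hi
    simp only [hT, Finset.mem_sigma, Finset.mem_powersetCard, Finset.mem_filter] at hi
    rw [sprob_subset, Finset.card_pair hi.2.2.2.2]
    simp [Finset.insert_subset_iff, hi.1, hi.2.2.1]
  rw [Finset.sum_congr rfl hb, Finset.sum_const, nsmul_eq_mul]
  have hcard : (T.card : ℝ) ≤ n.choose k * ((k:ℝ) ^ (l + 1) / (l + 1).factorial *
      (((k:ℝ) / n) ^ (l + 1) * n.choose k)) := by
    rw [hT, Finset.card_sigma]
    push_cast
    calc ∑ A ∈ E, (((Finset.powersetCard (l + 1) A).sigma fun Z => (E.filter fun B => Z ⊆ B ∧ A ≠ B)).card : ℝ)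
        ≤ ∑ A ∈ E, ((k:ℝ) ^ (l + 1) / (l + 1).factorial * (((k:ℝ) / n) ^ (l + 1) * n.choose k)) := by
          refine Finset.sum_le_sum fun A hA => ?_
          rw [Finset.card_sigma]
          push_cast
          calc ∑ Z ∈ Finset.powersetCard (l + 1) A, ((E.filter fun B => Z ⊆ B ∧ A ≠ B).card : ℝ)
              ≤ ∑ Z ∈ Finset.powersetCard (l + 1) A, (((k:ℝ) / n) ^ (l + 1) * n.choose k) := by
                refine Finset.sum_le_sum fun Z hZ => ?_
                rw [Finset.mem_powersetCard] at hZ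
                have := card_supersets_le hn hkn Z
                rw [hZ.2] at this
                refine le_trans ?_ this
                exact_mod_cast Finset.card_le_card fun B hB => by
                  rw [Finset.mem_filter] at hB ⊢; exact ⟨hB.1, hB.2.1⟩
            _ = (k.choose (l + 1) : ℝ) * (((k:ℝ) / n) ^ (l + 1) * n.choose k) := by
                rw [Finset.sum_const, nsmul_eq_mul, Finset.card_powersetCard, mem_kSets.1 hA]
            _ ≤ _ := by
                gcongr
                exact Nat.choose_le_pow_div (l + 1) k
      _ = _ := by rw [Finset.sum_const, nsmul_eq_mul, hE, card_kSets]
  calc (T.card : ℝ) * p ^ 2 ≤ n.choose k * ((k:ℝ) ^ (l + 1) / (l + 1).factorial *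
      (((k:ℝ) / n) ^ (l + 1) * n.choose k)) * p ^ 2 := by gcongr
    _ = _ := by
      have : (k:ℝ) ^ 2 / n = k * (k / n) := by ring
      rw [this, mul_pow (k:ℝ)]; ring

end
end EKRP

namespace EKRP
noncomputable section

/-- light part of the correction factor -/
def FB (n k l h s : ℕ) : ℝ :=
  Real.exp ((k:ℝ) / n * (1 - interProb n k) * (interProb n k)⁻¹ ^ h * ((l + 1) * s ^ 2))

lemma FB_mono {n k l h s s' : ℕ} (hkn : 2 * k ≤ n) (hs : s ≤ s') : FB n k l h s ≤ FB n k l h s' := by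
  unfold FB
  apply Real.exp_le_exp.2
  have hq1 : interProb n k ≤ 1 := interProb_le_one (by omega)
  have hq0 := interProb_nonneg n k
  refine mul_le_mul_of_nonneg_left ?_ (mul_nonneg (mul_nonneg (by positivity) (by linarith)) (by positivity))
  have : (s:ℝ) ≤ s' := by exact_mod_cast hs
  gcongr

lemma ext_card {n k l K s t d h m : ℕ} (hk : 1 ≤ k) (hkn : 2 * k ≤ n) (hq : 0 < interProb n k)
    (C : Finset (Finset (Fin n))) (hC : C ⊆ kSets n k) (hs : C.card = s) (hst : s ≤ t) (hG : Good l K C)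
    (X : Finset (Fin n)) (hX : X.card ≤ 1) (hd : ∀ v ∉ X, vdeg C v ≤ d)
    (hm : t + (m + 1) ^ 2 * K < (m + 1) * (h + 1) ∨ d ≤ h)
    (hw : k * ((l + 1) * t ^ 2 + 2) ≤ n) (F : Finset (Finset (Fin n)))
    (hF : ∀ A ∈ F, A ∈ kSets n k ∧ Disjoint A X ∧ ∀ B ∈ C, (A ∩ B).Nonempty) :
    (F.card : ℝ) ≤ (n.choose k : ℝ) * interProb n k ^ s *
        ((1 + (k:ℝ) / n * (interProb n k)⁻¹ ^ d) ^ m * FB n k l h t) := by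
  classical
  have hm' : (Finset.univ.filter fun v => v ∉ X ∧ h < vdeg C v).card ≤ m := by
    by_contra hcon
    push Not at hcon
    rcases hm with hm | hm
    · obtain ⟨M, hM, hMc⟩ := Finset.exists_subset_card_eq (Nat.succ_le_of_lt hcon)
      have := heavy C hG.2.2 M (h := h) (fun v hv => (Finset.mem_filter.1 (hM hv)).2.2)
      rw [hMc, hs] at this
      simp only [Nat.succ_eq_add_one] at this
      omega
    · obtain ⟨v, hv⟩ := Finset.card_pos.1 (by omega : 0 < (Finset.univ.filter fun v => v ∉ X ∧ h < vdeg C v).card)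
      rw [Finset.mem_filter] at hv
      have := hd v hv.2.1
      omega
  have hw' : k * ((l + 1) * s ^ 2 + 2) ≤ n := le_trans (by gcongr) hw
  have h1 := ext_count hk hkn hq C hC hs hG.2.1 X hX hd hm' hw'
  refine le_trans ?_ (h1.trans ?_)
  · exact_mod_cast Finset.card_le_card fun A hA => by
      rw [Finset.mem_filter]; exact ⟨(hF A hA).1, (hF A hA).2⟩
  · have := FB_mono (n := n) (k := k) (l := l) (h := h) hkn hst
    unfold FB at this ⊢
    gcongr

lemma prod_qpow (N q : ℝ) (F : ℝ) (d r : ℕ) :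
    ∏ i ∈ Finset.range r, (N * q ^ (d + i) * F) = (N * F) ^ r * q ^ (d * r + r.choose 2) := by
  induction r with
  | zero => simp
  | succ r ih =>
    rw [Finset.prod_range_succ, ih, Nat.choose_succ_succ' r 1, Nat.choose_one_right]
    ring

lemma G_prob {n k l K a t h : ℕ} {p : ℝ} (hk : 1 ≤ k) (hkn : 2 * k ≤ n) (hq : 0 < interProb n k)
    (h0 : 0 ≤ p) (h1 : p ≤ 1) (hah : a ≤ h) (hw : k * ((l + 1) * t ^ 2 + 2) ≤ n) :
    hprob n k p (fun H => ∃ R ⊆ H, R.card = t ∧ Good l K R ∧ ∀ v, vdeg R v ≤ a) ≤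
      (p * n.choose k * FB n k l h t) ^ t * interProb n k ^ t.choose 2 / t.factorial := by
  classical
  set q := interProb n k with hqd
  set F := FB n k l h t with hF
  have hF0 : 0 ≤ F := Real.exp_nonneg _
  have key := R_prob (E₁ := kSets n k) (S := ∅) h0 h1
    (𝒟 := fun R => R ⊆ kSets n k ∧ Good l K R ∧ ∀ v, vdeg R v ≤ a)
    (fun C D hDC h => ⟨hDC.trans h.1, h.2.1.mono hDC, fun v => (vdeg_mono hDC v).trans (h.2.2 v)⟩)
    (fun i => (n.choose k : ℝ) * q ^ (0 + i) * F) (fun i => by positivity) t ?_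
  · rw [prod_qpow] at key
    refine (sprob_mono h0 h1 ?_).trans (key.trans (le_of_eq ?_))
    · rintro G hG ⟨R, hR, hc, hg, hv⟩
      refine ⟨R, hR, hc, ?_⟩
      rw [Finset.empty_union]
      exact ⟨hR.trans hG, hg, hv⟩
    · simp only [zero_mul, zero_add, mul_pow]; ring
  · intro R hR hRt hD Fm hFm
    rw [Finset.empty_union] at hD
    have := ext_card (X := ∅) (m := 0) (s := R.card) (t := t) (h := h) (d := a) hk hkn hq R hR rfl hRt.le hD.2.1 (by simp)
      (fun v _ => hD.2.2 v) (Or.inr hah) hw Fm ?_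
    · refine this.trans (le_of_eq ?_)
      simp only [pow_zero, one_mul, zero_add]
      rfl
    · intro A hA
      have h3 := hFm A hA
      rw [Finset.empty_union] at h3
      refine ⟨h3.1, by simp, fun B hB => ?_⟩
      exact h3.2.2.2.1.1 A (Finset.mem_insert_self _ _) B (Finset.mem_insert_of_mem hB)

lemma card_union_star {n : ℕ} {E S R : Finset (Finset (Fin n))} {x : Fin n} (hS : S ⊆ starOf E x)
    (hR : R ⊆ E \ starOf E x) : (S ∪ R).card = S.card + R.card := by
  rw [Finset.card_union_of_disjoint]
  exact Finset.disjoint_of_subset_left hS (Finset.disjoint_of_subset_right hR Finset.disjoint_sdiff)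

lemma ext_mem {n l K k : ℕ} {S R : Finset (Finset (Fin n))} {A : Finset (Fin n)} {x : Fin n}
    (hA : A ∈ kSets n k \ starOf (kSets n k) x) (hG : Good l K (S ∪ insert A R)) :
    A ∈ kSets n k ∧ Disjoint A {x} ∧ ∀ B ∈ S ∪ R, (A ∩ B).Nonempty := by
  have h1 := Finset.mem_sdiff.1 hA
  refine ⟨h1.1, ?_, fun B hB => ?_⟩
  · rw [Finset.disjoint_singleton_right]
    intro hx
    exact h1.2 (Finset.mem_filter.2 ⟨h1.1, hx⟩)
  · refine hG.1 A (Finset.mem_union_right _ (Finset.mem_insert_self _ _)) B ?_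
    rcases Finset.mem_union.1 hB with h | h
    · exact Finset.mem_union_left _ h
    · exact Finset.mem_union_right _ (Finset.mem_insert_of_mem h)

lemma S1_prob {n k l K d r h m : ℕ} {p : ℝ} (hk : 1 ≤ k) (hkn : 2 * k ≤ n) (hq : 0 < interProb n k)
    (h0 : 0 ≤ p) (h1 : p ≤ 1) (x : Fin n)
    (hm : (d + r) + (m + 1) ^ 2 * K < (m + 1) * (h + 1) ∨ d ≤ h)
    (hw : k * ((l + 1) * (d + r) ^ 2 + 2) ≤ n) :
    hprob n k p (fun H => ∃ S ⊆ H ∩ starOf (kSets n k) x, S.card = d ∧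
      ∃ R ⊆ H \ starOf (kSets n k) x, R.card = r ∧ (S ∪ R ⊆ kSets n k ∧ Good l K (S ∪ R) ∧ ∀ v, vdeg (S ∪ R) v ≤ d)) ≤
      phi n k p ^ d / d.factorial * ((p * n.choose k *
        ((1 + (k:ℝ) / n * (interProb n k)⁻¹ ^ d) ^ m * FB n k l h (d + r))) ^ r *
          interProb n k ^ (d * r + r.choose 2) / r.factorial) := by
  classical
  set q := interProb n k with hqd
  set F := (1 + (k:ℝ) / n * q⁻¹ ^ d) ^ m * FB n k l h (d + r) with hF
  have hF0 : 0 ≤ F := mul_nonneg (by positivity) (Real.exp_nonneg _)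
  have key := SR_prob (E := kSets n k) (E₀ := starOf (kSets n k) x) (Finset.filter_subset _ _) h0 h1
    (𝒟 := fun R => R ⊆ kSets n k ∧ Good l K R ∧ ∀ v, vdeg R v ≤ d)
    (fun C D hDC h => ⟨hDC.trans h.1, h.2.1.mono hDC, fun v => (vdeg_mono hDC v).trans (h.2.2 v)⟩)
    (fun i => (n.choose k : ℝ) * q ^ (d + i) * F) (fun i => by positivity) d r ?_
  · rw [prod_qpow] at key
    refine key.trans (le_of_eq ?_)
    have : ((starOf (kSets n k) x).card : ℝ) = (n-1).choose (k-1) := by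
      exact_mod_cast card_star hk x
    rw [this]
    unfold phi
    simp only [mul_pow]; ring
  · intro S hS hSd R hR hRr hD Fm hFm
    have hc := card_union_star hS hR
    rw [hSd] at hc
    exact ext_card (X := {x}) (s := d + R.card) (t := d + r) hk hkn hq (S ∪ R) hD.1 hc (by omega) hD.2.1 (by simp)
      (fun v _ => hD.2.2 v) hm hw Fm (fun A hA => ext_mem (hFm A hA).1 (hFm A hA).2.2.2.1)

lemma deg_S2 {n l K : ℕ} {S R : Finset (Finset (Fin n))} {x v : Fin n} (hS : ∀ A ∈ S, x ∈ A)
    (hG : Good l K (S ∪ R)) (hv : v ≠ x) : vdeg (S ∪ R) v ≤ K + R.card := by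
  have h1 : starOf (S ∪ R) v ⊆ ((S ∪ R).filter fun A => x ∈ A ∧ v ∈ A) ∪ R := by
    intro A hA
    simp only [starOf, Finset.mem_filter, Finset.mem_union] at hA ⊢
    rcases hA.1 with h | h
    · exact Or.inl ⟨Or.inl h, hS A h, hA.2⟩
    · exact Or.inr h
  exact (Finset.card_le_card h1).trans ((Finset.card_union_le _ _).trans
    (Nat.add_le_add_right (hG.2.2 x v hv.symm) _))

lemma S2_ext {n k l K s r t : ℕ} (hk : 1 ≤ k) (hkn : 2 * k ≤ n) (hq : 0 < interProb n k) {x : Fin n}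
    (hw : k * ((l + 1) * t ^ 2 + 2) ≤ n) {S R : Finset (Finset (Fin n))}
    (hS : S ⊆ starOf (kSets n k) x) (hs : s ≤ S.card) (hR : R ⊆ kSets n k \ starOf (kSets n k) x)
    (hRr : R.card < r) (hst : S.card + r ≤ t) (hD : Good l K (S ∪ R)) (Fm : Finset (Finset (Fin n)))
    (hFm : ∀ A ∈ Fm, A ∈ kSets n k \ starOf (kSets n k) x ∧ A ∉ R ∧ Good l K (S ∪ insert A R)) :
    (Fm.card : ℝ) ≤ n.choose k * interProb n k ^ s * FB n k l (K + r) t := by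
  have hc := card_union_star hS hR
  have hsub : S ∪ R ⊆ kSets n k :=
    Finset.union_subset (hS.trans (Finset.filter_subset _ _)) (hR.trans Finset.sdiff_subset)
  have hx : ∀ A ∈ S, x ∈ A := fun A hA => (Finset.mem_filter.1 (hS hA)).2
  have := ext_card (X := {x}) (m := 0) (d := K + r) (h := K + r) (t := t) hk hkn hq (S ∪ R) hsub hc (by omega) hD (by simp)
    (fun v hv => (deg_S2 hx hD (by simpa using hv)).trans (by omega)) (Or.inr le_rfl) hw Fm
    (fun A hA => ext_mem (hFm A hA).1 (hFm A hA).2.2)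
  refine this.trans ?_
  rw [pow_zero, one_mul]
  have hF0 : 0 ≤ FB n k l (K + r) t := Real.exp_nonneg _
  have hqp : interProb n k ^ (S.card + R.card) ≤ interProb n k ^ s :=
    pow_le_pow_of_le_one hq.le (interProb_le_one (by omega)) (by omega)
  gcongr

lemma S2b_prob {n k l K d r : ℕ} {p : ℝ} (hk : 1 ≤ k) (hkn : 2 * k ≤ n) (hq : 0 < interProb n k)
    (h0 : 0 ≤ p) (h1 : p ≤ 1) (x : Fin n)
    (hw : k * ((l + 1) * (d + r) ^ 2 + 2) ≤ n) :
    hprob n k p (fun H => ∃ S ⊆ H ∩ starOf (kSets n k) x, S.card = d ∧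
      ∃ R ⊆ H \ starOf (kSets n k) x, R.card = r ∧ Good l K (S ∪ R)) ≤
      phi n k p ^ d / d.factorial * ((p * n.choose k * interProb n k ^ d * FB n k l (K + r) (d + r)) ^ r
        / r.factorial) := by
  classical
  have hF0 : 0 ≤ FB n k l (K + r) (d + r) := Real.exp_nonneg _
  have key := SR_prob (E := kSets n k) (E₀ := starOf (kSets n k) x) (Finset.filter_subset _ _) h0 h1
    (𝒟 := Good l K) (fun C D hDC h => h.mono hDC)
    (fun i => (n.choose k : ℝ) * interProb n k ^ d * FB n k l (K + r) (d + r)) (fun i => by positivity) d r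
    (fun S hS hSd R hR hRr hD Fm hFm =>
      S2_ext (s := d) (r := r) (t := d + r) hk hkn hq hw hS hSd.ge hR hRr (by omega) hD Fm hFm)
  refine key.trans (le_of_eq ?_)
  have : ((starOf (kSets n k) x).card : ℝ) = (n-1).choose (k-1) := by
    exact_mod_cast card_star hk x
  rw [this, Finset.prod_const, Finset.card_range]
  unfold phi
  simp only [mul_pow]; ring

lemma S2a_prob' {n k l K s D m r : ℕ} {p : ℝ} (hk : 1 ≤ k) (hkn : 2 * k ≤ n) (hq : 0 < interProb n k)
    (h0 : 0 ≤ p) (h1 : p ≤ 1) (x : Fin n) (hD : 1 ≤ D)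
    (hw : k * ((l + 1) * (D + r) ^ 2 + 2) ≤ n) :
    hprob n k p (fun H => ∃ S ⊆ H ∩ starOf (kSets n k) x, (s ≤ S.card ∧
      (H ∩ starOf (kSets n k) x).card ≤ S.card + m ∧ (H ∩ starOf (kSets n k) x).card ≤ D) ∧
      ∃ R ⊆ H \ starOf (kSets n k) x, R.card = r ∧ Good l K (S ∪ R)) ≤
      binomProbGe ((n-1).choose (k-1)) p s * (3 * D ^ m) *
        ((p * n.choose k * interProb n k ^ s * FB n k l (K + r) (D + r)) ^ r / r.factorial) := by
  classical
  have hF0 : 0 ≤ FB n k l (K + r) (D + r) := Real.exp_nonneg _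
  have key := S2a_prob (E := kSets n k) (E₀ := starOf (kSets n k) x) (Finset.filter_subset _ _) h0 h1
    (𝒟 := Good l K) (fun C D hDC h => h.mono hDC)
    (fun i => (n.choose k : ℝ) * interProb n k ^ s * FB n k l (K + r) (D + r)) (fun i => by positivity) s D m r hD
    (fun S hS hSd hSD R hR hRr hG Fm hFm =>
      S2_ext (s := s) (r := r) (t := D + r) hk hkn hq hw hS hSd hR hRr (by omega) hG Fm hFm)
  refine key.trans (le_of_eq ?_)
  have : (starOf (kSets n k) x).card = (n-1).choose (k-1) := card_star hk x
  rw [this, Finset.prod_const, Finset.card_range]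
  simp only [mul_pow]; ring

/-- case analysis -/
lemma bad_cases {n k l K D f τ t a b r₀ : ℕ} (hn : 0 < n) {H : Finset (Finset (Fin n))} (hH : H ⊆ kSets n k)
    (hbad : Bad f τ H)
    (hP1 : ¬ ∃ x y : Fin n, x ≠ y ∧ K + 1 ≤ (H.filter fun A => x ∈ A ∧ y ∈ A).card)
    (hP2 : ¬ ∃ A ∈ H, ∃ B ∈ H, A ≠ B ∧ l < (A ∩ B).card) (hΔ : ¬ D + 1 ≤ maxDegree H)
    (htτ : t ≤ τ) (hbt : b < t) :
    (∃ R ⊆ H, R.card = t ∧ Good l K R ∧ ∀ v, vdeg R v ≤ a) ∨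
    (∃ i ∈ (Finset.univ : Finset (Fin n)) ×ˢ Finset.Icc (a + 1) b, ∃ S ⊆ H ∩ starOf (kSets n k) i.1, S.card = i.2 ∧
      ∃ R ⊆ H \ starOf (kSets n k) i.1, R.card = t - i.2 ∧
        (S ∪ R ⊆ kSets n k ∧ Good l K (S ∪ R) ∧ ∀ v, vdeg (S ∪ R) v ≤ i.2)) ∨
    (∃ x ∈ (Finset.univ : Finset (Fin n)), ∃ S ⊆ H ∩ starOf (kSets n k) x, S.card = b + 1 ∧
      ∃ R ⊆ H \ starOf (kSets n k) x, R.card = r₀ ∧ Good l K (S ∪ R)) ∨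
    (∃ i ∈ (Finset.univ : Finset (Fin n)) ×ˢ Finset.Ico 1 r₀, ∃ S ⊆ H ∩ starOf (kSets n k) i.1,
      (τ - i.2 ≤ S.card ∧ (H ∩ starOf (kSets n k) i.1).card ≤ S.card + f * i.2 ∧
        (H ∩ starOf (kSets n k) i.1).card ≤ D) ∧
      ∃ R ⊆ H \ starOf (kSets n k) i.1, R.card = i.2 ∧ Good l K (S ∪ R)) := by
  classical
  haveI : Nonempty (Fin n) := ⟨⟨0, hn⟩⟩
  obtain ⟨C, hCH, hcl, hτ, hC⟩ := hbad
  push Not at hP1 hP2 hΔ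
  have hgood : Good l K C := by
    refine ⟨hcl, fun A hA B hB hne => hP2 A (hCH hA) B (hCH hB) hne, fun x y hxy => ?_⟩
    have := hP1 x y hxy
    have h2 := Finset.card_le_card (Finset.filter_subset_filter (fun A => x ∈ A ∧ y ∈ A) hCH)
    omega
  have hstH : ∀ x, H ∩ starOf (kSets n k) x = starOf H x := by
    intro x
    ext A
    simp only [starOf, Finset.mem_inter, Finset.mem_filter]
    constructor
    · rintro ⟨a, _, b⟩; exact ⟨a, b⟩
    · rintro ⟨a, b⟩; exact ⟨a, hH a, b⟩
  have hst1 : ∀ (C' : Finset (Finset (Fin n))) (x : Fin n), C' ⊆ H → starOf C' x ⊆ H ∩ starOf (kSets n k) x := by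
    intro C' x hC'
    rw [hstH]
    exact Finset.filter_subset_filter _ hC'
  have hst2 : ∀ (C' : Finset (Finset (Fin n))) (x : Fin n), C' ⊆ H →
      C'.filter (fun A => x ∉ A) ⊆ H \ starOf (kSets n k) x := by
    intro C' x hC' A hA
    simp only [starOf, Finset.mem_filter, Finset.mem_sdiff] at hA ⊢
    exact ⟨hC' hA.1, fun h => hA.2 h.2⟩
  have hun : ∀ (C' : Finset (Finset (Fin n))) (x : Fin n), starOf C' x ∪ C'.filter (fun A => x ∉ A) = C' := by
    intro C' x; exact Finset.filter_union_filter_not_eq _ _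
  by_cases hbig : ∃ x, b + 1 ≤ vdeg C x
  · obtain ⟨x, hx⟩ := hbig
    by_cases hr : r₀ ≤ mdeg C x
    · right; right; left
      obtain ⟨S, hS, hSc⟩ := Finset.exists_subset_card_eq hx
      obtain ⟨R, hR, hRc⟩ := Finset.exists_subset_card_eq hr
      refine ⟨x, Finset.mem_univ _, S, hS.trans (hst1 C x hCH), hSc, R, hR.trans (hst2 C x hCH), hRc, ?_⟩
      exact hgood.mono (Finset.union_subset (hS.trans (Finset.filter_subset _ _))
        (hR.trans (Finset.filter_subset _ _)))
    · right; right; right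
      have h1 := hC x
      have hadd := vdeg_add_mdeg C x
      refine ⟨(x, mdeg C x), ?_, starOf C x, hst1 C x hCH, ⟨?_, ?_, ?_⟩,
        C.filter (fun A => x ∉ A), hst2 C x hCH, rfl, ?_⟩
      · simp only [Finset.mem_product, Finset.mem_univ, Finset.mem_Ico, true_and]; omega
      · change τ - mdeg C x ≤ vdeg C x; omega
      · rw [hstH]; exact h1.2
      · rw [hstH]; change vdeg H x ≤ D
        have := vdeg_le_maxDegree H x; omega
      · rw [hun]; exact hgood
  · push Not at hbig
    obtain ⟨C', hC', hCc⟩ := Finset.exists_subset_card_eq (htτ.trans hτ)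
    have hg' := hgood.mono hC'
    obtain ⟨x, hx⟩ := Finite.exists_max (vdeg C')
    by_cases hda : vdeg C' x ≤ a
    · left
      exact ⟨C', hC'.trans hCH, hCc, hg', fun v => (hx v).trans hda⟩
    · right; left
      have hb' : vdeg C' x ≤ b := by have := vdeg_mono hC' x; have := hbig x; omega
      have hadd := vdeg_add_mdeg C' x
      refine ⟨(x, vdeg C' x), ?_, starOf C' x, hst1 C' x (hC'.trans hCH), rfl,
        C'.filter (fun A => x ∉ A), hst2 C' x (hC'.trans hCH), ?_, ?_⟩
      · simp only [Finset.mem_product, Finset.mem_univ, Finset.mem_Icc, true_and]; omega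
      · change mdeg C' x = t - vdeg C' x; omega
      · rw [hun]; exact ⟨(hC'.trans hCH).trans hH, hg', hx⟩

end
end EKRP

namespace EKRP
noncomputable section

lemma sum_half_pow (r : ℕ) : ∑ i ∈ Finset.Ico 1 r, ((1:ℝ) / 2) ^ i ≤ 1 := by
  have h : ∀ m : ℕ, ∑ i ∈ Finset.Ico 1 (m + 1), ((1:ℝ) / 2) ^ i = 1 - (1 / 2) ^ m := by
    intro m
    induction m with
    | zero => simp
    | succ m ih => rw [Finset.sum_Ico_succ_top (by omega), ih]; ring
  rcases r with _ | m
  · simp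
  · rw [h]
    have : (0:ℝ) ≤ (1 / 2) ^ m := by positivity
    linarith

set_option maxHeartbeats 1000000 in
lemma bad_prob {n k l K D f τ t a b r₀ : ℕ} {p θ : ℝ} (hk : 1 ≤ k) (hkn : 2 * k ≤ n)
    (hq : 0 < interProb n k) (h0 : 0 ≤ p) (h1 : p ≤ 1) (hθ : 0 ≤ θ)
    (htτ : t ≤ τ) (hbt : b < t) (htD : t ≤ D + r₀) (hbD : b + 1 ≤ D) (hD : 1 ≤ D)
    (hw : k * ((l + 1) * (D + r₀) ^ 2 + 2) ≤ n)
    (g1 : (n:ℝ) ^ 2 * (phi n k p * (k / n)) ^ (K + 1) ≤ θ)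
    (g2 : mubar n k p ^ 2 * (((k:ℝ) ^ 2 / n) ^ (l + 1) / (l + 1).factorial) ≤ θ)
    (g3 : n * (phi n k p ^ (D + 1) / (D + 1).factorial) ≤ θ)
    (g5 : ∀ d ∈ Finset.Icc (a + 1) b, ∃ h m : ℕ, (t + (m + 1) ^ 2 * K < (m + 1) * (h + 1) ∨ d ≤ h) ∧
      (n:ℝ) * b * (phi n k p ^ d / d.factorial * ((mubar n k p *
        ((1 + (k:ℝ) / n * (interProb n k)⁻¹ ^ d) ^ m * FB n k l h t)) ^ (t - d) *
          interProb n k ^ (d * (t - d) + (t - d).choose 2) / (t - d).factorial)) ≤ θ)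
    (g6 : (n:ℝ) * (phi n k p ^ (b + 1) / (b + 1).factorial * ((mubar n k p * interProb n k ^ (b + 1) *
      FB n k l (K + r₀) (b + 1 + r₀)) ^ r₀ / r₀.factorial)) ≤ θ)
    (g7 : ∀ r ∈ Finset.Ico 1 r₀, (n:ℝ) * (binomProbGe ((n-1).choose (k-1)) p (τ - r) * (3 * D ^ (f * r)) *
        ((mubar n k p * interProb n k ^ (τ - r) * FB n k l (K + r) (D + r)) ^ r / r.factorial)) ≤ θ * (1 / 2) ^ r) :
    hprob n k p (Bad f τ) ≤ 6 * θ +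
      (mubar n k p * FB n k l a t) ^ t * interProb n k ^ t.choose 2 / t.factorial := by
  classical
  have hn : 0 < n := by omega
  have hn' : (n:ℝ) ≠ 0 := by positivity
  have hk' : (k:ℝ) ≠ 0 := by positivity
  have hmu := phi_mul (n := n) hk (by omega) p
  have hw' : ∀ s, s ≤ D + r₀ → k * ((l + 1) * s ^ 2 + 2) ≤ n := fun s hs => le_trans (by gcongr) hw
  have e1 := (P1_prob (K := K) hn (by omega : k ≤ n) h0 h1)
  have e1' : p * (((k:ℝ) / n) ^ 2 * n.choose k) = phi n k p * (k / n) := by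
    have : p * (((k:ℝ) / n) ^ 2 * n.choose k) = (p * n.choose k) * (k / n) ^ 2 := by ring
    rw [this, hmu]; unfold mubar; field_simp
  rw [e1'] at e1
  have e2 := (P2_prob (l := l) hn (by omega : k ≤ n) h0 h1)
  rw [hmu] at e2
  have e3 := hprob_maxdeg_ge (n := n) hk h0 h1 (show 1 ≤ D + 1 by omega)
  have e3' : hprob n k p (fun H => D + 1 ≤ maxDegree H) ≤ θ := by
    refine e3.trans (le_trans ?_ g3)
    refine mul_le_mul_of_nonneg_left (binom_upper h0 h1 _) (by positivity)
  have e4 := G_prob (l := l) (K := K) (a := a) (t := t) (h := a) hk hkn hq h0 h1 le_rfl (hw' t htD)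
  rw [hmu] at e4
  set PG : Finset (Finset (Fin n)) → Prop := fun H => ∃ R ⊆ H, R.card = t ∧ Good l K R ∧ ∀ v, vdeg R v ≤ a with hPG
  set P1 : Fin n × ℕ → Finset (Finset (Fin n)) → Prop := fun i H => ∃ S ⊆ H ∩ starOf (kSets n k) i.1, S.card = i.2 ∧
      ∃ R ⊆ H \ starOf (kSets n k) i.1, R.card = t - i.2 ∧
        (S ∪ R ⊆ kSets n k ∧ Good l K (S ∪ R) ∧ ∀ v, vdeg (S ∪ R) v ≤ i.2) with hP1
  set P2 : Fin n → Finset (Finset (Fin n)) → Prop := fun x H => ∃ S ⊆ H ∩ starOf (kSets n k) x, S.card = b + 1 ∧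
      ∃ R ⊆ H \ starOf (kSets n k) x, R.card = r₀ ∧ Good l K (S ∪ R) with hP2
  set P3 : Fin n × ℕ → Finset (Finset (Fin n)) → Prop := fun i H => ∃ S ⊆ H ∩ starOf (kSets n k) i.1,
      (τ - i.2 ≤ S.card ∧ (H ∩ starOf (kSets n k) i.1).card ≤ S.card + f * i.2 ∧
        (H ∩ starOf (kSets n k) i.1).card ≤ D) ∧
      ∃ R ⊆ H \ starOf (kSets n k) i.1, R.card = i.2 ∧ Good l K (S ∪ R) with hP3
  have e5 : hprob n k p (fun H => ∃ i ∈ (Finset.univ : Finset (Fin n)) ×ˢ Finset.Icc (a + 1) b, P1 i H) ≤ θ := by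
    rcases Nat.eq_zero_or_pos b with hb | hb
    · subst hb
      have : hprob n k p (fun H => ∃ i ∈ (Finset.univ : Finset (Fin n)) ×ˢ Finset.Icc (a + 1) 0, P1 i H) = 0 := by
        change sprob _ _ _ = 0
        rw [sprob_eq]
        have : ∀ H ⊆ kSets n k, ind (∃ i ∈ (Finset.univ : Finset (Fin n)) ×ˢ Finset.Icc (a + 1) 0, P1 i H) = 0 := by
          intro H _
          apply ind_false
          rintro ⟨i, hi, -⟩
          simp at hi
        rw [ex_congr this, ex_const]
      rw [this]; exact hθ
    refine (sprob_exists h0 h1 _ P1).trans ?_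
    have hb' : (0:ℝ) < b := by exact_mod_cast hb
    have hn0 : (0:ℝ) < n := by exact_mod_cast hn
    have : ∀ i ∈ (Finset.univ : Finset (Fin n)) ×ˢ Finset.Icc (a + 1) b, sprob (kSets n k) p (P1 i) ≤ θ / (n * b) := by
      rintro ⟨x, d⟩ hi
      have hd : d ∈ Finset.Icc (a + 1) b := (Finset.mem_product.1 hi).2
      obtain ⟨h, m, hm, hle⟩ := g5 d hd
      have hdb := (Finset.mem_Icc.1 hd).2
      have hdt : d + (t - d) = t := by omega
      have := S1_prob (l := l) (K := K) (d := d) (r := t - d) (h := h) (m := m) hk hkn hq h0 h1 x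
        (by rw [hdt]; exact hm) (by rw [hdt]; exact hw' t htD)
      rw [hdt, hmu] at this
      rw [le_div_iff₀ (by positivity), mul_comm]
      refine le_trans ?_ hle
      exact mul_le_mul_of_nonneg_left this (by positivity)
    refine (Finset.sum_le_sum this).trans ?_
    rw [Finset.sum_const, Finset.card_product, Finset.card_univ, Fintype.card_fin, Nat.card_Icc, nsmul_eq_mul]
    rw [Nat.cast_mul]
    have hle : ((b + 1 - (a + 1) : ℕ) : ℝ) ≤ b := by exact_mod_cast (by omega)
    calc (n:ℝ) * ((b + 1 - (a + 1) : ℕ) : ℝ) * (θ / (n * b)) ≤ n * b * (θ / (n * b)) := by gcongr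
      _ = θ := by field_simp
  have e6 : hprob n k p (fun H => ∃ x ∈ (Finset.univ : Finset (Fin n)), P2 x H) ≤ θ := by
    refine (sprob_exists h0 h1 _ P2).trans (le_trans ?_ g6)
    have : ∀ x ∈ (Finset.univ : Finset (Fin n)), sprob (kSets n k) p (P2 x) ≤
      phi n k p ^ (b + 1) / (b + 1).factorial * ((mubar n k p * interProb n k ^ (b + 1) *
      FB n k l (K + r₀) (b + 1 + r₀)) ^ r₀ / r₀.factorial) := by
      intro x _
      have := S2b_prob (l := l) (K := K) (d := b + 1) (r := r₀) hk hkn hq h0 h1 x (hw' _ (by omega))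
      rw [hmu] at this
      exact this
    refine (Finset.sum_le_sum this).trans ?_
    rw [Finset.sum_const, Finset.card_univ, Fintype.card_fin, nsmul_eq_mul]
  have e7 : hprob n k p (fun H => ∃ i ∈ (Finset.univ : Finset (Fin n)) ×ˢ Finset.Ico 1 r₀, P3 i H) ≤ θ := by
    refine (sprob_exists h0 h1 _ P3).trans ?_
    rw [Finset.sum_product_right]
    have : ∀ r ∈ Finset.Ico 1 r₀, ∑ x : Fin n, sprob (kSets n k) p (P3 (x, r)) ≤ θ * (1 / 2) ^ r := by
      intro r hr
      refine le_trans ?_ (g7 r hr)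
      have hb : ∀ x ∈ (Finset.univ : Finset (Fin n)), sprob (kSets n k) p (P3 (x, r)) ≤
          binomProbGe ((n-1).choose (k-1)) p (τ - r) * (3 * D ^ (f * r)) *
          ((mubar n k p * interProb n k ^ (τ - r) * FB n k l (K + r) (D + r)) ^ r / r.factorial) := by
        intro x _
        have := S2a_prob' (l := l) (K := K) (s := τ - r) (D := D) (m := f * r) (r := r) hk hkn hq h0 h1 x hD
          (hw' _ (by have := (Finset.mem_Ico.1 hr).2; omega))
        rw [hmu] at this
        exact this
      refine (Finset.sum_le_sum hb).trans ?_
      rw [Finset.sum_const, Finset.card_univ, Fintype.card_fin, nsmul_eq_mul]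
    refine (Finset.sum_le_sum this).trans ?_
    rw [← Finset.mul_sum]
    have := mul_le_mul_of_nonneg_left (sum_half_pow r₀) hθ
    linarith
  have hbig : hprob n k p (Bad f τ) ≤ hprob n k p (fun H =>
      (∃ x y : Fin n, x ≠ y ∧ K + 1 ≤ (H.filter fun A => x ∈ A ∧ y ∈ A).card) ∨
      ((∃ A ∈ H, ∃ B ∈ H, A ≠ B ∧ l < (A ∩ B).card) ∨ (D + 1 ≤ maxDegree H ∨ (PG H ∨
      ((∃ i ∈ (Finset.univ : Finset (Fin n)) ×ˢ Finset.Icc (a + 1) b, P1 i H) ∨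
      ((∃ x ∈ (Finset.univ : Finset (Fin n)), P2 x H) ∨
      (∃ i ∈ (Finset.univ : Finset (Fin n)) ×ˢ Finset.Ico 1 r₀, P3 i H))))))) := by
    refine sprob_mono h0 h1 fun H hH hbad => ?_
    by_cases c1 : ∃ x y : Fin n, x ≠ y ∧ K + 1 ≤ (H.filter fun A => x ∈ A ∧ y ∈ A).card
    · exact Or.inl c1
    by_cases c2 : ∃ A ∈ H, ∃ B ∈ H, A ≠ B ∧ l < (A ∩ B).card
    · exact Or.inr (Or.inl c2)
    by_cases c3 : D + 1 ≤ maxDegree H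
    · exact Or.inr (Or.inr (Or.inl c3))
    exact Or.inr (Or.inr (Or.inr (bad_cases hn hH hbad c1 c2 c3 htτ hbt)))
  refine hbig.trans ?_
  refine (hprob_or h0 h1 _ _).trans ?_
  have o2 := hprob_or (n := n) (k := k) h0 h1 (fun H => ∃ A ∈ H, ∃ B ∈ H, A ≠ B ∧ l < (A ∩ B).card)
    (fun H => D + 1 ≤ maxDegree H ∨ (PG H ∨
      ((∃ i ∈ (Finset.univ : Finset (Fin n)) ×ˢ Finset.Icc (a + 1) b, P1 i H) ∨
      ((∃ x ∈ (Finset.univ : Finset (Fin n)), P2 x H) ∨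
      (∃ i ∈ (Finset.univ : Finset (Fin n)) ×ˢ Finset.Ico 1 r₀, P3 i H)))))
  have o3 := hprob_or (n := n) (k := k) h0 h1 (fun H => D + 1 ≤ maxDegree H) (fun H => PG H ∨
      ((∃ i ∈ (Finset.univ : Finset (Fin n)) ×ˢ Finset.Icc (a + 1) b, P1 i H) ∨
      ((∃ x ∈ (Finset.univ : Finset (Fin n)), P2 x H) ∨
      (∃ i ∈ (Finset.univ : Finset (Fin n)) ×ˢ Finset.Ico 1 r₀, P3 i H))))
  have o4 := hprob_or (n := n) (k := k) h0 h1 PG (fun H =>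
      ((∃ i ∈ (Finset.univ : Finset (Fin n)) ×ˢ Finset.Icc (a + 1) b, P1 i H) ∨
      ((∃ x ∈ (Finset.univ : Finset (Fin n)), P2 x H) ∨
      (∃ i ∈ (Finset.univ : Finset (Fin n)) ×ˢ Finset.Ico 1 r₀, P3 i H))))
  have o5 := hprob_or (n := n) (k := k) h0 h1
      (fun H => ∃ i ∈ (Finset.univ : Finset (Fin n)) ×ˢ Finset.Icc (a + 1) b, P1 i H) (fun H =>
      ((∃ x ∈ (Finset.univ : Finset (Fin n)), P2 x H) ∨
      (∃ i ∈ (Finset.univ : Finset (Fin n)) ×ˢ Finset.Ico 1 r₀, P3 i H)))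
  have o6 := hprob_or (n := n) (k := k) h0 h1 (fun H => ∃ x ∈ (Finset.univ : Finset (Fin n)), P2 x H) (fun H =>
      (∃ i ∈ (Finset.univ : Finset (Fin n)) ×ˢ Finset.Ico 1 r₀, P3 i H))
  linarith

end
end EKRP

namespace EKRP
noncomputable section

/-- numerical context of regime B -/
structure RB (β : ℝ) (n k : ℕ) (x w L Y u : ℝ) : Prop where
  hβ0 : 0 < β
  hβ1 : β ≤ 1 / 100
  hw : w = β * x / 10 ^ 9
  hw0 : 10 ^ 20 ≤ w
  hβw : 1 / β ≤ w
  hk : 2 ≤ k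
  hkn : 2 * k < n
  hn : (n:ℝ) = Real.exp x
  hq : interProb n k = Real.exp (-L)
  hL0 : 0 < L
  hL : L ≤ 2 * w
  hkY : (k:ℝ) / n = Real.exp (-Y)
  hY1 : x / 2 - w ≤ Y
  hY2 : Y ≤ x / 2 + w
  huL : u * L = Y
  hu : u ≤ Real.exp (x / 4 - 10 ^ 9 * w)
  hxw : x ≤ Real.exp w

namespace RB
variable {β : ℝ} {n k : ℕ} {x w L Y u : ℝ}

lemma x_ge (B : RB β n k x w L Y u) : 10 ^ 11 * w ≤ x := by
  have h1 := B.hw; have h2 := B.hβ1; have h3 := B.hβ0; have h4 := B.hw0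
  have hx : 0 < x := by
    by_contra h
    push Not at h
    have : β * x ≤ 0 := mul_nonpos_of_nonneg_of_nonpos h3.le h
    rw [h1] at h4
    nlinarith
  have : β * x ≤ 1 / 100 * x := mul_le_mul_of_nonneg_right h2 hx.le
  rw [h1]; nlinarith

lemma w_pos (B : RB β n k x w L Y u) : 0 < w := by have := B.hw0; linarith
lemma x_big (B : RB β n k x w L Y u) : 10 ^ 31 ≤ x := by
  have := B.hw0; have := B.x_ge; linarith
lemma Y_ge (B : RB β n k x w L Y u) : 0.49 * x ≤ Y := by
  have h1 := B.hY1; have h2 := B.x_ge; have := B.w_pos; linarith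
lemma Y_le (B : RB β n k x w L Y u) : Y ≤ 0.51 * x := by
  have h1 := B.hY2; have h2 := B.x_ge; have := B.w_pos; linarith
lemma x_pos (B : RB β n k x w L Y u) : 0 < x := by have := B.x_big; linarith
lemma Y_pos (B : RB β n k x w L Y u) : 0 < Y := by have := B.Y_ge; have := B.x_pos; linarith
lemma u_pos (B : RB β n k x w L Y u) : 0 < u := by
  have h1 := B.huL; have h2 := B.Y_pos; have h3 := B.hL0
  by_contra h
  push Not at h
  nlinarith
lemma uw_ge (B : RB β n k x w L Y u) : 0.24 * x ≤ u * w := by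
  have h1 := B.huL; have h2 := B.Y_ge; have h3 := B.hL; have h4 := B.u_pos
  have := B.x_pos
  nlinarith
lemma u_big (B : RB β n k x w L Y u) : 2 * 10 ^ 10 ≤ u := by
  have h1 := B.uw_ge; have h2 := B.x_ge; have h3 := B.w_pos
  by_contra h
  push Not at h
  nlinarith
lemma βu_ge (B : RB β n k x w L Y u) : 2 * 10 ^ 8 ≤ β * u := by
  have h1 := B.uw_ge; rw [B.hw] at h1; have h3 := B.x_pos
  by_contra h
  push Not at h
  nlinarith
lemma βx (B : RB β n k x w L Y u) : β * x = 10 ^ 9 * w := by rw [B.hw]; ring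
lemma exp_w_big (B : RB β n k x w L Y u) : 10 ^ 20 ≤ Real.exp w := by
  have := Real.add_one_le_exp w; have := B.hw0; linarith
lemma q_pos (B : RB β n k x w L Y u) : 0 < interProb n k := by rw [B.hq]; exact Real.exp_pos _
lemma one_sub_q_le (B : RB β n k x w L Y u) : 1 - interProb n k ≤ L := by
  rw [B.hq]; have := Real.add_one_le_exp (-L); linarith
lemma one_sub_q_nonneg (B : RB β n k x w L Y u) : 0 ≤ 1 - interProb n k := by
  have := interProb_le_one (n := n) (k := k) (by have := B.hkn; omega); linarith
lemma one_sub_q_ge (B : RB β n k x w L Y u) : L * Real.exp (-(2 * w)) ≤ 1 - interProb n k := by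
  have h1 : L + 1 ≤ Real.exp L := Real.add_one_le_exp L
  have h2 : L * Real.exp (-L) ≤ 1 - Real.exp (-L) := by
    have : Real.exp L * Real.exp (-L) = 1 := by rw [← Real.exp_add]; simp
    nlinarith [Real.exp_pos (-L)]
  rw [B.hq]
  refine le_trans ?_ h2
  exact mul_le_mul_of_nonneg_left (Real.exp_le_exp.2 (by linarith [B.hL])) B.hL0.le
lemma qpow (B : RB β n k x w L Y u) (m : ℕ) : interProb n k ^ m = Real.exp (-(L * m)) := by
  rw [B.hq, ← Real.exp_nat_mul]; congr 1; ring
lemma qipow (B : RB β n k x w L Y u) (m : ℕ) : (interProb n k)⁻¹ ^ m = Real.exp (L * m) := by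
  rw [B.hq, ← Real.exp_neg, ← Real.exp_nat_mul]; congr 1; ring
lemma mubar_eq (B : RB β n k x w L Y u) (p : ℝ) : mubar n k p = phi n k p * Real.exp Y := by
  have h1 := B.hkY
  have hk : (0:ℝ) < k := by have := B.hk; exact_mod_cast (by omega)
  have hn : (0:ℝ) < n := by have := B.hkn; exact_mod_cast (by omega)
  have : (n:ℝ) / k = Real.exp Y := by
    rw [← inv_div, h1, Real.exp_neg, inv_inv]
  unfold mubar
  rw [mul_div_assoc, this]
lemma k_eq (B : RB β n k x w L Y u) : (k:ℝ) = Real.exp (x - Y) := by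
  have hn : (0:ℝ) < n := by have := B.hkn; exact_mod_cast (by omega)
  have h1 := B.hkY
  rw [div_eq_iff hn.ne'] at h1
  rw [h1, B.hn, ← Real.exp_add]; congr 1; ring
lemma k2n (B : RB β n k x w L Y u) : (k:ℝ) ^ 2 / n ≤ Real.exp (2 * w) := by
  rw [B.k_eq, B.hn, ← Real.exp_nat_mul, ← Real.exp_sub]
  apply Real.exp_le_exp.2
  have := B.hY1; push_cast; linarith
lemma uq (B : RB β n k x w L Y u) : u * (1 - interProb n k) ≤ Real.exp w := by
  have h1 := mul_le_mul_of_nonneg_left B.one_sub_q_le B.u_pos.le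
  rw [B.huL] at h1
  have := B.Y_le; have := B.hxw; have := B.x_pos
  linarith
lemma u_le_n (B : RB β n k x w L Y u) : u ≤ Real.exp (x / 4) := by
  refine B.hu.trans (Real.exp_le_exp.2 ?_)
  have := B.w_pos; linarith

/-- parameters -/
lemma l_bd (B : RB β n k x w L Y u) :
    Real.exp (10 ^ 8 * w) ≤ (⌈Real.exp (10 ^ 8 * w)⌉₊ : ℝ) ∧
    (⌈Real.exp (10 ^ 8 * w)⌉₊ : ℝ) + 1 ≤ Real.exp (10 ^ 8 * w + w) := by
  refine ⟨Nat.le_ceil _, ?_⟩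
  have h1 := Nat.ceil_lt_add_one (Real.exp_nonneg (10 ^ 8 * w))
  have h2 : 1 ≤ Real.exp (10 ^ 8 * w) := Real.one_le_exp (by have := B.w_pos; positivity)
  rw [Real.exp_add]
  have h3 := B.exp_w_big
  nlinarith

lemma D_bd (B : RB β n k x w L Y u) :
    Real.exp (2000 * w) * u ≤ (⌈Real.exp (2000 * w) * u⌉₊ : ℝ) ∧
    (⌈Real.exp (2000 * w) * u⌉₊ : ℝ) ≤ Real.exp (2001 * w) * u := by
  refine ⟨Nat.le_ceil _, ?_⟩
  have h0 := B.u_pos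
  have h1 := Nat.ceil_lt_add_one (a := Real.exp (2000 * w) * u) (by positivity)
  have h2 : 1 ≤ Real.exp (2000 * w) := Real.one_le_exp (by have := B.w_pos; positivity)
  have h3 := B.exp_w_big
  have h4 : Real.exp (2001 * w) = Real.exp (2000 * w) * Real.exp w := by
    rw [← Real.exp_add]; congr 1; ring
  have h5 := B.u_big
  rw [h4]
  have h6 : 1 ≤ Real.exp (2000 * w) * u := by nlinarith
  nlinarith

lemma r_bd (B : RB β n k x w L Y u) :
    β / 10 * u ≤ (⌈β / 10 * u⌉₊ : ℝ) ∧ (⌈β / 10 * u⌉₊ : ℝ) ≤ β / 10 * u + 1 ∧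
    (⌈β / 10 * u⌉₊ : ℝ) ≤ u / 500 := by
  have h0 := B.u_pos
  have hβ := B.hβ0
  have h1 := Nat.ceil_lt_add_one (a := β / 10 * u) (by positivity)
  refine ⟨Nat.le_ceil _, h1.le, ?_⟩
  have h2 := B.hβ1
  have h3 := B.u_big
  nlinarith

lemma L_r (B : RB β n k x w L Y u) : L * (⌈β / 10 * u⌉₊ : ℝ) ≤ 10 ^ 8 * w := by
  have h1 := B.r_bd.2.1
  have h2 := B.hL0
  have h3 := B.huL
  have h4 := B.βx
  have h5 := B.Y_le
  have h6 := B.hL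
  have hβ := B.hβ0
  have h7 := B.w_pos
  have : L * (⌈β / 10 * u⌉₊ : ℝ) ≤ L * (β / 10 * u + 1) := mul_le_mul_of_nonneg_left h1 h2.le
  have h8 : L * (β / 10 * u + 1) = β / 10 * Y + L := by rw [← h3]; ring
  have h9 : β / 10 * Y ≤ β / 10 * (0.51 * x) := mul_le_mul_of_nonneg_left h5 (by positivity)
  nlinarith

lemma b_bd (B : RB β n k x w L Y u) :
    (⌊1.001 * u⌋₊ : ℝ) ≤ 1.001 * u ∧ 1.001 * u ≤ (⌊1.001 * u⌋₊ : ℝ) + 1 := by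
  have h0 := B.u_pos
  exact ⟨Nat.floor_le (by positivity), (Nat.lt_floor_add_one _).le⟩

lemma FB_le (B : RB β n k x w L Y u) {l h s : ℕ} {c Hh : ℝ} (hl : (l:ℝ) + 1 ≤ Real.exp (10 ^ 8 * w + w))
    (hs : (s:ℝ) ≤ Real.exp c * u) (hh : L * h ≤ Hh) :
    FB n k l h s ≤ Real.exp (Real.exp (-(x / 4) + 2 * c + Hh - 8 * 10 ^ 8 * w)) := by
  unfold FB
  apply Real.exp_le_exp.2
  rw [B.qipow, B.hkY]
  have hu := B.u_pos
  have hq0 := B.one_sub_q_nonneg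
  have h1 : (1 - interProb n k) * (s:ℝ) ^ 2 ≤ Real.exp w * (Real.exp (2 * c) * Real.exp (x / 4 - 10 ^ 9 * w)) := by
    calc (1 - interProb n k) * (s:ℝ) ^ 2 ≤ (1 - interProb n k) * (Real.exp c * u) ^ 2 := by gcongr
      _ = (u * (1 - interProb n k)) * (Real.exp (2 * c) * u) := by
          have : Real.exp (2 * c) = Real.exp c ^ 2 := by rw [← Real.exp_nat_mul]; norm_num
          rw [this]; ring
      _ ≤ _ := by
          have := B.uq
          have := B.hu
          gcongr
  calc Real.exp (-Y) * (1 - interProb n k) * Real.exp (L * h) * (((l:ℝ) + 1) * s ^ 2)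
      = Real.exp (-Y) * Real.exp (L * h) * ((l:ℝ) + 1) * ((1 - interProb n k) * (s:ℝ) ^ 2) := by ring
    _ ≤ Real.exp (-Y) * Real.exp Hh * Real.exp (10 ^ 8 * w + w) *
        (Real.exp w * (Real.exp (2 * c) * Real.exp (x / 4 - 10 ^ 9 * w))) := by
        have := Real.exp_le_exp.2 hh
        have h2 : 0 ≤ (1 - interProb n k) * (s:ℝ) ^ 2 := by positivity
        gcongr
    _ = Real.exp (-Y + Hh + (10 ^ 8 * w + w) + (w + (2 * c + (x / 4 - 10 ^ 9 * w)))) := by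
        simp only [Real.exp_add]
    _ ≤ _ := by
        apply Real.exp_le_exp.2
        have := B.hY1; have := B.w_pos
        linarith

lemma exp_exp_le_two (B : RB β n k x w L Y u) {E : ℝ} (hE : E ≤ -w) : Real.exp (Real.exp E) ≤ 2 := by
  have h1 : Real.exp E ≤ Real.exp (-w) := Real.exp_le_exp.2 hE
  have h2 : Real.exp (-w) ≤ 1 / 2 := by
    rw [Real.exp_neg, inv_le_comm₀ (Real.exp_pos _) (by norm_num)]
    have := B.exp_w_big; linarith
  calc Real.exp (Real.exp E) ≤ Real.exp (Real.log 2) := by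
        apply Real.exp_le_exp.2
        have := Real.log_two_gt_d9
        linarith
    _ = 2 := Real.exp_log (by norm_num)

end RB

lemma choose_two_add (d r : ℕ) : (d + r).choose 2 = d.choose 2 + (d * r + r.choose 2) := by
  induction r with
  | zero => simp
  | succ r ih =>
    rw [← add_assoc, Nat.choose_succ_succ' (d + r) 1, ih, Nat.choose_succ_succ' r 1,
      Nat.choose_one_right, Nat.choose_one_right]
    ring

/-- algebra for S1 -/
lemma S1_alg {μ e q F : ℝ} (hq : q ≠ 0) (d r : ℕ) :
    (μ * e) ^ d / d.factorial * ((μ * F) ^ r * q ^ (d * r + r.choose 2) / r.factorial) =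
      (μ ^ (d + r) * q ^ (d + r).choose 2 / (d + r).factorial) * (d + r).choose d * (e ^ d * q⁻¹ ^ d.choose 2) * F ^ r := by
  have h1 : (((d + r).choose d : ℕ) : ℝ) * d.factorial * r.factorial = (d + r).factorial := by
    rw [Nat.choose_symm_add]
    exact_mod_cast Nat.add_choose_mul_factorial_mul_factorial d r
  have hd : (d.factorial : ℝ) ≠ 0 := by exact_mod_cast Nat.factorial_ne_zero d
  have hr : (r.factorial : ℝ) ≠ 0 := by exact_mod_cast Nat.factorial_ne_zero r
  have hdr : ((d + r).factorial : ℝ) ≠ 0 := by exact_mod_cast Nat.factorial_ne_zero _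
  have h2 : (((d + r).choose d : ℕ) : ℝ) / (d + r).factorial = 1 / (d.factorial * r.factorial) := by
    rw [div_eq_div_iff hdr (mul_ne_zero hd hr), ← h1]; ring
  have h3 : q ^ (d + r).choose 2 * q⁻¹ ^ d.choose 2 = q ^ (d * r + r.choose 2) := by
    rw [choose_two_add, pow_add, inv_pow]
    field_simp
  calc _ = μ ^ (d + r) * e ^ d * F ^ r * q ^ (d * r + r.choose 2) * (1 / (d.factorial * r.factorial)) := by
        rw [mul_pow, mul_pow, pow_add μ d r]; field_simp
    _ = _ := by rw [← h2, ← h3]; ring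

end
end EKRP

namespace EKRP
noncomputable section

/-- the simplified first-moment quantity -/
def Lt (n k : ℕ) (p : ℝ) (t : ℕ) : ℝ := mubar n k p ^ t * interProb n k ^ t.choose 2 / t.factorial

namespace RB
variable {β : ℝ} {n k : ℕ} {x w L Y u p : ℝ}

lemma num_hw (B : RB β n k x w L Y u) {l D r : ℕ} (hl : (l:ℝ) + 1 ≤ Real.exp (10 ^ 8 * w + w))
    (hD : (D:ℝ) ≤ Real.exp (2001 * w) * u) (hr : (r:ℝ) ≤ u / 500) :
    k * ((l + 1) * (D + r) ^ 2 + 2) ≤ n := by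
  have hx := B.x_ge
  have hw := B.w_pos
  have hu := B.u_pos
  have h1 : (D:ℝ) + r ≤ Real.exp (2002 * w) * u := by
    have : Real.exp (2002 * w) = Real.exp (2001 * w) * Real.exp w := by
      rw [← Real.exp_add]; congr 1; ring
    rw [this]
    have h2 := B.exp_w_big
    have h3 : 1 ≤ Real.exp (2001 * w) := Real.one_le_exp (by positivity)
    nlinarith [mul_pos hu (Real.exp_pos (2001 * w))]
  have h2 : ((D:ℝ) + r) ^ 2 ≤ Real.exp (4004 * w + x / 2 - 2 * 10 ^ 9 * w) := by
    calc ((D:ℝ) + r) ^ 2 ≤ (Real.exp (2002 * w) * Real.exp (x / 4 - 10 ^ 9 * w)) ^ 2 := by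
          have := B.hu
          gcongr
          exact h1.trans (by gcongr)
      _ = _ := by rw [← Real.exp_add, ← Real.exp_nat_mul]; congr 1; push_cast; ring
  have h3 : ((l:ℝ) + 1) * ((D:ℝ) + r) ^ 2 ≤ Real.exp (x / 2 - 10 ^ 9 * w) := by
    calc _ ≤ Real.exp (10 ^ 8 * w + w) * Real.exp (4004 * w + x / 2 - 2 * 10 ^ 9 * w) := by gcongr
      _ ≤ _ := by
        rw [← Real.exp_add]; apply Real.exp_le_exp.2; linarith
  have h4 : (2:ℝ) ≤ Real.exp (x / 2 - 10 ^ 9 * w) := by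
    have := Real.add_one_le_exp (x / 2 - 10 ^ 9 * w)
    have := B.hw0
    linarith
  have h5 : (k:ℝ) * (((l:ℝ) + 1) * ((D:ℝ) + r) ^ 2 + 2) ≤ n := by
    calc (k:ℝ) * (((l:ℝ) + 1) * ((D:ℝ) + r) ^ 2 + 2) ≤ Real.exp (x - Y) * (2 * Real.exp (x / 2 - 10 ^ 9 * w)) := by
          rw [B.k_eq]; gcongr; linarith
      _ ≤ Real.exp (x - Y) * (Real.exp w * Real.exp (x / 2 - 10 ^ 9 * w)) := by
          have := B.exp_w_big
          gcongr; linarith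
      _ ≤ Real.exp x := by
          rw [← Real.exp_add, ← Real.exp_add]; apply Real.exp_le_exp.2
          have := B.hY1; linarith
      _ = n := B.hn.symm
  exact_mod_cast h5

lemma phi_le' (B : RB β n k x w L Y u) (hφ : phi n k p ≤ Real.exp (1000 * w) * u) :
    phi n k p ≤ Real.exp (x / 4) := by
  refine hφ.trans ?_
  calc Real.exp (1000 * w) * u ≤ Real.exp (1000 * w) * Real.exp (x / 4 - 10 ^ 9 * w) := by
        have := B.hu; gcongr
    _ ≤ _ := by
        rw [← Real.exp_add]; apply Real.exp_le_exp.2; have := B.w_pos; linarith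

lemma num_g1 (B : RB β n k x w L Y u) (h0 : 0 ≤ p) (hφ : phi n k p ≤ Real.exp (1000 * w) * u) :
    (n:ℝ) ^ 2 * (phi n k p * (k / n)) ^ (11 + 1) ≤ Real.exp (-w) := by
  have h1 := B.phi_le' hφ
  have hp := phi_nonneg (n := n) (k := k) h0
  rw [B.hn, ← B.hn, B.hkY, B.hn]
  calc Real.exp x ^ 2 * (phi n k p * Real.exp (-Y)) ^ (11 + 1)
      ≤ Real.exp x ^ 2 * (Real.exp (x / 4) * Real.exp (-Y)) ^ (11 + 1) := by gcongr
    _ = Real.exp (2 * x + 12 * (x / 4 - Y)) := by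
        rw [← Real.exp_add, ← Real.exp_nat_mul, ← Real.exp_nat_mul, ← Real.exp_add]
        congr 1
    _ ≤ _ := by
        apply Real.exp_le_exp.2
        have := B.hY1; have := B.x_ge; have := B.w_pos
        linarith

lemma num_g2 (B : RB β n k x w L Y u) (h0 : 0 ≤ p) (hφ : phi n k p ≤ Real.exp (1000 * w) * u) {l : ℕ}
    (hl : Real.exp (10 ^ 8 * w) ≤ l) :
    mubar n k p ^ 2 * (((k:ℝ) ^ 2 / n) ^ (l + 1) / (l + 1).factorial) ≤ Real.exp (-w) := by
  have h1 := B.phi_le' hφ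
  have hp := phi_nonneg (n := n) (k := k) h0
  have hw := B.w_pos
  have hx := B.x_pos
  have hμ : mubar n k p ≤ Real.exp x := by
    rw [B.mubar_eq]
    calc _ ≤ Real.exp (x / 4) * Real.exp Y := by gcongr
      _ ≤ _ := by
        rw [← Real.exp_add]; apply Real.exp_le_exp.2; have := B.Y_le; linarith
  have hμ0 := mubar_nonneg (n := n) (k := k) h0
  have h2 : ((k:ℝ) ^ 2 / n) ^ (l + 1) / (l + 1).factorial ≤ (Real.exp (-w)) ^ (l + 1) := by
    refine (pow_div_fact_le (by positivity) (by omega)).trans ?_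
    gcongr
    rw [div_le_iff₀ (by positivity)]
    calc Real.exp 1 * ((k:ℝ) ^ 2 / n) ≤ Real.exp 1 * Real.exp (2 * w) := by gcongr; exact B.k2n
      _ ≤ Real.exp (-w) * Real.exp (10 ^ 8 * w) := by
        rw [← Real.exp_add, ← Real.exp_add]; apply Real.exp_le_exp.2; have := B.hw0; linarith
      _ ≤ _ := by push_cast; gcongr; linarith
  have h3 : 4 * x ≤ (l:ℝ) := by
    refine le_trans ?_ hl
    calc 4 * x ≤ Real.exp w * Real.exp w := by
          have := B.hxw; have := B.exp_w_big; gcongr; linarith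
      _ ≤ _ := by rw [← Real.exp_add]; apply Real.exp_le_exp.2; linarith
  calc _ ≤ Real.exp x ^ 2 * Real.exp (-w) ^ (l + 1) := by gcongr
    _ = Real.exp (2 * x - w * (l + 1)) := by
        rw [← Real.exp_nat_mul, ← Real.exp_nat_mul, ← Real.exp_add]; congr 1; push_cast; ring
    _ ≤ _ := by
        apply Real.exp_le_exp.2
        have := B.hw0
        nlinarith

lemma num_g3 (B : RB β n k x w L Y u) (h0 : 0 ≤ p) (hφ : phi n k p ≤ Real.exp (1000 * w) * u) {D : ℕ}
    (hD : Real.exp (2000 * w) * u ≤ D) :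
    (n:ℝ) * (phi n k p ^ (D + 1) / (D + 1).factorial) ≤ Real.exp (-w) := by
  have hp := phi_nonneg (n := n) (k := k) h0
  have hw := B.w_pos
  have hw0 := B.hw0
  have hx := B.x_pos
  have hu := B.u_pos
  have h2 : phi n k p ^ (D + 1) / (D + 1).factorial ≤ (Real.exp (-(999 * w))) ^ (D + 1) := by
    refine (pow_div_fact_le hp (by omega)).trans ?_
    gcongr
    rw [div_le_iff₀ (by positivity)]
    calc Real.exp 1 * phi n k p ≤ Real.exp 1 * (Real.exp (1000 * w) * u) := by gcongr
      _ = Real.exp (1 + 1000 * w) * u := by rw [Real.exp_add]; ring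
      _ ≤ Real.exp (-(999 * w) + 2000 * w) * u := by
          exact mul_le_mul_of_nonneg_right (Real.exp_le_exp.2 (by linarith)) hu.le
      _ = Real.exp (-(999 * w)) * (Real.exp (2000 * w) * u) := by rw [Real.exp_add]; ring
      _ ≤ _ := by push_cast; gcongr; linarith
  have h3 : u ≤ D := by
    refine le_trans ?_ hD
    have : 1 ≤ Real.exp (2000 * w) := Real.one_le_exp (by positivity)
    nlinarith
  calc _ ≤ Real.exp x * Real.exp (-(999 * w)) ^ (D + 1) := by rw [B.hn]; gcongr
    _ = Real.exp (x - 999 * w * (D + 1)) := by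
        rw [← Real.exp_nat_mul, ← Real.exp_add]; congr 1; push_cast; ring
    _ ≤ _ := by
        apply Real.exp_le_exp.2
        have := B.uw_ge
        nlinarith

lemma num_G (B : RB β n k x w L Y u) {l a t : ℕ} (h0 : 0 ≤ p)
    (hl : (l:ℝ) + 1 ≤ Real.exp (10 ^ 8 * w + w))
    (ha : L * a ≤ 10 ^ 8 * w) (ht : (t:ℝ) ≤ 4 * u) :
    (mubar n k p * FB n k l a t) ^ t * interProb n k ^ t.choose 2 / t.factorial ≤ 2 * Lt n k p t := by
  have hw := B.w_pos
  have hx := B.x_ge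
  have hμ0 := mubar_nonneg (n := n) (k := k) h0
  have hq := B.q_pos
  have hF := B.FB_le (l := l) (h := a) (s := t) (c := w) hl
    (ht.trans (by have := B.exp_w_big; have := B.u_pos; gcongr; linarith)) ha
  have hF0 : 0 ≤ FB n k l a t := (Real.exp_pos _).le
  have hFt : FB n k l a t ^ t ≤ 2 := by
    calc FB n k l a t ^ t ≤ Real.exp (Real.exp (-(x / 4) + 2 * w + 10 ^ 8 * w - 8 * 10 ^ 8 * w)) ^ t := by gcongr
      _ = Real.exp (t * Real.exp (-(x / 4) + 2 * w + 10 ^ 8 * w - 8 * 10 ^ 8 * w)) := by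
          rw [← Real.exp_nat_mul]
      _ ≤ Real.exp (Real.exp (-w)) := by
          apply Real.exp_le_exp.2
          calc (t:ℝ) * Real.exp (-(x / 4) + 2 * w + 10 ^ 8 * w - 8 * 10 ^ 8 * w)
              ≤ (Real.exp w * Real.exp (x / 4)) * Real.exp (-(x / 4) + 2 * w + 10 ^ 8 * w - 8 * 10 ^ 8 * w) := by
                gcongr
                have := B.exp_w_big; have := B.u_le_n; have := B.u_pos
                refine ht.trans ?_
                gcongr; linarith
            _ ≤ _ := by
                rw [← Real.exp_add, ← Real.exp_add]; apply Real.exp_le_exp.2; linarith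
      _ ≤ 2 := B.exp_exp_le_two le_rfl
  unfold Lt
  rw [mul_pow, mul_div_assoc', div_le_div_iff_of_pos_right (by positivity)]
  have : 0 ≤ mubar n k p ^ t * interProb n k ^ t.choose 2 := by positivity
  calc mubar n k p ^ t * FB n k l a t ^ t * interProb n k ^ t.choose 2
      = FB n k l a t ^ t * (mubar n k p ^ t * interProb n k ^ t.choose 2) := by ring
    _ ≤ _ := by gcongr

/-- combination step for g5 -/
lemma num_g5_aux (B : RB β n k x w L Y u) {d t b : ℕ} {F g : ℝ} (h0 : 0 ≤ p)
    (hd : (d:ℝ) ≤ 1.001 * u) (hdt : d ≤ t) (ht : (t:ℝ) ≤ 4 * u) (hΛ : Lt n k p t ≤ 1)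
    (hb : (b:ℝ) ≤ Real.exp x) (hF0 : 0 ≤ F) (hF : F ≤ Real.exp g)
    (hfin : 2 * x + 4 * u + g * (t - d) - 0.24 * x * d ≤ -w) :
    (n:ℝ) * b * (phi n k p ^ d / d.factorial * ((mubar n k p * F) ^ (t - d) *
      interProb n k ^ (d * (t - d) + (t - d).choose 2) / (t - d).factorial)) ≤ Real.exp (-w) := by
  have hq := B.q_pos
  have hμ0 := mubar_nonneg (n := n) (k := k) h0
  have hφ : phi n k p = mubar n k p * Real.exp (-Y) := by
    rw [B.mubar_eq, mul_assoc, ← Real.exp_add]; simp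
  rw [hφ, S1_alg hq.ne' d (t - d), Nat.add_sub_cancel' hdt]
  change (n:ℝ) * b * (Lt n k p t * _ * _ * _) ≤ _
  have hL0 : 0 ≤ Lt n k p t := by unfold Lt; positivity
  have h1 : ((t.choose d : ℕ) : ℝ) ≤ Real.exp (4 * u) := by
    have : ((t.choose d : ℕ) : ℝ) ≤ (2:ℝ) ^ t := by exact_mod_cast Nat.choose_le_two_pow t d
    refine this.trans ?_
    calc (2:ℝ) ^ t ≤ Real.exp 1 ^ t := by gcongr; have := Real.exp_one_gt_d9; linarith
      _ = Real.exp t := by rw [← Real.exp_nat_mul]; simp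
      _ ≤ _ := Real.exp_le_exp.2 ht
  have h2 : Real.exp (-Y) ^ d * (interProb n k)⁻¹ ^ d.choose 2 ≤ Real.exp (-(0.24 * x * d)) := by
    rw [B.qipow, ← Real.exp_nat_mul, ← Real.exp_add]
    apply Real.exp_le_exp.2
    have h3 : ((d.choose 2 : ℕ) : ℝ) ≤ d * (1.001 * u) / 2 := by
      rw [Nat.cast_choose_two]
      have : (0:ℝ) ≤ d := Nat.cast_nonneg d
      nlinarith
    have h4 := mul_le_mul_of_nonneg_left h3 B.hL0.le
    have h5 : L * ((d:ℝ) * (1.001 * u) / 2) = 0.5005 * d * Y := by rw [← B.huL]; ring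
    have h6 : 0.49 * x * d ≤ Y * d := mul_le_mul_of_nonneg_right B.Y_ge (Nat.cast_nonneg d)
    have h7 : 0 ≤ x * d := mul_nonneg B.x_pos.le (Nat.cast_nonneg d)
    nlinarith
  have h3 : F ^ (t - d) ≤ Real.exp (g * (t - d)) := by
    calc F ^ (t - d) ≤ Real.exp g ^ (t - d) := by gcongr
      _ = _ := by rw [← Real.exp_nat_mul, Nat.cast_sub hdt]; congr 1; ring
  have hqi : 0 ≤ (interProb n k)⁻¹ := by positivity
  calc _ ≤ Real.exp x * Real.exp x * (1 * Real.exp (4 * u) * Real.exp (-(0.24 * x * d)) * Real.exp (g * (t - d))) := by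
        rw [B.hn]; gcongr
    _ = Real.exp (2 * x + 4 * u + g * (t - d) - 0.24 * x * d) := by
        rw [one_mul, ← Real.exp_add, ← Real.exp_add, ← Real.exp_add, ← Real.exp_add]; congr 1; ring
    _ ≤ _ := Real.exp_le_exp.2 hfin

end RB
end
end EKRP

namespace EKRP
noncomputable section

namespace RB
variable {β : ℝ} {n k : ℕ} {x w L Y u p : ℝ}

set_option maxHeartbeats 1000000 in
lemma num_g5 (B : RB β n k x w L Y u) {l a b t : ℕ} (h0 : 0 ≤ p)
    (hl : (l:ℝ) + 1 ≤ Real.exp (10 ^ 8 * w + w)) (ha : β / 10 * u ≤ a) (hb : (b:ℝ) ≤ 1.001 * u)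
    (hbt : b < t) (ht : (t:ℝ) ≤ 4 * u) (hΛ : Lt n k p t ≤ 1) :
    ∀ d ∈ Finset.Icc (a + 1) b, ∃ h m : ℕ, (t + (m + 1) ^ 2 * 11 < (m + 1) * (h + 1) ∨ d ≤ h) ∧
      (n:ℝ) * b * (phi n k p ^ d / d.factorial * ((mubar n k p * ((1 + (k:ℝ) / n * (interProb n k)⁻¹ ^ d) ^ m *
        FB n k l h t)) ^ (t - d) * interProb n k ^ (d * (t - d) + (t - d).choose 2) / (t - d).factorial))
        ≤ Real.exp (-w) := by
  intro d hd
  rw [Finset.mem_Icc] at hd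
  have hw := B.w_pos
  have hw0 := B.hw0
  have hx := B.x_ge
  have hxb := B.x_big
  have hu := B.u_pos
  have hub := B.u_big
  have huw := B.uw_ge
  have hdb : (d:ℝ) ≤ b := by exact_mod_cast hd.2
  have hda : (a:ℝ) + 1 ≤ d := by exact_mod_cast hd.1
  have hd1 : (d:ℝ) ≤ 1.001 * u := hdb.trans hb
  have hdt : d ≤ t := by omega
  have hb' : (b:ℝ) ≤ Real.exp x := by
    have h1 := B.u_le_n
    have h2 : Real.exp (x / 4) * Real.exp w ≤ Real.exp x := by
      rw [← Real.exp_add]; exact Real.exp_le_exp.2 (by linarith)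
    have h3 := B.exp_w_big
    have := Real.exp_pos (x / 4)
    nlinarith
  have hts : (t:ℝ) ≤ Real.exp w * u := by
    have := B.exp_w_big
    refine ht.trans (by gcongr; linarith)
  have hLd : L * d ≤ 1.001 * Y := by
    rw [← B.huL]; have := B.hL0; nlinarith
  by_cases hc : (d:ℝ) ≤ u / 2
  · refine ⟨d, 0, Or.inr le_rfl, ?_⟩
    have hF := B.FB_le (h := d) (s := t) (c := w) (Hh := Y / 2) hl hts
      (by rw [← B.huL]; have := B.hL0; nlinarith)
    have hF2 : FB n k l d t ≤ Real.exp 1 := by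
      refine (hF.trans (B.exp_exp_le_two (by have := B.hY2; linarith))).trans ?_
      have := Real.exp_one_gt_d9; linarith
    have hF0 : 0 ≤ FB n k l d t := (Real.exp_pos _).le
    rw [pow_zero, one_mul]
    refine B.num_g5_aux h0 hd1 hdt ht hΛ hb' hF0 hF2 ?_
    have h1 : β * x * u / 10 ≤ x * d := by
      have := mul_le_mul_of_nonneg_left (ha.trans (by linarith : (a:ℝ) ≤ d)) B.x_pos.le
      linarith
    rw [B.βx] at h1
    have hd0 : (0:ℝ) ≤ d := Nat.cast_nonneg d
    nlinarith
  · push Not at hc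
    refine ⟨⌊u / 3⌋₊, 15, Or.inl ?_, ?_⟩
    · have h1 := (Nat.lt_floor_add_one (u / 3)).le
      have : (t:ℝ) + (15 + 1) ^ 2 * 11 < (15 + 1) * ((⌊u / 3⌋₊ : ℝ) + 1) := by
        linarith
      exact_mod_cast this
    · have hfl : (⌊u / 3⌋₊ : ℝ) ≤ u / 3 := Nat.floor_le (by positivity)
      have hF := B.FB_le (h := ⌊u / 3⌋₊) (s := t) (c := w) (Hh := Y / 3) hl hts
        (by rw [← B.huL]; have := B.hL0; nlinarith)
      have hF2 : FB n k l ⌊u / 3⌋₊ t ≤ Real.exp 1 := by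
        refine (hF.trans (B.exp_exp_le_two (by have := B.hY2; linarith))).trans ?_
        have := Real.exp_one_gt_d9; linarith
      have hF0 : 0 ≤ FB n k l ⌊u / 3⌋₊ t := (Real.exp_pos _).le
      have h1 : 1 + (k:ℝ) / n * (interProb n k)⁻¹ ^ d ≤ Real.exp (0.001 * Y + 1) := by
        rw [B.qipow, B.hkY, ← Real.exp_add]
        have h2 : Real.exp (-Y + L * d) ≤ Real.exp (0.001 * Y) := Real.exp_le_exp.2 (by linarith)
        have h3 : 1 ≤ Real.exp (0.001 * Y) := Real.one_le_exp (by have := B.Y_pos; positivity)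
        have h4 := Real.exp_add (0.001 * Y) 1
        have := Real.exp_one_gt_d9
        rw [h4]
        nlinarith
      have h10 : 0 ≤ 1 + (k:ℝ) / n * (interProb n k)⁻¹ ^ d := by
        have := B.q_pos
        positivity
      have h4 : (1 + (k:ℝ) / n * (interProb n k)⁻¹ ^ d) ^ 15 * FB n k l ⌊u / 3⌋₊ t ≤ Real.exp (0.015 * Y + 16) := by
        calc _ ≤ Real.exp (0.001 * Y + 1) ^ 15 * Real.exp 1 := by gcongr
          _ = _ := by
            rw [← Real.exp_nat_mul, ← Real.exp_add]; congr 1; push_cast; ring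
      refine B.num_g5_aux h0 hd1 hdt ht hΛ hb' (by positivity) h4 ?_
      have hY := B.Y_le
      have hYp := B.Y_pos
      have htd : (t:ℝ) - d ≤ 3.5 * u := by linarith
      have h5 : (0.015 * Y + 16) * ((t:ℝ) - d) ≤ (0.008 * x) * (3.5 * u) := by
        calc _ ≤ (0.015 * Y + 16) * (3.5 * u) := by gcongr
          _ ≤ _ := by gcongr; linarith
      have h6 : x * (u / 2) ≤ x * d := mul_le_mul_of_nonneg_left hc.le B.x_pos.le
      nlinarith

set_option maxHeartbeats 1000000 in
lemma num_g6 (B : RB β n k x w L Y u) {l b r₀ : ℕ} (h0 : 0 ≤ p)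
    (hφ : phi n k p ≤ Real.exp (1000 * w) * u)
    (hl : (l:ℝ) + 1 ≤ Real.exp (10 ^ 8 * w + w)) (hb : (b:ℝ) ≤ 1.001 * u) (hb2 : 1.001 * u ≤ (b:ℝ) + 1)
    (hr1 : β / 10 * u ≤ r₀) (hr2 : (r₀:ℝ) ≤ u / 500) (hr3 : L * r₀ ≤ 10 ^ 8 * w) :
    (n:ℝ) * (phi n k p ^ (b + 1) / (b + 1).factorial *
      ((mubar n k p * interProb n k ^ (b + 1) * FB n k l (11 + r₀) (b + 1 + r₀)) ^ r₀ / r₀.factorial))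
      ≤ Real.exp (-w) := by
  have hp := phi_nonneg (n := n) (k := k) h0
  have hw := B.w_pos
  have hw0 := B.hw0
  have hx := B.x_ge
  have hxb := B.x_big
  have hu := B.u_pos
  have hub := B.u_big
  have huw := B.uw_ge
  have hβ := B.hβ0
  have hβu := B.βu_ge
  have hr0 : (0:ℝ) < r₀ := by nlinarith
  have hr0' : 1 ≤ r₀ := by exact_mod_cast hr0
  have hew := B.exp_w_big
  have h1 : phi n k p ^ (b + 1) / (b + 1).factorial ≤ Real.exp (1012 * (w * u)) := by
    refine (pow_div_fact_le hp (by omega)).trans ?_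
    have h2 : Real.exp 1 * phi n k p / ((b + 1 : ℕ) : ℝ) ≤ Real.exp (1001 * w) := by
      rw [div_le_iff₀ (by positivity)]
      calc Real.exp 1 * phi n k p ≤ Real.exp 1 * (Real.exp (1000 * w) * u) := by gcongr
        _ = Real.exp (1 + 1000 * w) * u := by rw [Real.exp_add]; ring
        _ ≤ Real.exp (1001 * w) * u :=
            mul_le_mul_of_nonneg_right (Real.exp_le_exp.2 (by linarith)) hu.le
        _ ≤ _ := by push_cast; gcongr; linarith
    calc _ ≤ Real.exp (1001 * w) ^ (b + 1) := by gcongr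
      _ = Real.exp (1001 * w * (b + 1)) := by
          rw [← Real.exp_nat_mul]; congr 1; push_cast; ring
      _ ≤ _ := by
          apply Real.exp_le_exp.2
          have : (b:ℝ) + 1 ≤ 1.01 * u := by linarith
          nlinarith [mul_le_mul_of_nonneg_left this hw.le]
  have hF := B.FB_le (h := 11 + r₀) (s := b + 1 + r₀) (c := w) (Hh := 22 * w + 10 ^ 8 * w) hl
    (by
      push_cast
      calc (b:ℝ) + 1 + r₀ ≤ 4 * u := by linarith
        _ ≤ _ := by gcongr; linarith)
    (by push_cast; have := B.hL; nlinarith)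
  have hF2 := hF.trans (B.exp_exp_le_two (by linarith))
  have hF0 : 0 ≤ FB n k l (11 + r₀) (b + 1 + r₀) := (Real.exp_pos _).le
  have hq := B.q_pos
  have hμ0 := mubar_nonneg (n := n) (k := k) h0
  have h3 : mubar n k p * interProb n k ^ (b + 1) ≤ Real.exp (1000 * w) * u * Real.exp (-(0.001 * Y)) := by
    rw [B.mubar_eq, B.qpow, mul_assoc, ← Real.exp_add]
    have : Y + -(L * ((b + 1 : ℕ) : ℝ)) ≤ -(0.001 * Y) := by
      have h4 := mul_le_mul_of_nonneg_left hb2 B.hL0.le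
      have h5 : L * (1.001 * u) = 1.001 * Y := by rw [← B.huL]; ring
      push_cast
      linarith
    have h6 := Real.exp_le_exp.2 this
    exact mul_le_mul hφ h6 (Real.exp_pos _).le (by positivity)
  have h7 : u ≤ Real.exp w * r₀ := by
    have h8 : u ≤ 10 * (1 / β) * r₀ := by
      rw [mul_one_div, div_mul_eq_mul_div, le_div_iff₀ hβ]
      linarith
    refine h8.trans ?_
    gcongr
    have h9 := Real.quadratic_le_exp_of_nonneg hw.le
    have := B.hβw
    nlinarith
  have h10 : (mubar n k p * interProb n k ^ (b + 1) * FB n k l (11 + r₀) (b + 1 + r₀)) ^ r₀ / r₀.factorial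
      ≤ Real.exp (-(40000 * (w * u))) := by
    refine (pow_div_fact_le (by positivity) hr0').trans ?_
    have h11 : Real.exp 1 * (mubar n k p * interProb n k ^ (b + 1) * FB n k l (11 + r₀) (b + 1 + r₀)) / r₀ ≤
        Real.exp (-(0.0004 * x)) := by
      rw [div_le_iff₀ hr0]
      calc _ ≤ Real.exp 1 * (Real.exp (1000 * w) * (Real.exp w * r₀) * Real.exp (-(0.001 * Y)) * Real.exp w) := by
            have h3' : mubar n k p * interProb n k ^ (b + 1) ≤
                Real.exp (1000 * w) * (Real.exp w * r₀) * Real.exp (-(0.001 * Y)) :=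
              h3.trans (by gcongr)
            exact mul_le_mul_of_nonneg_left (mul_le_mul h3' (by linarith) hF0 (by positivity)) (Real.exp_pos _).le
        _ = Real.exp (1 + 1002 * w - 0.001 * Y) * r₀ := by
            have : (1 + 1002 * w - 0.001 * Y) = 1 + 1000 * w + w + (-(0.001 * Y)) + w := by ring
            rw [this, Real.exp_add, Real.exp_add, Real.exp_add, Real.exp_add]; ring
        _ ≤ _ := mul_le_mul_of_nonneg_right (Real.exp_le_exp.2 (by have := B.Y_ge; linarith)) hr0.le
    calc _ ≤ Real.exp (-(0.0004 * x)) ^ r₀ := by gcongr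
      _ = Real.exp (-(0.0004 * x) * r₀) := by
          rw [← Real.exp_nat_mul]; congr 1; ring
      _ ≤ _ := by
          apply Real.exp_le_exp.2
          have := mul_le_mul_of_nonneg_left hr1 B.x_pos.le
          have h12 : x * (β / 10 * u) = 10 ^ 8 * (w * u) := by
            have := B.βx
            calc x * (β / 10 * u) = (β * x) * u / 10 := by ring
              _ = _ := by rw [this]; ring
          linarith
  calc _ ≤ Real.exp x * (Real.exp (1012 * (w * u)) * Real.exp (-(40000 * (w * u)))) := by
        rw [B.hn]; gcongr
    _ = Real.exp (x + 1012 * (w * u) - 40000 * (w * u)) := by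
        rw [← Real.exp_add, ← Real.exp_add]; congr 1; ring
    _ ≤ _ := by
        apply Real.exp_le_exp.2
        have : w ≤ w * u := by nlinarith
        nlinarith

/-- all conditions but g7 -/
lemma core (B : RB β n k x w L Y u) {f τ t : ℕ} (h0 : 0 ≤ p) (h1 : p ≤ 1)
    (hφ : phi n k p ≤ Real.exp (1000 * w) * u) (htτ : t ≤ τ) (ht0 : 1.01 * u ≤ t) (ht : (t:ℝ) ≤ 4 * u)
    (hΛ : Lt n k p t ≤ 1)
    (g7 : ∀ l D r : ℕ, (l:ℝ) + 1 ≤ Real.exp (10 ^ 8 * w + w) → (D:ℝ) ≤ Real.exp (2001 * w) * u → 1 ≤ r →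
      (r:ℝ) ≤ u / 500 → L * r ≤ 10 ^ 8 * w →
      (n:ℝ) * (binomProbGe ((n - 1).choose (k - 1)) p (τ - r) * (3 * (D:ℝ) ^ (f * r)) *
        ((mubar n k p * interProb n k ^ (τ - r) * FB n k l (11 + r) (D + r)) ^ r / r.factorial)) ≤
        Real.exp (-w) * (1 / 2) ^ r) :
    hprob n k p (Bad f τ) ≤ 6 * Real.exp (-w) + 2 * Lt n k p t := by
  have hw := B.w_pos
  have hu := B.u_pos
  have hub := B.u_big
  obtain ⟨l1, l2⟩ := B.l_bd
  obtain ⟨D1, D2⟩ := B.D_bd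
  obtain ⟨r1, _, r2⟩ := B.r_bd
  obtain ⟨b1, b2⟩ := B.b_bd
  have r3 := B.L_r
  set l := ⌈Real.exp (10 ^ 8 * w)⌉₊
  set D := ⌈Real.exp (2000 * w) * u⌉₊
  set r₀ := ⌈β / 10 * u⌉₊
  set b := ⌊1.001 * u⌋₊
  have hbt : b < t := by
    have : (b:ℝ) < t := by linarith
    exact_mod_cast this
  have hDu : 10 * u ≤ D := by
    refine le_trans ?_ D1
    gcongr
    have := Real.add_one_le_exp (2000 * w); have := B.hw0
    linarith
  have htD : t ≤ D := by
    have : (t:ℝ) ≤ D := by linarith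
    exact_mod_cast this
  refine le_trans (bad_prob (l := l) (K := 11) (D := D) (t := t) (a := r₀) (b := b) (r₀ := r₀) (θ := Real.exp (-w))
    (by have := B.hk; omega) (by have := B.hkn; omega) B.q_pos h0 h1 (Real.exp_pos _).le htτ hbt
    (by omega) (by omega) (by omega) (B.num_hw l2 D2 r2) (B.num_g1 h0 hφ) (B.num_g2 h0 hφ l1)
    (B.num_g3 h0 hφ D1) (B.num_g5 h0 l2 r1 b1 hbt ht hΛ) (B.num_g6 h0 hφ l2 b1 b2 r1 r2 r3) ?_) ?_
  · intro r hr
    rw [Finset.mem_Ico] at hr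
    have hrr : (r:ℝ) ≤ r₀ := by exact_mod_cast hr.2.le
    have := B.hL0
    exact g7 l D r l2 D2 hr.1 (hrr.trans r2) (le_trans (by gcongr) r3)
  · have := B.num_G (l := l) (a := r₀) (t := t) h0 l2 r3 ht
    linarith

end RB
end
end EKRP

namespace EKRP
noncomputable section

lemma two_choose_two (t : ℕ) : t.choose 2 * 2 = (t - 1) * t := by
  rw [Nat.choose_two_right, mul_comm (t - 1) t]
  exact Nat.div_mul_cancel (Nat.even_mul_pred_self t).two_dvd

namespace RB
variable {β : ℝ} {n k : ℕ} {x w L Y u p : ℝ}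

lemma mu_q (B : RB β n k x w L Y u) {t : ℕ} (ht : 1 ≤ t) (h0 : 0 ≤ p) (hΛ : Lt n k p t ≤ 1) :
    mubar n k p ^ 2 * interProb n k ^ (t - 1) ≤ (t:ℝ) ^ 2 := by
  have hμ0 := mubar_nonneg (n := n) (k := k) h0
  have hq := B.q_pos
  have h1 : mubar n k p ^ t * interProb n k ^ t.choose 2 ≤ (t:ℝ) ^ t := by
    unfold Lt at hΛ
    rw [div_le_one (by positivity)] at hΛ
    exact hΛ.trans (by exact_mod_cast Nat.factorial_le_pow t)
  have h2 : (mubar n k p ^ 2 * interProb n k ^ (t - 1)) ^ t ≤ ((t:ℝ) ^ 2) ^ t := by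
    calc (mubar n k p ^ 2 * interProb n k ^ (t - 1)) ^ t
        = (mubar n k p ^ t * interProb n k ^ t.choose 2) ^ 2 := by
          rw [mul_pow, mul_pow, ← pow_mul, ← pow_mul, ← pow_mul, ← pow_mul, two_choose_two, mul_comm 2 t]
      _ ≤ ((t:ℝ) ^ t) ^ 2 := by gcongr
      _ = _ := by rw [← pow_mul, ← pow_mul, mul_comm]
  exact le_of_pow_le_pow_left₀ (by omega) (by positivity) h2

set_option maxHeartbeats 1000000 in
lemma g7_mid (B : RB β n k x w L Y u) {τ t : ℕ} (h0 : 0 < p) (h1 : p ≤ 1)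
    (hφ2 : Real.exp (-(100 * w)) * u ≤ phi n k p) (ht0 : 1.01 * u ≤ t) (ht : (t:ℝ) ≤ 4 * u) (htτ : t ≤ τ)
    (hΛ : Lt n k p t ≤ 1) (hτ : (τ:ℝ) ≤ 8 * phi n k p + x + 4 * u)
    (hτM : 2 * (τ + 1) ≤ (n - 1).choose (k - 1))
    (hbin : (n:ℝ) * binomProbGe ((n - 1).choose (k - 1)) p (τ + 1) ≤ x) :
    ∀ l D r : ℕ, (l:ℝ) + 1 ≤ Real.exp (10 ^ 8 * w + w) → (D:ℝ) ≤ Real.exp (2001 * w) * u → 1 ≤ r →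
      (r:ℝ) ≤ u / 500 → L * r ≤ 10 ^ 8 * w →
      (n:ℝ) * (binomProbGe ((n - 1).choose (k - 1)) p (τ - r) * (3 * (D:ℝ) ^ (1 * r)) *
        ((mubar n k p * interProb n k ^ (τ - r) * FB n k l (11 + r) (D + r)) ^ r / r.factorial)) ≤
        Real.exp (-w) * (1 / 2) ^ r := by
  intro l D r hl hD hr hr2 hr3
  have hw := B.w_pos
  have hw0 := B.hw0
  have hx := B.x_ge
  have hxp := B.x_pos
  have hu := B.u_pos
  have hub := B.u_big
  have huw := B.uw_ge
  have hew := B.exp_w_big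
  have hq := B.q_pos
  have hφ0 : 0 < phi n k p := lt_of_lt_of_le (by positivity) hφ2
  have hμp : 0 < mubar n k p := by rw [B.mubar_eq]; positivity
  have hquad := Real.quadratic_le_exp_of_nonneg hw.le
  have htp : 1 ≤ t := by
    have : (0:ℝ) < t := by linarith
    exact_mod_cast this
  have hrt : r ≤ t := by
    have : (r:ℝ) ≤ t := by linarith
    exact_mod_cast this
  have hrτ : r ≤ τ := hrt.trans htτ
  -- the ratio
  have hR : 1 + 2 * ((τ + 1 : ℕ) : ℝ) / (p * ((n - 1).choose (k - 1) : ℕ)) ≤ Real.exp (102 * w) := by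
    change 1 + 2 * ((τ + 1 : ℕ) : ℝ) / phi n k p ≤ _
    have h2 : 2 * ((τ + 1 : ℕ) : ℝ) ≤ (16 + Real.exp (101 * w)) * phi n k p := by
      have h3 : Real.exp w * u ≤ Real.exp (101 * w) * phi n k p := by
        calc Real.exp w * u = Real.exp (101 * w) * (Real.exp (-(100 * w)) * u) := by
              rw [← mul_assoc, ← Real.exp_add]; congr 2; ring
          _ ≤ _ := by gcongr
      have h4 : 2 * x + 8 * u + 2 ≤ Real.exp w * u := by
        have : 9 * w + 9 ≤ Real.exp w := by nlinarith
        have h5 := mul_le_mul_of_nonneg_right this hu.le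
        nlinarith
      push_cast
      linarith
    have h3 : 2 * ((τ + 1 : ℕ) : ℝ) / phi n k p ≤ 16 + Real.exp (101 * w) := by
      rwa [div_le_iff₀ hφ0]
    have h4 : Real.exp (102 * w) = Real.exp w * Real.exp (101 * w) := by
      rw [← Real.exp_add]; congr 1; ring
    have h5 : 1 ≤ Real.exp (101 * w) := Real.one_le_exp (by positivity)
    rw [h4]
    nlinarith
  have hR0 : 0 ≤ 1 + 2 * ((τ + 1 : ℕ) : ℝ) / (p * ((n - 1).choose (k - 1) : ℕ)) := by positivity
  have hb := binom_ratio_pow hτM h0 h1 (r + 1)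
  have he : τ + 1 - (r + 1) = τ - r := by omega
  rw [he] at hb
  have hbn := binom_nonneg (M := (n - 1).choose (k - 1)) h0.le h1 (τ + 1)
  have hbn' := binom_nonneg (M := (n - 1).choose (k - 1)) h0.le h1 (τ - r)
  have hnb : (n:ℝ) * binomProbGe ((n - 1).choose (k - 1)) p (τ - r) ≤ Real.exp (102 * w) ^ (r + 1) * x := by
    calc _ ≤ (n:ℝ) * ((1 + 2 * ((τ + 1 : ℕ) : ℝ) / (p * ((n - 1).choose (k - 1) : ℕ))) ^ (r + 1) *
            binomProbGe ((n - 1).choose (k - 1)) p (τ + 1)) := by gcongr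
      _ = (1 + 2 * ((τ + 1 : ℕ) : ℝ) / (p * ((n - 1).choose (k - 1) : ℕ))) ^ (r + 1) *
          ((n:ℝ) * binomProbGe ((n - 1).choose (k - 1)) p (τ + 1)) := by ring
      _ ≤ _ := by gcongr
  -- the extension factor
  have hFs : ((D + r : ℕ) : ℝ) ≤ Real.exp (2002 * w) * u := by
    have h2 : Real.exp (2002 * w) = Real.exp (2001 * w) * Real.exp w := by
      rw [← Real.exp_add]; congr 1; ring
    have h3 : 1 ≤ Real.exp (2001 * w) := Real.one_le_exp (by positivity)
    push_cast
    rw [h2]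
    nlinarith [mul_pos hu (Real.exp_pos (2001 * w))]
  have hF := B.FB_le (h := 11 + r) (s := D + r) (Hh := 22 * w + 10 ^ 8 * w) hl hFs
    (by push_cast; have := B.hL; nlinarith)
  have hF2 := hF.trans (B.exp_exp_le_two (by linarith))
  have hF0 : 0 ≤ FB n k l (11 + r) (D + r) := (Real.exp_pos _).le
  have hX : mubar n k p * interProb n k ^ (τ - r) ≤ 16 * u * Real.exp (100 * w) * Real.exp (-Y) * Real.exp (10 ^ 8 * w) := by
    have h2 : interProb n k ^ (τ - r) ≤ interProb n k ^ (t - 1) * Real.exp (10 ^ 8 * w) := by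
      rw [B.qpow, B.qpow, ← Real.exp_add, Nat.cast_sub hrτ, Nat.cast_sub htp]
      apply Real.exp_le_exp.2
      have h3 : (t:ℝ) ≤ τ := by exact_mod_cast htτ
      have h4 := mul_le_mul_of_nonneg_left h3 B.hL0.le
      push_cast
      have := B.hL0
      linarith
    have h3 := B.mu_q htp h0.le hΛ
    have h4 : mubar n k p * interProb n k ^ (t - 1) ≤ (t:ℝ) ^ 2 / mubar n k p := by
      rw [le_div_iff₀ hμp]; linarith
    have h5 : (t:ℝ) ^ 2 / mubar n k p ≤ 16 * u * Real.exp (100 * w) * Real.exp (-Y) := by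
      rw [div_le_iff₀ hμp, B.mubar_eq]
      have h6 : u ≤ Real.exp (100 * w) * phi n k p := by
        calc u = Real.exp (100 * w) * (Real.exp (-(100 * w)) * u) := by
              rw [← mul_assoc, ← Real.exp_add]; simp
          _ ≤ _ := by gcongr
      have h7 : Real.exp (-Y) * Real.exp Y = 1 := by rw [← Real.exp_add]; simp
      calc (t:ℝ) ^ 2 ≤ (4 * u) ^ 2 := by gcongr
        _ = 16 * u * u := by ring
        _ ≤ 16 * u * (Real.exp (100 * w) * phi n k p) := by gcongr
        _ = 16 * u * (Real.exp (100 * w) * phi n k p) * (Real.exp (-Y) * Real.exp Y) := by rw [h7, mul_one]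
        _ = _ := by ring
    calc _ ≤ mubar n k p * (interProb n k ^ (t - 1) * Real.exp (10 ^ 8 * w)) := by gcongr
      _ = (mubar n k p * interProb n k ^ (t - 1)) * Real.exp (10 ^ 8 * w) := by ring
      _ ≤ _ := by
        have := h4.trans h5
        gcongr
  have hX0 : 0 ≤ mubar n k p * interProb n k ^ (τ - r) := by positivity
  have hbase : Real.exp (102 * w) * ((D:ℝ) * (mubar n k p * interProb n k ^ (τ - r) * FB n k l (11 + r) (D + r))) ≤
      Real.exp (-(200 * w)) * (1 / 2) := by
    calc _ ≤ Real.exp (102 * w) * ((Real.exp (2001 * w) * u) *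
          ((16 * u * Real.exp (100 * w) * Real.exp (-Y) * Real.exp (10 ^ 8 * w)) * 2)) := by
          have h2 := mul_le_mul hX hF2 hF0 (by positivity)
          have h3 : 0 ≤ mubar n k p * interProb n k ^ (τ - r) * FB n k l (11 + r) (D + r) := by positivity
          exact mul_le_mul_of_nonneg_left (mul_le_mul hD h2 h3 (by positivity)) (Real.exp_pos _).le
      _ = 32 * u ^ 2 * (Real.exp (102 * w) * Real.exp (2001 * w) * Real.exp (100 * w) * Real.exp (-Y) * Real.exp (10 ^ 8 * w)) := by ring
      _ ≤ Real.exp w * Real.exp (x / 4 - 10 ^ 9 * w) ^ 2 * (Real.exp (102 * w) * Real.exp (2001 * w) * Real.exp (100 * w) * Real.exp (-Y) * Real.exp (10 ^ 8 * w)) := by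
          have := B.hu
          gcongr
          linarith
      _ = Real.exp (w + 2 * (x / 4 - 10 ^ 9 * w) + (102 * w + 2001 * w + 100 * w + (-Y) + 10 ^ 8 * w)) := by
          have : Real.exp (x / 4 - 10 ^ 9 * w) ^ 2 = Real.exp (2 * (x / 4 - 10 ^ 9 * w)) := by
            rw [← Real.exp_nat_mul]; norm_num
          rw [this, ← Real.exp_add, ← Real.exp_add, ← Real.exp_add, ← Real.exp_add, ← Real.exp_add, ← Real.exp_add]
      _ ≤ Real.exp (-(200 * w) + (-1)) := by
          apply Real.exp_le_exp.2; have := B.hY1; linarith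
      _ ≤ _ := by
          rw [Real.exp_add]
          gcongr
          rw [Real.exp_neg, inv_le_comm₀ (Real.exp_pos _) (by norm_num)]
          have := Real.exp_one_gt_d9; linarith
  have hZ0 : 0 ≤ mubar n k p * interProb n k ^ (τ - r) * FB n k l (11 + r) (D + r) := by positivity
  set Z := mubar n k p * interProb n k ^ (τ - r) * FB n k l (11 + r) (D + r)
  have hfac : Z ^ r / r.factorial ≤ Z ^ r := div_le_self (by positivity) (by exact_mod_cast Nat.factorial_pos r)
  calc (n:ℝ) * (binomProbGe ((n - 1).choose (k - 1)) p (τ - r) * (3 * (D:ℝ) ^ (1 * r)) * (Z ^ r / r.factorial))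
      = ((n:ℝ) * binomProbGe ((n - 1).choose (k - 1)) p (τ - r)) * ((3 * (D:ℝ) ^ (1 * r)) * (Z ^ r / r.factorial)) := by ring
    _ ≤ (Real.exp (102 * w) ^ (r + 1) * x) * ((3 * (D:ℝ) ^ (1 * r)) * Z ^ r) := by
        gcongr
    _ = 3 * x * Real.exp (102 * w) * (Real.exp (102 * w) * ((D:ℝ) * Z)) ^ r := by
        rw [one_mul, mul_pow, mul_pow]; ring
    _ ≤ 3 * x * Real.exp (102 * w) * (Real.exp (-(200 * w)) * (1 / 2)) ^ r := by
        gcongr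
    _ = 3 * x * Real.exp (102 * w) * Real.exp (-(200 * w)) ^ r * (1 / 2) ^ r := by
        rw [mul_pow]; ring
    _ ≤ Real.exp (-w) * (1 / 2) ^ r := by
        gcongr
        have h2 : Real.exp (-(200 * w)) ^ r ≤ Real.exp (-(200 * w)) := by
          apply pow_le_of_le_one (Real.exp_pos _).le _ (by omega)
          rw [Real.exp_le_one_iff]; linarith
        calc _ ≤ Real.exp w * Real.exp w * Real.exp (102 * w) * Real.exp (-(200 * w)) := by
              have := B.hxw
              gcongr; linarith
          _ ≤ _ := by
              rw [← Real.exp_add, ← Real.exp_add, ← Real.exp_add]; apply Real.exp_le_exp.2; linarith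

set_option maxHeartbeats 1000000 in
lemma g7_large (B : RB β n k x w L Y u) {τ : ℕ} (h0 : 0 ≤ p) (h1 : p ≤ 1)
    (hφ : phi n k p ≤ Real.exp (1000 * w) * u) (ht0 : 30 * u ≤ τ) :
    ∀ l D r : ℕ, (l:ℝ) + 1 ≤ Real.exp (10 ^ 8 * w + w) → (D:ℝ) ≤ Real.exp (2001 * w) * u → 1 ≤ r →
      (r:ℝ) ≤ u / 500 → L * r ≤ 10 ^ 8 * w →
      (n:ℝ) * (binomProbGe ((n - 1).choose (k - 1)) p (τ - r) * (3 * (D:ℝ) ^ (4 * r)) *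
        ((mubar n k p * interProb n k ^ (τ - r) * FB n k l (11 + r) (D + r)) ^ r / r.factorial)) ≤
        Real.exp (-w) * (1 / 2) ^ r := by
  intro l D r hl hD hr hr2 hr3
  have hw := B.w_pos
  have hw0 := B.hw0
  have hx := B.x_ge
  have hxp := B.x_pos
  have hu := B.u_pos
  have hub := B.u_big
  have hew := B.exp_w_big
  have hq := B.q_pos
  have hφ0 := phi_nonneg (n := n) (k := k) h0
  have hμp := mubar_nonneg (n := n) (k := k) h0
  have hrτ : r ≤ τ := by
    have : (r:ℝ) ≤ τ := by linarith
    exact_mod_cast this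
  have hFs : ((D + r : ℕ) : ℝ) ≤ Real.exp (2002 * w) * u := by
    have h2 : Real.exp (2002 * w) = Real.exp (2001 * w) * Real.exp w := by
      rw [← Real.exp_add]; congr 1; ring
    have h3 : 1 ≤ Real.exp (2001 * w) := Real.one_le_exp (by positivity)
    push_cast
    rw [h2]
    nlinarith [mul_pos hu (Real.exp_pos (2001 * w))]
  have hF := B.FB_le (h := 11 + r) (s := D + r) (Hh := 22 * w + 10 ^ 8 * w) hl hFs
    (by push_cast; have := B.hL; nlinarith)
  have hF2 := hF.trans (B.exp_exp_le_two (by linarith))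
  have hF0 : 0 ≤ FB n k l (11 + r) (D + r) := (Real.exp_pos _).le
  have hX : mubar n k p * interProb n k ^ (τ - r) ≤ Real.exp (x / 4 + Y - 20 * Y) := by
    rw [B.mubar_eq, B.qpow, Nat.cast_sub hrτ, mul_assoc, ← Real.exp_add]
    have h2 := B.phi_le' hφ
    calc _ ≤ Real.exp (x / 4) * Real.exp (Y - 20 * Y) := by
          have h3 : 20 * u ≤ (τ:ℝ) - r := by linarith
          have h4 := mul_le_mul_of_nonneg_left h3 B.hL0.le
          have h5 : L * (20 * u) = 20 * Y := by rw [← B.huL]; ring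
          exact mul_le_mul h2 (Real.exp_le_exp.2 (by linarith)) (Real.exp_pos _).le (Real.exp_pos _).le
      _ = _ := by rw [← Real.exp_add]; congr 1; ring
  have hD' : (D:ℝ) ≤ Real.exp (x / 4) := by
    calc (D:ℝ) ≤ Real.exp (2001 * w) * Real.exp (x / 4 - 10 ^ 9 * w) := by
          have := B.hu
          exact hD.trans (by gcongr)
      _ ≤ _ := by rw [← Real.exp_add]; apply Real.exp_le_exp.2; linarith
  have hX0 : 0 ≤ mubar n k p * interProb n k ^ (τ - r) := by positivity
  have hZ0 : 0 ≤ mubar n k p * interProb n k ^ (τ - r) * FB n k l (11 + r) (D + r) := by positivity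
  have hbase : (D:ℝ) ^ 4 * (mubar n k p * interProb n k ^ (τ - r) * FB n k l (11 + r) (D + r)) ≤
      Real.exp (-(3 * x)) * (1 / 2) := by
    calc _ ≤ Real.exp (x / 4) ^ 4 * (Real.exp (x / 4 + Y - 20 * Y) * Real.exp 1) := by
          have h2 : FB n k l (11 + r) (D + r) ≤ Real.exp 1 := by
            have := Real.exp_one_gt_d9; linarith
          gcongr
      _ = Real.exp (x + (x / 4 + Y - 20 * Y + 1)) := by
          rw [← Real.exp_nat_mul, ← Real.exp_add, ← Real.exp_add]; congr 1; push_cast; ring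
      _ ≤ Real.exp (-(3 * x) + (-1)) := by
          apply Real.exp_le_exp.2; have := B.Y_ge; have := B.x_big; linarith
      _ ≤ _ := by
          rw [Real.exp_add]
          gcongr
          rw [Real.exp_neg, inv_le_comm₀ (Real.exp_pos _) (by norm_num)]
          have := Real.exp_one_gt_d9; linarith
  set Z := mubar n k p * interProb n k ^ (τ - r) * FB n k l (11 + r) (D + r)
  have hfac : Z ^ r / r.factorial ≤ Z ^ r := div_le_self (by positivity) (by exact_mod_cast Nat.factorial_pos r)
  have hbn' := binom_nonneg (M := (n - 1).choose (k - 1)) h0 h1 (τ - r)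
  have hb1 := binom_le_one (M := (n - 1).choose (k - 1)) h0 h1 (τ - r)
  calc (n:ℝ) * (binomProbGe ((n - 1).choose (k - 1)) p (τ - r) * (3 * (D:ℝ) ^ (4 * r)) * (Z ^ r / r.factorial))
      ≤ (n:ℝ) * (1 * (3 * (D:ℝ) ^ (4 * r)) * Z ^ r) := by
        gcongr
    _ = 3 * Real.exp x * ((D:ℝ) ^ 4 * Z) ^ r := by
        rw [mul_pow, pow_mul, B.hn]; ring
    _ ≤ 3 * Real.exp x * (Real.exp (-(3 * x)) * (1 / 2)) ^ r := by
        gcongr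
    _ = 3 * Real.exp x * Real.exp (-(3 * x)) ^ r * (1 / 2) ^ r := by
        rw [mul_pow]; ring
    _ ≤ Real.exp (-w) * (1 / 2) ^ r := by
        gcongr
        have h2 : Real.exp (-(3 * x)) ^ r ≤ Real.exp (-(3 * x)) := by
          apply pow_le_of_le_one (Real.exp_pos _).le _ (by omega)
          rw [Real.exp_le_one_iff]; linarith
        calc _ ≤ Real.exp w * Real.exp x * Real.exp (-(3 * x)) := by
              gcongr; linarith
          _ ≤ _ := by
              rw [← Real.exp_add, ← Real.exp_add]; apply Real.exp_le_exp.2; linarith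

lemma Lt_small (B : RB β n k x w L Y u) {s : ℕ} (h0 : 0 ≤ p)
    (hφ : phi n k p ≤ Real.exp (1000 * w) * u) (hs : 3 * u ≤ s) : Lt n k p s ≤ Real.exp (-w) := by
  have hw := B.w_pos
  have hw0 := B.hw0
  have hx := B.x_ge
  have hxp := B.x_pos
  have hu := B.u_pos
  have hub := B.u_big
  have hφ0 := phi_nonneg (n := n) (k := k) h0
  have hμp := mubar_nonneg (n := n) (k := k) h0
  have hs0 : (1:ℝ) ≤ s := by linarith
  have hs1 : 1 ≤ s := by exact_mod_cast hs0
  unfold Lt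
  have h1 : mubar n k p ^ s / s.factorial ≤ Real.exp (s * (1 + 1000 * w + Y)) := by
    refine (pow_div_fact_le hμp hs1).trans ?_
    rw [Real.exp_nat_mul]
    gcongr
    rw [div_le_iff₀ (by linarith), B.mubar_eq]
    calc _ ≤ Real.exp 1 * (Real.exp (1000 * w) * u * Real.exp Y) := by gcongr
      _ = Real.exp (1 + 1000 * w + Y) * u := by rw [Real.exp_add, Real.exp_add]; ring
      _ ≤ _ := by gcongr; linarith
  have h2 : interProb n k ^ s.choose 2 ≤ Real.exp (s * (-(1.5 * Y) + w)) := by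
    rw [B.qpow, Nat.cast_choose_two]
    apply Real.exp_le_exp.2
    have h3 : L * (3 * u - 1) ≤ L * (s - 1) := mul_le_mul_of_nonneg_left (by linarith) B.hL0.le
    have h4 : L * (3 * u) = 3 * Y := by rw [← B.huL]; ring
    have := B.hL
    have h5 := mul_le_mul_of_nonneg_left (show 3 * Y - 2 * w ≤ L * (s - 1) by linarith) (show (0:ℝ) ≤ s by linarith)
    linarith
  have hq := B.q_pos
  calc _ = mubar n k p ^ s / s.factorial * interProb n k ^ s.choose 2 := by ring
    _ ≤ Real.exp (s * (1 + 1000 * w + Y)) * Real.exp (s * (-(1.5 * Y) + w)) := by gcongr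
    _ = Real.exp (s * (1 + 1001 * w - 0.5 * Y)) := by rw [← Real.exp_add]; congr 1; ring
    _ ≤ _ := by
      apply Real.exp_le_exp.2
      have h6 : 1 + 1001 * w - 0.5 * Y ≤ -w := by have := B.Y_ge; linarith
      nlinarith

end RB
end
end EKRP

namespace EKRP
noncomputable section

lemma nu_q {ν q : ℝ} (hν : 0 ≤ ν) (hq : 0 ≤ q) {t : ℕ} (ht : 1 ≤ t) (h : ν ^ t / t.factorial * q ^ t.choose 2 ≤ 1) :
    ν ^ 2 * q ^ (t - 1) ≤ (t:ℝ) ^ 2 := by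
  have h1 : ν ^ t * q ^ t.choose 2 ≤ (t:ℝ) ^ t := by
    rw [div_mul_eq_mul_div, div_le_one (by positivity)] at h
    exact h.trans (by exact_mod_cast Nat.factorial_le_pow t)
  have h2 : (ν ^ 2 * q ^ (t - 1)) ^ t ≤ ((t:ℝ) ^ 2) ^ t := by
    calc (ν ^ 2 * q ^ (t - 1)) ^ t
        = (ν ^ t * q ^ t.choose 2) ^ 2 := by
          rw [mul_pow, mul_pow, ← pow_mul, ← pow_mul, ← pow_mul, ← pow_mul, two_choose_two, mul_comm 2 t]
      _ ≤ ((t:ℝ) ^ t) ^ 2 := by gcongr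
      _ = _ := by rw [← pow_mul, ← pow_mul, mul_comm]
  exact le_of_pow_le_pow_left₀ (by omega) (by positivity) h2

lemma gchoose_le {μ : ℝ} {s : ℕ} (h : (s:ℝ) ≤ μ) : gchoose μ s ≤ μ ^ s / s.factorial := by
  unfold gchoose
  gcongr
  calc ∏ i ∈ Finset.range s, (μ - i) ≤ ∏ _i ∈ Finset.range s, μ := by
        refine Finset.prod_le_prod (fun i hi => ?_) fun i _ => ?_
        · rw [Finset.mem_range] at hi
          have : (i:ℝ) ≤ s := by exact_mod_cast hi.le
          linarith
        · have : (0:ℝ) ≤ i := Nat.cast_nonneg i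
          linarith
    _ = μ ^ s := by simp

lemma gchoose_ge_half {μ : ℝ} {t : ℕ} (ht : 1 ≤ t) (h : 2 * (t:ℝ) ^ 2 ≤ μ) : μ ^ t / t.factorial ≤ 2 * gchoose μ t := by
  have ht' : (1:ℝ) ≤ t := by exact_mod_cast ht
  have hμ : 0 < μ := by nlinarith
  have htμ : (t:ℝ) ≤ μ := by nlinarith
  unfold gchoose
  rw [← mul_div_assoc]
  gcongr
  have h1 : (μ - t) ^ t ≤ ∏ i ∈ Finset.range t, (μ - i) := by
    calc (μ - t) ^ t = ∏ _i ∈ Finset.range t, (μ - t) := by simp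
      _ ≤ _ := by
        refine Finset.prod_le_prod (fun i _ => by linarith) fun i hi => ?_
        rw [Finset.mem_range] at hi
        have : (i:ℝ) ≤ t := by exact_mod_cast hi.le
        linarith
  have h2 : 1 / 2 ≤ (1 + -(t / μ)) ^ t := by
    have h3 : (t:ℝ) / μ ≤ 1 := by rw [div_le_one hμ]; exact htμ
    have h4 := one_add_mul_le_pow (a := -(t / μ)) (by linarith) t
    have h5 : (t:ℝ) * (t / μ) ≤ 1 / 2 := by
      rw [← mul_div_assoc, div_le_iff₀ hμ]; nlinarith
    linarith
  have h3 : (μ - t) ^ t = μ ^ t * (1 + -(t / μ)) ^ t := by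
    rw [← mul_pow]; congr 1; field_simp; ring
  have h4 : μ ^ t * (1 / 2) ≤ μ ^ t * (1 + -(t / μ)) ^ t := by gcongr
  linarith

namespace RB
variable {β : ℝ} {n k : ℕ} {x w L Y u p η : ℝ}

lemma phi_lower (B : RB β n k x w L Y u) {t : ℕ} (ht : 1 ≤ t) (h0 : 0 ≤ p)
    (h : 1 / 2 ≤ (n:ℝ) * (phi n k p ^ t / t.factorial)) :
    (t:ℝ) * Real.exp (-1 - (x + 1) / t) ≤ phi n k p := by
  have hφ0 := phi_nonneg (n := n) (k := k) h0
  have ht' : (0:ℝ) < t := by exact_mod_cast ht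
  have h1 := factorial_ge t
  have h2 : (t.factorial : ℝ) ≤ 2 * Real.exp x * phi n k p ^ t := by
    rw [B.hn, ← mul_div_assoc, le_div_iff₀ (by positivity)] at h
    linarith
  have h3 : ((t:ℝ) / Real.exp 1) ^ t ≤ (Real.exp ((x + 1) / t) * phi n k p) ^ t := by
    rw [mul_pow, ← Real.exp_nat_mul, mul_div_cancel₀ _ ht'.ne', Real.exp_add]
    refine (h1.trans h2).trans ?_
    refine mul_le_mul_of_nonneg_right ?_ (by positivity)
    nlinarith [Real.exp_one_gt_d9, Real.exp_pos x]
  have h4 := le_of_pow_le_pow_left₀ (by omega) (by positivity) h3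
  have h5 : Real.exp (-1 - (x + 1) / t) = (Real.exp 1)⁻¹ * (Real.exp ((x + 1) / t))⁻¹ := by
    rw [← Real.exp_neg, ← Real.exp_neg, ← Real.exp_add]; congr 1
  rw [h5, ← mul_assoc, ← div_eq_mul_inv, ← div_eq_mul_inv, div_le_iff₀ (Real.exp_pos _)]
  linarith

set_option maxHeartbeats 1000000 in
lemma mid_facts (B : RB β n k x w L Y u) {t : ℕ} (h0 : 0 ≤ p) (hφ : phi n k p ≤ Real.exp (1000 * w) * u)
    (hη : Real.exp (-w) ≤ η) (hη1 : η ≤ 1 / 100) (ht3 : 3 ≤ t) (hΛ : Lam n k p t ≤ η)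
    (hmin : ∀ s < t, η < Lam n k p s) (hφt : 1 / 2 ≤ (n:ℝ) * (phi n k p ^ t / t.factorial)) :
    1.9 * u ≤ t ∧ (t:ℝ) ≤ 4 * u ∧ Real.exp (-(100 * w)) * u ≤ phi n k p ∧ Lt n k p t ≤ 2 * η := by
  have hw := B.w_pos
  have hw0 := B.hw0
  have hx := B.x_ge
  have hxp := B.x_pos
  have hxb := B.x_big
  have hu := B.u_pos
  have hub := B.u_big
  have hq := B.q_pos
  have hL0 := B.hL0
  have hY1 := B.Y_ge
  have hY2 := B.Y_le
  have hew := B.exp_w_big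
  have hφ0 := phi_nonneg (n := n) (k := k) h0
  have hμ0 := mubar_nonneg (n := n) (k := k) h0
  have ht3' : (3:ℝ) ≤ t := by exact_mod_cast ht3
  have hlow := B.phi_lower (by omega) h0 hφt
  have hx3 : (x + 1) / t ≤ (x + 1) / 3 := by gcongr
  have hμ : (t:ℝ) * Real.exp (Y - 1 - (x + 1) / t) ≤ mubar n k p := by
    rw [B.mubar_eq]
    calc _ = (t:ℝ) * Real.exp (-1 - (x + 1) / t) * Real.exp Y := by
          rw [mul_assoc, ← Real.exp_add]; congr 2; ring
      _ ≤ _ := by gcongr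
  have hμ2 : 2 * (t:ℝ) ≤ mubar n k p := by
    refine le_trans ?_ hμ
    rw [mul_comm]
    gcongr
    have := Real.add_one_le_exp (Y - 1 - (x + 1) / t)
    linarith
  have hge := gchoose_ge hμ2
  have h1 : (mubar n k p / 2) ^ t / t.factorial * interProb n k ^ t.choose 2 ≤ 1 := by
    refine le_trans ?_ (show η ≤ 1 by linarith)
    refine le_trans ?_ hΛ
    unfold Lam; gcongr
  have h2 := nu_q (by positivity) hq.le (by omega) h1
  have h3 : 2 * (Y - 2 - (x + 1) / t) ≤ L * t := by
    have h4 : (t:ℝ) * Real.exp (Y - 2 - (x + 1) / t) ≤ mubar n k p / 2 := by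
      have : Real.exp (Y - 1 - (x + 1) / t) = Real.exp 1 * Real.exp (Y - 2 - (x + 1) / t) := by
        rw [← Real.exp_add]; congr 1; ring
      rw [this] at hμ
      have h5 := Real.exp_one_gt_d9
      have h6 : 0 < (t:ℝ) * Real.exp (Y - 2 - (x + 1) / t) := by positivity
      nlinarith
    have h5 : ((t:ℝ) * Real.exp (Y - 2 - (x + 1) / t)) ^ 2 * interProb n k ^ (t - 1) ≤ (t:ℝ) ^ 2 * 1 := by
      rw [mul_one]
      refine le_trans ?_ h2
      gcongr
    rw [mul_pow, mul_assoc] at h5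
    have h6 := le_of_mul_le_mul_left h5 (by positivity)
    rw [B.qpow, ← Real.exp_nat_mul, ← Real.exp_add, Real.exp_le_one_iff, Nat.cast_sub (by omega)] at h6
    push_cast at h6
    linarith
  have ht58 : 0.58 * u ≤ t := by
    have : L * (0.58 * u) ≤ L * t := by
      have : L * (0.58 * u) = 0.58 * Y := by rw [← B.huL]; ring
      rw [this]
      linarith
    exact le_of_mul_le_mul_left this hL0
  have ht19 : 1.9 * u ≤ t := by
    have h4 : (x + 1) / t ≤ 0.001 * x := by
      rw [div_le_iff₀ (by linarith)]
      nlinarith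
    have : L * (1.9 * u) ≤ L * t := by
      have : L * (1.9 * u) = 1.9 * Y := by rw [← B.huL]; ring
      rw [this]
      linarith
    exact le_of_mul_le_mul_left this hL0
  have hφl : Real.exp (-(100 * w)) * u ≤ phi n k p := by
    refine le_trans ?_ hlow
    rw [mul_comm]
    refine mul_le_mul (by linarith) (Real.exp_le_exp.2 ?_) (Real.exp_pos _).le (by linarith)
    have : (x + 1) / t ≤ 10 * w := by
      rw [div_le_iff₀ (by linarith)]
      have := B.uw_ge
      nlinarith
    linarith
  have ht4 : (t:ℝ) ≤ 4 * u := by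
    by_contra hcon
    push Not at hcon
    have hc := Nat.ceil_lt_add_one (a := 3 * u) (by positivity)
    have hst : (⌈3 * u⌉₊ : ℝ) < t := by linarith
    have h4 := hmin ⌈3 * u⌉₊ (by exact_mod_cast hst)
    have h5 := B.Lt_small h0 hφ (Nat.le_ceil (3 * u))
    have h6 : Lam n k p ⌈3 * u⌉₊ ≤ Lt n k p ⌈3 * u⌉₊ := by
      unfold Lam Lt
      rw [mul_div_right_comm]
      gcongr
      exact gchoose_le (by linarith)
    linarith
  refine ⟨ht19, ht4, hφl, ?_⟩
  have h4 : 2 * (t:ℝ) ^ 2 ≤ mubar n k p := by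
    rw [B.mubar_eq]
    calc 2 * (t:ℝ) ^ 2 ≤ 2 * (4 * u) ^ 2 := by gcongr
      _ = 32 * u * u := by ring
      _ ≤ Real.exp w * Real.exp (x / 4) * u := by
          have := B.u_le_n; gcongr; linarith
      _ ≤ Real.exp (-(100 * w) + Y) * u := by
          rw [← Real.exp_add]
          exact mul_le_mul_of_nonneg_right (Real.exp_le_exp.2 (by linarith)) hu.le
      _ = Real.exp (-(100 * w)) * u * Real.exp Y := by rw [Real.exp_add]; ring
      _ ≤ _ := by gcongr
  have h5 := gchoose_ge_half (by omega) h4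
  calc Lt n k p t = mubar n k p ^ t / t.factorial * interProb n k ^ t.choose 2 := by unfold Lt; ring
    _ ≤ 2 * gchoose (mubar n k p) t * interProb n k ^ t.choose 2 := by gcongr
    _ = 2 * Lam n k p t := by unfold Lam; ring
    _ ≤ _ := by linarith

set_option maxHeartbeats 1000000 in
lemma mid (B : RB β n k x w L Y u) {e : ℝ} (h0 : 0 ≤ p) (h1 : p ≤ 1) (hφ : phi n k p ≤ Real.exp (1000 * w) * u)
    (hη : Real.exp (-w) ≤ η) (hη1 : η ≤ 1 / 100) (hxη : 1 / x ≤ η) (he : e ≤ η)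
    (hL : hprob n k p (fun H => e < Lam n k p (maxDegree H)) ≤ η) :
    hprob n k p (fun H => ¬ EKR H) ≤ 14 * η := by
  have hw := B.w_pos
  have hw0 := B.hw0
  have hx := B.x_ge
  have hxp := B.x_pos
  have hxb := B.x_big
  have hu := B.u_pos
  have hub := B.u_big
  have hew := B.exp_w_big
  have hlog : Real.log n = x := by rw [B.hn, Real.log_exp]
  have hn10 : 10 ≤ n := by
    have : (10:ℝ) ≤ n := by rw [B.hn]; have := Real.add_one_le_exp x; linarith
    exact_mod_cast this
  obtain ⟨hk2, hp, t₂, ht3, hΛ, hmin, hΔ, hφt, -⟩ := t2_facts hn10 B.hkn h0 h1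
    ((Real.exp_pos _).trans_le hη) hη1 he hL
  obtain ⟨ht19, ht4, hφl, hLt⟩ := B.mid_facts h0 hφ hη hη1 ht3 hΛ hmin hφt
  have hφ0 : 0 < phi n k p := lt_of_lt_of_le (by positivity) hφl
  have hφx := B.phi_le' hφ
  have hux := B.u_le_n
  have hM := choose_ge_self hk2 B.hkn.le
  have hM' : (n:ℝ) - 1 ≤ ((n-1).choose (k-1) : ℝ) := by
    have : (n:ℝ) ≤ ((n-1).choose (k-1) : ℝ) + 1 := by exact_mod_cast hM
    linarith
  have hbig : 16 * phi n k p + 2 * x + 8 * u + 3 ≤ (n-1).choose (k-1) := by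
    have h2 : x ≤ Real.exp (x / 4) := B.hxw.trans (Real.exp_le_exp.2 (by linarith))
    have h3 : Real.exp w * Real.exp (x / 4) ≤ n := by
      rw [B.hn, ← Real.exp_add]; exact Real.exp_le_exp.2 (by linarith)
    have h4 : 1 ≤ Real.exp (x / 4) := Real.one_le_exp (by positivity)
    nlinarith
  have he2 := exp_two_le
  have hE : Real.exp 2 * phi n k p ≤ 8 * phi n k p := by gcongr
  obtain ⟨t₁, hb1, ht1le, hΔ1⟩ := t1_choice (n := n) (k := k) (by omega) (by omega) (by have := B.hkn; omega) hp h1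
      (by rw [hlog]; linarith)
  rw [hlog] at hb1 ht1le hΔ1
  have herr : (phi n k p + 2 * (Real.exp 2 * phi n k p + x)) ^ 2 * k / (n * phi n k p) ≤ Real.exp (-w) := by
    have a1 : phi n k p + 2 * (Real.exp 2 * phi n k p + x) ≤ Real.exp (1002 * w) * u := by
      have b1 : x ≤ Real.exp w * u := by
        have := B.hxw; nlinarith
      have b2 : Real.exp (1002 * w) = Real.exp w * Real.exp w * Real.exp (1000 * w) := by
        rw [← Real.exp_add, ← Real.exp_add]; congr 1; ring
      have b3 : 1 ≤ Real.exp (1000 * w) := Real.one_le_exp (by positivity)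
      calc _ ≤ 17 * (Real.exp (1000 * w) * u) + 2 * (Real.exp w * u) := by linarith
        _ ≤ 17 * (Real.exp w * Real.exp (1000 * w) * u) + 2 * (Real.exp w * Real.exp (1000 * w) * u) := by
            have d1 : Real.exp (1000 * w) * u ≤ Real.exp w * Real.exp (1000 * w) * u :=
              mul_le_mul_of_nonneg_right (le_mul_of_one_le_left (Real.exp_pos _).le (by linarith)) hu.le
            have d2 : Real.exp w * u ≤ Real.exp w * Real.exp (1000 * w) * u :=
              mul_le_mul_of_nonneg_right (le_mul_of_one_le_right (Real.exp_pos _).le b3) hu.le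
            linarith
        _ = 19 * (Real.exp w * Real.exp (1000 * w) * u) := by ring
        _ ≤ Real.exp w * (Real.exp w * Real.exp (1000 * w) * u) := by gcongr; linarith
        _ = _ := by rw [b2]; ring
    have a3 : (phi n k p)⁻¹ ≤ Real.exp (100 * w) * u⁻¹ := by
      rw [← neg_neg (100 * w), Real.exp_neg (-(100 * w)), ← mul_inv]
      gcongr
    have hn0 : (0:ℝ) < n := by rw [B.hn]; positivity
    calc _ = (phi n k p + 2 * (Real.exp 2 * phi n k p + x)) ^ 2 * (k / n) * (phi n k p)⁻¹ := by
            field_simp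
      _ ≤ (Real.exp (1002 * w) * u) ^ 2 * Real.exp (-Y) * (Real.exp (100 * w) * u⁻¹) := by
          rw [B.hkY]; gcongr
      _ = Real.exp (2004 * w + (-Y) + 100 * w) * u := by
          have : Real.exp (2004 * w) = Real.exp (1002 * w) ^ 2 := by
            rw [← Real.exp_nat_mul]; congr 1; push_cast; ring
          rw [Real.exp_add, Real.exp_add, this]; field_simp
      _ ≤ Real.exp (2004 * w + (-Y) + 100 * w) * Real.exp (x / 4) := by gcongr
      _ ≤ _ := by
          rw [← Real.exp_add]; apply Real.exp_le_exp.2; have := B.Y_ge; linarith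
  have hexp : Real.exp ((phi n k p + 2 * (Real.exp 2 * phi n k p + x)) ^ 2 * k / (n * phi n k p)) - 1 ≤ 2 * η := by
    have c1 := Real.exp_le_exp.2 herr
    have c2 : |Real.exp (-w)| ≤ 1 := by
      rw [abs_of_pos (Real.exp_pos _)]; linarith
    have c3 := Real.abs_exp_sub_one_le c2
    rw [abs_of_pos (Real.exp_pos (-w))] at c3
    have := le_abs_self (Real.exp (Real.exp (-w)) - 1)
    linarith
  set τ := max t₁ t₂ with hτ
  have hτle : (τ:ℝ) ≤ 8 * phi n k p + x + 4 * u := by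
    rw [hτ, Nat.cast_max]
    exact max_le (by linarith) (by linarith)
  have hτM : 2 * (τ + 1) ≤ (n - 1).choose (k - 1) := by
    have : 2 * ((τ:ℝ) + 1) ≤ (n-1).choose (k-1) := by linarith
    exact_mod_cast this
  have hbin : (n:ℝ) * binomProbGe ((n - 1).choose (k - 1)) p (τ + 1) ≤ x := by
    refine le_trans ?_ hb1.le
    gcongr
    exact binom_anti h0 h1 (by omega)
  have hLt1 : Lt n k p t₂ ≤ 1 := by linarith
  have hbad := B.core (f := 1) (τ := τ) (t := t₂) h0 h1 hφ (le_max_right _ _) (by linarith) ht4 hLt1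
    (B.g7_mid hp h1 hφl (by linarith) ht4 (le_max_right _ _) hLt1 hτle hτM hbin)
  have hsum : hprob n k p (fun H => ¬ EKR H) ≤ hprob n k p (fun H => maxDegree H < t₁) +
        hprob n k p (fun H => maxDegree H < t₂) + hprob n k p (Bad 1 τ) := by
    refine le_trans (hprob_mono h0 h1 (Q := fun H => ((maxDegree H < t₁ ∨ maxDegree H < t₂) ∨ Bad 1 τ H)) ?_) ?_
    · intro H _ hE
      by_cases ha : maxDegree H < t₁
      · exact Or.inl (Or.inl ha)
      by_cases hb : maxDegree H < t₂
      · exact Or.inl (Or.inr hb)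
      exact Or.inr (bad_of_not_ekr hE (by omega))
    · refine (hprob_or h0 h1 _ _).trans ?_
      gcongr
      exact hprob_or h0 h1 _ _
  linarith

set_option maxHeartbeats 1000000 in
lemma large (B : RB β n k x w L Y u) {θ : ℝ} (h0 : 0 ≤ p) (h1 : p ≤ 1) (hφ : Real.exp (1000 * w) * u ≤ phi n k p)
    (hlg : ∀ (k : ℕ) (p φ₁ : ℝ), 1 ≤ k → 2 * k ≤ n →
    0 ≤ p → p ≤ 1 → 0 < φ₁ → φ₁ ≤ phi n k p → 1 ≤ n * (1 - interProb n k) →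
    160 * Real.log n ≤ φ₁ * (1 - interProb n k) →
    ∃ p', 0 ≤ p' ∧ p' ≤ 1 ∧ phi n k p' = φ₁ ∧
    hprob n k p (fun H => ¬ EKR H) ≤ θ + 2 * hprob n k p' (Bad 4 ⌈φ₁ / 4⌉₊)) :
    hprob n k p (fun H => ¬ EKR H) ≤ θ + 16 * Real.exp (-w) := by
  have hw := B.w_pos
  have hw0 := B.hw0
  have hx := B.x_ge
  have hxp := B.x_pos
  have hxb := B.x_big
  have hu := B.u_pos
  have hub := B.u_big
  have hew := B.exp_w_big
  have hlog : Real.log n = x := by rw [B.hn, Real.log_exp]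
  have hux := B.u_le_n
  have hq1 := B.one_sub_q_ge
  have hYu : u * (L * Real.exp (-(2 * w))) = Y * Real.exp (-(2 * w)) := by rw [← B.huL]; ring
  have hYe : Real.exp (-(2 * w)) ≤ Y * Real.exp (-(2 * w)) := by
    have := B.Y_ge
    have : 1 ≤ Y := by linarith
    nlinarith [Real.exp_pos (-(2 * w))]
  have c1 : 1 ≤ (n:ℝ) * (1 - interProb n k) := by
    have d1 : Real.exp (2 * w) * u ≤ n := by
      rw [B.hn]
      calc _ ≤ Real.exp (2 * w) * Real.exp (x / 4) := by gcongr
        _ ≤ _ := by rw [← Real.exp_add]; exact Real.exp_le_exp.2 (by linarith)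
    have d2 : Real.exp (2 * w) * Real.exp (-(2 * w)) = 1 := by rw [← Real.exp_add]; simp
    calc 1 = Real.exp (2 * w) * Real.exp (-(2 * w)) := d2.symm
      _ ≤ Real.exp (2 * w) * (Y * Real.exp (-(2 * w))) := by gcongr
      _ = Real.exp (2 * w) * u * (L * Real.exp (-(2 * w))) := by rw [← hYu]; ring
      _ ≤ _ := by
        have := B.hL0
        gcongr
  have c2 : 160 * Real.log n ≤ Real.exp (1000 * w) * u * (1 - interProb n k) := by
    rw [hlog]
    calc 160 * x ≤ Real.exp w * Y := by have := B.Y_ge; nlinarith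
      _ ≤ Real.exp (998 * w) * Y := by
          have := B.Y_pos
          exact mul_le_mul_of_nonneg_right (Real.exp_le_exp.2 (by linarith)) this.le
      _ = Real.exp (1000 * w) * u * (L * Real.exp (-(2 * w))) := by
          rw [mul_assoc, hYu]
          have : Real.exp (998 * w) = Real.exp (1000 * w) * Real.exp (-(2 * w)) := by
            rw [← Real.exp_add]; congr 1; ring
          rw [this]; ring
      _ ≤ _ := by gcongr
  obtain ⟨p', hp0, hp1, hφ', hfin⟩ := hlg k p _ (by have := B.hk; omega) B.hkn.le h0 h1 (by positivity) hφ c1 c2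
  set τ := ⌈Real.exp (1000 * w) * u / 4⌉₊
  have hτ : 30 * u ≤ τ := by
    refine le_trans ?_ (Nat.le_ceil _)
    have : Real.exp w ≤ Real.exp (1000 * w) := Real.exp_le_exp.2 (by linarith)
    nlinarith
  have hc := Nat.ceil_lt_add_one (a := 3 * u) (by positivity)
  have hc2 := Nat.le_ceil (3 * u)
  have hs := B.Lt_small hp0 hφ'.le hc2
  have hw1 : Real.exp (-w) ≤ 1 := by rw [Real.exp_le_one_iff]; linarith
  have hbad := B.core (f := 4) (τ := τ) (t := ⌈3 * u⌉₊) hp0 hp1 hφ'.le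
    (by
      have : (⌈3 * u⌉₊ : ℝ) ≤ τ := by linarith
      exact_mod_cast this) (by linarith) (by linarith) (by linarith)
    (B.g7_large hp0 hp1 hφ'.le hτ)
  linarith

end RB
end
end EKRP

namespace EKRP
noncomputable section

lemma one_sub_q_ge_exp {n k : ℕ} (hkn : 2 * k < n) :
    Real.exp (-((k:ℝ) ^ 2 / (n - 2 * k))) ≤ 1 - interProb n k := by
  refine le_trans ?_ (EKRP.one_sub_q_ge hkn)
  have hnk : (2:ℝ) * k < n := by exact_mod_cast hkn
  have hk0 : (0:ℝ) ≤ k := by positivity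
  have h2 : (0:ℝ) < n - k := by linarith
  have h3 : (0:ℝ) < n - 2 * k := by linarith
  have h4 : Real.exp (-((k:ℝ) / (n - 2 * k))) ≤ 1 - (k:ℝ) / (n - k) := by
    have h5 := Real.add_one_le_exp ((k:ℝ) / (n - 2 * k))
    have h6 : 1 - (k:ℝ) / (n - k) = ((k:ℝ) / (n - 2 * k) + 1)⁻¹ := by
      refine eq_inv_of_mul_eq_one_left ?_
      obtain ⟨m, hm⟩ : ∃ m : ℝ, m = n - 2 * k := ⟨_, rfl⟩
      have hm0 : 0 < m := by linarith
      have hnm : (n:ℝ) - k = m + k := by linarith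
      have hmk : 0 < m + k := by linarith
      rw [← hm, hnm]
      field_simp
      ring
    rw [h6, Real.exp_neg]
    gcongr
  have h7 : Real.exp (-((k:ℝ) ^ 2 / (n - 2 * k))) = Real.exp (-((k:ℝ) / (n - 2 * k))) ^ k := by
    rw [← Real.exp_nat_mul]; congr 1; ring
  rw [h7]
  gcongr

set_option maxHeartbeats 1000000 in
lemma rb_exists {c : ℝ} (hc : c < 1 / 4) : ∃ β : ℝ, 0 < β ∧ β ≤ 1 / 100 ∧ ∀ᶠ n : ℕ in atTop, ∀ k : ℕ,
    2 ≤ k → 2 * k < n → (k : ℝ) < Real.sqrt (c * n * Real.log n) → gam n k < β / 10 ^ 9 →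
    ∃ L Y u : ℝ, RB β n k (Real.log n) (β * Real.log n / 10 ^ 9) L Y u := by
  set c₀ := max c 0 with hc₀
  have hc0 : 0 ≤ c₀ := le_max_right _ _
  have hcc : c ≤ c₀ := le_max_left _ _
  have hc4 : c₀ < 1 / 4 := max_lt hc (by norm_num)
  obtain ⟨d, hd⟩ : ∃ d, d = 1 / 4 - c₀ := ⟨_, rfl⟩
  have hd0 : 0 < d := by linarith
  have hd4 : d ≤ 1 / 4 := by linarith
  obtain ⟨β, hβ⟩ : ∃ β, β = d / 100 := ⟨_, rfl⟩
  have hβ0 : 0 < β := by rw [hβ]; positivity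
  have hβ1 : β ≤ 1 / 100 := by rw [hβ]; linarith
  obtain ⟨a, ha⟩ : ∃ a, a = β / 10 ^ 9 := ⟨_, rfl⟩
  have ha0 : 0 < a := by rw [ha]; positivity
  have haβ : 10 ^ 9 * a = β := by rw [ha]; field_simp
  refine ⟨β, hβ0, hβ1, ?_⟩
  filter_upwards [eventually_ge_atTop 10,
    ev_log (eventually_ge_atTop (10 ^ 20 / a)), ev_log (eventually_ge_atTop (1 / β / a)),
    ev_log (ev_lin_exp (a := a) ha0 1), ev_log (ev_exp_small (a := 1/4) (by norm_num) hd0),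
    ev_log (ev_lin_exp (a := d / 4) (by positivity) 1)] with n hn hx1 hx2 hx3 hx4 hx5 k hk2 hkn hkc hγ
  have hn2 : 2 ≤ n := by omega
  have hlog := log_pos_of_two hn2
  have hne : (n:ℝ) = Real.exp (Real.log n) := n_eq_exp hn2
  have hkn' : (k:ℝ) / n = _ := kn_eq_exp hn2 (by omega)
  have hk2n := k2n_eq_exp (n := n) (k := k) hn2 (by omega)
  have hnpos : (0:ℝ) < n := by rw [hne]; positivity
  have hkpos : (2:ℝ) ≤ k := by exact_mod_cast hk2
  have hkl : (k:ℝ) ^ 2 < c * n * Real.log n := (Real.lt_sqrt (by positivity)).1 hkc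
  generalize hxx : Real.log n = x at *
  obtain ⟨w, hw⟩ : ∃ w, w = a * x := ⟨_, rfl⟩
  have hwx : β * x / 10 ^ 9 = w := by rw [hw, ha]; ring
  rw [hwx]
  rw [← ha] at hγ
  rw [div_le_iff₀ ha0] at hx1 hx2
  have hw20 : 10 ^ 20 ≤ w := by linarith
  have hβw : 1 / β ≤ w := by linarith
  rw [one_mul] at hx3 hx5
  rw [← hw] at hx3
  have hwβ : 10 ^ 9 * w = β * x := by rw [hw, ← haβ]; ring
  have hwx' : 1000 * w ≤ x := by nlinarith
  have hκ : (k:ℝ) ^ 2 / n ≤ c₀ * x := by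
    rw [div_le_iff₀ hnpos]
    have : c * n * x ≤ c₀ * n * x := by gcongr
    linarith
  have hγlow : -w ≤ gam n k * x := by
    have : Real.exp (-(gam n k * x)) ≤ Real.exp w := by
      rw [← hk2n]; nlinarith
    have := Real.exp_le_exp.1 this
    linarith
  have hγup : gam n k * x ≤ w := by rw [hw]; gcongr
  obtain ⟨Y, hY⟩ : ∃ Y, Y = (1 + gam n k) / 2 * x := ⟨_, rfl⟩
  rw [← hY] at hkn'
  have hY1 : x / 2 - w ≤ Y := by linarith
  have hY2 : Y ≤ x / 2 + w := by linarith
  -- lower bound on the intersection probability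
  have hql : Real.exp (-(2 * w)) ≤ interProb n k := by
    have e1 : Real.exp (-(2 * w)) = Real.exp (-w) * Real.exp (-w) := by
      rw [← Real.exp_add]; congr 1; ring
    have e2 : Real.exp (-w) ≤ 1 / 2 := by
      rw [Real.exp_neg, inv_le_comm₀ (Real.exp_pos _) (by norm_num)]
      have := Real.add_one_le_exp w
      norm_num; linarith
    have e3 := Real.exp_pos (-w)
    by_cases hQ : (k:ℝ) ^ 2 / n ≤ 1
    · have h1 := interProb_ge_half (n := n) (k := k) (by omega) (by omega) hQ
      have h2 : Real.exp (-w) ≤ (k:ℝ) ^ 2 / n := by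
        rw [hk2n]; exact Real.exp_le_exp.2 (by linarith)
      nlinarith
    · push Not at hQ
      have h1 := interProb_ge_exp (n := n) (k := k) (by omega) (by omega)
      have h2 : Real.exp (-((k:ℝ) ^ 2 / n)) ≤ Real.exp (-1) := Real.exp_le_exp.2 (by linarith)
      have h3 : Real.exp (-1) ≤ 1 / 2 := by
        rw [Real.exp_neg, inv_le_comm₀ (Real.exp_pos _) (by norm_num)]
        have := Real.exp_one_gt_d9
        norm_num; linarith
      nlinarith
  have hq0 : 0 < interProb n k := (Real.exp_pos _).trans_le hql
  -- lower bound on `1 - q`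
  have hq1 : Real.exp (-((1 / 4 - d / 2) * x)) ≤ 1 - interProb n k := by
    refine le_trans ?_ (one_sub_q_ge_exp hkn)
    refine Real.exp_le_exp.2 (neg_le_neg ?_)
    have hρ : (k:ℝ) / n ≤ d := by
      rw [hkn']
      refine le_trans (Real.exp_le_exp.2 ?_) hx4
      linarith
    have h2kn : (2:ℝ) * k < n := by exact_mod_cast hkn
    rw [div_le_iff₀ (by linarith)]
    rw [div_le_iff₀ hnpos] at hκ hρ
    refine hκ.trans ?_
    have f1 : c₀ * n ≤ (1 / 4 - d / 2) * (n - 2 * k) := by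
      have : (1 / 4 - d / 2) * (2 * k) ≤ 1 / 4 * (2 * k) := by gcongr; linarith
      have : c₀ = 1 / 4 - d := by linarith
      rw [this]; nlinarith
    calc c₀ * x * n = (c₀ * n) * x := by ring
      _ ≤ ((1 / 4 - d / 2) * (n - 2 * k)) * x := by gcongr
      _ = _ := by ring
  have hE := Real.exp_pos (-((1 / 4 - d / 2) * x))
  obtain ⟨L, hL⟩ : ∃ L, L = -Real.log (interProb n k) := ⟨_, rfl⟩
  have hLq : interProb n k = Real.exp (-L) := by rw [hL, neg_neg, Real.exp_log hq0]
  have hL1 : 1 - interProb n k ≤ L := by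
    have := Real.log_le_sub_one_of_pos hq0
    linarith
  have hL0 : 0 < L := by linarith
  refine ⟨L, Y, Y / L, ?_⟩
  exact {
    hβ0 := hβ0
    hβ1 := hβ1
    hw := hwx.symm
    hw0 := hw20
    hβw := hβw
    hk := hk2
    hkn := hkn
    hn := hne
    hq := hLq
    hL0 := hL0
    hL := by
      rw [hLq] at hql
      have := Real.exp_le_exp.1 hql
      linarith
    hkY := hkn'
    hY1 := hY1
    hY2 := hY2
    huL := by field_simp
    hu := by
      rw [div_le_iff₀ hL0]
      calc Y ≤ x := by linarith
        _ ≤ Real.exp (d / 4 * x) := hx5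
        _ ≤ Real.exp (x / 4 - 10 ^ 9 * w + -((1 / 4 - d / 2) * x)) := by
            apply Real.exp_le_exp.2
            rw [hwβ, hβ]; nlinarith
        _ = Real.exp (x / 4 - 10 ^ 9 * w) * Real.exp (-((1 / 4 - d / 2) * x)) := Real.exp_add _ _
        _ ≤ _ := by
          apply mul_le_mul_of_nonneg_left _ (Real.exp_pos _).le
          linarith
    hxw := hx3 }

lemma regB {c β : ℝ} (hβ0 : 0 < β) (hRB : ∀ᶠ n : ℕ in atTop, ∀ k : ℕ,
    2 ≤ k → 2 * k < n → (k : ℝ) < Real.sqrt (c * n * Real.log n) → gam n k < β / 10 ^ 9 →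
    ∃ L Y u : ℝ, RB β n k (Real.log n) (β * Real.log n / 10 ^ 9) L Y u) {θ : ℝ} (hθ : 0 < θ) :
    ∃ η > 0, ∀ᶠ n : ℕ in atTop,
    ∀ (k : ℕ) (p e : ℝ), 2 * k < n → (k : ℝ) < Real.sqrt (c * n * Real.log n) → 0 ≤ p → p ≤ 1 →
    gam n k < β / 10 ^ 9 → e ≤ η →
    hprob n k p (fun H => e < Lam n k p (maxDegree H)) ≤ η → hprob n k p (fun H => ¬ EKR H) ≤ θ := by
  obtain ⟨η, hη⟩ : ∃ η : ℝ, η = min (1 / 100) (θ / 100) := ⟨_, rfl⟩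
  have hη0 : 0 < η := by rw [hη]; positivity
  have hη1 : η ≤ 1 / 100 := by rw [hη]; exact min_le_left _ _
  have hηθ : η ≤ θ / 100 := by rw [hη]; exact min_le_right _ _
  refine ⟨η, hη0, ?_⟩
  filter_upwards [hRB, eventually_ge_atTop 10, large_gen (θ := θ / 2) (by positivity),
    ev_log (ev_exp_small (a := β / 10 ^ 9) (by positivity) hη0),
    ev_log (eventually_ge_atTop (1 / η))] with n hRB hn hlg hx1 hx2 k p e hkn hkc h0 h1 hγ he hL
  obtain ⟨hk2, -⟩ := t2_facts hn hkn h0 h1 hη0 hη1 he hL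
  obtain ⟨L, Y, u, B⟩ := hRB k hk2 hkn hkc hγ
  have hw : Real.exp (-(β * Real.log n / 10 ^ 9)) ≤ η := by
    rw [show β * Real.log n / 10 ^ 9 = β / 10 ^ 9 * Real.log n by ring]; exact hx1
  have hxη : 1 / Real.log n ≤ η := by
    rw [one_div_le (log_pos_of_two (by omega)) hη0]; exact hx2
  rcases le_total (phi n k p) (Real.exp (1000 * (β * Real.log n / 10 ^ 9)) * u) with h | h
  · have := B.mid h0 h1 h hw hη1 hxη he hL
    linarith
  · have := B.large h0 h1 h hlg
    linarith

theorem main_thm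
    (c : ℝ) (hc : c < 1 / 4)
    (k : ℕ → ℕ) (p : ℕ → ℝ)
    (hp0 : ∀ n, 0 ≤ p n) (hp1 : ∀ n, p n ≤ 1)
    (hnk : ∀ᶠ n in atTop, 2 * k n < n)
    (hk : ∀ᶠ n in atTop, (k n : ℝ) < Real.sqrt (c * n * Real.log n))
    (ε : ℕ → ℝ) (hε : Tendsto ε atTop (nhds 0))
    (hLam : Tendsto (fun n => hprob n (k n) (p n)
        (fun H => ε n < Lam n (k n) (p n) (maxDegree H))) atTop (nhds 0)) :
    Tendsto (fun n => hprob n (k n) (p n) (fun H => EKR H)) atTop (nhds 1) := by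
  obtain ⟨β, hβ0, hβ1, hRB⟩ := rb_exists hc
  rw [Metric.tendsto_nhds]
  intro θ hθ
  obtain ⟨η₁, hη₁, hA⟩ := regA (δ := β / 10 ^ 9) (by positivity) (by linarith) (half_pos hθ)
  obtain ⟨η₂, hη₂, hB⟩ := regB (c := c) hβ0 hRB (half_pos hθ)
  have hη : 0 < min η₁ η₂ := lt_min hη₁ hη₂
  filter_upwards [hA, hB, hnk, hk, hε.eventually_le_const hη, hLam.eventually_le_const hη] with
    n hA hB hnk hk hε hLam
  have key : hprob n (k n) (p n) (fun H => ¬ EKR H) ≤ θ / 2 := by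
    rcases le_or_gt (β / 10 ^ 9) (gam n (k n)) with h | h
    · exact hA (k n) (p n) (ε n) hnk (hp0 n) (hp1 n) h (hε.trans (min_le_left _ _))
        (hLam.trans (min_le_left _ _))
    · exact hB (k n) (p n) (ε n) hnk hk (hp0 n) (hp1 n) h (hε.trans (min_le_right _ _))
        (hLam.trans (min_le_right _ _))
  have hle : hprob n (k n) (p n) (fun H => EKR H) ≤ 1 := sprob_le_one (hp0 n) (hp1 n) _
  have hcp := hprob_compl (n := n) (k := k n) (p := p n) (fun H => EKR H)
  rw [hcp] at key
  rw [Real.dist_eq, abs_sub_lt_iff]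
  constructor <;> linarith

end
end EKRP


/-- **Theorem (sufficiency).** Fix `c < 1/4`. If `k = k(n) < √(c n log n)` and `p = p(n)`
is such that `Λ(Δ) < o(1)` almost surely (i.e. there is `ε(n) → 0` with
`Pr(Λ(Δ) > ε(n)) → 0`), then `H_k(n,p)` satisfies EKR almost surely. -/
theorem ekr_random_sufficient
    (c : ℝ) (hc : c < 1 / 4)
    (k : ℕ → ℕ) (p : ℕ → ℝ)
    (hp0 : ∀ n, 0 ≤ p n) (hp1 : ∀ n, p n ≤ 1)
    (hnk : ∀ᶠ n in atTop, 2 * k n < n)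
    (hk : ∀ᶠ n in atTop, (k n : ℝ) < Real.sqrt (c * n * Real.log n))
    (ε : ℕ → ℝ) (hε : Tendsto ε atTop (nhds 0))
    (hLam : Tendsto (fun n => hprob n (k n) (p n)
        (fun H => ε n < Lam n (k n) (p n) (maxDegree H))) atTop (nhds 0)) :
    Tendsto (fun n => hprob n (k n) (p n) (fun H => EKR H)) atTop (nhds 1) := by
  exact EKRP.main_thm c hc k p hp0 hp1 hnk hk ε hε hLam
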